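/- Under the standing assumptions, suppose the exponent p from hypothesis (f3) satisfies 2 + 4/N < p < 2*. Then there exists b > 0 such that: (i) there exists λ > −λ₁(Ω) with ∫_Ω u_λ² dx = b; (ii) for every c with 0 < c < b there exist λ, λ̃ ∈ (−λ₁(Ω), +∞) with λ ≠ λ̃ such that ∫_Ω u_λ² dx = ∫_Ω u_{λ̃}² dx = c; (iii) for every c > b there exists no λ > −λ₁(Ω) with ∫_Ω u_λ² dx = c. -/

import Mathlib

open MeasureTheory Set Filter Topology

noncomputable section

/-- `N`-dimensional Euclidean space. -/
abbrev Euc (N : ℕ) := EuclideanSpace ℝ (Fin N)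

/-- The Laplacian of a real-valued function on Euclidean space, defined as the
sum of the pure second partial derivatives in the coordinate directions. -/
def lap {N : ℕ} (u : Euc N → ℝ) (x : Euc N) : ℝ :=
  ∑ i : Fin N,
    fderiv ℝ (fun y => fderiv ℝ u y (EuclideanSpace.single i 1)) x (EuclideanSpace.single i 1)

/-- The first Dirichlet eigenvalue of `-Δ` on `Ω`, defined as the infimum of
Rayleigh quotients of nonzero smooth functions with compact support contained in `Ω`. -/
def firstEig {N : ℕ} (Ω : Set (Euc N)) : ℝ :=
  sInf { r : ℝ | ∃ φ : Euc N → ℝ, ContDiff ℝ (⊤ : ℕ∞) φ ∧ HasCompactSupport φ ∧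
    tsupport φ ⊆ Ω ∧ φ ≠ 0 ∧
    r = (∫ x, ‖fderiv ℝ φ x‖ ^ 2) / (∫ x, (φ x) ^ 2) }

/-- `u` is a (classical) positive solution of `-Δ u + lam • u = f(x, u)` in `Ω`,
vanishing on the boundary: `u ∈ C²(Ω) ∩ C(closure Ω)`, `u > 0` in `Ω`, `u = 0` on `∂Ω`. -/
def IsPosSolution {N : ℕ} (Ω : Set (Euc N)) (f : Euc N → ℝ → ℝ) (lam : ℝ)
    (u : Euc N → ℝ) : Prop :=
  ContDiffOn ℝ 2 u Ω ∧ ContinuousOn u (closure Ω) ∧ (∀ x ∈ Ω, 0 < u x) ∧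
    (∀ x ∈ frontier Ω, u x = 0) ∧ ∀ x ∈ Ω, - lap u x + lam * u x = f x (u x)

/-- The standing assumptions of the paper: `Ω ⊆ ℝ^N` is a bounded domain with `C¹`
boundary, convex in every coordinate direction and invariant under a blockwise
orthogonal group `G = O(m₁) × ⋯ × O(m_ℓ)` with every `m_i ≥ 2`; the nonlinearity
`f` satisfies (f1), (f2), (f3) with splitting `f(x,t) = d(x)|t|^{p-2} t + g(x,t)`;
and for every `λ > -λ₁(Ω)` the problem has exactly one positive solution `u λ`. -/
structure Standing (N : ℕ) (Ω : Set (Euc N)) (f : Euc N → ℝ → ℝ)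
    (d : Euc N → ℝ) (g : Euc N → ℝ → ℝ) (p : ℝ) (u : ℝ → Euc N → ℝ) : Prop where
  dim : 2 ≤ N
  isOpen : IsOpen Ω
  conn : IsConnected Ω
  bdd : Bornology.IsBounded Ω
  c1bdry : ∀ x ∈ frontier Ω, ∃ U : Set (Euc N), IsOpen U ∧ x ∈ U ∧
      ∃ F : Euc N → ℝ, ContDiff ℝ 1 F ∧ (∀ y ∈ U, fderiv ℝ F y ≠ 0) ∧
        Ω ∩ U = {y ∈ U | F y < 0}
  conv : ∀ i : Fin N, ∀ x ∈ Ω, ∀ y ∈ Ω, (∀ j, j ≠ i → x j = y j) → segment ℝ x y ⊆ Ω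
  symm : ∃ ℓ : ℕ, 1 ≤ ℓ ∧ ∃ β : Fin N → Fin ℓ, Monotone β ∧ Function.Surjective β ∧
      (∀ j, 2 ≤ (Finset.univ.filter (fun i => β i = j)).card) ∧
      ∀ e : Euc N ≃ₗᵢ[ℝ] Euc N,
        (∀ j : Fin ℓ, ∀ x : Euc N, (∀ i, β i ≠ j → x i = 0) → ∀ i, β i ≠ j → e x i = 0) →
          e '' Ω = Ω ∧ (∀ x t, f (e x) t = f x t) ∧ ∀ x, d (e x) = d x
  f_c1 : ContDiffOn ℝ 1 (Function.uncurry f) (Ω ×ˢ (univ : Set ℝ))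
  f_zero : ∀ x ∈ Ω, f x 0 = 0 ∧ deriv (f x) 0 = 0
  f_ar : ∃ a b : ℝ, 2 < a ∧ a ≤ b ∧ (3 ≤ N → b < 2 * N / ((N : ℝ) - 2)) ∧
      ∀ᵐ x ∂(volume : Measure (Euc N)).restrict Ω, ∀ t : ℝ, t ≠ 0 →
        0 < (a - 1) * f x t * t ∧ (a - 1) * f x t * t ≤ deriv (f x) t * t ^ 2 ∧
          deriv (f x) t * t ^ 2 ≤ (b - 1) * f x t * t
  f_bdd : ∃ M : ℝ, 0 < M ∧ ∀ x ∈ Ω, |f x 1| < M ∧ |f x (-1)| < M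
  hp : 2 < p ∧ (3 ≤ N → p < 2 * N / ((N : ℝ) - 2))
  f_split : ∀ x t, f x t = d x * |t| ^ (p - 2) * t + g x t
  d_c1 : ContDiffOn ℝ 1 d (closure Ω)
  d_bdd : ∃ C : ℝ, ∀ x ∈ Ω, |d x| ≤ C
  d_nonneg : ∀ x ∈ closure Ω, 0 ≤ d x
  d_zero : d 0 = 1
  g_top : ∀ x ∈ Ω, Tendsto (fun t : ℝ => g x t / t ^ (p - 1)) atTop (𝓝 0)
  g_zero : ∀ x ∈ Ω, Tendsto (fun t : ℝ => g x t / t) (𝓝[≠] (0 : ℝ)) (𝓝 0)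
  mono : ∀ i : Fin N, ∀ x ∈ Ω, ∀ y ∈ Ω, (∀ j, j ≠ i → x j = y j) → |x i| ≤ |y i| →
      (∀ t, f y t ≤ f x t) ∧ d y ≤ d x
  sol : ∀ lam : ℝ, - firstEig Ω < lam →
      IsPosSolution Ω f lam (u lam) ∧
        ∀ v, IsPosSolution Ω f lam v → EqOn v (u lam) (closure Ω)

section TestFunctions

variable {N : ℕ} {Ω : Set (Euc N)}

/-- The `i`-th partial derivative. -/
def pd (i : Fin N) (u : Euc N → ℝ) (x : Euc N) : ℝ :=
  fderiv ℝ u x (EuclideanSpace.single i 1)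

theorem lap_eq_sum_pd (u : Euc N → ℝ) (x : Euc N) : lap u x = ∑ i, pd i (pd i u) x := rfl

/-- `C¹` functions with compact support in `Ω`. -/
structure IsTest (Ω : Set (Euc N)) (ψ : Euc N → ℝ) : Prop where
  cd : ContDiff ℝ 1 ψ
  cs : HasCompactSupport ψ
  sub : tsupport ψ ⊆ Ω

theorem norm_fderiv_sq_eq (u : Euc N → ℝ) (x : Euc N) :
    ‖fderiv ℝ u x‖ ^ 2 = ∑ i, pd i u x * pd i u x := by
  set L := fderiv ℝ u x with hL
  set v := (InnerProductSpace.toDual ℝ (Euc N)).symm L with hv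
  have h1 : ‖L‖ = ‖v‖ := by rw [hv]; simp
  have h2 : ∀ i, pd i u x = v i := by
    intro i
    have : L (EuclideanSpace.single i 1) = inner ℝ v (EuclideanSpace.single i (1 : ℝ)) := by
      rw [hv, InnerProductSpace.toDual_symm_apply]
    rw [pd, ← hL, this]
    simp [EuclideanSpace.inner_single_right]
  rw [h1, EuclideanSpace.norm_sq_eq]
  simp only [h2, Real.norm_eq_abs, sq, abs_mul_abs_self]

theorem fderiv_apply_eq_sum (u : Euc N → ℝ) (x v : Euc N) :
    fderiv ℝ u x v = ∑ i, v i * pd i u x := by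
  have : v = ∑ i, v i • EuclideanSpace.single i (1 : ℝ) := by
    ext j
    simp [Finset.sum_apply, Pi.single_apply]
  conv_lhs => rw [this]
  simp [map_sum, pd]

theorem continuous_pd {ψ : Euc N → ℝ} (h : ContDiff ℝ 1 ψ) (i : Fin N) : Continuous (pd i ψ) :=
  (h.continuous_fderiv (by norm_num)).clm_apply continuous_const

theorem tsupport_pd_subset (i : Fin N) (ψ : Euc N → ℝ) : tsupport (pd i ψ) ⊆ tsupport ψ := by
  refine closure_minimal ?_ (isClosed_tsupport ψ)
  intro x hx
  refine support_fderiv_subset ℝ (f := ψ) ?_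
  intro h0
  apply hx
  simp [pd, h0]

theorem hasCompactSupport_pd {ψ : Euc N → ℝ} (h : HasCompactSupport ψ) (i : Fin N) :
    HasCompactSupport (pd i ψ) := by
  exact h.mono' ((subset_tsupport _).trans (tsupport_pd_subset i ψ))

theorem IsTest.zero_off {ψ : Euc N → ℝ} (h : IsTest Ω ψ) {x : Euc N} (hx : x ∉ Ω) : ψ x = 0 :=
  image_eq_zero_of_notMem_tsupport fun hx' => hx (h.sub hx')

theorem continuous_mul_of_tsupport (hΩ : IsOpen Ω) {f g : Euc N → ℝ} (hf : ContinuousOn f Ω)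
    (hg : Continuous g) (hs : tsupport g ⊆ Ω) : Continuous (fun x => f x * g x) := by
  rw [continuous_iff_continuousAt]
  intro x
  by_cases hx : x ∈ tsupport g
  · exact (hf.continuousAt (hΩ.mem_nhds (hs hx))).mul hg.continuousAt
  · have h0 : (fun x => f x * g x) =ᶠ[𝓝 x] fun _ => 0 := by
      filter_upwards [(isClosed_tsupport g).isOpen_compl.mem_nhds hx] with y hy
      rw [image_eq_zero_of_notMem_tsupport hy, mul_zero]
    exact (continuousAt_const).congr h0.symm

theorem integrable_mul_of_tsupport (hΩ : IsOpen Ω) {f g : Euc N → ℝ} (hf : ContinuousOn f Ω)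
    (hg : Continuous g) (hc : HasCompactSupport g) (hs : tsupport g ⊆ Ω) :
    Integrable (fun x => f x * g x) :=
  (continuous_mul_of_tsupport hΩ hf hg hs).integrable_of_hasCompactSupport hc.mul_left

theorem contDiffOn_pd (hΩ : IsOpen Ω) {v : Euc N → ℝ} (hv : ContDiffOn ℝ 2 v Ω) (i : Fin N) :
    ContDiffOn ℝ 1 (pd i v) Ω :=
  ((hv.fderiv_of_isOpen hΩ (m := 1) (by norm_num)).clm_apply contDiffOn_const)

theorem continuousOn_lap (hΩ : IsOpen Ω) {v : Euc N → ℝ} (hv : ContDiffOn ℝ 2 v Ω) :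
    ContinuousOn (lap v) Ω := by
  have : ∀ i, ContinuousOn (pd i (pd i v)) Ω := fun i =>
    ((contDiffOn_pd hΩ hv i).continuousOn_fderiv_of_isOpen hΩ (by norm_num)).clm_apply
      continuousOn_const
  exact continuousOn_finsetSum _ fun i _ => this i

theorem IsTest.setIntegral_eq {ψ : Euc N → ℝ} (h : IsTest Ω ψ) {F : Euc N → ℝ}
    (hF : ∀ x, x ∉ tsupport ψ → F x = 0) : ∫ x in Ω, F x = ∫ x, F x :=
  setIntegral_eq_integral_of_forall_compl_eq_zero fun x hx => hF x fun hsupp => hx (h.sub hsupp)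

/-- Integration by parts against a test function. -/
theorem integral_pd_mul_pd (hΩ : IsOpen Ω) {v ψ : Euc N → ℝ} (hv : ContDiffOn ℝ 2 v Ω)
    (hψ : IsTest Ω ψ) :
    ∫ x in Ω, ∑ i, pd i v x * pd i ψ x = ∫ x in Ω, (-lap v x) * ψ x := by
  have hts : ∀ i, tsupport (pd i ψ) ⊆ Ω := fun i => (tsupport_pd_subset i ψ).trans hψ.sub
  have hpv : ∀ i, ContinuousOn (pd i v) Ω := fun i => (contDiffOn_pd hΩ hv i).continuousOn
  have hppv : ∀ i, ContinuousOn (pd i (pd i v)) Ω := fun i =>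
    ((contDiffOn_pd hΩ hv i).continuousOn_fderiv_of_isOpen hΩ (by norm_num)).clm_apply
      continuousOn_const
  have hI1 : ∀ i, Integrable (fun x => pd i v x * pd i ψ x) := fun i =>
    integrable_mul_of_tsupport hΩ (hpv i) (continuous_pd hψ.cd i) (hasCompactSupport_pd hψ.cs i)
      (hts i)
  have hI2 : ∀ i, Integrable (fun x => pd i (pd i v) x * ψ x) := fun i =>
    integrable_mul_of_tsupport hΩ (hppv i) hψ.cd.continuous hψ.cs hψ.sub
  have key : ∀ i, ∫ x, pd i v x * pd i ψ x = - ∫ x, pd i (pd i v) x * ψ x := by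
    intro i
    refine integral_mul_fderiv_eq_neg_fderiv_mul_of_integrable (hI2 i) (hI1 i)
      (integrable_mul_of_tsupport hΩ (hpv i) hψ.cd.continuous hψ.cs hψ.sub) ?_ ?_
    · intro x hx
      exact ((contDiffOn_pd hΩ hv i).contDiffAt (hΩ.mem_nhds (hψ.sub hx))).differentiableAt
        (by norm_num)
    · intro x _
      exact hψ.cd.differentiable (by norm_num) x
  rw [hψ.setIntegral_eq, hψ.setIntegral_eq, integral_finsetSum _ fun i _ => hI1 i]
  · simp_rw [key, lap_eq_sum_pd, neg_mul, Finset.sum_mul]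
    rw [integral_neg, integral_finsetSum _ fun i _ => hI2 i, Finset.sum_neg_distrib]
  · intro x hx
    rw [image_eq_zero_of_notMem_tsupport hx, mul_zero]
  · intro x hx
    refine Finset.sum_eq_zero fun i _ => ?_
    rw [image_eq_zero_of_notMem_tsupport fun h => hx (tsupport_pd_subset i ψ h), mul_zero]

/-- The bilinear form `∫ ∇φ·∇ψ + μ φ ψ`. -/
def form (Ω : Set (Euc N)) (μ : ℝ) (φ ψ : Euc N → ℝ) : ℝ :=
  ∫ x in Ω, (∑ i, pd i φ x * pd i ψ x + μ * (φ x * ψ x))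

theorem IsTest.integrable_mul {φ ψ : Euc N → ℝ} (hφ : IsTest Ω φ) (hψ : IsTest Ω ψ) :
    Integrable (fun x => φ x * ψ x) (volume.restrict Ω) :=
  ((hφ.cd.continuous.mul hψ.cd.continuous).integrable_of_hasCompactSupport
    hψ.cs.mul_left).integrableOn

theorem IsTest.integrable_pd_mul {φ ψ : Euc N → ℝ} (hφ : IsTest Ω φ) (hψ : IsTest Ω ψ) :
    Integrable (fun x => ∑ i, pd i φ x * pd i ψ x) (volume.restrict Ω) :=
  integrable_finsetSum _ fun i _ =>
    (((continuous_pd hφ.cd i).mul (continuous_pd hψ.cd i)).integrable_of_hasCompactSupport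
      (hasCompactSupport_pd hψ.cs i).mul_left).integrableOn

theorem IsTest.integrable_form (μ : ℝ) {φ ψ : Euc N → ℝ} (hφ : IsTest Ω φ) (hψ : IsTest Ω ψ) :
    Integrable (fun x => ∑ i, pd i φ x * pd i ψ x + μ * (φ x * ψ x)) (volume.restrict Ω) :=
  (hφ.integrable_pd_mul hψ).add ((hφ.integrable_mul hψ).const_mul μ)

theorem form_eq (μ : ℝ) {φ ψ : Euc N → ℝ} (hφ : IsTest Ω φ) (hψ : IsTest Ω ψ) :
    form Ω μ φ ψ = (∫ x in Ω, ∑ i, pd i φ x * pd i ψ x) + μ * ∫ x in Ω, φ x * ψ x := by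
  rw [form, integral_add (hφ.integrable_pd_mul hψ) ((hφ.integrable_mul hψ).const_mul μ),
    integral_const_mul]

theorem form_comm (μ : ℝ) (φ ψ : Euc N → ℝ) : form Ω μ φ ψ = form Ω μ ψ φ := by
  simp only [form, mul_comm]

theorem pd_add {φ ψ : Euc N → ℝ} (hφ : ContDiff ℝ 1 φ) (hψ : ContDiff ℝ 1 ψ) (i : Fin N)
    (x : Euc N) : pd i (fun y => φ y + ψ y) x = pd i φ x + pd i ψ x := by
  have := fderiv_fun_add (hφ.differentiable (by norm_num) x) (hψ.differentiable (by norm_num) x)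
  simp [pd, this]

theorem pd_const_mul {ψ : Euc N → ℝ} (hψ : ContDiff ℝ 1 ψ) (c : ℝ) (i : Fin N)
    (x : Euc N) : pd i (fun y => c * ψ y) x = c * pd i ψ x := by
  have := fderiv_const_mul (hψ.differentiable (by norm_num) x) c
  simp [pd, this]

theorem IsTest.add {φ ψ : Euc N → ℝ} (hφ : IsTest Ω φ) (hψ : IsTest Ω ψ) :
    IsTest Ω (fun x => φ x + ψ x) where
  cd := hφ.cd.add hψ.cd
  cs := hφ.cs.add hψ.cs
  sub := (closure_mono (Function.support_add φ ψ)).trans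
    (by rw [closure_union]; exact union_subset hφ.sub hψ.sub)

theorem IsTest.const_mul {ψ : Euc N → ℝ} (hψ : IsTest Ω ψ) (c : ℝ) :
    IsTest Ω (fun x => c * ψ x) where
  cd := contDiff_const.mul hψ.cd
  cs := hψ.cs.mul_left
  sub := (closure_mono (fun x hx => by
    intro h; apply hx; simp [h])).trans hψ.sub

theorem form_add_right (μ : ℝ) {φ ψ χ : Euc N → ℝ} (hφ : IsTest Ω φ) (hψ : IsTest Ω ψ)
    (hχ : IsTest Ω χ) :
    form Ω μ φ (fun x => ψ x + χ x) = form Ω μ φ ψ + form Ω μ φ χ := by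
  rw [form, form, form, ← integral_add (hφ.integrable_form μ hψ) (hφ.integrable_form μ hχ)]
  congr 1
  ext x
  simp only [pd_add hψ.cd hχ.cd, mul_add, Finset.sum_add_distrib]
  ring

theorem form_const_mul_right (μ : ℝ) (φ : Euc N → ℝ) {ψ : Euc N → ℝ} (hψ : IsTest Ω ψ) (c : ℝ) :
    form Ω μ φ (fun x => c * ψ x) = c * form Ω μ φ ψ := by
  rw [form, form, ← integral_const_mul]
  congr 1
  ext x
  simp only [pd_const_mul hψ.cd, mul_add, Finset.mul_sum]
  congr 1
  · exact Finset.sum_congr rfl fun i _ => by ring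
  · ring

theorem form_self_nonneg {μ : ℝ} (hμ : 0 ≤ μ) (ψ : Euc N → ℝ) : 0 ≤ form Ω μ ψ ψ := by
  refine integral_nonneg fun x => ?_
  exact add_nonneg (Finset.sum_nonneg fun i _ => mul_self_nonneg _)
    (mul_nonneg hμ (mul_self_nonneg _))

theorem form_add_self (μ : ℝ) {φ ψ : Euc N → ℝ} (hφ : IsTest Ω φ) (hψ : IsTest Ω ψ) (t : ℝ) :
    form Ω μ (fun x => φ x + t * ψ x) (fun x => φ x + t * ψ x) =
      form Ω μ φ φ + 2 * t * form Ω μ φ ψ + t ^ 2 * form Ω μ ψ ψ := by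
  have h1 := hφ.add (hψ.const_mul t)
  rw [form_add_right μ h1 hφ (hψ.const_mul t), form_const_mul_right μ _ hψ, form_comm μ _ φ,
    form_comm μ _ ψ, form_add_right μ hφ hφ (hψ.const_mul t), form_const_mul_right μ _ hψ,
    form_add_right μ hψ hφ (hψ.const_mul t), form_const_mul_right μ _ hψ, form_comm μ ψ φ]
  ring

/-- The norm associated with `form`. -/
def nrm (Ω : Set (Euc N)) (μ : ℝ) (ψ : Euc N → ℝ) : ℝ := √(form Ω μ ψ ψ)

theorem nrm_nonneg (μ : ℝ) (ψ : Euc N → ℝ) : 0 ≤ nrm Ω μ ψ := Real.sqrt_nonneg _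

theorem nrm_sq {μ : ℝ} (hμ : 0 ≤ μ) (ψ : Euc N → ℝ) : nrm Ω μ ψ ^ 2 = form Ω μ ψ ψ :=
  Real.sq_sqrt (form_self_nonneg hμ ψ)

/-- A linear-plus-quadratic perturbation bounded below by `-e` has small linear part. -/
theorem abs_le_of_forall_quadratic {A B e : ℝ} (hB : 0 ≤ B) (he : 0 ≤ e)
    (h : ∀ t : ℝ, 0 ≤ t * A + t ^ 2 * B / 2 + e ^ 2 / 2) : |A| ≤ e * √B := by
  have h2 : discrim (B / 2) A (e ^ 2 / 2) ≤ 0 := discrim_le_zero fun t => by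
    have := h t; nlinarith
  rw [discrim] at h2
  refine abs_le_of_sq_le_sq ?_ (by positivity)
  rw [mul_pow, Real.sq_sqrt hB]
  linarith

end TestFunctions

section Poincare

variable {N : ℕ} {Ω : Set (Euc N)}

theorem IsTest.exists_smooth_approx (hΩ : IsOpen Ω) {ψ : Euc N → ℝ} (hψ : IsTest Ω ψ) {δ : ℝ}
    (hδ : 0 < δ) : ∃ φ : Euc N → ℝ, ContDiff ℝ (⊤ : ℕ∞) φ ∧ IsTest Ω φ ∧
      (∀ x, |φ x - ψ x| ≤ δ) ∧ ∀ i x, |pd i φ x - pd i ψ x| ≤ δ := by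
  obtain ⟨r, hr, hrΩ⟩ := hψ.cs.isCompact.exists_cthickening_subset_open hΩ hψ.sub
  have hu1 : UniformContinuous ψ := hψ.cs.uniformContinuous_of_continuous hψ.cd.continuous
  have hu2 : UniformContinuous (fderiv ℝ ψ) :=
    (hψ.cs.fderiv ℝ).uniformContinuous_of_continuous (hψ.cd.continuous_fderiv (by norm_num))
  obtain ⟨r1, hr1, h1⟩ := Metric.uniformContinuous_iff.1 hu1 δ hδ
  obtain ⟨r2, hr2, h2⟩ := Metric.uniformContinuous_iff.1 hu2 δ hδ
  set R := min r (min r1 r2) with hR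
  have hR0 : 0 < R := lt_min hr (lt_min hr1 hr2)
  let b : ContDiffBump (0 : Euc N) := ⟨R / 2, R, by positivity, by linarith⟩
  let φ : Euc N → ℝ := convolution (b.normed volume) ψ (ContinuousLinearMap.lsmul ℝ ℝ) volume
  have hfd : ∀ x, HasFDerivAt φ (convolution (b.normed volume) (fderiv ℝ ψ)
      ((ContinuousLinearMap.lsmul ℝ ℝ).precompR (Euc N)) volume x) x := fun x =>
    hψ.cs.hasFDerivAt_convolution_right _ (b.continuous_normed.locallyIntegrable) hψ.cd x
  have hsup : Function.support φ ⊆ Metric.cthickening r (tsupport ψ) := by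
    intro x hx
    obtain ⟨y, hy, z, hz, rfl⟩ := support_convolution_subset _ hx
    rw [b.support_normed_eq] at hy
    refine Metric.mem_cthickening_of_dist_le (y + z) z r _ (subset_tsupport _ hz) ?_
    have : dist y 0 < R := hy
    have h3 : R ≤ r := min_le_left _ _
    simpa [dist_eq_norm] using (le_of_lt (lt_of_lt_of_le this h3))
  have htsup : tsupport φ ⊆ Metric.cthickening r (tsupport ψ) :=
    closure_minimal hsup Metric.isClosed_cthickening
  have hcs : HasCompactSupport φ :=
    (hψ.cs.isCompact.cthickening).of_isClosed_subset (isClosed_tsupport _) htsup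
  have hcd : ContDiff ℝ (⊤ : ℕ∞) φ :=
    (b.hasCompactSupport_normed).contDiff_convolution_left _ b.contDiff_normed
      hψ.cd.continuous.locallyIntegrable
  refine ⟨φ, hcd, ⟨hcd.of_le (by exact_mod_cast le_top), hcs, htsup.trans hrΩ⟩, ?_, ?_⟩
  · intro x
    have := b.dist_normed_convolution_le (μ := volume) (x₀ := x) (ε := δ)
      hψ.cd.continuous.aestronglyMeasurable (g := ψ) (fun y hy => (h1 (lt_of_lt_of_le hy
        ((min_le_right _ _).trans (min_le_left _ _)))).le)
    simpa [Real.dist_eq] using this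
  · intro i x
    have h3 := (hfd x).fderiv
    have h4 : dist (convolution (b.normed volume) (fderiv ℝ ψ)
        (ContinuousLinearMap.lsmul ℝ ℝ) volume x) (fderiv ℝ ψ x) ≤ δ :=
      b.dist_normed_convolution_le (μ := volume) (x₀ := x) (ε := δ) (g := fderiv ℝ ψ)
      (hψ.cd.continuous_fderiv (by norm_num)).aestronglyMeasurable (fun y hy => (h2
        (lt_of_lt_of_le hy ((min_le_right _ _).trans (min_le_right _ _)))).le)
    have h5 : convolution (b.normed volume) (fderiv ℝ ψ)
      ((ContinuousLinearMap.lsmul ℝ ℝ).precompR (Euc N)) volume x =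
      convolution (b.normed volume) (fderiv ℝ ψ) (ContinuousLinearMap.lsmul ℝ ℝ) volume x := by
      simp only [convolution]
      congr 1
    rw [pd, pd, h3, h5, ← sub_apply, ← Real.norm_eq_abs]
    refine (ContinuousLinearMap.le_opNorm _ _).trans ?_
    rw [dist_eq_norm] at h4
    simpa using h4

theorem IsTest.exists_bound {ψ : Euc N → ℝ} (hψ : IsTest Ω ψ) :
    ∃ C, 0 ≤ C ∧ (∀ x, |ψ x| ≤ C) ∧ ∀ i x, |pd i ψ x| ≤ C := by
  obtain ⟨C, hC⟩ := hψ.cs.exists_bound_of_continuous hψ.cd.continuous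
  have : ∀ i, ∃ D, ∀ x, ‖pd i ψ x‖ ≤ D := fun i =>
    (hasCompactSupport_pd hψ.cs i).exists_bound_of_continuous (continuous_pd hψ.cd i)
  choose D hD using this
  have hDn : ∀ i, 0 ≤ D i := fun i => (norm_nonneg _).trans (hD i 0)
  have hCn : 0 ≤ C := (norm_nonneg _).trans (hC 0)
  have hs : 0 ≤ ∑ i, D i := Finset.sum_nonneg fun i _ => hDn i
  refine ⟨C + ∑ i, D i, by positivity, fun x => (hC x).trans (by linarith), fun i x => ?_⟩
  have := Finset.single_le_sum (fun i _ => hDn i) (Finset.mem_univ i)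
  exact (hD i x).trans (by linarith)

/-- The Poincaré inequality with the optimal constant, for `C¹` test functions. -/
theorem firstEig_mul_le (hΩ : IsOpen Ω) (hb : Bornology.IsBounded Ω) {ψ : Euc N → ℝ}
    (hψ : IsTest Ω ψ) :
    firstEig Ω * ∫ x in Ω, ψ x * ψ x ≤ ∫ x in Ω, ∑ i, pd i ψ x * pd i ψ x := by
  have smooth : ∀ φ : Euc N → ℝ, ContDiff ℝ (⊤ : ℕ∞) φ → IsTest Ω φ →
      firstEig Ω * ∫ x in Ω, φ x * φ x ≤ ∫ x in Ω, ∑ i, pd i φ x * pd i φ x := by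
    intro φ hφ ht
    by_cases h0 : φ = 0
    · subst h0
      simp only [Pi.zero_apply, mul_zero, integral_zero]
      exact integral_nonneg fun x => Finset.sum_nonneg fun i _ => mul_self_nonneg _
    have hle : firstEig Ω ≤ (∫ x, ‖fderiv ℝ φ x‖ ^ 2) / (∫ x, (φ x) ^ 2) := by
      refine csInf_le ⟨0, ?_⟩ ⟨φ, hφ, ht.cs, ht.sub, h0, rfl⟩
      rintro r ⟨φ, -, -, -, -, rfl⟩
      positivity
    have e1 : ∫ x in Ω, φ x * φ x = ∫ x, (φ x) ^ 2 := by
      rw [ht.setIntegral_eq fun x hx => by simp [image_eq_zero_of_notMem_tsupport hx]]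
      simp [sq]
    have e2 : ∫ x in Ω, ∑ i, pd i φ x * pd i φ x = ∫ x, ‖fderiv ℝ φ x‖ ^ 2 := by
      rw [ht.setIntegral_eq fun x hx => Finset.sum_eq_zero fun i _ => by
        rw [image_eq_zero_of_notMem_tsupport fun h => hx (tsupport_pd_subset i φ h), mul_zero]]
      simp [norm_fderiv_sq_eq]
    rw [e1, e2]
    rcases (integral_nonneg fun x => sq_nonneg (φ x) : 0 ≤ ∫ x, (φ x) ^ 2).eq_or_lt with h | h
    · rw [← h, mul_zero]; positivity
    · rwa [le_div_iff₀ h] at hle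
  have hδ : ∀ n : ℕ, (0 : ℝ) < 1 / (n + 1) := fun n => by positivity
  choose φ h1 h2 h3 h4 using fun n : ℕ => hψ.exists_smooth_approx hΩ (hδ n)
  obtain ⟨C, hC0, hC1, hC2⟩ := hψ.exists_bound
  have hfin : IsFiniteMeasure (volume.restrict Ω) :=
    ⟨by simpa using hb.measure_lt_top⟩
  have lim : ∀ (A : ℕ → ℝ) (a : ℝ), (∀ n : ℕ, |A n - a| ≤ 1 / ((n : ℝ) + 1)) →
      Tendsto A atTop (𝓝 a) := by
    intro A a h
    rw [tendsto_iff_dist_tendsto_zero]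
    exact squeeze_zero (fun _ => dist_nonneg) h tendsto_one_div_add_atTop_nhds_zero_nat
  have bd : ∀ (a b : ℝ) (n : ℕ), |a - b| ≤ 1 / ((n : ℝ) + 1) → |b| ≤ C → |a| ≤ C + 1 := by
    intro a b n h hb
    have : 1 / ((n : ℝ) + 1) ≤ 1 := by
      rw [div_le_one (by positivity)]; linarith [(Nat.cast_nonneg n : (0 : ℝ) ≤ n)]
    have := abs_sub_abs_le_abs_sub a b
    linarith
  have sqb : ∀ a : ℝ, |a| ≤ C + 1 → |a * a| ≤ (C + 1) * (C + 1) := fun a h => by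
    rw [abs_mul]; exact mul_le_mul h h (abs_nonneg _) (by linarith)
  have L1 : Tendsto (fun n => ∫ x in Ω, φ n x * φ n x) atTop (𝓝 (∫ x in Ω, ψ x * ψ x)) := by
    refine tendsto_integral_of_dominated_convergence (fun _ => (C + 1) * (C + 1)) ?_
      (integrable_const _) ?_ ?_
    · exact fun n => ((h2 n).cd.continuous.mul (h2 n).cd.continuous).aestronglyMeasurable
    · exact fun n => ae_of_all _ fun x => sqb _ (bd _ _ n (h3 n x) (hC1 x))
    · refine ae_of_all _ fun x => ?_
      have := lim (fun n => φ n x) (ψ x) fun n => h3 n x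
      exact this.mul this
  have L2 : Tendsto (fun n => ∫ x in Ω, ∑ i, pd i (φ n) x * pd i (φ n) x) atTop
      (𝓝 (∫ x in Ω, ∑ i, pd i ψ x * pd i ψ x)) := by
    refine tendsto_integral_of_dominated_convergence
      (fun _ => ∑ i : Fin N, (C + 1) * (C + 1)) ?_ (integrable_const _) ?_ ?_
    · exact fun n => (continuous_finsetSum _ fun i _ => (continuous_pd (h2 n).cd i).mul
        (continuous_pd (h2 n).cd i)).aestronglyMeasurable
    · exact fun n => ae_of_all _ fun x => (Finset.abs_sum_le_sum_abs _ _).trans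
        (Finset.sum_le_sum fun i _ => sqb _ (bd _ _ n (h4 n i x) (hC2 i x)))
    · refine ae_of_all _ fun x => tendsto_finsetSum _ fun i _ => ?_
      have := lim (fun n => pd i (φ n) x) (pd i ψ x) fun n => h4 n i x
      exact this.mul this
  exact le_of_tendsto_of_tendsto' (L1.const_mul _) L2 fun n => smooth _ (h1 n) (h2 n)

theorem sobolev (hN : 2 ≤ N) (hΩ : IsOpen Ω) (hb : Bornology.IsBounded Ω) {m : ℝ} (hm : 2 ≤ m)
    (hm' : 3 ≤ N → m < 2 * N / ((N : ℝ) - 2)) :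
    ∃ C, 0 < C ∧ ∀ ψ, IsTest Ω ψ →
      ∫ x in Ω, |ψ x| ^ m ≤ C * (∫ x in Ω, ∑ i, pd i ψ x * pd i ψ x) ^ (m / 2) := by
  have hN' : (2 : ℝ) ≤ N := by exact_mod_cast hN
  have key : ∃ q : ℝ, 1 ≤ q ∧ q < 2 ∧ q⁻¹ - (N : ℝ)⁻¹ ≤ m⁻¹ := by
    have h0 : (2 : ℝ)⁻¹ - (N : ℝ)⁻¹ < m⁻¹ := by
      rcases lt_or_eq_of_le hN with h | h
      · have h3 : 3 ≤ N := h
        have h3' : (3 : ℝ) ≤ N := by exact_mod_cast h3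
        have := hm' h3
        rw [lt_div_iff₀ (by linarith)] at this
        rw [← sub_pos]
        have e : m⁻¹ - (2⁻¹ - (N : ℝ)⁻¹) = (2 * N - m * (N - 2)) / (2 * m * N) := by
          field_simp
        rw [e]
        apply div_pos <;> nlinarith
      · rw [← h]; simp only [Nat.cast_ofNat, sub_self]; positivity
    have hcont : Tendsto (fun q : ℝ => q⁻¹ - (N : ℝ)⁻¹) (𝓝[<] 2) (𝓝 ((2 : ℝ)⁻¹ - (N : ℝ)⁻¹)) :=
      ((tendsto_inv₀ (by norm_num)).sub_const _).mono_left nhdsWithin_le_nhds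
    have e1 := hcont.eventually (gt_mem_nhds h0)
    have e2 : ∀ᶠ q : ℝ in 𝓝[<] 2, 1 < q := nhdsWithin_le_nhds (lt_mem_nhds (by norm_num))
    obtain ⟨q, ha, hb, hc⟩ := (e1.and (e2.and self_mem_nhdsWithin)).exists
    exact ⟨q, hb.le, hc, ha.le⟩
  obtain ⟨q, hq1, hq2, hqm⟩ := key
  have hq0 : 0 < q := by linarith
  have hm0 : 0 < m := by linarith
  set C1 : NNReal := eLpNormLESNormFDerivOfLeConst ℝ (volume : Measure (Euc N)) Ω q.toNNReal
    m.toNNReal with hC1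
  have hfin : IsFiniteMeasure (volume.restrict Ω) := ⟨by simpa using hb.measure_lt_top⟩
  set V := (volume.restrict Ω) univ ^ (1 / q - 1 / 2 : ℝ) with hV
  have hVt : V ≠ ⊤ := ENNReal.rpow_ne_top_of_nonneg
    (by rw [sub_nonneg]; exact one_div_le_one_div_of_le hq0 hq2.le) (measure_ne_top _ _)
  refine ⟨(C1 * V.toReal) ^ m + 1, by positivity, fun ψ hψ => ?_⟩
  have g1 := eLpNorm_le_eLpNorm_fderiv_of_le (μ := (volume : Measure (Euc N))) (F := ℝ) hψ.cd
    ((subset_tsupport _).trans hψ.sub) (p := q.toNNReal) (q := m.toNNReal)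
    (by simpa using hq1) (by
      rw [← NNReal.coe_lt_coe, Real.coe_toNNReal _ hq0.le]; simp; linarith)
    (by simpa [Real.coe_toNNReal _ hq0.le, Real.coe_toNNReal _ hm0.le] using hqm) hb
  rw [← hC1] at g1
  have r1 : eLpNorm ψ (ENNReal.ofReal m) volume = eLpNorm ψ (ENNReal.ofReal m) (volume.restrict Ω) := by
    rw [← eLpNorm_indicator_eq_eLpNorm_restrict hΩ.measurableSet]
    congr 1
    ext x
    by_cases hx : x ∈ Ω
    · simp [hx]
    · simp [hx, hψ.zero_off hx]
  have r2 : eLpNorm (fderiv ℝ ψ) (ENNReal.ofReal q) volume =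
      eLpNorm (fderiv ℝ ψ) (ENNReal.ofReal q) (volume.restrict Ω) := by
    rw [← eLpNorm_indicator_eq_eLpNorm_restrict (f := fderiv ℝ ψ) hΩ.measurableSet]
    congr 1
    ext1 x
    by_cases hx : x ∈ Ω
    · simp [hx]
    · have : fderiv ℝ ψ x = 0 := by
        by_contra h
        exact hx (hψ.sub (support_fderiv_subset ℝ h))
      simp [hx, this]
  change eLpNorm ψ (ENNReal.ofReal m) volume ≤
    C1 * eLpNorm (fderiv ℝ ψ) (ENNReal.ofReal q) volume at g1
  rw [r1, r2] at g1
  have hcf : Continuous (fderiv ℝ ψ) := hψ.cd.continuous_fderiv (by norm_num)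
  have g2 := eLpNorm_le_eLpNorm_mul_rpow_measure_univ (μ := volume.restrict Ω) (p := ENNReal.ofReal q)
    (q := 2) (f := fderiv ℝ ψ)
    (by rw [show (2 : ENNReal) = ENNReal.ofReal 2 by simp]; exact ENNReal.ofReal_le_ofReal hq2.le)
    hcf.aestronglyMeasurable
  rw [ENNReal.toReal_ofReal hq0.le, ENNReal.toReal_ofNat, ← hV] at g2
  have m1 : MemLp ψ (ENNReal.ofReal m) (volume.restrict Ω) :=
    (hψ.cd.continuous.memLp_of_hasCompactSupport hψ.cs).restrict _
  have m2 : MemLp (fderiv ℝ ψ) 2 (volume.restrict Ω) :=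
    (hcf.memLp_of_hasCompactSupport (hψ.cs.fderiv ℝ)).restrict _
  have v1 := m1.eLpNorm_eq_integral_rpow_norm (by simpa using hm0) (by simp)
  have v2 := m2.eLpNorm_eq_integral_rpow_norm (by simp) (by simp)
  rw [ENNReal.toReal_ofReal hm0.le] at v1
  set D := ∫ x in Ω, ∑ i, pd i ψ x * pd i ψ x with hD
  have hD' : ∫ x in Ω, ‖fderiv ℝ ψ x‖ ^ (2 : ENNReal).toReal = D := by
    simp [hD, norm_fderiv_sq_eq]
  have hDn : 0 ≤ D := integral_nonneg fun x => Finset.sum_nonneg fun i _ => mul_self_nonneg _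
  set S := ∫ x in Ω, |ψ x| ^ m with hS
  have hSn : 0 ≤ S := integral_nonneg fun x => by positivity
  rw [hD'] at v2
  have v1' : eLpNorm ψ (ENNReal.ofReal m) (volume.restrict Ω) = ENNReal.ofReal (S ^ m⁻¹) := v1
  have g3 : ENNReal.ofReal (S ^ m⁻¹) ≤ ENNReal.ofReal (C1 * V.toReal * D ^ (1 / 2 : ℝ)) := by
    rw [← v1']
    refine g1.trans ?_
    rw [ENNReal.ofReal_mul (by positivity), ENNReal.ofReal_mul (by positivity), ENNReal.ofReal_coe_nnreal,
      ENNReal.ofReal_toReal hVt, mul_assoc]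
    refine mul_le_mul_right (g2.trans ?_) _
    rw [v2, mul_comm]
    simp
  rw [ENNReal.ofReal_le_ofReal_iff (by positivity)] at g3
  have g4 := Real.rpow_le_rpow (by positivity) g3 hm0.le
  rw [← Real.rpow_mul hSn, inv_mul_cancel₀ hm0.ne', Real.rpow_one, Real.mul_rpow (by positivity)
    (by positivity), ← Real.rpow_mul hDn] at g4
  have e : (1 / 2 : ℝ) * m = m / 2 := by ring
  rw [e] at g4
  have : 0 ≤ D ^ (m / 2) := by positivity
  linarith

theorem firstEig_pos (hN : 2 ≤ N) (hΩ : IsOpen Ω) (hne : Ω.Nonempty) (hb : Bornology.IsBounded Ω) :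
    0 < firstEig Ω := by
  obtain ⟨C, hC, h⟩ := sobolev hN hΩ hb (m := 2) le_rfl (by
    intro h3
    have h3' : (3 : ℝ) ≤ N := by exact_mod_cast h3
    rw [lt_div_iff₀ (by linarith)]
    linarith)
  refine lt_of_lt_of_le (inv_pos.2 hC) (le_csInf ?_ ?_)
  · obtain ⟨x, hx⟩ := hne
    obtain ⟨φ, h1, h2, h3, -, h5⟩ := exists_contDiff_tsupport_subset (n := (⊤ : ℕ∞)) (hΩ.mem_nhds hx)
    exact ⟨_, φ, h3, h2, h1, fun h => by simp [h] at h5, rfl⟩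
  · rintro r ⟨φ, h1, h2, h3, h4, rfl⟩
    have ht : IsTest Ω φ := ⟨h1.of_le (by exact_mod_cast le_top), h2, h3⟩
    have := h φ ht
    rw [ht.setIntegral_eq fun x hx => by simp [image_eq_zero_of_notMem_tsupport hx],
      ht.setIntegral_eq fun x hx => Finset.sum_eq_zero fun i _ => by
        rw [image_eq_zero_of_notMem_tsupport fun h => hx (tsupport_pd_subset i φ h), mul_zero]] at this
    simp only [Real.rpow_two, sq_abs, div_self (two_ne_zero' ℝ), Real.rpow_one,
      ← norm_fderiv_sq_eq] at this
    have hpos : 0 < ∫ x, (φ x) ^ 2 := by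
      have hc : Continuous fun x => φ x ^ 2 := h1.continuous.pow 2
      obtain ⟨x, hx⟩ := Function.ne_iff.1 h4
      refine hc.integral_pos_of_hasCompactSupport_nonneg_nonzero ?_ (fun x => sq_nonneg _)
        (x := x) (by simpa using hx)
      exact h2.comp_left (g := fun t : ℝ => t ^ 2) (by simp)
    rw [le_div_iff₀ hpos, inv_mul_le_iff₀ hC]
    exact this

end Poincare

section WeakSolutions

variable {N : ℕ} {Ω : Set (Euc N)}

theorem integral_mul_le_sqrt {α : Type*} [MeasurableSpace α] {μ : Measure α} {f g : α → ℝ}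
    (hf : MemLp f 2 μ) (hg : MemLp g 2 μ) :
    |∫ x, f x * g x ∂μ| ≤ √(∫ x, f x * f x ∂μ) * √(∫ x, g x * g x ∂μ) := by
  have hI : ∀ {f g : α → ℝ}, MemLp f 2 μ → MemLp g 2 μ → Integrable (fun x => f x * g x) μ :=
    fun hf hg => hf.integrable_mul hg
  refine abs_le_of_forall_quadratic (integral_nonneg fun x => mul_self_nonneg _)
    (Real.sqrt_nonneg _) fun t => ?_
  rw [Real.sq_sqrt (integral_nonneg fun x => mul_self_nonneg _)]
  have : 0 ≤ ∫ x, (f x * f x + (2 * t) * (f x * g x) + t ^ 2 * (g x * g x)) ∂μ :=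
    integral_nonneg fun x => by
      simp only [Pi.zero_apply]; nlinarith [sq_nonneg (f x + t * g x)]
  rw [integral_add ((hI hf hf).fun_add ((hI hf hg).const_mul _)) ((hI hg hg).const_mul _),
    integral_add (hI hf hf) ((hI hf hg).const_mul _), integral_const_mul, integral_const_mul] at this
  linarith

theorem memLp_integrable_mul {α : Type*} [MeasurableSpace α] {μ : Measure α} {f g : α → ℝ}
    (hf : MemLp f 2 μ) (hg : MemLp g 2 μ) : Integrable (fun x => f x * g x) μ :=
  hf.integrable_mul hg

theorem norm_toLp_sq {α : Type*} [MeasurableSpace α] {μ : Measure α} {f : α → ℝ}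
    (hf : MemLp f 2 μ) : ‖hf.toLp f‖ ^ 2 = ∫ x, f x * f x ∂μ := by
  rw [← real_inner_self_eq_norm_sq, L2.inner_def]
  refine integral_congr_ae ?_
  filter_upwards [hf.coeFn_toLp] with x hx
  rw [hx]
  simp [sq]

theorem IsTest.memLp {ψ : Euc N → ℝ} (h : IsTest Ω ψ) : MemLp ψ 2 (volume.restrict Ω) :=
  (h.cd.continuous.memLp_of_hasCompactSupport h.cs).restrict _

theorem integral_sq_le_nrm (hΩ : IsOpen Ω) (hb : Bornology.IsBounded Ω) (hl : 0 < firstEig Ω)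
    {μ : ℝ} (hμ : 0 ≤ μ) {ψ : Euc N → ℝ} (hψ : IsTest Ω ψ) :
    ∫ x in Ω, ψ x * ψ x ≤ (firstEig Ω)⁻¹ * nrm Ω μ ψ ^ 2 := by
  have h1 := firstEig_mul_le hΩ hb hψ
  have h2 : 0 ≤ ∫ x in Ω, ψ x * ψ x := integral_nonneg fun x => mul_self_nonneg _
  rw [nrm_sq hμ, form_eq μ hψ hψ, ← mul_le_mul_iff_right₀ hl, ← mul_assoc,
    mul_inv_cancel₀ hl.ne', one_mul]
  nlinarith [mul_nonneg hμ h2]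

theorem sqrt_integral_le_nrm (hΩ : IsOpen Ω) (hb : Bornology.IsBounded Ω) (hl : 0 < firstEig Ω)
    {μ : ℝ} (hμ : 0 ≤ μ) {ψ : Euc N → ℝ} (hψ : IsTest Ω ψ) :
    √(∫ x in Ω, ψ x * ψ x) ≤ √(firstEig Ω)⁻¹ * nrm Ω μ ψ := by
  rw [← Real.sqrt_sq (nrm_nonneg (Ω := Ω) μ ψ), ← Real.sqrt_mul (inv_nonneg.2 hl.le)]
  exact Real.sqrt_le_sqrt (integral_sq_le_nrm hΩ hb hl hμ hψ)

/-- `w` is the weak solution of `-Δ w + μ w = h` with zero boundary values, expressed through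
approximation by test functions. -/
structure WSol (Ω : Set (Euc N)) (μ : ℝ) (h w : Euc N → ℝ) : Prop where
  rhs : MemLp h 2 (volume.restrict Ω)
  mem : MemLp w 2 (volume.restrict Ω)
  approx : ∃ (φ : ℕ → Euc N → ℝ) (ε : ℕ → ℝ), (∀ n, IsTest Ω (φ n)) ∧ Tendsto ε atTop (𝓝 0) ∧
    (∀ n ψ, IsTest Ω ψ → |form Ω μ (φ n) ψ - ∫ x in Ω, h x * ψ x| ≤ ε n * nrm Ω μ ψ) ∧
    Tendsto (fun n => ∫ x in Ω, (φ n x - w x) * (φ n x - w x)) atTop (𝓝 0)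

theorem exists_wsol (hΩ : IsOpen Ω) (hb : Bornology.IsBounded Ω) (hl : 0 < firstEig Ω)
    {μ : ℝ} (hμ : 0 ≤ μ) {h : Euc N → ℝ} (hh : MemLp h 2 (volume.restrict Ω)) :
    ∃ w, WSol Ω μ h w := by
  have hI : ∀ {ψ}, IsTest Ω ψ → Integrable (fun x => h x * ψ x) (volume.restrict Ω) :=
    fun hψ => hh.integrable_mul hψ.memLp
  set J : (Euc N → ℝ) → ℝ := fun φ => form Ω μ φ φ / 2 - ∫ x in Ω, h x * φ x with hJ
  set S : Set ℝ := J '' {φ | IsTest Ω φ} with hS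
  set c := √(∫ x in Ω, h x * h x) * √(firstEig Ω)⁻¹ with hc
  have hc0 : 0 ≤ c := by positivity
  have hlin : ∀ ψ, IsTest Ω ψ → |∫ x in Ω, h x * ψ x| ≤ c * nrm Ω μ ψ := fun ψ hψ => by
    refine (integral_mul_le_sqrt hh hψ.memLp).trans ?_
    rw [hc, mul_assoc]
    exact mul_le_mul_of_nonneg_left (sqrt_integral_le_nrm hΩ hb hl hμ hψ) (Real.sqrt_nonneg _)
  have hbb : BddBelow S := by
    refine ⟨-(c ^ 2 / 2), ?_⟩
    rintro _ ⟨φ, hφ, rfl⟩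
    have h1 := le_of_abs_le (hlin φ hφ)
    simp only [hJ]
    rw [← nrm_sq hμ]
    nlinarith [sq_nonneg (nrm Ω μ φ - c)]
  have h0 : IsTest Ω (fun _ : Euc N => (0 : ℝ)) :=
    ⟨contDiff_const, HasCompactSupport.zero, by
      have : tsupport (fun _ : Euc N => (0 : ℝ)) = ∅ := by
        rw [tsupport_eq_empty_iff]; rfl
      simp [this]⟩
  have hne : S.Nonempty := ⟨_, _, h0, rfl⟩
  have hex : ∀ n : ℕ, ∃ φ, IsTest Ω φ ∧ J φ < sInf S + (1 / ((n : ℝ) + 1)) ^ 2 / 2 := by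
    intro n
    obtain ⟨_, ⟨φ, hφ, rfl⟩, hlt⟩ := exists_lt_of_csInf_lt hne
      (show sInf S < sInf S + (1 / ((n : ℝ) + 1)) ^ 2 / 2 by
        have : 0 < (1 / ((n : ℝ) + 1)) ^ 2 / 2 := by positivity
        linarith)
    exact ⟨φ, hφ, hlt⟩
  choose φ hφ hJφ using hex
  set ε : ℕ → ℝ := fun n => 1 / ((n : ℝ) + 1) with hε
  have hε0 : ∀ n, 0 < ε n := fun n => by positivity
  have hεlim : Tendsto ε atTop (𝓝 0) := tendsto_one_div_add_atTop_nhds_zero_nat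
  have hgrad : ∀ n ψ, IsTest Ω ψ → |form Ω μ (φ n) ψ - ∫ x in Ω, h x * ψ x| ≤ ε n * nrm Ω μ ψ := by
    intro n ψ hψ
    refine abs_le_of_forall_quadratic (form_self_nonneg hμ ψ) (hε0 n).le fun t => ?_
    have h1 : sInf S ≤ J (fun x => φ n x + t * ψ x) :=
      csInf_le hbb ⟨_, (hφ n).add (hψ.const_mul t), rfl⟩
    have h2 := hJφ n
    simp only [hJ] at h1 h2
    rw [form_add_self μ (hφ n) hψ] at h1
    have h3 : ∫ x in Ω, h x * (φ n x + t * ψ x) =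
        (∫ x in Ω, h x * φ n x) + t * ∫ x in Ω, h x * ψ x := by
      rw [← integral_const_mul, ← integral_add (hI (hφ n)) ((hI hψ).const_mul t)]
      congr 1; ext x; ring
    rw [h3] at h1
    linarith
  have hsub : ∀ n m, IsTest Ω (fun x => φ n x + (-1) * φ m x) := fun n m =>
    (hφ n).add ((hφ m).const_mul _)
  have hcau : ∀ n m, nrm Ω μ (fun x => φ n x + (-1) * φ m x) ≤ ε n + ε m := by
    intro n m
    set ψ := fun x => φ n x + (-1) * φ m x with hψ
    have h1 := abs_le.1 (hgrad n ψ (hsub n m))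
    have h2 := abs_le.1 (hgrad m ψ (hsub n m))
    have h3 : form Ω μ ψ ψ = form Ω μ (φ n) ψ - form Ω μ (φ m) ψ := by
      conv_lhs => rw [hψ]
      rw [form_add_right μ (hsub n m) (hφ n) ((hφ m).const_mul _), form_const_mul_right μ _ (hφ m),
        form_comm μ _ (φ n), form_comm μ _ (φ m)]
      ring
    have h4 : nrm Ω μ ψ ^ 2 ≤ (ε n + ε m) * nrm Ω μ ψ := by
      rw [nrm_sq hμ, h3]; linarith [h1.2, h2.1]
    rcases (nrm_nonneg (Ω := Ω) μ ψ).eq_or_lt with h5 | h5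
    · rw [← h5]; linarith [hε0 n, hε0 m]
    · rw [sq] at h4; exact le_of_mul_le_mul_right h4 h5
  set Φ : ℕ → Lp ℝ 2 (volume.restrict Ω) := fun n => (hφ n).memLp.toLp (φ n) with hΦ
  have hdist : ∀ n m, dist (Φ n) (Φ m) ≤ √(firstEig Ω)⁻¹ * (ε n + ε m) := by
    intro n m
    have e1 : Φ n - Φ m = (hsub n m).memLp.toLp _ := by
      rw [hΦ, ← MemLp.toLp_sub]
      congr 1; ext x; simp; ring
    rw [dist_eq_norm, e1, ← Real.sqrt_sq (norm_nonneg _), norm_toLp_sq]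
    exact (sqrt_integral_le_nrm hΩ hb hl hμ (hsub n m)).trans
      (mul_le_mul_of_nonneg_left (hcau n m) (Real.sqrt_nonneg _))
  have hC : CauchySeq Φ := by
    refine cauchySeq_of_le_tendsto_0 (fun n => √(firstEig Ω)⁻¹ * (ε n + ε n)) ?_ ?_
    · intro n m k hn hm
      refine (hdist n m).trans (mul_le_mul_of_nonneg_left ?_ (Real.sqrt_nonneg _))
      have : ∀ {a b : ℕ}, a ≤ b → ε b ≤ ε a := fun {a b} hab => by
        simp only [hε]
        have : (a : ℝ) ≤ b := by exact_mod_cast hab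
        exact one_div_le_one_div_of_le (by positivity) (by linarith)
      linarith [this hn, this hm]
    · simpa using (hεlim.add hεlim).const_mul (√(firstEig Ω)⁻¹)
  obtain ⟨W, hW⟩ := cauchySeq_tendsto_of_complete hC
  refine ⟨W, hh, Lp.memLp W, φ, ε, hφ, hεlim, hgrad, ?_⟩
  have h1 : ∀ n, ∫ x in Ω, (φ n x - W x) * (φ n x - W x) = ‖Φ n - W‖ ^ 2 := by
    intro n
    have e : Φ n - W = ((hφ n).memLp.sub (Lp.memLp W)).toLp _ := by
      rw [MemLp.toLp_sub (hφ n).memLp (Lp.memLp W), Lp.toLp_coeFn]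
    rw [e, norm_toLp_sq]
    rfl
  simp_rw [h1]
  have := (tendsto_iff_norm_sub_tendsto_zero.1 hW).pow 2
  simpa using this

theorem WSol.add {μ : ℝ} {h₁ h₂ w₁ w₂ : Euc N → ℝ} (H₁ : WSol Ω μ h₁ w₁) (H₂ : WSol Ω μ h₂ w₂)
    {c : ℝ} :
    WSol Ω μ (fun x => h₁ x + c * h₂ x) (fun x => w₁ x + c * w₂ x) := by
  obtain ⟨r₁, m₁, φ₁, ε₁, t₁, l₁, g₁, c₁⟩ := H₁
  obtain ⟨r₂, m₂, φ₂, ε₂, t₂, l₂, g₂, c₂⟩ := H₂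
  refine ⟨r₁.add (r₂.const_mul c), m₁.add (m₂.const_mul c), fun n x => φ₁ n x + c * φ₂ n x,
    fun n => ε₁ n + |c| * ε₂ n, fun n => (t₁ n).add ((t₂ n).const_mul c), ?_, ?_, ?_⟩
  · simpa using l₁.add (l₂.const_mul |c|)
  · intro n ψ hψ
    rw [form_comm, form_add_right μ hψ (t₁ n) ((t₂ n).const_mul c), form_const_mul_right μ _ (t₂ n),
      form_comm μ ψ, form_comm μ ψ]
    have e : ∫ x in Ω, (h₁ x + c * h₂ x) * ψ x =
        (∫ x in Ω, h₁ x * ψ x) + c * ∫ x in Ω, h₂ x * ψ x := by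
      rw [← integral_const_mul, ← integral_add (memLp_integrable_mul r₁ hψ.memLp)
        ((memLp_integrable_mul r₂ hψ.memLp).const_mul c)]
      congr 1; ext x; ring
    rw [e]
    calc _ = |(form Ω μ (φ₁ n) ψ - ∫ x in Ω, h₁ x * ψ x) +
          c * (form Ω μ (φ₂ n) ψ - ∫ x in Ω, h₂ x * ψ x)| := by congr 1; ring
      _ ≤ ε₁ n * nrm Ω μ ψ + |c| * (ε₂ n * nrm Ω μ ψ) := by
          refine (abs_add_le _ _).trans (add_le_add (g₁ n ψ hψ) ?_)
          rw [abs_mul]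
          exact mul_le_mul_of_nonneg_left (g₂ n ψ hψ) (abs_nonneg _)
      _ = _ := by ring
  · have hlim : Tendsto (fun n => 2 * (∫ x in Ω, (φ₁ n x - w₁ x) * (φ₁ n x - w₁ x)) +
        2 * c ^ 2 * ∫ x in Ω, (φ₂ n x - w₂ x) * (φ₂ n x - w₂ x)) atTop (𝓝 0) := by
      simpa using (c₁.const_mul 2).add (c₂.const_mul (2 * c ^ 2))
    refine squeeze_zero (fun n => integral_nonneg fun x => mul_self_nonneg _) (fun n => ?_) hlim
    have i₁ : Integrable (fun x => (φ₁ n x - w₁ x) * (φ₁ n x - w₁ x)) (volume.restrict Ω) := memLp_integrable_mul ((t₁ n).memLp.sub m₁) ((t₁ n).memLp.sub m₁)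
    have i₂ : Integrable (fun x => (φ₂ n x - w₂ x) * (φ₂ n x - w₂ x)) (volume.restrict Ω) := memLp_integrable_mul ((t₂ n).memLp.sub m₂) ((t₂ n).memLp.sub m₂)
    rw [← integral_const_mul, ← integral_const_mul, ← integral_add (i₁.const_mul _) (i₂.const_mul _)]
    have i₃ := (((t₁ n).memLp.add ((t₂ n).memLp.const_mul c)).sub (m₁.add (m₂.const_mul c)))
    refine integral_mono (i₃.integrable_mul i₃) ((i₁.const_mul _).add (i₂.const_mul _)) fun x => ?_
    nlinarith [sq_nonneg ((φ₁ n x - w₁ x) - c * (φ₂ n x - w₂ x))]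

end WeakSolutions

section Comparison

variable {N : ℕ} {Ω : Set (Euc N)}

theorem hasDerivAt_posPart_sq (t : ℝ) : HasDerivAt (fun s : ℝ => max s 0 ^ 2) (2 * max t 0) t := by
  rcases lt_trichotomy t 0 with ht | rfl | ht
  · rw [max_eq_right ht.le, mul_zero]
    refine (hasDerivAt_const t (0 : ℝ)).congr_of_eventuallyEq ?_
    filter_upwards [gt_mem_nhds ht] with s hs
    simp [max_eq_right hs.le]
  · simp only [max_self, mul_zero]
    rw [hasDerivAt_iff_tendsto_slope]
    have h1 : Tendsto (fun s : ℝ => max s 0) (𝓝[≠] 0) (𝓝 0) := by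
      have : Continuous fun s : ℝ => max s 0 := by fun_prop
      simpa using (this.tendsto 0).mono_left nhdsWithin_le_nhds
    refine h1.congr' ?_
    filter_upwards [self_mem_nhdsWithin] with s hs
    have hs : s ≠ 0 := hs
    simp only [slope_def_field, max_self]
    rcases le_total s 0 with h | h
    · simp [max_eq_right h]
    · rw [max_eq_left h]; field_simp; simp [sq]
  · rw [max_eq_left ht.le]
    refine (by simpa using hasDerivAt_pow 2 t : HasDerivAt (fun s : ℝ => s ^ 2) (2 * t) t).congr_of_eventuallyEq ?_
    filter_upwards [lt_mem_nhds ht] with s hs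
    simp [max_eq_left hs.le]

/-- A `C¹` regularization of the positive part. -/
def softPos (δ t : ℝ) : ℝ := (max t 0 ^ 2 - max (t - δ) 0 ^ 2) / (2 * δ)

def softPosDeriv (δ t : ℝ) : ℝ := (max t 0 - max (t - δ) 0) / δ

theorem hasDerivAt_softPos {δ : ℝ} (hδ : 0 < δ) (t : ℝ) :
    HasDerivAt (softPos δ) (softPosDeriv δ t) t := by
  have h1 := hasDerivAt_posPart_sq t
  have h2 := (hasDerivAt_posPart_sq (t - δ)).comp_sub_const t δ
  have h3 : HasDerivAt (softPos δ) _ t := (h1.sub h2).div_const (2 * δ)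
  refine h3.congr_deriv ?_
  unfold softPosDeriv
  field_simp

theorem continuous_softPosDeriv (δ : ℝ) : Continuous (softPosDeriv δ) := by
  unfold softPosDeriv; fun_prop

theorem contDiff_softPos {δ : ℝ} (hδ : 0 < δ) : ContDiff ℝ 1 (softPos δ) := by
  rw [contDiff_one_iff_deriv]
  refine ⟨fun t => (hasDerivAt_softPos hδ t).differentiableAt, ?_⟩
  rw [show deriv (softPos δ) = softPosDeriv δ from funext fun t => (hasDerivAt_softPos hδ t).deriv]
  exact continuous_softPosDeriv δ

theorem softPosDeriv_mem {δ : ℝ} (hδ : 0 < δ) (t : ℝ) :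
    0 ≤ softPosDeriv δ t ∧ softPosDeriv δ t ≤ 1 := by
  rw [softPosDeriv]
  constructor
  · exact div_nonneg (sub_nonneg.2 (max_le_max_right _ (by linarith))) hδ.le
  · rw [div_le_one hδ]
    rcases le_total t 0 with h | h
    · rw [max_eq_right h]; linarith [le_max_right (t - δ) 0]
    · rw [max_eq_left h]; linarith [le_max_left (t - δ) 0]

theorem softPos_of_nonpos {δ t : ℝ} (hδ : 0 < δ) (ht : t ≤ 0) : softPos δ t = 0 := by
  rw [softPos, max_eq_right ht, max_eq_right (by linarith)]; simp

theorem softPos_nonneg {δ : ℝ} (hδ : 0 < δ) (t : ℝ) : 0 ≤ softPos δ t := by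
  rw [softPos]
  refine div_nonneg (sub_nonneg.2 ?_) (by linarith)
  exact pow_le_pow_left₀ (le_max_right _ _) (max_le_max_right _ (by linarith)) 2

theorem softPos_le {δ t : ℝ} (hδ : 0 < δ) (ht : 0 ≤ t) : softPos δ t ≤ t := by
  rw [softPos, div_le_iff₀ (by linarith), max_eq_left ht]
  rcases le_total t δ with h | h
  · rw [max_eq_right (by linarith)]; nlinarith
  · rw [max_eq_left (by linarith)]; nlinarith

theorem le_softPos_add {δ : ℝ} (hδ : 0 < δ) (t : ℝ) : t ≤ softPos δ t + δ := by
  rcases le_total t δ with h | h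
  · linarith [softPos_nonneg hδ t]
  · have : softPos δ t = t - δ / 2 := by
      rw [softPos, max_eq_left (by linarith), max_eq_left (by linarith)]; field_simp; ring
    linarith

/-- The truncation `(φ - v)⁺`, regularized. -/
def trunc (Ω : Set (Euc N)) (δ : ℝ) (φ v : Euc N → ℝ) : Euc N → ℝ :=
  Ω.indicator fun x => softPos δ (φ x - v x)

theorem isTest_trunc (hΩ : IsOpen Ω) {δ : ℝ} (hδ : 0 < δ) {φ v : Euc N → ℝ} (hφ : IsTest Ω φ)
    (hv : ContDiffOn ℝ 1 v Ω) (hv0 : ∀ x ∈ Ω, 0 < v x) : IsTest Ω (trunc Ω δ φ v) := by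
  have h0 : ∀ x, φ x = 0 → trunc Ω δ φ v x = 0 := by
    intro x hx
    by_cases h : x ∈ Ω
    · rw [trunc, indicator_of_mem h]
      exact softPos_of_nonpos hδ (by rw [hx]; linarith [hv0 x h])
    · exact indicator_of_notMem h _
  have hts : tsupport (trunc Ω δ φ v) ⊆ tsupport φ := closure_mono fun x hx h => hx (h0 x h)
  refine ⟨?_, hφ.cs.of_isClosed_subset (isClosed_tsupport _) hts, hts.trans hφ.sub⟩
  rw [contDiff_iff_contDiffAt]
  intro x
  by_cases hx : x ∈ Ω
  · have h1 : ContDiffAt ℝ 1 (fun y => softPos δ (φ y - v y)) x :=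
      (contDiff_softPos hδ).contDiffAt.comp x
        (hφ.cd.contDiffAt.sub (hv.contDiffAt (hΩ.mem_nhds hx)))
    refine h1.congr_of_eventuallyEq ?_
    filter_upwards [hΩ.mem_nhds hx] with y hy
    rw [trunc, indicator_of_mem hy]
  · have h1 : trunc Ω δ φ v =ᶠ[𝓝 x] fun _ => 0 := by
      filter_upwards [(isClosed_tsupport φ).isOpen_compl.mem_nhds fun h => hx (hφ.sub h)] with y hy
      exact h0 y (image_eq_zero_of_notMem_tsupport hy)
    exact contDiffAt_const.congr_of_eventuallyEq h1

theorem pd_trunc (hΩ : IsOpen Ω) {δ : ℝ} (hδ : 0 < δ) {φ v : Euc N → ℝ} (hφ : IsTest Ω φ)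
    (hv : ContDiffOn ℝ 1 v Ω) {x : Euc N} (hx : x ∈ Ω) (i : Fin N) :
    pd i (trunc Ω δ φ v) x = softPosDeriv δ (φ x - v x) * (pd i φ x - pd i v x) := by
  have d1 := (hφ.cd.differentiable (by norm_num) x).hasFDerivAt
  have d2 := ((hv.contDiffAt (hΩ.mem_nhds hx)).differentiableAt (by norm_num)).hasFDerivAt
  have h1 := (hasDerivAt_softPos hδ (φ x - v x)).comp_hasFDerivAt x (d1.sub d2)
  have h2 : trunc Ω δ φ v =ᶠ[𝓝 x] (softPos δ ∘ (φ - v)) := by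
    filter_upwards [hΩ.mem_nhds hx] with y hy
    rw [trunc, indicator_of_mem hy]; rfl
  rw [pd, (h1.congr_of_eventuallyEq h2).fderiv]
  simp [pd]

/-- Quantitative comparison principle with a classical supersolution up to an `L²` error. -/
theorem WSol.comparison (hΩ : IsOpen Ω) (hb : Bornology.IsBounded Ω) (hl : 0 < firstEig Ω)
    {μ : ℝ} (hμ : 0 ≤ μ) {h w v e : Euc N → ℝ} (H : WSol Ω μ h w) (hv : ContDiffOn ℝ 2 v Ω)
    (hv0 : ∀ x ∈ Ω, 0 < v x) (he : MemLp e 2 (volume.restrict Ω)) 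
    (hle : ∀ x ∈ Ω, h x ≤ -lap v x + μ * v x + e x) :
    MemLp (fun x => max (w x - v x) 0) 2 (volume.restrict Ω) ∧
    ∫ x in Ω, max (w x - v x) 0 * max (w x - v x) 0 ≤
      3 * (firstEig Ω)⁻¹ ^ 2 * ∫ x in Ω, e x * e x := by
  obtain ⟨hh, hw, φ, ε, hφ, hε, hg, hφw⟩ := H
  have hv1 : ContDiffOn ℝ 1 v Ω := hv.of_le (by norm_num)
  have hfin : IsFiniteMeasure (volume.restrict Ω) := ⟨by simpa using hb.measure_lt_top⟩
  have hvm : AEStronglyMeasurable v (volume.restrict Ω) :=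
    hv.continuousOn.aestronglyMeasurable hΩ.measurableSet
  set P : Euc N → ℝ := fun x => max (w x - v x) 0 with hP
  have hPm : MemLp P 2 (volume.restrict Ω) := by
    refine hw.of_le ((hw.1.sub hvm).sup aestronglyMeasurable_const) ?_
    filter_upwards [ae_restrict_mem hΩ.measurableSet] with x hx
    have := hv0 x hx
    simp only [hP, Real.norm_eq_abs, abs_of_nonneg (le_max_right (w x - v x) 0)]
    exact max_le (by linarith [le_abs_self (w x)]) (abs_nonneg _)
  refine ⟨hPm, ?_⟩
  set E := √(∫ x in Ω, e x * e x) with hE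
  set l := √(firstEig Ω)⁻¹ with hl'
  set δ : ℕ → ℝ := fun n => 1 / ((n : ℝ) + 1) with hδ
  have hδ0 : ∀ n, 0 < δ n := fun n => by positivity
  set ψ : ℕ → Euc N → ℝ := fun n => trunc Ω (δ n) (φ n) v with hψ
  have hψt : ∀ n, IsTest Ω (ψ n) := fun n => isTest_trunc hΩ (hδ0 n) (hφ n) hv1 hv0
  have hψn : ∀ n x, 0 ≤ ψ n x := fun n x => indicator_nonneg (fun y _ => softPos_nonneg (hδ0 n) _) x
  -- the energy estimate
  have hnrm : ∀ n, nrm Ω μ (ψ n) ≤ |ε n| + E * l := by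
    intro n
    have i1 : Integrable (fun x => ∑ i, pd i v x * pd i (ψ n) x) (volume.restrict Ω) :=
      integrable_finsetSum _ fun i _ => (integrable_mul_of_tsupport hΩ
        (contDiffOn_pd hΩ hv i).continuousOn (continuous_pd (hψt n).cd i)
        (hasCompactSupport_pd (hψt n).cs i)
        ((tsupport_pd_subset i _).trans (hψt n).sub)).integrableOn
    have i2 : Integrable (fun x => v x * ψ n x) (volume.restrict Ω) :=
      (integrable_mul_of_tsupport hΩ hv.continuousOn (hψt n).cd.continuous (hψt n).cs
        (hψt n).sub).integrableOn
    have i3 : Integrable (fun x => (-lap v x) * ψ n x) (volume.restrict Ω) :=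
      (integrable_mul_of_tsupport hΩ (continuousOn_lap hΩ hv).neg (hψt n).cd.continuous (hψt n).cs
        (hψt n).sub).integrableOn
    have h1 : form Ω μ (ψ n) (ψ n) ≤ form Ω μ (φ n) (ψ n) -
        ((∫ x in Ω, ∑ i, pd i v x * pd i (ψ n) x) + μ * ∫ x in Ω, v x * ψ n x) := by
      rw [form, form, ← integral_const_mul, ← integral_add i1 (i2.const_mul μ),
        ← integral_sub ((hφ n).integrable_form μ (hψt n)) (i1.fun_add (i2.const_mul μ))]
      refine setIntegral_mono_on ((hψt n).integrable_form μ (hψt n))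
        (((hφ n).integrable_form μ (hψt n)).sub (i1.add (i2.const_mul μ))) hΩ.measurableSet
        fun x hx => ?_
      have a1 : ∑ i, pd i (ψ n) x * pd i (ψ n) x ≤
          ∑ i, pd i (φ n) x * pd i (ψ n) x - ∑ i, pd i v x * pd i (ψ n) x := by
        rw [← Finset.sum_sub_distrib]
        refine Finset.sum_le_sum fun i _ => ?_
        obtain ⟨s0, s1⟩ := softPosDeriv_mem (hδ0 n) (φ n x - v x)
        simp only [hψ]
        rw [pd_trunc hΩ (hδ0 n) (hφ n) hv1 hx i]
        set s := softPosDeriv (δ n) (φ n x - v x)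
        set D := pd i (φ n) x - pd i v x
        have : pd i (φ n) x * (s * D) - pd i v x * (s * D) = s * (D * D) := by
          simp only [D]; ring
        rw [this]
        nlinarith [mul_nonneg (mul_nonneg s0 (sub_nonneg.2 s1)) (mul_self_nonneg D)]
      have a2 : ψ n x * ψ n x ≤ φ n x * ψ n x - v x * ψ n x := by
        have e1 : ψ n x = softPos (δ n) (φ n x - v x) := indicator_of_mem hx _
        rcases le_total (φ n x - v x) 0 with h | h
        · rw [e1, softPos_of_nonpos (hδ0 n) h]; simp
        · have := softPos_le (hδ0 n) h
          rw [← e1] at this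
          nlinarith [hψn n x]
      nlinarith
    rw [integral_pd_mul_pd hΩ hv (hψt n)] at h1
    have h2 := le_of_abs_le (hg n (ψ n) (hψt n))
    have h3 : ∫ x in Ω, h x * ψ n x ≤ (∫ x in Ω, (-lap v x) * ψ n x) +
        μ * (∫ x in Ω, v x * ψ n x) + ∫ x in Ω, e x * ψ n x := by
      have i4 := memLp_integrable_mul he (hψt n).memLp
      rw [← integral_const_mul, ← integral_add i3 (i2.const_mul μ),
        ← integral_add (i3.fun_add (i2.const_mul μ)) i4]
      refine setIntegral_mono_on (memLp_integrable_mul hh (hψt n).memLp)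
        ((i3.add (i2.const_mul μ)).add i4) hΩ.measurableSet fun x hx => ?_
      have := mul_le_mul_of_nonneg_right (hle x hx) (hψn n x)
      linarith
    have h4 : ∫ x in Ω, e x * ψ n x ≤ E * l * nrm Ω μ (ψ n) := by
      refine (le_of_abs_le (integral_mul_le_sqrt he (hψt n).memLp)).trans ?_
      rw [mul_assoc]
      exact mul_le_mul_of_nonneg_left (sqrt_integral_le_nrm hΩ hb hl hμ (hψt n)) (Real.sqrt_nonneg _)
    have h5 : nrm Ω μ (ψ n) ^ 2 ≤ (|ε n| + E * l) * nrm Ω μ (ψ n) := by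
      have := mul_le_mul_of_nonneg_right (le_abs_self (ε n)) (nrm_nonneg (Ω := Ω) μ (ψ n))
      rw [nrm_sq hμ]; linarith
    rcases (nrm_nonneg (Ω := Ω) μ (ψ n)).eq_or_lt with h6 | h6
    · rw [← h6]; positivity
    · rw [sq] at h5; exact le_of_mul_le_mul_right h5 h6
  set V := ∫ _ in Ω, (1 : ℝ) with hV
  have hbound : ∀ n, ∫ x in Ω, P x * P x ≤ 3 * ((firstEig Ω)⁻¹ * (|ε n| + E * l) ^ 2 +
      δ n ^ 2 * V + ∫ x in Ω, (φ n x - w x) * (φ n x - w x)) := by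
    intro n
    have j1 := memLp_integrable_mul (hψt n).memLp (hψt n).memLp
    have j2 : Integrable (fun _ : Euc N => δ n ^ 2 * (1 : ℝ)) (volume.restrict Ω) :=
      integrable_const _
    have j3 : Integrable (fun x => (φ n x - w x) * (φ n x - w x)) (volume.restrict Ω) :=
      memLp_integrable_mul ((hφ n).memLp.sub hw) ((hφ n).memLp.sub hw)
    have k1 : ∫ x in Ω, P x * P x ≤ 3 * ((∫ x in Ω, ψ n x * ψ n x) +
      δ n ^ 2 * V + ∫ x in Ω, (φ n x - w x) * (φ n x - w x)) := by
      rw [hV, ← integral_const_mul (δ n ^ 2), ← integral_add j1 j2, ← integral_add (j1.fun_add j2) j3,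
        ← integral_const_mul]
      refine setIntegral_mono_on (memLp_integrable_mul hPm hPm)
        (((j1.fun_add j2).fun_add j3).const_mul 3) hΩ.measurableSet fun x hx => ?_
      have e1 : ψ n x = softPos (δ n) (φ n x - v x) := indicator_of_mem hx _
      have e2 := le_softPos_add (hδ0 n) (φ n x - v x)
      rw [← e1] at e2
      have e3 := hψn n x
      have e4 := hδ0 n
      have e5 := neg_abs_le (φ n x - w x)
      have e6 := sq_abs (φ n x - w x)
      have e7 : P x ≤ ψ n x + δ n + |φ n x - w x| :=
        max_le (by linarith) (by positivity)
      have e8 : 0 ≤ P x := le_max_right _ _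
      have e9 : P x * P x ≤ (ψ n x + δ n + |φ n x - w x|) ^ 2 := by
        rw [sq]; exact mul_self_le_mul_self e8 e7
      nlinarith [sq_nonneg (ψ n x - δ n), sq_nonneg (ψ n x - |φ n x - w x|),
        sq_nonneg (δ n - |φ n x - w x|)]
    have k2 := integral_sq_le_nrm hΩ hb hl hμ (hψt n)
    have k3 : (firstEig Ω)⁻¹ * nrm Ω μ (ψ n) ^ 2 ≤ (firstEig Ω)⁻¹ * (|ε n| + E * l) ^ 2 :=
      mul_le_mul_of_nonneg_left (pow_le_pow_left₀ (nrm_nonneg _ _) (hnrm n) 2) (inv_nonneg.2 hl.le)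
    linarith
  have hlim : Tendsto (fun n => 3 * ((firstEig Ω)⁻¹ * (|ε n| + E * l) ^ 2 +
      δ n ^ 2 * V + ∫ x in Ω, (φ n x - w x) * (φ n x - w x))) atTop
      (𝓝 (3 * ((firstEig Ω)⁻¹ * (|0| + E * l) ^ 2 + 0 ^ 2 * V + 0))) :=
    (((((hε.abs.add_const _).pow 2).const_mul _).add
      ((tendsto_one_div_add_atTop_nhds_zero_nat.pow 2).mul_const V)).add hφw).const_mul 3
  refine (ge_of_tendsto' hlim hbound).trans (le_of_eq ?_)
  have e1 : E ^ 2 = ∫ x in Ω, e x * e x := Real.sq_sqrt (integral_nonneg fun x => mul_self_nonneg _)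
  have e2 : l ^ 2 = (firstEig Ω)⁻¹ := Real.sq_sqrt (inv_nonneg.2 hl.le)
  rw [abs_zero, zero_add, mul_pow, e1, e2]
  ring

/-- If `w` has classical supersolutions below `V` up to errors vanishing in `L²`, then
`w ≤ V` almost everywhere. -/
theorem WSol.ae_le_of_supersolutions (hΩ : IsOpen Ω) (hb : Bornology.IsBounded Ω)
    (hl : 0 < firstEig Ω) {μ : ℝ} (hμ : 0 ≤ μ) {h w V : Euc N → ℝ} (H : WSol Ω μ h w)
    (hex : ∀ η > 0, ∃ v e : Euc N → ℝ, ContDiffOn ℝ 2 v Ω ∧ (∀ x ∈ Ω, 0 < v x) ∧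
      (∀ x ∈ Ω, v x ≤ V x) ∧ MemLp e 2 (volume.restrict Ω) ∧
      (∀ x ∈ Ω, h x ≤ -lap v x + μ * v x + e x) ∧ ∫ x in Ω, e x * e x ≤ η)
    (hV : AEStronglyMeasurable V (volume.restrict Ω)) :
    ∀ᵐ x ∂volume.restrict Ω, w x ≤ V x := by
  set P : Euc N → ℝ := fun x => max (w x - V x) 0 with hP
  have hPm : MemLp P 2 (volume.restrict Ω) := by
    obtain ⟨v, e, hv, hv0, hvV, he, hle, -⟩ := hex 1 one_pos
    have := (H.comparison hΩ hb hl hμ hv hv0 he hle).1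
    refine this.of_le ((H.mem.1.sub hV).sup aestronglyMeasurable_const) ?_
    filter_upwards [ae_restrict_mem hΩ.measurableSet] with x hx
    simp only [hP, Real.norm_eq_abs, abs_of_nonneg (le_max_right _ (0 : ℝ))]
    exact max_le_max_right _ (by linarith [hvV x hx])
  have h0 : ∫ x in Ω, P x * P x ≤ 0 := by
    refine le_of_forall_pos_le_add fun η hη => ?_
    have hK : 0 < 3 * (firstEig Ω)⁻¹ ^ 2 := by positivity
    obtain ⟨v, e, hv, hv0, hvV, he, hle, hη'⟩ := hex (η / (3 * (firstEig Ω)⁻¹ ^ 2)) (by positivity)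
    obtain ⟨m, hm⟩ := H.comparison hΩ hb hl hμ hv hv0 he hle
    have : ∫ x in Ω, P x * P x ≤ ∫ x in Ω, max (w x - v x) 0 * max (w x - v x) 0 := by
      refine setIntegral_mono_on (memLp_integrable_mul hPm hPm) (memLp_integrable_mul m m)
        hΩ.measurableSet fun x hx => ?_
      exact mul_self_le_mul_self (le_max_right _ _) (max_le_max_right _ (by linarith [hvV x hx]))
    have h2 := mul_le_mul_of_nonneg_left hη' hK.le
    rw [mul_div_cancel₀ _ hK.ne'] at h2
    linarith
  have h1 : ∫ x in Ω, P x * P x = 0 := le_antisymm h0 (integral_nonneg fun x => mul_self_nonneg _)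
  rw [integral_eq_zero_iff_of_nonneg (fun x => mul_self_nonneg _)
    (memLp_integrable_mul hPm hPm)] at h1
  filter_upwards [h1] with x hx
  have h2 : P x = 0 := mul_self_eq_zero.1 hx
  have := le_max_left (w x - V x) 0
  simp only [hP] at h2
  linarith

theorem WSol.ae_nonpos (hΩ : IsOpen Ω) (hb : Bornology.IsBounded Ω)
    (hl : 0 < firstEig Ω) {μ : ℝ} (hμ : 0 ≤ μ) {h w : Euc N → ℝ} (H : WSol Ω μ h w)
    (hh : ∀ x ∈ Ω, h x ≤ 0) : ∀ᵐ x ∂volume.restrict Ω, w x ≤ 0 := by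
  have : ∀ n : ℕ, ∀ᵐ x ∂volume.restrict Ω, w x ≤ 1 / ((n : ℝ) + 1) := fun n => by
    have hn : (0 : ℝ) < 1 / ((n : ℝ) + 1) := by positivity
    refine H.ae_le_of_supersolutions hΩ hb hl hμ (V := fun _ => 1 / ((n : ℝ) + 1)) (fun η hη =>
      ⟨fun _ => 1 / ((n : ℝ) + 1), fun _ => 0, contDiffOn_const, fun x _ => hn, fun x _ => le_rfl,
        MemLp.zero, fun x hx => ?_, by simpa using hη.le⟩) aestronglyMeasurable_const
    have : lap (fun _ : Euc N => 1 / ((n : ℝ) + 1)) x = 0 := by simp [lap]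
    rw [this]
    have := mul_nonneg hμ hn.le
    linarith [hh x hx]
  filter_upwards [ae_all_iff.2 this] with x hx
  exact ge_of_tendsto' tendsto_one_div_add_atTop_nhds_zero_nat hx

end Comparison

section Kernel

variable {N : ℕ}

/-- The regularized power `(|z|² + t²)^(-N/2)`. -/
def kerPow (t : ℝ) (z : Euc N) : ℝ := (‖z‖ ^ 2 + t ^ 2) ^ (-(N : ℝ) / 2)

/-- A radial function with gradient `-z (|z|² + t²)^(-N/2)`: the regularized Newtonian kernel. -/
def kerP (R t : ℝ) (z : Euc N) : ℝ :=
  (1 / 2) * ∫ τ in (‖z‖ ^ 2)..(R ^ 2), (τ + t ^ 2) ^ (-(N : ℝ) / 2)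

/-- The negative Laplacian of `kerP`. -/
def kerRho (t : ℝ) (z : Euc N) : ℝ := N * t ^ 2 * (‖z‖ ^ 2 + t ^ 2) ^ (-(N : ℝ) / 2 - 1)

theorem hasFDerivAt_kerP {R t : ℝ} (hR : 0 < R) {z : Euc N} (hz : 0 < ‖z‖ ^ 2 + t ^ 2) :
    HasFDerivAt (kerP R t) (-(kerPow t z) • innerSL ℝ z) z := by
  have hc : ∀ τ : ℝ, 0 < τ + t ^ 2 →
      ContinuousAt (fun τ : ℝ => (τ + t ^ 2) ^ (-(N : ℝ) / 2)) τ := fun τ hτ =>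
    (continuousAt_id.add continuousAt_const).rpow_const (Or.inl hτ.ne')
  have hI : IntervalIntegrable (fun τ : ℝ => (τ + t ^ 2) ^ (-(N : ℝ) / 2)) volume (‖z‖ ^ 2) (R ^ 2) := by
    refine ContinuousOn.intervalIntegrable fun τ hτ => (hc τ ?_).continuousWithinAt
    have h1 : min (‖z‖ ^ 2) (R ^ 2) ≤ τ := hτ.1
    rcases min_le_iff.1 h1 with h | h
    · linarith
    · nlinarith [sq_nonneg t]
  have hs : StronglyMeasurableAtFilter (fun τ : ℝ => (τ + t ^ 2) ^ (-(N : ℝ) / 2)) (𝓝 (‖z‖ ^ 2)) :=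
    (Measurable.stronglyMeasurable (by fun_prop)).stronglyMeasurableAtFilter
  have h1 := intervalIntegral.integral_hasDerivAt_left hI hs (hc _ hz)
  have h2 : HasFDerivAt (fun y : Euc N => ‖y‖ ^ 2) (2 • innerSL ℝ z) z :=
    (hasStrictFDerivAt_norm_sq z).hasFDerivAt
  have h3 := (h1.comp_hasFDerivAt z h2).const_mul (1 / 2)
  refine h3.congr_fderiv ?_
  ext v
  simp [kerPow]
  ring

theorem kerPow_hasFDerivAt {t : ℝ} {z : Euc N} (hz : 0 < ‖z‖ ^ 2 + t ^ 2) :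
    HasFDerivAt (kerPow t) (-(N * (‖z‖ ^ 2 + t ^ 2) ^ (-(N : ℝ) / 2 - 1)) • innerSL ℝ z) z := by
  have h2 : HasFDerivAt (fun y : Euc N => ‖y‖ ^ 2 + t ^ 2) (2 • innerSL ℝ z) z :=
    (hasStrictFDerivAt_norm_sq z).hasFDerivAt.add_const _
  have h3 := (Real.hasDerivAt_rpow_const (p := -(N : ℝ) / 2) (Or.inl hz.ne')).comp_hasFDerivAt z h2
  refine HasFDerivAt.congr_fderiv h3 ?_
  ext v
  simp
  ring

theorem isOpen_kerDom (t : ℝ) : IsOpen {z : Euc N | 0 < ‖z‖ ^ 2 + t ^ 2} :=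
  isOpen_lt continuous_const (by fun_prop)

theorem contDiffOn_kerPow (t : ℝ) :
    ContDiffOn ℝ (⊤ : ℕ∞) (kerPow t : Euc N → ℝ) {z | 0 < ‖z‖ ^ 2 + t ^ 2} := fun _ hz =>
  (((contDiff_norm_sq ℝ).add contDiff_const).contDiffAt.rpow_const_of_ne
    (ne_of_gt hz)).contDiffWithinAt

theorem contDiffOn_kerP {R : ℝ} (hR : 0 < R) (t : ℝ) :
    ContDiffOn ℝ (⊤ : ℕ∞) (kerP R t : Euc N → ℝ) {z | 0 < ‖z‖ ^ 2 + t ^ 2} := by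
  rw [contDiffOn_infty_iff_fderiv_of_isOpen (isOpen_kerDom t)]
  refine ⟨fun z hz => (hasFDerivAt_kerP hR hz).differentiableAt.differentiableWithinAt, ?_⟩
  refine ContDiffOn.congr (f := fun z : Euc N => -(kerPow t z) • innerSL ℝ z) ?_
    fun z hz => (hasFDerivAt_kerP hR hz).fderiv
  exact (contDiffOn_kerPow t).neg.smul (innerSL ℝ).contDiff.contDiffOn

theorem innerSL_single (z : Euc N) (i : Fin N) :
    innerSL ℝ z (EuclideanSpace.single i (1 : ℝ)) = z i := by
  simp [EuclideanSpace.inner_single_right]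

theorem pd_kerP {R t : ℝ} (hR : 0 < R) {z : Euc N} (hz : 0 < ‖z‖ ^ 2 + t ^ 2) (i : Fin N) :
    pd i (kerP R t) z = -(z i * kerPow t z) := by
  rw [pd, (hasFDerivAt_kerP hR hz).fderiv, smul_apply, innerSL_single, smul_eq_mul]
  ring

theorem pd_pd_kerP {R t : ℝ} (hR : 0 < R) {z : Euc N} (hz : 0 < ‖z‖ ^ 2 + t ^ 2) (i : Fin N) :
    pd i (pd i (kerP R t)) z =
      N * (‖z‖ ^ 2 + t ^ 2) ^ (-(N : ℝ) / 2 - 1) * z i ^ 2 - kerPow t z := by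
  have h1 : pd i (kerP R t) =ᶠ[𝓝 z] fun y => -(y i * kerPow t y) := by
    filter_upwards [(isOpen_kerDom t).mem_nhds hz] with y hy
    exact pd_kerP hR hy i
  have h2 : HasFDerivAt (fun y : Euc N => y i) (EuclideanSpace.proj (𝕜 := ℝ) i) z :=
    (EuclideanSpace.proj (𝕜 := ℝ) i : Euc N →L[ℝ] ℝ).hasFDerivAt
  have h3 := (h2.mul (kerPow_hasFDerivAt hz)).neg
  have h4 : pd i (pd i (kerP R t)) z = pd i (fun y => -(y i * kerPow t y)) z := by
    rw [pd, h1.fderiv_eq]; rfl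
  have h5 : fderiv ℝ (fun y : Euc N => -(y i * kerPow t y)) z = _ := h3.fderiv
  rw [h4, pd, h5]
  simp [EuclideanSpace.inner_single_right]
  ring

theorem lap_kerP {R t : ℝ} (hR : 0 < R) {z : Euc N} (hz : 0 < ‖z‖ ^ 2 + t ^ 2) :
    lap (kerP R t) z = -kerRho t z := by
  rw [lap_eq_sum_pd]
  simp_rw [pd_pd_kerP hR hz]
  rw [Finset.sum_sub_distrib, ← Finset.mul_sum, ← EuclideanSpace.real_norm_sq_eq, Finset.sum_const,
    Finset.card_univ, Fintype.card_fin, nsmul_eq_mul, kerPow, kerRho]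
  have : (‖z‖ ^ 2 + t ^ 2) ^ (-(N : ℝ) / 2) =
      (‖z‖ ^ 2 + t ^ 2) ^ (-(N : ℝ) / 2 - 1) * (‖z‖ ^ 2 + t ^ 2) := by
    rw [Real.rpow_sub_one hz.ne', div_mul_cancel₀ _ hz.ne']
  rw [this]
  ring

end Kernel

section Convolution

variable {N : ℕ}

/-- The convolution `∫ h(y) K(x - y) dy`. -/
def cv (h K : Euc N → ℝ) (x : Euc N) : ℝ := ∫ y, h y * K (x - y)

open scoped Convolution in
theorem cv_eq (h K : Euc N → ℝ) : cv h K = h ⋆[ContinuousLinearMap.mul ℝ ℝ] K := rfl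

theorem contDiff_cv {h K : Euc N → ℝ} (hh : LocallyIntegrable h) (hc : HasCompactSupport K)
    {n : ℕ∞} (hK : ContDiff ℝ n K) : ContDiff ℝ n (cv h K) := by
  rw [cv_eq]
  exact hc.contDiff_convolution_right _ hh hK

theorem integrable_cv {h K : Euc N → ℝ} (hh : LocallyIntegrable h) (hc : HasCompactSupport K)
    (hK : Continuous K) (x : Euc N) : Integrable fun y => h y * K (x - y) :=
  hc.convolutionExists_right (ContinuousLinearMap.mul ℝ ℝ) hh hK x

theorem pd_cv {h K : Euc N → ℝ} (hh : LocallyIntegrable h) (hc : HasCompactSupport K)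
    (hK : ContDiff ℝ 1 K) (i : Fin N) : pd i (cv h K) = cv h (pd i K) := by
  ext x
  rw [pd, cv_eq, (hc.hasFDerivAt_convolution_right _ hh hK x).fderiv, convolution_precompR_apply]
  · rfl
  · exact hh
  · exact hc.fderiv ℝ
  · exact hK.continuous_fderiv (by norm_num)

theorem cv_comm (h K : Euc N → ℝ) : cv h K = cv K h := by
  ext x
  unfold cv
  rw [← integral_sub_left_eq_self _ _ x]
  refine integral_congr_ae (ae_of_all _ fun y => ?_)
  simp [mul_comm]

theorem lap_cv {h K : Euc N → ℝ} (hh : LocallyIntegrable h) (hc : HasCompactSupport K)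
    (hK : ContDiff ℝ 2 K) : lap (cv h K) = cv h (lap K) := by
  ext x
  rw [lap_eq_sum_pd]
  have hK1 : ∀ i, ContDiff ℝ 1 (pd i K) := fun i => by
    rw [← contDiffOn_univ]
    exact contDiffOn_pd isOpen_univ hK.contDiffOn i
  have h1 : ∀ i, pd i (pd i (cv h K)) = cv h (pd i (pd i K)) := fun i => by
    rw [pd_cv hh hc (hK.of_le (by norm_num)), pd_cv hh (hasCompactSupport_pd hc i) (hK1 i)]
  simp_rw [h1, cv]
  rw [← integral_finsetSum]
  · simp_rw [← Finset.mul_sum]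
    rfl
  · exact fun i _ => integrable_cv hh (hasCompactSupport_pd (hasCompactSupport_pd hc i) i)
      (continuous_pd (hK1 i) i) x

theorem integrable_cv_of_bdd {h K : Euc N → ℝ} (hh : AEStronglyMeasurable h) {S : ℝ}
    (hS : ∀ x, |h x| ≤ S) (hK : Integrable K) (x : Euc N) :
    Integrable fun y => h y * K (x - y) :=
  (hK.comp_sub_left x).bdd_mul hh (ae_of_all _ fun y => hS y)

theorem abs_cv_le {h K : Euc N → ℝ} {S : ℝ}
    (hS : ∀ x, |h x| ≤ S) (hK : Integrable K) (x : Euc N) : |cv h K x| ≤ S * ∫ z, |K z| := by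
  have h1 : ∫ y, |K (x - y)| = ∫ z, |K z| := integral_sub_left_eq_self (fun z => |K z|) volume x
  rw [cv, ← h1, ← integral_const_mul]
  refine (abs_integral_le_integral_abs).trans (integral_mono_of_nonneg (ae_of_all _ fun y => abs_nonneg _)
    ((hK.comp_sub_left x).abs.const_mul S) (ae_of_all _ fun y => ?_))
  simp only [abs_mul]
  exact mul_le_mul_of_nonneg_right (hS y) (abs_nonneg _)

theorem abs_cv_sub_le {h K L : Euc N → ℝ} (hh : AEStronglyMeasurable h) {S : ℝ}
    (hS : ∀ x, |h x| ≤ S) (hK : Integrable K) (hL : Integrable L) (x : Euc N) :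
    |cv h K x - cv h L x| ≤ S * ∫ z, |K z - L z| := by
  have h1 : cv h K x - cv h L x = cv h (fun z => K z - L z) x := by
    unfold cv
    rw [← integral_sub (integrable_cv_of_bdd hh hS hK x) (integrable_cv_of_bdd hh hS hL x)]
    simp_rw [mul_sub]
  rw [h1]
  exact abs_cv_le hS (hK.sub hL) x

theorem pd_cv_left {h K : Euc N → ℝ} (hK : LocallyIntegrable K) (hc : HasCompactSupport h)
    (hh : ContDiff ℝ 1 h) (i : Fin N) : pd i (cv h K) = cv (pd i h) K := by
  rw [cv_comm, pd_cv hK hc hh, cv_comm]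

/-- `L¹` convergence of a dominated family. -/
theorem tendsto_integral_abs_sub {ι : Type*} {l : Filter ι} [l.IsCountablyGenerated]
    {F : ι → Euc N → ℝ} {F₀ D : Euc N → ℝ} (hF : ∀ᶠ t in l, AEStronglyMeasurable (F t))
    (hF₀ : AEStronglyMeasurable F₀) (hD : Integrable D) (hle : ∀ᶠ t in l, ∀ᵐ z, |F t z| ≤ D z)
    (hle₀ : ∀ᵐ z, |F₀ z| ≤ D z)
    (hlim : ∀ᵐ z, Tendsto (fun t => F t z) l (𝓝 (F₀ z))) :
    Tendsto (fun t => ∫ z, |F t z - F₀ z|) l (𝓝 0) := by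
  have h0 : (0 : ℝ) = ∫ _ : Euc N, (0 : ℝ) := by simp
  rw [h0]
  refine tendsto_integral_filter_of_dominated_convergence (fun z => D z + D z) ?_ ?_ (hD.add hD) ?_
  · filter_upwards [hF] with t ht using (ht.sub hF₀).norm
  · filter_upwards [hle] with t ht
    filter_upwards [ht, hle₀] with z hz hz₀
    rw [Real.norm_eq_abs, abs_abs]
    exact (abs_sub _ _).trans (add_le_add hz hz₀)
  · filter_upwards [hlim] with z hz
    have := (hz.sub_const (F₀ z)).abs
    simpa using this

end Convolution

section KernelBounds

variable {N : ℕ}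

theorem mem_kerDom {t : ℝ} {z : Euc N} (hz : z ≠ 0) : 0 < ‖z‖ ^ 2 + t ^ 2 := by
  have := norm_pos_iff.2 hz
  positivity

theorem mem_kerDom_of_ne {t : ℝ} (ht : t ≠ 0) (z : Euc N) : 0 < ‖z‖ ^ 2 + t ^ 2 := by
  positivity

theorem intervalIntegrable_kerP {R t : ℝ} (hR : 0 < R) {z : Euc N} (hz : 0 < ‖z‖ ^ 2 + t ^ 2) :
    IntervalIntegrable (fun τ : ℝ => (τ + t ^ 2) ^ (-(N : ℝ) / 2)) volume (‖z‖ ^ 2) (R ^ 2) := by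
  refine ContinuousOn.intervalIntegrable fun τ hτ => ContinuousAt.continuousWithinAt ?_
  have h1 : min (‖z‖ ^ 2) (R ^ 2) ≤ τ := hτ.1
  refine (continuousAt_id.add continuousAt_const).rpow_const (Or.inl (ne_of_gt ?_))
  change 0 < τ + t ^ 2
  rcases min_le_iff.1 h1 with h | h
  · linarith
  · nlinarith [sq_nonneg t]

theorem kerPow_nonneg (t : ℝ) (z : Euc N) : 0 ≤ kerPow t z := by unfold kerPow; positivity

theorem kerPow_le (t : ℝ) {z : Euc N} (hz : z ≠ 0) : kerPow t z ≤ ‖z‖ ^ (-(N : ℝ)) := by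
  have h0 := norm_pos_iff.2 hz
  have h1 : ‖z‖ ^ (-(N : ℝ)) = (‖z‖ ^ 2) ^ (-(N : ℝ) / 2) := by
    rw [← Real.rpow_natCast, ← Real.rpow_mul h0.le]; congr 1; push_cast; ring
  rw [h1, kerPow]
  exact Real.rpow_le_rpow_of_nonpos (by positivity) (by nlinarith [sq_nonneg t])
    (by have : (0 : ℝ) ≤ N := Nat.cast_nonneg N
        linarith)

theorem kerP_nonneg {R : ℝ} (t : ℝ) {z : Euc N} (hz : z ≠ 0) (hzR : ‖z‖ ≤ R) :
    0 ≤ kerP R t z := by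
  have h0 := norm_pos_iff.2 hz
  refine mul_nonneg (by norm_num) (intervalIntegral.integral_nonneg (by gcongr) fun τ hτ => ?_)
  have : 0 ≤ τ := le_trans (by positivity) hτ.1
  positivity

theorem kerP_le {R : ℝ} (hR : 0 < R) (t : ℝ) {z : Euc N} (hz : z ≠ 0) (hzR : ‖z‖ ≤ R) :
    kerP R t z ≤ kerP R 0 z := by
  have h0 := norm_pos_iff.2 hz
  refine mul_le_mul_of_nonneg_left (intervalIntegral.integral_mono_on (by gcongr)
    (intervalIntegrable_kerP hR (mem_kerDom hz)) (intervalIntegrable_kerP hR (mem_kerDom hz))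
    fun τ hτ => ?_) (by norm_num)
  have : 0 < τ := lt_of_lt_of_le (by positivity) hτ.1
  refine Real.rpow_le_rpow_of_nonpos (by positivity) (by nlinarith [sq_nonneg t]) ?_
  have : (0 : ℝ) ≤ N := Nat.cast_nonneg N
  linarith

theorem kerP_zero_le {R s : ℝ} (hR : 0 < R) (hs : 0 < s) (hsN : (N : ℝ) ≤ s + 2) {z : Euc N}
    (hz : z ≠ 0) (hzR : ‖z‖ ≤ R) :
    kerP R 0 z ≤ R ^ (s + 2 - N) / s * ‖z‖ ^ (-s) := by
  have h0 := norm_pos_iff.2 hz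
  have hle : ‖z‖ ^ 2 ≤ R ^ 2 := by gcongr
  have hnot : (0 : ℝ) ∉ uIcc (‖z‖ ^ 2) (R ^ 2) := by
    rw [uIcc_of_le hle]
    intro h
    have := h.1
    have : 0 < ‖z‖ ^ 2 := by positivity
    linarith
  have h1 : ∫ τ in (‖z‖ ^ 2)..(R ^ 2), (τ + 0 ^ 2) ^ (-(N : ℝ) / 2) ≤
      ∫ τ in (‖z‖ ^ 2)..(R ^ 2), R ^ (s + 2 - N) * τ ^ (-s / 2 - 1) := by
    refine intervalIntegral.integral_mono_on hle
      (intervalIntegrable_kerP hR (mem_kerDom hz)) ?_ fun τ hτ => ?_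
    · exact (intervalIntegral.intervalIntegrable_rpow (Or.inr hnot)).const_mul _
    · have hτ0 : 0 < τ := lt_of_lt_of_le (by positivity) hτ.1
      have e1 : (τ + 0 ^ 2) ^ (-(N : ℝ) / 2) = τ ^ ((s + 2 - N) / 2) * τ ^ (-s / 2 - 1) := by
        rw [← Real.rpow_add hτ0]; congr 1 <;> ring
      have e2 : R ^ (s + 2 - N) = (R ^ 2) ^ ((s + 2 - N) / 2) := by
        rw [← Real.rpow_natCast, ← Real.rpow_mul hR.le]; congr 1; push_cast; ring
      rw [e1, e2]
      exact mul_le_mul_of_nonneg_right (Real.rpow_le_rpow hτ0.le hτ.2 (by linarith)) (by positivity)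
  have h2 : ∫ τ in (‖z‖ ^ 2)..(R ^ 2), R ^ (s + 2 - N) * τ ^ (-s / 2 - 1) ≤
      R ^ (s + 2 - N) * (2 / s * ‖z‖ ^ (-s)) := by
    rw [intervalIntegral.integral_const_mul, integral_rpow (Or.inr ⟨by linarith, hnot⟩)]
    refine mul_le_mul_of_nonneg_left ?_ (by positivity)
    have e3 : (‖z‖ ^ 2) ^ (-s / 2 - 1 + 1) = ‖z‖ ^ (-s) := by
      rw [← Real.rpow_natCast, ← Real.rpow_mul h0.le]; congr 1; push_cast; ring
    rw [e3]
    have h4 : 0 ≤ (R ^ 2) ^ (-s / 2 - 1 + 1) := by positivity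
    have h5 : -s / 2 - 1 + 1 = -(s / 2) := by ring
    rw [h5] at h4 ⊢
    rw [div_neg, ← neg_div, div_le_iff₀ (by positivity)]
    field_simp
    linarith
  calc kerP R 0 z ≤ 1 / 2 * (R ^ (s + 2 - N) * (2 / s * ‖z‖ ^ (-s))) :=
        mul_le_mul_of_nonneg_left (h1.trans h2) (by norm_num)
    _ = _ := by ring

theorem tendsto_kerPow {z : Euc N} (hz : z ≠ 0) :
    Tendsto (fun t : ℝ => kerPow t z) (𝓝[>] 0) (𝓝 (kerPow 0 z)) := by
  refine Tendsto.mono_left (ContinuousAt.tendsto ?_) nhdsWithin_le_nhds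
  unfold kerPow
  exact (by fun_prop : ContinuousAt (fun t : ℝ => ‖z‖ ^ 2 + t ^ 2) 0).rpow_const
    (Or.inl (mem_kerDom hz).ne')

theorem tendsto_kerP {R : ℝ} (hR : 0 < R) {z : Euc N} (hz : z ≠ 0) (hzR : ‖z‖ ≤ R) :
    Tendsto (fun t : ℝ => kerP R t z) (𝓝[>] 0) (𝓝 (kerP R 0 z)) := by
  have h0 := norm_pos_iff.2 hz
  have hle : ‖z‖ ^ 2 ≤ R ^ 2 := by gcongr
  have hpos : ∀ τ ∈ uIoc (‖z‖ ^ 2) (R ^ 2), 0 < τ := fun τ hτ => by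
    rw [uIoc_of_le hle] at hτ
    exact lt_trans (by positivity) hτ.1
  refine Tendsto.const_mul _ ?_
  refine intervalIntegral.tendsto_integral_filter_of_dominated_convergence
    (fun τ => (τ + 0 ^ 2) ^ (-(N : ℝ) / 2)) ?_ ?_ (intervalIntegrable_kerP hR (mem_kerDom hz)) ?_
  · exact Eventually.of_forall fun t => (Measurable.aestronglyMeasurable (by fun_prop))
  · refine Eventually.of_forall fun t => ae_of_all _ fun τ hτ => ?_
    have := hpos τ hτ
    rw [Real.norm_of_nonneg (by positivity)]
    refine Real.rpow_le_rpow_of_nonpos (by positivity) (by nlinarith [sq_nonneg t]) ?_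
    have : (0 : ℝ) ≤ N := Nat.cast_nonneg N
    linarith
  · refine ae_of_all _ fun τ hτ => Tendsto.mono_left (ContinuousAt.tendsto ?_) nhdsWithin_le_nhds
    have := hpos τ hτ
    exact (by fun_prop : ContinuousAt (fun t : ℝ => τ + t ^ 2) 0).rpow_const
      (Or.inl (by positivity))

/-- The integrable majorants `|z|^(-s)` on a closed ball. -/
def kerDom (R s : ℝ) : Euc N → ℝ := fun z => (Iic R).indicator (fun r => r ^ (-s)) ‖z‖

theorem integrable_kerDom (hN : 2 ≤ N) (R : ℝ) {s : ℝ} (hs : s < N) :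
    Integrable (kerDom R s : Euc N → ℝ) := by
  have : Nontrivial (Euc N) := by
    have : Nonempty (Fin N) := ⟨⟨0, by omega⟩⟩
    infer_instance
  unfold kerDom
  rw [integrable_fun_norm_addHaar volume, finrank_euclideanSpace_fin]
  have h1 : IntegrableOn (fun y : ℝ => y ^ ((N : ℝ) - 1 - s)) (Ioc 0 R) := by
    rcases le_or_gt 0 R with hR | hR
    · rw [← intervalIntegrable_iff_integrableOn_Ioc_of_le hR]
      exact intervalIntegral.intervalIntegrable_rpow' (by linarith)
    · rw [Ioc_eq_empty (by linarith)]; exact integrableOn_empty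
  rw [← integrable_indicator_iff measurableSet_Ioc] at h1
  refine (h1.integrableOn (s := Ioi 0)).congr_fun (fun y hy => ?_) measurableSet_Ioi
  have hy : 0 < y := hy
  by_cases hyR : y ≤ R
  · rw [indicator_of_mem (show y ∈ Ioc 0 R from ⟨hy, hyR⟩)]
    rw [indicator_of_mem (show y ∈ Iic R from hyR), smul_eq_mul, ← Real.rpow_natCast,
      ← Real.rpow_add hy, Nat.cast_sub (by omega)]
    congr 1
    push_cast
    ring
  · rw [indicator_of_notMem (fun h => hyR h.2)]
    rw [indicator_of_notMem (show y ∉ Iic R from hyR), smul_zero]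

theorem kerDom_nonneg (R s : ℝ) (z : Euc N) : 0 ≤ kerDom R s z := by
  unfold kerDom
  rw [indicator_apply]
  split_ifs
  · positivity
  · exact le_rfl

theorem kerDom_of_le {R s : ℝ} {z : Euc N} (hz : ‖z‖ ≤ R) : kerDom R s z = ‖z‖ ^ (-s) :=
  indicator_of_mem (s := Iic R) hz _

end KernelBounds

section CutoffKernel

variable {N : ℕ}

theorem cutoff_zero (b : ContDiffBump (0 : Euc N)) {z : Euc N} (hz : b.rOut < ‖z‖) :
    z ∉ tsupport b := by
  rw [b.tsupport_eq]
  simpa using hz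

theorem cutoff_contDiff (b : ContDiffBump (0 : Euc N)) (n : ℕ∞) : ContDiff ℝ n (b : Euc N → ℝ) :=
  b.contDiff

theorem isTest_cutoff (b : ContDiffBump (0 : Euc N)) : IsTest univ (b : Euc N → ℝ) :=
  ⟨b.contDiff, b.hasCompactSupport, subset_univ _⟩

theorem pd_cutoff_of_lt (b : ContDiffBump (0 : Euc N)) {z : Euc N} (hz : ‖z‖ < b.rIn) (i : Fin N) :
    pd i b z = 0 := by
  have h1 : (b : Euc N → ℝ) =ᶠ[𝓝 z] fun _ => 1 := by
    filter_upwards [Metric.isOpen_ball.mem_nhds (show z ∈ Metric.ball (0 : Euc N) b.rIn by simpa using hz)]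
      with y hy
    exact b.one_of_mem_closedBall (Metric.ball_subset_closedBall hy)
  rw [pd, h1.fderiv_eq]
  simp

theorem lap_cutoff_of_lt (b : ContDiffBump (0 : Euc N)) {z : Euc N} (hz : ‖z‖ < b.rIn) :
    lap b z = 0 := by
  rw [lap_eq_sum_pd]
  refine Finset.sum_eq_zero fun i _ => ?_
  have h1 : pd i b =ᶠ[𝓝 z] fun _ => 0 := by
    filter_upwards [Metric.isOpen_ball.mem_nhds (show z ∈ Metric.ball (0 : Euc N) b.rIn by simpa using hz)]
      with y hy
    exact pd_cutoff_of_lt b (by simpa using hy) i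
  rw [pd, h1.fderiv_eq]
  simp

theorem pd_cutoff_of_gt (b : ContDiffBump (0 : Euc N)) {z : Euc N} (hz : b.rOut < ‖z‖) (i : Fin N) :
    pd i b z = 0 :=
  image_eq_zero_of_notMem_tsupport fun h => cutoff_zero b hz (tsupport_pd_subset i _ h)

theorem lap_cutoff_of_gt (b : ContDiffBump (0 : Euc N)) {z : Euc N} (hz : b.rOut < ‖z‖) :
    lap b z = 0 :=
  Finset.sum_eq_zero fun i _ => image_eq_zero_of_notMem_tsupport (f := pd i (pd i b)) fun h =>
    cutoff_zero b hz (tsupport_pd_subset i _ (tsupport_pd_subset i _ h))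

theorem contDiff_pd_top {u : Euc N → ℝ} (hu : ContDiff ℝ (⊤ : ℕ∞) u) (i : Fin N) :
    ContDiff ℝ (⊤ : ℕ∞) (pd i u) :=
  (hu.fderiv_right (m := (⊤ : ℕ∞)) (by simp)).clm_apply contDiff_const

theorem contDiff_lap_top {u : Euc N → ℝ} (hu : ContDiff ℝ (⊤ : ℕ∞) u) :
    ContDiff ℝ (⊤ : ℕ∞) (lap u) :=
  ContDiff.sum fun i _ => contDiff_pd_top (contDiff_pd_top hu i) i

/-- The regularized Newtonian kernel, cut off. -/
def kerK (b : ContDiffBump (0 : Euc N)) (t : ℝ) (z : Euc N) : ℝ := b z * kerP b.rOut t z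

/-- The gradient of `kerK`. -/
def kerG (b : ContDiffBump (0 : Euc N)) (t : ℝ) (i : Fin N) (z : Euc N) : ℝ :=
  -(b z * (z i * kerPow t z)) + pd i b z * kerP b.rOut t z

/-- The part of `-Δ kerK` produced by the cutoff. -/
def kerOm (b : ContDiffBump (0 : Euc N)) (t : ℝ) (z : Euc N) : ℝ :=
  2 * ∑ i, pd i b z * (z i * kerPow t z) - lap b z * kerP b.rOut t z

variable (b : ContDiffBump (0 : Euc N))

theorem contDiffOn_kerK (t : ℝ) :
    ContDiffOn ℝ (⊤ : ℕ∞) (kerK b t) {z | 0 < ‖z‖ ^ 2 + t ^ 2} :=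
  (cutoff_contDiff b _).contDiffOn.mul (contDiffOn_kerP b.rOut_pos t)

theorem contDiff_coord (i : Fin N) : ContDiff ℝ (⊤ : ℕ∞) (fun z : Euc N => z i) :=
  (EuclideanSpace.proj (𝕜 := ℝ) i : Euc N →L[ℝ] ℝ).contDiff

theorem contDiffOn_kerG (t : ℝ) (i : Fin N) :
    ContDiffOn ℝ (⊤ : ℕ∞) (kerG b t i) {z | 0 < ‖z‖ ^ 2 + t ^ 2} :=
  (((cutoff_contDiff b _).contDiffOn.mul
    ((contDiff_coord i).contDiffOn.mul (contDiffOn_kerPow t))).neg).add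
    ((contDiff_pd_top (cutoff_contDiff b _) i).contDiffOn.mul (contDiffOn_kerP b.rOut_pos t))

theorem contDiffOn_kerOm (t : ℝ) :
    ContDiffOn ℝ (⊤ : ℕ∞) (kerOm b t) {z | 0 < ‖z‖ ^ 2 + t ^ 2} :=
  (contDiffOn_const.mul (ContDiffOn.sum fun i _ =>
    (contDiff_pd_top (cutoff_contDiff b _) i).contDiffOn.mul
    ((contDiff_coord i).contDiffOn.mul (contDiffOn_kerPow t)))).sub
    ((contDiff_lap_top (cutoff_contDiff b _)).contDiffOn.mul (contDiffOn_kerP b.rOut_pos t))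

theorem measurable_of_contDiffOn {t : ℝ} {F : Euc N → ℝ}
    (h : ContDiffOn ℝ (⊤ : ℕ∞) F {z | 0 < ‖z‖ ^ 2 + t ^ 2}) : Measurable F :=
  measurable_of_continuousOn_compl_singleton 0
    (h.continuousOn.mono fun _ hz => mem_kerDom hz)

theorem contDiff_of_contDiffOn_kerDom {t : ℝ} (ht : t ≠ 0) {F : Euc N → ℝ}
    (h : ContDiffOn ℝ (⊤ : ℕ∞) F {z | 0 < ‖z‖ ^ 2 + t ^ 2}) : ContDiff ℝ (⊤ : ℕ∞) F := by
  rw [← contDiffOn_univ]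
  exact h.mono fun z _ => mem_kerDom_of_ne ht z

theorem pd_kerK {t : ℝ} {z : Euc N} (hz : 0 < ‖z‖ ^ 2 + t ^ 2) (i : Fin N) :
    pd i (kerK b t) z = kerG b t i z := by
  have h1 : HasFDerivAt (kerK b t) _ z :=
    ((cutoff_contDiff b 1).differentiable (by norm_num) z).hasFDerivAt.mul
      (hasFDerivAt_kerP b.rOut_pos hz)
  rw [pd, h1.fderiv]
  simp only [add_apply, smul_apply, smul_eq_mul, innerSL_single, kerG, pd]
  ring

theorem neg_lap_kerK {t : ℝ} {z : Euc N} (hz : 0 < ‖z‖ ^ 2 + t ^ 2) :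
    -lap (kerK b t) z = b z * kerRho t z + kerOm b t z := by
  have hR := b.rOut_pos
  have key : ∀ i, pd i (pd i (kerK b t)) z = b z * pd i (pd i (kerP b.rOut t)) z
      - 2 * (pd i b z * (z i * kerPow t z)) + pd i (pd i b) z * kerP b.rOut t z := by
    intro i
    have h1 : pd i (kerK b t) =ᶠ[𝓝 z] fun y => b y * pd i (kerP b.rOut t) y +
        pd i b y * kerP b.rOut t y := by
      filter_upwards [(isOpen_kerDom t).mem_nhds hz] with y hy
      rw [pd_kerK b hy, kerG, pd_kerP hR hy]
      ring
    have hz' : {z : Euc N | 0 < ‖z‖ ^ 2 + t ^ 2} ∈ 𝓝 z := (isOpen_kerDom t).mem_nhds hz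
    have hb := ((cutoff_contDiff b 1).differentiable (by norm_num) z).hasFDerivAt
    have hb' := ((contDiff_pd_top (cutoff_contDiff b _) i).differentiable (by simp) z).hasFDerivAt
    have hP := hasFDerivAt_kerP hR hz
    have hP' : DifferentiableAt ℝ (pd i (kerP b.rOut t)) z :=
      ((contDiffOn_pd (isOpen_kerDom t) ((contDiffOn_kerP hR t).of_le (by norm_cast)) i).contDiffAt
        hz').differentiableAt (by norm_num)
    have h2 := (hb.mul hP'.hasFDerivAt).add (hb'.mul hP)
    have h3 : fderiv ℝ (fun y => b y * pd i (kerP b.rOut t) y + pd i b y * kerP b.rOut t y) z = _ :=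
      h2.fderiv
    have e4 : pd i (pd i (kerK b t)) z = fderiv ℝ (pd i (kerK b t)) z (EuclideanSpace.single i 1) := rfl
    rw [e4, h1.fderiv_eq, h3]
    simp only [add_apply, smul_apply, smul_eq_mul, innerSL_single]
    have e1 : fderiv ℝ (pd i (kerP b.rOut t)) z (EuclideanSpace.single i 1) =
      pd i (pd i (kerP b.rOut t)) z := rfl
    have e2 : fderiv ℝ (pd i b) z (EuclideanSpace.single i 1) = pd i (pd i b) z := rfl
    have e3 : fderiv ℝ b z (EuclideanSpace.single i 1) = pd i b z := rfl
    rw [e1, e2, e3, pd_kerP hR hz]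
    ring
  rw [lap_eq_sum_pd]
  simp_rw [key]
  have e5 : kerRho t z = -lap (kerP b.rOut t) z := by rw [lap_kerP hR hz]; ring
  rw [e5, lap_eq_sum_pd, kerOm, lap_eq_sum_pd, Finset.sum_add_distrib, Finset.sum_sub_distrib,
    ← Finset.mul_sum, ← Finset.mul_sum, Finset.sum_mul]
  ring

theorem hasCompactSupport_mul_cutoff {F : Euc N → ℝ} (hF : ∀ z, b.rOut < ‖z‖ → F z = 0) :
    HasCompactSupport F := by
  refine HasCompactSupport.of_support_subset_isCompact
    (isCompact_closedBall (0 : Euc N) b.rOut) fun z hz => ?_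
  by_contra h
  exact hz (hF z (by simpa using h))

theorem kerK_of_gt (t : ℝ) {z : Euc N} (hz : b.rOut < ‖z‖) : kerK b t z = 0 := by
  rw [kerK, image_eq_zero_of_notMem_tsupport (cutoff_zero b hz), zero_mul]

theorem kerG_of_gt (t : ℝ) (i : Fin N) {z : Euc N} (hz : b.rOut < ‖z‖) : kerG b t i z = 0 := by
  rw [kerG, image_eq_zero_of_notMem_tsupport (cutoff_zero b hz), pd_cutoff_of_gt b hz]
  ring

theorem kerOm_of_gt (t : ℝ) {z : Euc N} (hz : b.rOut < ‖z‖) : kerOm b t z = 0 := by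
  simp [kerOm, pd_cutoff_of_gt b hz, lap_cutoff_of_gt b hz]

theorem kerOm_of_lt (t : ℝ) {z : Euc N} (hz : ‖z‖ < b.rIn) : kerOm b t z = 0 := by
  simp [kerOm, pd_cutoff_of_lt b hz, lap_cutoff_of_lt b hz]

theorem contDiff_kerOm (t : ℝ) : ContDiff ℝ (⊤ : ℕ∞) (kerOm b t) := by
  rw [contDiff_iff_contDiffAt]
  intro z
  by_cases hz : z = 0
  · have h1 : kerOm b t =ᶠ[𝓝 z] fun _ => 0 := by
      filter_upwards [Metric.isOpen_ball.mem_nhds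
        (show z ∈ Metric.ball (0 : Euc N) b.rIn by simp [hz, b.rIn_pos])] with y hy
      exact kerOm_of_lt b t (by simpa using hy)
    exact contDiffAt_const.congr_of_eventuallyEq h1
  · exact (contDiffOn_kerOm b t).contDiffAt ((isOpen_kerDom t).mem_nhds (mem_kerDom hz))

theorem kerK_even (t : ℝ) (z : Euc N) : kerK b t (-z) = kerK b t z := by
  rw [kerK, kerK, b.neg, kerP, kerP, norm_neg]

end CutoffKernel

section KernelLimits

variable {N : ℕ} (b : ContDiffBump (0 : Euc N))

theorem kerK_nonneg (t : ℝ) {z : Euc N} (hz : z ≠ 0) : 0 ≤ kerK b t z := by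
  rcases le_or_gt ‖z‖ b.rOut with h | h
  · exact mul_nonneg b.nonneg (kerP_nonneg t hz h)
  · rw [kerK_of_gt b t h]

theorem kerK_le_zero (t : ℝ) {z : Euc N} (hz : z ≠ 0) : kerK b t z ≤ kerK b 0 z := by
  rcases le_or_gt ‖z‖ b.rOut with h | h
  · exact mul_le_mul_of_nonneg_left (kerP_le b.rOut_pos t hz h) b.nonneg
  · rw [kerK_of_gt b t h, kerK_of_gt b 0 h]

theorem abs_kerP_le {s : ℝ} (hs : 0 < s) (hsN : (N : ℝ) ≤ s + 2) (t : ℝ) {z : Euc N}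
    (hz : z ≠ 0) (h : ‖z‖ ≤ b.rOut) :
    |kerP b.rOut t z| ≤ b.rOut ^ (s + 2 - N) / s * ‖z‖ ^ (-s) := by
  rw [abs_of_nonneg (kerP_nonneg t hz h)]
  exact (kerP_le b.rOut_pos t hz h).trans (kerP_zero_le b.rOut_pos hs hsN hz h)

theorem abs_kerK_le {s : ℝ} (hs : 0 < s) (hsN : (N : ℝ) ≤ s + 2) (t : ℝ) {z : Euc N} (hz : z ≠ 0) :
    |kerK b t z| ≤ b.rOut ^ (s + 2 - N) / s * kerDom b.rOut s z := by
  have hR := b.rOut_pos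
  rcases le_or_gt ‖z‖ b.rOut with h | h
  · rw [kerDom_of_le h, kerK, abs_mul, abs_of_nonneg b.nonneg]
    exact (mul_le_of_le_one_left (abs_nonneg _) b.le_one).trans (abs_kerP_le b hs hsN t hz h)
  · rw [kerK_of_gt b t h, abs_zero]
    exact mul_nonneg (by positivity) (kerDom_nonneg _ _ _)

theorem abs_coord_mul_kerPow_le (t : ℝ) (i : Fin N) {z : Euc N} (hz : z ≠ 0) :
    |z i * kerPow t z| ≤ ‖z‖ ^ (-((N : ℝ) - 1)) := by
  have h0 := norm_pos_iff.2 hz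
  rw [abs_mul, abs_of_nonneg (kerPow_nonneg t z)]
  calc |z i| * kerPow t z ≤ ‖z‖ * ‖z‖ ^ (-(N : ℝ)) :=
        mul_le_mul (PiLp.norm_apply_le z i) (kerPow_le t hz) (kerPow_nonneg _ _) h0.le
    _ = _ := by rw [mul_comm, ← Real.rpow_add_one h0.ne']; congr 1; ring

theorem exists_abs_kerG_le (hN : 2 ≤ N) : ∃ C, 0 ≤ C ∧ ∀ t i (z : Euc N), z ≠ 0 →
    |kerG b t i z| ≤ C * kerDom b.rOut (N - 1) z := by
  obtain ⟨C₁, hC₁, -, h1⟩ := (isTest_cutoff b).exists_bound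
  have hR := b.rOut_pos
  have hN' : (2 : ℝ) ≤ N := by exact_mod_cast hN
  have hN1 : (0 : ℝ) < N - 1 := by linarith
  set A := b.rOut ^ ((N : ℝ) - 1 + 2 - N) / (N - 1)
  have hA : 0 ≤ A := by positivity
  refine ⟨1 + C₁ * A, by positivity, fun t i z hz => ?_⟩
  rcases le_or_gt ‖z‖ b.rOut with h | h
  · rw [kerDom_of_le h, kerG]
    have e1 : |b z * (z i * kerPow t z)| ≤ ‖z‖ ^ (-((N : ℝ) - 1)) := by
      rw [abs_mul, abs_of_nonneg b.nonneg]
      exact (mul_le_of_le_one_left (abs_nonneg _) b.le_one).trans (abs_coord_mul_kerPow_le t i hz)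
    have e2 : |pd i b z * kerP b.rOut t z| ≤ C₁ * (A * ‖z‖ ^ (-((N : ℝ) - 1))) := by
      rw [abs_mul]
      exact mul_le_mul (h1 i z) (abs_kerP_le b hN1 (by linarith) t hz h) (abs_nonneg _) hC₁
    have e3 := abs_add_le (-(b z * (z i * kerPow t z))) (pd i b z * kerP b.rOut t z)
    rw [abs_neg] at e3
    linarith
  · rw [kerG_of_gt b t i h, abs_zero]
    exact mul_nonneg (by positivity) (kerDom_nonneg _ _ _)

theorem exists_abs_kerOm_le (hN : 2 ≤ N) : ∃ C, 0 ≤ C ∧ ∀ t (z : Euc N), z ≠ 0 →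
    |kerOm b t z| ≤ C * kerDom b.rOut (N - 1) z := by
  obtain ⟨C₁, hC₁, -, h1⟩ := (isTest_cutoff b).exists_bound
  have hcs : HasCompactSupport (lap b) := hasCompactSupport_mul_cutoff b fun z hz =>
    lap_cutoff_of_gt b hz
  obtain ⟨C₂, h2⟩ := hcs.exists_bound_of_continuous (contDiff_lap_top (cutoff_contDiff b _)).continuous
  have hC₂ : 0 ≤ C₂ := (norm_nonneg _).trans (h2 0)
  have hR := b.rOut_pos
  have hN' : (2 : ℝ) ≤ N := by exact_mod_cast hN
  have hN1 : (0 : ℝ) < N - 1 := by linarith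
  set A := b.rOut ^ ((N : ℝ) - 1 + 2 - N) / (N - 1)
  have hA : 0 ≤ A := by positivity
  refine ⟨2 * (N * C₁) + C₂ * A, by positivity, fun t z hz => ?_⟩
  rcases le_or_gt ‖z‖ b.rOut with h | h
  · rw [kerDom_of_le h, kerOm]
    have e1 : |∑ i, pd i b z * (z i * kerPow t z)| ≤ N * C₁ * ‖z‖ ^ (-((N : ℝ) - 1)) := by
      refine (Finset.abs_sum_le_sum_abs _ _).trans ?_
      refine (Finset.sum_le_card_nsmul _ _ (C₁ * ‖z‖ ^ (-((N : ℝ) - 1))) fun i _ => ?_).trans_eq ?_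
      · rw [abs_mul]
        exact mul_le_mul (h1 i z) (abs_coord_mul_kerPow_le t i hz) (abs_nonneg _) hC₁
      · simp [mul_assoc]
    have e2 : |lap b z * kerP b.rOut t z| ≤ C₂ * (A * ‖z‖ ^ (-((N : ℝ) - 1))) := by
      rw [abs_mul]
      exact mul_le_mul (h2 z) (abs_kerP_le b hN1 (by linarith) t hz h) (abs_nonneg _) hC₂
    have e3 := abs_sub (2 * ∑ i, pd i b z * (z i * kerPow t z)) (lap b z * kerP b.rOut t z)
    rw [abs_mul, abs_two] at e3
    linarith
  · rw [kerOm_of_gt b t h, abs_zero]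
    exact mul_nonneg (by positivity) (kerDom_nonneg _ _ _)

theorem tendsto_kerK {z : Euc N} (hz : z ≠ 0) :
    Tendsto (fun t => kerK b t z) (𝓝[>] 0) (𝓝 (kerK b 0 z)) := by
  rcases le_or_gt ‖z‖ b.rOut with h | h
  · exact (tendsto_kerP b.rOut_pos hz h).const_mul _
  · simp_rw [kerK_of_gt b _ h]; exact tendsto_const_nhds

theorem tendsto_kerG (i : Fin N) {z : Euc N} (hz : z ≠ 0) :
    Tendsto (fun t => kerG b t i z) (𝓝[>] 0) (𝓝 (kerG b 0 i z)) := by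
  rcases le_or_gt ‖z‖ b.rOut with h | h
  · exact ((((tendsto_kerPow hz).const_mul _).const_mul _).neg).add
      ((tendsto_kerP b.rOut_pos hz h).const_mul _)
  · simp_rw [kerG_of_gt b _ i h]; exact tendsto_const_nhds

theorem tendsto_kerOm {z : Euc N} (hz : z ≠ 0) :
    Tendsto (fun t => kerOm b t z) (𝓝[>] 0) (𝓝 (kerOm b 0 z)) := by
  rcases le_or_gt ‖z‖ b.rOut with h | h
  · exact ((tendsto_finsetSum _ fun i _ => ((tendsto_kerPow hz).const_mul _).const_mul _).const_mul
      2).sub ((tendsto_kerP b.rOut_pos hz h).const_mul _)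
  · simp_rw [kerOm_of_gt b _ h]; exact tendsto_const_nhds

theorem ae_ne_zero (hN : 2 ≤ N) : ∀ᵐ z : Euc N, z ≠ 0 := by
  have : Nonempty (Fin N) := ⟨⟨0, by omega⟩⟩
  have : Nontrivial (Euc N) := inferInstance
  exact Measure.ae_ne volume 0

theorem integrable_of_kerDom_bound (hN : 2 ≤ N) {F : Euc N → ℝ} (hF : Measurable F) {R C s : ℝ}
    (hs : s < N) (h : ∀ z, z ≠ 0 → |F z| ≤ C * kerDom R s z) : Integrable F :=
  ((integrable_kerDom hN R hs).const_mul C).mono' hF.aestronglyMeasurable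
    ((ae_ne_zero hN).mono fun z hz => h z hz)

theorem measurable_kerK (t : ℝ) : Measurable (kerK b t) :=
  measurable_of_contDiffOn (contDiffOn_kerK b t)

theorem measurable_kerG (t : ℝ) (i : Fin N) : Measurable (kerG b t i) :=
  measurable_of_contDiffOn (contDiffOn_kerG b t i)

theorem integrable_kerK (hN : 2 ≤ N) (t : ℝ) : Integrable (kerK b t) :=
  have hN' : (2 : ℝ) ≤ N := by exact_mod_cast hN
  integrable_of_kerDom_bound hN (measurable_kerK b t) (s := N - 1) (by linarith)
    fun _ hz => abs_kerK_le b (by linarith) (by linarith) t hz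

theorem integrable_kerG (hN : 2 ≤ N) (t : ℝ) (i : Fin N) : Integrable (kerG b t i) :=
  let ⟨_, _, hC⟩ := exists_abs_kerG_le b hN
  integrable_of_kerDom_bound hN (measurable_kerG b t i) (s := N - 1) (by linarith)
    fun z hz => hC t i z hz

theorem integrable_kerOm (t : ℝ) : Integrable (kerOm b t) :=
  (contDiff_kerOm b t).continuous.integrable_of_hasCompactSupport
    (hasCompactSupport_mul_cutoff b fun _ hz => kerOm_of_gt b t hz)

theorem tendsto_kerK_L1 (hN : 2 ≤ N) :
    Tendsto (fun t => ∫ z, |kerK b t z - kerK b 0 z|) (𝓝[>] 0) (𝓝 0) := by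
  have hN' : (2 : ℝ) ≤ N := by exact_mod_cast hN
  have hb := fun t => (ae_ne_zero hN).mono fun z hz =>
    abs_kerK_le b (s := N - 1) (by linarith) (by linarith) t hz
  exact tendsto_integral_abs_sub
    (Eventually.of_forall fun t => (measurable_kerK b t).aestronglyMeasurable)
    (measurable_kerK b 0).aestronglyMeasurable ((integrable_kerDom hN _ (by linarith)).const_mul _)
    (Eventually.of_forall hb) (hb 0) ((ae_ne_zero hN).mono fun z hz => tendsto_kerK b hz)

theorem tendsto_kerG_L1 (hN : 2 ≤ N) (i : Fin N) :
    Tendsto (fun t => ∫ z, |kerG b t i z - kerG b 0 i z|) (𝓝[>] 0) (𝓝 0) := by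
  obtain ⟨C, hC, h⟩ := exists_abs_kerG_le b hN
  have hb := fun t => (ae_ne_zero hN).mono fun z hz => h t i z hz
  exact tendsto_integral_abs_sub
    (Eventually.of_forall fun t => (measurable_kerG b t i).aestronglyMeasurable)
    (measurable_kerG b 0 i).aestronglyMeasurable
    ((integrable_kerDom hN _ (by linarith)).const_mul _)
    (Eventually.of_forall hb) (hb 0) ((ae_ne_zero hN).mono fun z hz => tendsto_kerG b i hz)

theorem tendsto_kerOm_L1 (hN : 2 ≤ N) :
    Tendsto (fun t => ∫ z, |kerOm b t z - kerOm b 0 z|) (𝓝[>] 0) (𝓝 0) := by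
  obtain ⟨C, hC, h⟩ := exists_abs_kerOm_le b hN
  have hb := fun t => (ae_ne_zero hN).mono fun z hz => h t z hz
  exact tendsto_integral_abs_sub
    (Eventually.of_forall fun t => (contDiff_kerOm b t).continuous.aestronglyMeasurable)
    (contDiff_kerOm b 0).continuous.aestronglyMeasurable
    ((integrable_kerDom hN _ (by linarith)).const_mul _)
    (Eventually.of_forall hb) (hb 0) ((ae_ne_zero hN).mono fun z hz => tendsto_kerOm b hz)

/-- The normalizing constant of the Newtonian kernel. -/
def newtonConst (N : ℕ) : ℝ := ∫ z : Euc N, kerRho 1 z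

theorem kerRho_nonneg (t : ℝ) (z : Euc N) : 0 ≤ kerRho t z := by unfold kerRho; positivity

theorem continuous_kerRho {t : ℝ} (ht : t ≠ 0) : Continuous (kerRho t : Euc N → ℝ) :=
  continuous_const.mul ((by fun_prop : Continuous fun z : Euc N => ‖z‖ ^ 2 + t ^ 2).rpow_const
    fun z => Or.inl (mem_kerDom_of_ne ht z).ne')

theorem integrable_kerRho_one : Integrable (kerRho 1 : Euc N → ℝ) := by
  have h := integrable_rpow_neg_one_add_norm_sq (E := Euc N) (μ := volume) (r := N + 2) (by simp)
  refine (h.const_mul (N : ℝ)).congr (ae_of_all _ fun z => ?_)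
  simp only [kerRho]
  rw [add_comm (1 : ℝ)]
  congr 1
  · ring
  · congr 1
    · ring
    · ring

theorem newtonConst_pos (hN : 2 ≤ N) : 0 < newtonConst N := by
  rw [newtonConst, integral_pos_iff_support_of_nonneg (kerRho_nonneg 1) integrable_kerRho_one]
  have : Function.support (kerRho 1 : Euc N → ℝ) = univ := by
    rw [Set.eq_univ_iff_forall]
    intro z
    have : (0 : ℝ) < N := by exact_mod_cast (by omega : 0 < N)
    have : 0 < kerRho 1 z := by unfold kerRho; positivity
    exact this.ne'
  rw [this]
  exact isOpen_univ.measure_pos _ univ_nonempty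

theorem cv_cutoff_kerRho (g : Euc N → ℝ) {t : ℝ} (ht : 0 < t) (x : Euc N) :
    cv g (fun z => b z * kerRho t z) x = ∫ y, g (x - t • y) * b (t • y) * kerRho 1 y := by
  have h1 := Measure.integral_comp_smul volume
    (fun z : Euc N => g (x - z) * (b z * kerRho t z)) t
  rw [finrank_euclideanSpace_fin] at h1
  have h2 : cv g (fun z => b z * kerRho t z) x = ∫ z, g (x - z) * (b z * kerRho t z) := by
    rw [cv, ← integral_sub_left_eq_self _ _ x]
    simp
  have ht' : (0 : ℝ) < t ^ N := by positivity
  have h3 : ∫ z, g (x - z) * (b z * kerRho t z) =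
      t ^ N * ∫ z, g (x - t • z) * (b (t • z) * kerRho t (t • z)) := by
    rw [h1, abs_of_pos (by positivity), smul_eq_mul, mul_inv_cancel_left₀ ht'.ne']
  rw [h2, h3, ← integral_const_mul]
  refine integral_congr_ae (ae_of_all _ fun y => ?_)
  have h4 : t ^ N * kerRho t (t • y) = kerRho 1 y := by
    have e1 : ‖t • y‖ ^ 2 + t ^ 2 = t ^ 2 * (‖y‖ ^ 2 + 1 ^ 2) := by
      rw [norm_smul, Real.norm_of_nonneg ht.le]; ring
    have e2 : (t ^ 2) ^ (-(N : ℝ) / 2 - 1) = (t ^ N)⁻¹ * (t ^ 2)⁻¹ := by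
      rw [← Real.rpow_natCast t 2, ← Real.rpow_natCast t N, ← Real.rpow_mul ht.le,
        ← Real.rpow_neg ht.le, ← Real.rpow_neg ht.le, ← Real.rpow_add ht]
      congr 1; push_cast; ring
    rw [kerRho, kerRho, e1, Real.mul_rpow (by positivity) (by positivity), e2]
    field_simp
  simp only
  rw [← h4]
  ring

theorem abs_cv_cutoff_kerRho_le {g : Euc N → ℝ} {S : ℝ} (hS : ∀ x, |g x| ≤ S) {t : ℝ} (ht : 0 < t)
    (x : Euc N) : |cv g (fun z => b z * kerRho t z) x| ≤ S * newtonConst N := by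
  rw [cv_cutoff_kerRho b g ht, newtonConst, ← integral_const_mul]
  refine abs_integral_le_integral_abs.trans (integral_mono_of_nonneg
    (ae_of_all _ fun y => abs_nonneg _) (integrable_kerRho_one.const_mul S)
    (ae_of_all _ fun y => ?_))
  simp only [abs_mul, abs_of_nonneg (kerRho_nonneg 1 y), abs_of_nonneg b.nonneg]
  exact mul_le_mul_of_nonneg_right ((mul_le_of_le_one_right (abs_nonneg _) b.le_one).trans (hS _))
    (kerRho_nonneg 1 y)

theorem tendsto_cv_cutoff_kerRho {g : Euc N → ℝ} (hg : Measurable g) {S : ℝ}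
    (hS : ∀ x, |g x| ≤ S) {x : Euc N} (hx : ContinuousAt g x) :
    Tendsto (fun t => cv g (fun z => b z * kerRho t z) x) (𝓝[>] 0) (𝓝 (g x * newtonConst N)) := by
  have h0 : Tendsto (fun t : ℝ => ∫ y, g (x - t • y) * b (t • y) * kerRho 1 y) (𝓝[>] 0)
      (𝓝 (∫ y : Euc N, g x * kerRho 1 y)) := by
    refine tendsto_integral_filter_of_dominated_convergence (fun y => S * kerRho 1 y) ?_ ?_
      (integrable_kerRho_one.const_mul S) ?_
    · refine Eventually.of_forall fun t => Measurable.aestronglyMeasurable ?_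
      have := (continuous_kerRho (N := N) one_ne_zero).measurable
      have := b.continuous.measurable
      fun_prop
    · refine Eventually.of_forall fun t => ae_of_all _ fun y => ?_
      rw [Real.norm_eq_abs, abs_mul, abs_mul, abs_of_nonneg (kerRho_nonneg 1 y),
        abs_of_nonneg b.nonneg]
      exact mul_le_mul_of_nonneg_right
        ((mul_le_of_le_one_right (abs_nonneg _) b.le_one).trans (hS _)) (kerRho_nonneg 1 y)
    · refine ae_of_all _ fun y => ?_
      refine Tendsto.mono_left ?_ nhdsWithin_le_nhds
      have e1 : ContinuousAt (fun t : ℝ => g (x - t • y)) 0 :=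
        ContinuousAt.comp (g := g) (f := fun t : ℝ => x - t • y) (by simpa using hx) (by fun_prop)
      have e2 : ContinuousAt (fun t : ℝ => b (t • y)) 0 :=
        (b.continuous.comp (by fun_prop : Continuous fun t : ℝ => t • y)).continuousAt
      have e3 : Tendsto (fun t : ℝ => g (x - t • y) * b (t • y) * kerRho 1 y) (𝓝 0)
          (𝓝 (g (x - (0 : ℝ) • y) * b ((0 : ℝ) • y) * kerRho 1 y)) := ((e1.mul e2).mul (continuousAt_const (y := kerRho 1 y))).tendsto
      have e4 : b (0 : Euc N) = 1 := b.one_of_mem_closedBall (by simp [b.rIn_pos.le])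
      simpa [e4] using e3
  rw [integral_const_mul] at h0
  refine h0.congr' ?_
  filter_upwards [self_mem_nhdsWithin] with t ht
  exact (cv_cutoff_kerRho b g ht x).symm

end KernelLimits

section SupBound

variable {N : ℕ} {Ω : Set (Euc N)}

theorem WSol.neg {μ : ℝ} {h w : Euc N → ℝ} (H : WSol Ω μ h w) :
    WSol Ω μ (fun x => -h x) (fun x => -w x) := by
  have h1 := H.add H (c := -2)
  have e : ∀ r : Euc N → ℝ, (fun x => r x + -2 * r x) = fun x => -r x := fun r => by ext x; ring
  rwa [e, e] at h1

theorem ae_le_of_forall_pos_add {α : Type*} [MeasurableSpace α] {ν : Measure α} {w : α → ℝ} {B : ℝ}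
    (h : ∀ η > 0, ∀ᵐ x ∂ν, w x ≤ B + η) : ∀ᵐ x ∂ν, w x ≤ B := by
  have h1 : ∀ n : ℕ, ∀ᵐ x ∂ν, w x ≤ B + 1 / ((n : ℝ) + 1) := fun n => h _ (by positivity)
  filter_upwards [ae_all_iff.2 h1] with x hx
  refine ge_of_tendsto' (x := atTop) (f := fun n : ℕ => B + 1 / ((n : ℝ) + 1)) ?_ hx
  simpa using (tendsto_one_div_add_atTop_nhds_zero_nat (𝕜 := ℝ)).const_add B

theorem measurable_indicator_of_continuousOn (hΩ : IsOpen Ω) {h : Euc N → ℝ}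
    (hh : ContinuousOn h Ω) : Measurable (Ω.indicator h) := by
  classical
  rw [← piecewise_eq_indicator]
  exact hh.measurable_piecewise continuousOn_const hΩ.measurableSet

theorem abs_indicator_le {h : Euc N → ℝ} {S : ℝ} (hS0 : 0 ≤ S) (hS : ∀ x ∈ Ω, |h x| ≤ S)
    (x : Euc N) : |Ω.indicator h x| ≤ S := by
  by_cases hx : x ∈ Ω
  · rw [indicator_of_mem hx]; exact hS x hx
  · rw [indicator_of_notMem hx, abs_zero]; exact hS0

theorem memLp_indicator (hΩ : IsOpen Ω) (hb : Bornology.IsBounded Ω) {h : Euc N → ℝ} {S : ℝ}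
    (hh : ContinuousOn h Ω) (hS : ∀ x ∈ Ω, |h x| ≤ S) (r : ENNReal) :
    MemLp (Ω.indicator h) r := by
  rw [memLp_indicator_iff_restrict hΩ.measurableSet]
  have : IsFiniteMeasure (volume.restrict Ω) := ⟨by
    rw [Measure.restrict_apply_univ]; exact hb.measure_lt_top⟩
  refine MemLp.of_bound (hh.aestronglyMeasurable hΩ.measurableSet) S ?_
  exact (ae_restrict_iff' hΩ.measurableSet).2 (ae_of_all _ hS)

theorem memLp_of_continuousOn_bdd (hΩ : IsOpen Ω) (hb : Bornology.IsBounded Ω) {h : Euc N → ℝ}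
    {S : ℝ} (hh : ContinuousOn h Ω) (hS : ∀ x ∈ Ω, |h x| ≤ S) (r : ENNReal) :
    MemLp h r (volume.restrict Ω) := by
  have : IsFiniteMeasure (volume.restrict Ω) := ⟨by
    rw [Measure.restrict_apply_univ]; exact hb.measure_lt_top⟩
  refine MemLp.of_bound (hh.aestronglyMeasurable hΩ.measurableSet) S ?_
  exact (ae_restrict_iff' hΩ.measurableSet).2 (ae_of_all _ hS)

theorem kerDom_rpow (R s : ℝ) {r : ℝ} (hr : 0 < r) (z : Euc N) :
    kerDom R s z ^ r = kerDom R (s * r) z := by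
  unfold kerDom
  rw [indicator_apply, indicator_apply]
  split_ifs
  · rw [← Real.rpow_mul (norm_nonneg z)]; ring_nf
  · exact Real.zero_rpow hr.ne'

theorem memLp_kerK (hN : 2 ≤ N) (b : ContDiffBump (0 : Euc N)) {q q' : ℝ} (hq : (N : ℝ) / 2 < q)
    (hqq : q.HolderConjugate q') : MemLp (kerK b 0) (ENNReal.ofReal q') := by
  have hN' : (2 : ℝ) ≤ N := by exact_mod_cast hN
  have hq1 : 1 < q := hqq.lt
  have hR := b.rOut_pos
  have hinv : q'⁻¹ = 1 - q⁻¹ := by have := hqq.inv_add_inv_eq_one; linarith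
  have hq'0 : 0 < q' := hqq.symm.pos
  have hq0 : 0 < q := hqq.pos
  have hNq : (N : ℝ) * q⁻¹ < 2 := by
    rw [← div_eq_mul_inv, div_lt_iff₀ hq0]; linarith
  have hNq' : (N : ℝ) * q⁻¹ < N := by
    rw [← div_eq_mul_inv, div_lt_iff₀ hq0]; nlinarith
  set s : ℝ := N - 1 - N * q⁻¹ / 2 with hs
  have hs0 : 0 < s := by linarith
  have hsN : (N : ℝ) ≤ s + 2 := by linarith
  have hsq : s * q' < N := by
    have : s < N * q'⁻¹ := by rw [hinv]; linarith
    rwa [← div_eq_mul_inv, lt_div_iff₀ hq'0] at this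
  set C := b.rOut ^ (s + 2 - N) / s
  have hC : 0 ≤ C := by positivity
  rw [← integrable_norm_rpow_iff (measurable_kerK b 0).aestronglyMeasurable (by simpa using hq'0)
    (by simp), ENNReal.toReal_ofReal hq'0.le]
  refine integrable_of_kerDom_bound hN (by have := measurable_kerK b 0; fun_prop) hsq
    (C := C ^ q') (R := b.rOut) fun z hz => ?_
  rw [Real.norm_eq_abs, abs_of_nonneg (by positivity : (0 : ℝ) ≤ |kerK b 0 z| ^ q'),
    ← kerDom_rpow _ _ hq'0, ← Real.mul_rpow hC (kerDom_nonneg _ _ _)]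
  exact Real.rpow_le_rpow (abs_nonneg _) (abs_kerK_le b hs0 hsN 0 hz) hq'0.le

theorem exists_large_cutoff (hb : Bornology.IsBounded Ω) :
    ∃ b : ContDiffBump (0 : Euc N), ∀ x ∈ Ω, ∀ y ∈ Ω, ‖x - y‖ < b.rIn := by
  obtain ⟨D, hD0, hD⟩ := hb.exists_pos_norm_le
  refine ⟨⟨2 * D + 1, 2 * D + 2, by linarith, by linarith⟩, fun x hx y hy => ?_⟩
  have := norm_sub_le x y
  have := hD x hx
  have := hD y hy
  change ‖x - y‖ < 2 * D + 1
  linarith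

theorem locallyIntegrable_of_bdd {g : Euc N → ℝ} (hg : Measurable g) {S : ℝ}
    (hS : ∀ x, |g x| ≤ S) : LocallyIntegrable g := fun x =>
  ⟨Metric.ball x 1, Metric.ball_mem_nhds x one_pos, by
    have : IsFiniteMeasure (volume.restrict (Metric.ball x 1)) := ⟨by
      rw [Measure.restrict_apply_univ]; exact measure_ball_lt_top⟩
    exact Integrable.of_bound hg.aestronglyMeasurable S (ae_of_all _ hS)⟩

theorem lap_const_mul_add {u : Euc N → ℝ} (hu : ContDiff ℝ (⊤ : ℕ∞) u) (c e : ℝ) (x : Euc N) :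
    lap (fun y => c * u y + e) x = c * lap u x := by
  rw [lap_eq_sum_pd, lap_eq_sum_pd, Finset.mul_sum]
  refine Finset.sum_congr rfl fun i _ => ?_
  have h1 : pd i (fun y => c * u y + e) = fun y => c * pd i u y := by
    ext y
    have : pd i (fun y => c * u y + e) y = pd i (fun y => c * u y) y := by
      simp [pd]
    rw [this, pd_const_mul (hu.of_le (by norm_cast))]
  rw [h1, pd_const_mul ((contDiff_pd_top hu i).of_le (by norm_cast))]

theorem exists_sup_bound (hN : 2 ≤ N) (hΩ : IsOpen Ω) (hb : Bornology.IsBounded Ω)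
    (hl : 0 < firstEig Ω) {q : ℝ} (hq : (N : ℝ) / 2 < q) :
    ∃ C, 0 < C ∧ ∀ μ, 0 ≤ μ → ∀ h w, WSol Ω μ h w → ContinuousOn h Ω →
      (∃ S, ∀ x ∈ Ω, |h x| ≤ S) →
      ∀ᵐ x ∂volume.restrict Ω, |w x| ≤ C * (∫ x in Ω, |h x| ^ q) ^ (1 / q) := by
  obtain ⟨b, hbΩ⟩ := exists_large_cutoff hb
  have hN' : (2 : ℝ) ≤ N := by exact_mod_cast hN
  have hq1 : 1 < q := by linarith
  set q' := q.conjExponent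
  have hqq : q.HolderConjugate q' := .conjExponent hq1
  have hc := newtonConst_pos hN
  set c := newtonConst N
  set A := (∫ z, |kerK b 0 z| ^ q') ^ (1 / q')
  have hA : 0 ≤ A := by positivity
  have key : ∀ μ, 0 ≤ μ → ∀ h w, WSol Ω μ h w → ContinuousOn h Ω →
      (∃ S, ∀ x ∈ Ω, |h x| ≤ S) →
      ∀ᵐ x ∂volume.restrict Ω, w x ≤ c⁻¹ * A * (∫ x in Ω, |h x| ^ q) ^ (1 / q) := by
    rintro μ hμ h w H hh ⟨S₀, hS₀⟩
    set S := max S₀ 0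
    have hS0 : 0 ≤ S := le_max_right _ _
    have hS : ∀ x ∈ Ω, |h x| ≤ S := fun x hx => (hS₀ x hx).trans (le_max_left _ _)
    set I := (∫ x in Ω, |h x| ^ q) ^ (1 / q)
    set g := Ω.indicator fun x => |h x|
    have hgm : Measurable g := measurable_indicator_of_continuousOn hΩ hh.abs
    have hg0 : ∀ x, 0 ≤ g x := fun x => indicator_nonneg (fun _ _ => abs_nonneg _) x
    have hgS : ∀ x, |g x| ≤ S := abs_indicator_le hS0 (by simpa using hS)
    have hgL : LocallyIntegrable g := locallyIntegrable_of_bdd hgm hgS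
    have hKne : ∀ x : Euc N, ∀ᵐ y, x - y ≠ 0 := fun x => by
      have : Nonempty (Fin N) := ⟨⟨0, by omega⟩⟩
      have : Nontrivial (Euc N) := inferInstance
      filter_upwards [Measure.ae_ne volume x] with y hy
      exact sub_ne_zero.2 hy.symm
    have hB : ∀ t x, cv g (kerK b t) x ≤ A * I := by
      intro t x
      have h1 : cv g (kerK b t) x ≤ ∫ y, g y * |kerK b 0 (x - y)| := by
        refine integral_mono_ae (integrable_cv_of_bdd hgm.aestronglyMeasurable hgS
          (integrable_kerK b hN t) x) (integrable_cv_of_bdd hgm.aestronglyMeasurable hgS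
          (integrable_kerK b hN 0).abs x) ?_
        filter_upwards [hKne x] with y hy
        exact mul_le_mul_of_nonneg_left ((kerK_le_zero b t hy).trans (le_abs_self _)) (hg0 y)
      have h2 : MemLp (fun y => |kerK b 0 (x - y)|) (ENNReal.ofReal q') :=
        ((memLp_kerK hN b hq hqq).comp_measurePreserving
          (Measure.measurePreserving_sub_left volume x)).abs
      have h3 := integral_mul_le_Lp_mul_Lq_of_nonneg hqq (ae_of_all _ hg0)
        (ae_of_all _ fun y => abs_nonneg (kerK b 0 (x - y)))
        (memLp_indicator hΩ hb hh.abs (by simpa using hS) _) h2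
      have h4 : ∫ y, |kerK b 0 (x - y)| ^ q' = ∫ z, |kerK b 0 z| ^ q' :=
        integral_sub_left_eq_self (fun z => |kerK b 0 z| ^ q') volume x
      have h5 : ∫ y, g y ^ q = ∫ x in Ω, |h x| ^ q := by
        rw [← integral_indicator hΩ.measurableSet]
        refine integral_congr_ae (ae_of_all _ fun y => ?_)
        by_cases hy : y ∈ Ω
        · simp [g, hy]
        · simp [g, hy, Real.zero_rpow (by linarith : q ≠ 0)]
      rw [h4, h5, mul_comm] at h3
      exact h1.trans h3
    refine ae_le_of_forall_pos_add fun η hη => ?_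
    refine H.ae_le_of_supersolutions hΩ hb hl hμ (fun ε hε => ?_) (V := fun _ => _)
      aestronglyMeasurable_const
    set v : ℝ → Euc N → ℝ := fun t x => c⁻¹ * cv g (kerK b t) x + η with hv
    have hcd : ∀ t ≠ 0, ContDiff ℝ (⊤ : ℕ∞) (cv g (kerK b t)) := fun t ht =>
      contDiff_cv hgL (hasCompactSupport_mul_cutoff b fun _ hz => kerK_of_gt b t hz)
        (contDiff_of_contDiffOn_kerDom ht (contDiffOn_kerK b t))
    have hvcd : ∀ t ≠ 0, ContDiff ℝ (⊤ : ℕ∞) (v t) := fun t ht =>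
      (contDiff_const.mul (hcd t ht)).add contDiff_const
    have hlap : ∀ t ≠ 0, ∀ x ∈ Ω, -lap (v t) x = c⁻¹ * cv g (fun z => b z * kerRho t z) x := by
      intro t ht x hx
      rw [hv, lap_const_mul_add (hcd t ht), lap_cv hgL (hasCompactSupport_mul_cutoff b
        fun _ hz => kerK_of_gt b t hz) ((contDiff_of_contDiffOn_kerDom ht
        (contDiffOn_kerK b t)).of_le (by norm_cast)), ← mul_neg, cv, cv, ← integral_neg]
      congr 1
      refine integral_congr_ae (ae_of_all _ fun y => ?_)
      by_cases hy : y ∈ Ω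
      · have := neg_lap_kerK b (mem_kerDom_of_ne ht (x - y))
        rw [kerOm_of_lt b t (hbΩ x hx y hy), add_zero] at this
        simp only
        rw [← this]
        ring
      · simp [g, hy]
    set e : ℝ → Euc N → ℝ := fun t x => |h x| - -lap (v t) x with he
    have hec : ∀ t ≠ 0, ContinuousOn (e t) Ω := fun t ht =>
      hh.abs.sub (contDiff_lap_top (hvcd t ht)).continuous.neg.continuousOn
    have heb : ∀ t > 0, ∀ x ∈ Ω, |e t x| ≤ 2 * S := by
      intro t ht x hx
      have h1 := abs_cv_cutoff_kerRho_le b hgS ht x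
      have h2 : |c⁻¹ * cv g (fun z => b z * kerRho t z) x| ≤ S := by
        rw [abs_mul, abs_of_pos (by positivity), inv_mul_le_iff₀ hc]
        linarith
      rw [he]
      simp only
      rw [hlap t ht.ne' x hx]
      have := abs_sub (|h x|) (c⁻¹ * cv g (fun z => b z * kerRho t z) x)
      rw [abs_abs] at this
      linarith [hS x hx]
    have : IsFiniteMeasure (volume.restrict Ω) := ⟨by
      rw [Measure.restrict_apply_univ]; exact hb.measure_lt_top⟩
    have hlim : Tendsto (fun t => ∫ x in Ω, e t x * e t x) (𝓝[>] 0) (𝓝 (∫ x in Ω, (0 : ℝ))) := by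
      refine tendsto_integral_filter_of_dominated_convergence (fun _ => 2 * S * (2 * S)) ?_ ?_
        (integrable_const _) ?_
      · filter_upwards [self_mem_nhdsWithin] with t ht
        exact ((hec t (ne_of_gt ht)).mul (hec t (ne_of_gt ht))).aestronglyMeasurable
          hΩ.measurableSet
      · filter_upwards [self_mem_nhdsWithin] with t ht
        refine (ae_restrict_iff' hΩ.measurableSet).2 (ae_of_all _ fun x hx => ?_)
        rw [Real.norm_eq_abs, abs_mul]
        have := heb t ht x hx
        gcongr
      · refine (ae_restrict_iff' hΩ.measurableSet).2 (ae_of_all _ fun x hx => ?_)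
        have h1 : ContinuousAt g x := by
          refine (hh.abs.continuousAt (hΩ.mem_nhds hx)).congr ?_
          filter_upwards [hΩ.mem_nhds hx] with y hy
          exact (indicator_of_mem hy fun x => |h x|).symm
        have h2 := (tendsto_cv_cutoff_kerRho b hgm hgS h1).const_mul c⁻¹
        have h3 : c⁻¹ * (g x * newtonConst N) = |h x| := by
          have hgx : g x = |h x| := indicator_of_mem hx _
          rw [hgx]
          field_simp
          exact mul_comm _ _
        rw [h3] at h2
        have h4 : Tendsto (fun t => e t x) (𝓝[>] 0) (𝓝 0) := by
          have h5 := h2.const_sub (|h x|)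
          rw [sub_self] at h5
          refine h5.congr' ?_
          filter_upwards [self_mem_nhdsWithin] with t ht
          simp only [he, hlap t (ne_of_gt ht) x hx]
        simpa using h4.mul h4
    rw [integral_zero] at hlim
    obtain ⟨t, ht1, ht⟩ := ((hlim.eventually_le_const hε).and self_mem_nhdsWithin).exists
    have ht : 0 < t := ht
    have hcv0 : ∀ x, 0 ≤ cv g (kerK b t) x := fun x => by
      refine integral_nonneg_of_ae ?_
      filter_upwards [hKne x] with y hy
      exact mul_nonneg (hg0 y) (kerK_nonneg b t hy)
    have hv0 : ∀ x, 0 < v t x := fun x => by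
      have := hcv0 x
      simp only [hv]
      positivity
    refine ⟨v t, e t, ((hvcd t ht.ne').of_le (by norm_cast)).contDiffOn, fun x _ => hv0 x,
      fun x _ => ?_, memLp_of_continuousOn_bdd hΩ hb (hec t ht.ne') (heb t ht) _, fun x hx => ?_, ht1⟩
    · simp only [hv, mul_assoc]
      have := hB t x
      gcongr
    · simp only [he]
      have := mul_nonneg hμ (hv0 x).le
      linarith [le_abs_self (h x)]
  refine ⟨c⁻¹ * A + 1, by positivity, fun μ hμ h w H hh hS => ?_⟩
  have h2 := key μ hμ _ _ H.neg hh.neg (by simpa using hS)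
  simp only [abs_neg] at h2
  filter_upwards [key μ hμ h w H hh hS, h2] with x hx1 hx2
  have hI : 0 ≤ (∫ x in Ω, |h x| ^ q) ^ (1 / q) := by positivity
  have : |w x| ≤ c⁻¹ * A * (∫ x in Ω, |h x| ^ q) ^ (1 / q) := abs_le.2 ⟨by linarith, hx1⟩
  linarith

end SupBound

section Potential

variable {N : ℕ}

theorem fderiv_eq_sum (u : Euc N → ℝ) (x : Euc N) :
    fderiv ℝ u x = ∑ i, pd i u x • (EuclideanSpace.proj (𝕜 := ℝ) i : Euc N →L[ℝ] ℝ) := by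
  ext v
  rw [fderiv_apply_eq_sum, sum_apply]
  exact Finset.sum_congr rfl fun i _ => by simp [mul_comm]

theorem norm_proj_le (i : Fin N) : ‖(EuclideanSpace.proj (𝕜 := ℝ) i : Euc N →L[ℝ] ℝ)‖ ≤ 1 :=
  ContinuousLinearMap.opNorm_le_bound _ zero_le_one fun x => by
    simpa using PiLp.norm_apply_le x i

theorem norm_sum_smul_proj_le (c : Fin N → ℝ) :
    ‖∑ i, c i • (EuclideanSpace.proj (𝕜 := ℝ) i : Euc N →L[ℝ] ℝ)‖ ≤ ∑ i, |c i| := by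
  refine (norm_sum_le _ _).trans (Finset.sum_le_sum fun i _ => ?_)
  rw [norm_smul, Real.norm_eq_abs]
  exact mul_le_of_le_one_right (abs_nonneg _) (norm_proj_le i)

theorem contDiff_succ_of_pd {F : Euc N → ℝ} {n : ℕ} (hF : Differentiable ℝ F)
    (h : ∀ i, ContDiff ℝ n (pd i F)) : ContDiff ℝ (n + 1) F := by
  rw [contDiff_succ_iff_fderiv]
  refine ⟨hF, by simp, ?_⟩
  have : fderiv ℝ F = fun x => ∑ i, pd i F x • (EuclideanSpace.proj (𝕜 := ℝ) i : Euc N →L[ℝ] ℝ) :=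
    funext (fderiv_eq_sum F)
  rw [this]
  exact ContDiff.sum fun i _ => (h i).smul contDiff_const

theorem abs_sub_le_of_pd {F : Euc N → ℝ} (hF : Differentiable ℝ F) {C : Fin N → ℝ}
    (h : ∀ i x, |pd i F x| ≤ C i) (x y : Euc N) : |F x - F y| ≤ (∑ i, C i) * ‖x - y‖ := by
  refine convex_univ.norm_image_sub_le_of_norm_fderiv_le (𝕜 := ℝ) (fun z _ => hF z)
    (fun z _ => ?_) (mem_univ y) (mem_univ x)
  rw [fderiv_eq_sum]
  exact (norm_sum_smul_proj_le _).trans (Finset.sum_le_sum fun i _ => h i z)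

variable (b : ContDiffBump (0 : Euc N))

theorem pd_cv_kerK {k : Euc N → ℝ} (hk : Measurable k) {S : ℝ} (hS : ∀ x, |k x| ≤ S) {t : ℝ}
    (ht : t ≠ 0) (i : Fin N) : pd i (cv k (kerK b t)) = cv k (kerG b t i) := by
  rw [pd_cv (locallyIntegrable_of_bdd hk hS) (hasCompactSupport_mul_cutoff b
    fun _ hz => kerK_of_gt b t hz) ((contDiff_of_contDiffOn_kerDom ht
    (contDiffOn_kerK b t)).of_le (by norm_cast))]
  congr 1
  ext z
  exact pd_kerK b (mem_kerDom_of_ne ht z) i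

theorem tendstoUniformly_cv {k : Euc N → ℝ} (hk : Measurable k) {S : ℝ} (hS : ∀ x, |k x| ≤ S)
    {F : ℝ → Euc N → ℝ} (hF : ∀ t, Integrable (F t))
    (h : Tendsto (fun t => ∫ z, |F t z - F 0 z|) (𝓝[>] 0) (𝓝 0)) :
    TendstoUniformly (fun t => cv k (F t)) (cv k (F 0)) (𝓝[>] 0) := by
  rw [Metric.tendstoUniformly_iff]
  intro ε hε
  have h1 := h.const_mul S
  rw [mul_zero] at h1
  filter_upwards [h1.eventually_lt_const hε] with t ht x
  rw [dist_comm, Real.dist_eq]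
  exact (abs_cv_sub_le hk.aestronglyMeasurable hS (hF t) (hF 0) x).trans_lt ht

theorem continuous_cv_kerG (hN : 2 ≤ N) {k : Euc N → ℝ} (hk : Measurable k) {S : ℝ}
    (hS : ∀ x, |k x| ≤ S) (i : Fin N) : Continuous (cv k (kerG b 0 i)) := by
  refine (tendstoUniformly_cv hk hS (integrable_kerG b hN · i) (tendsto_kerG_L1 b hN i)).continuous
    (Eventually.frequently ?_)
  filter_upwards [self_mem_nhdsWithin] with t ht
  exact (contDiff_cv (n := 0) (locallyIntegrable_of_bdd hk hS) (hasCompactSupport_mul_cutoff b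
    fun _ hz => kerG_of_gt b t i hz) ((contDiff_of_contDiffOn_kerDom (ne_of_gt ht)
    (contDiffOn_kerG b t i)).of_le (by norm_cast))).continuous

theorem hasFDerivAt_cv_kerK (hN : 2 ≤ N) {k : Euc N → ℝ} (hk : Measurable k) {S : ℝ}
    (hS : ∀ x, |k x| ≤ S) (x : Euc N) :
    HasFDerivAt (cv k (kerK b 0))
      (∑ i, cv k (kerG b 0 i) x • (EuclideanSpace.proj (𝕜 := ℝ) i : Euc N →L[ℝ] ℝ)) x := by
  refine hasFDerivAt_of_tendstoUniformlyOnFilter (l := 𝓝[>] (0 : ℝ))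
    (f := fun t => cv k (kerK b t))
    (f' := fun t x => ∑ i, cv k (kerG b t i) x • (EuclideanSpace.proj (𝕜 := ℝ) i : Euc N →L[ℝ] ℝ))
    (g' := fun x => ∑ i, cv k (kerG b 0 i) x • (EuclideanSpace.proj (𝕜 := ℝ) i : Euc N →L[ℝ] ℝ))
    ?_ ?_ ?_
  · refine TendstoUniformlyOnFilter.mono_right (p' := ⊤)
      (tendstoUniformly_iff_tendstoUniformlyOnFilter.1 ?_) le_top
    rw [Metric.tendstoUniformly_iff]
    intro ε hε
    have h1 : Tendsto (fun t => ∑ i, S * ∫ z, |kerG b t i z - kerG b 0 i z|) (𝓝[>] 0)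
        (𝓝 (∑ i : Fin N, S * 0)) :=
      tendsto_finsetSum _ fun i _ => (tendsto_kerG_L1 b hN i).const_mul S
    simp only [mul_zero, Finset.sum_const_zero] at h1
    filter_upwards [h1.eventually_lt_const hε] with t ht x
    rw [dist_comm, dist_eq_norm, ← Finset.sum_sub_distrib]
    simp_rw [← sub_smul]
    refine ((norm_sum_smul_proj_le _).trans (Finset.sum_le_sum fun i _ => ?_)).trans_lt ht
    exact abs_cv_sub_le hk.aestronglyMeasurable hS (integrable_kerG b hN t i)
      (integrable_kerG b hN 0 i) x
  · refine (Filter.Eventually.prod_inl (p := fun t : ℝ => 0 < t) self_mem_nhdsWithin _).mono ?_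
    rintro ⟨t, x⟩ ht
    have hd : Differentiable ℝ (cv k (kerK b t)) :=
      (contDiff_cv (n := 1) (locallyIntegrable_of_bdd hk hS) (hasCompactSupport_mul_cutoff b
        fun _ hz => kerK_of_gt b t hz) ((contDiff_of_contDiffOn_kerDom (ne_of_gt ht)
        (contDiffOn_kerK b t)).of_le (by norm_cast))).differentiable (by norm_num)
    refine (hd x).hasFDerivAt.congr_fderiv ?_
    rw [fderiv_eq_sum]
    simp_rw [pd_cv_kerK b hk hS (ne_of_gt ht)]
  · exact Eventually.of_forall fun x => (tendstoUniformly_cv hk hS (integrable_kerK b hN)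
      (tendsto_kerK_L1 b hN)).tendsto_at x

theorem pd_cv_kerK_zero (hN : 2 ≤ N) {k : Euc N → ℝ} (hk : Measurable k) {S : ℝ}
    (hS : ∀ x, |k x| ≤ S) (i : Fin N) : pd i (cv k (kerK b 0)) = cv k (kerG b 0 i) := by
  ext x
  rw [pd, (hasFDerivAt_cv_kerK b hN hk hS x).fderiv, sum_apply]
  simp [Finset.sum_ite_eq']

theorem contDiff_cv_kerK (hN : 2 ≤ N) {k : Euc N → ℝ} (hk : Measurable k) {S : ℝ}
    (hS : ∀ x, |k x| ≤ S) : ContDiff ℝ 1 (cv k (kerK b 0)) := by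
  have := contDiff_succ_of_pd (n := 0)
    (fun x => (hasFDerivAt_cv_kerK b hN hk hS x).differentiableAt) fun i => by
      rw [pd_cv_kerK_zero b hN hk hS i]
      exact contDiff_zero.2 (continuous_cv_kerG b hN hk hS i)
  simpa using this

theorem contDiff_two_cv_kerK (hN : 2 ≤ N) {k : Euc N → ℝ} (hk : ContDiff ℝ 1 k)
    (hc : HasCompactSupport k) : ContDiff ℝ 2 (cv k (kerK b 0)) := by
  have hK := (integrable_kerK b hN 0).locallyIntegrable
  obtain ⟨S, -, hS, hS'⟩ := (⟨hk, hc, subset_univ _⟩ : IsTest univ k).exists_bound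
  have := contDiff_succ_of_pd (n := 1)
    ((contDiff_cv_kerK b hN hk.continuous.measurable hS).differentiable (by norm_num)) fun i => by
      rw [pd_cv_left hK hc hk]
      exact contDiff_cv_kerK b hN (continuous_pd hk i).measurable (hS' i)
  exact_mod_cast this

/-- Newtonian potentials are Lipschitz, uniformly with respect to the density. -/
theorem exists_lipschitz_cv_kerK (hN : 2 ≤ N) : ∃ Λ, 0 ≤ Λ ∧ ∀ (k : Euc N → ℝ) (S : ℝ),
    Measurable k → (∀ x, |k x| ≤ S) →
      ∀ x y, |cv k (kerK b 0) x - cv k (kerK b 0) y| ≤ S * Λ * ‖x - y‖ := by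
  refine ⟨∑ i, ∫ z, |kerG b 0 i z|, Finset.sum_nonneg fun i _ => integral_nonneg fun _ => abs_nonneg _,
    fun k S hk hS x y => ?_⟩
  rw [Finset.mul_sum]
  refine abs_sub_le_of_pd (fun x => (hasFDerivAt_cv_kerK b hN hk hS x).differentiableAt)
    (fun i x => ?_) x y
  rw [pd_cv_kerK_zero b hN hk hS]
  exact abs_cv_le hS (integrable_kerG b hN 0 i) x

theorem exists_lipschitz_cv {K : Euc N → ℝ} (hK : ContDiff ℝ 1 K) (hc : HasCompactSupport K) :
    ∃ Λ, 0 ≤ Λ ∧ ∀ (k : Euc N → ℝ) (S : ℝ), Measurable k → (∀ x, |k x| ≤ S) →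
      ∀ x y, |cv k K x - cv k K y| ≤ S * Λ * ‖x - y‖ := by
  refine ⟨∑ i, ∫ z, |pd i K z|, Finset.sum_nonneg fun i _ => integral_nonneg fun _ => abs_nonneg _,
    fun k S hk hS x y => ?_⟩
  rw [Finset.mul_sum]
  have hL := locallyIntegrable_of_bdd hk hS
  refine abs_sub_le_of_pd ((contDiff_cv (n := 1) hL hc hK).differentiable (by norm_num))
    (fun i x => ?_) x y
  rw [pd_cv hL hc hK]
  exact abs_cv_le hS ((continuous_pd hK i).integrable_of_hasCompactSupport
    (hasCompactSupport_pd hc i)) x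

end Potential

section Representation

variable {N : ℕ} {Ω : Set (Euc N)}

theorem WSol.very_weak (hΩ : IsOpen Ω) {μ : ℝ} {h w : Euc N → ℝ} (H : WSol Ω μ h w)
    {φ : Euc N → ℝ} (hφ : ContDiff ℝ 2 φ) (hc : HasCompactSupport φ) (hs : tsupport φ ⊆ Ω) :
    (∫ x in Ω, w x * -lap φ x) + μ * ∫ x in Ω, w x * φ x = ∫ x in Ω, h x * φ x := by
  obtain ⟨v, ε, hv, hε, hle, hL⟩ := H.approx
  have hT : IsTest Ω φ := ⟨hφ.of_le (by norm_num), hc, hs⟩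
  have hlc : HasCompactSupport (lap φ) := by
    refine hc.mono' ?_
    intro x hx
    by_contra hx'
    refine hx ?_
    refine Finset.sum_eq_zero fun i _ => ?_
    change pd i (pd i φ) x = 0
    exact image_eq_zero_of_notMem_tsupport fun h' =>
      hx' (tsupport_pd_subset i φ (tsupport_pd_subset i _ h'))
  have hlap : Continuous (lap φ) := by
    rw [← continuousOn_univ]
    exact continuousOn_lap isOpen_univ hφ.contDiffOn
  have hlim : ∀ g : Euc N → ℝ, Continuous g → HasCompactSupport g →
      Tendsto (fun n => ∫ x in Ω, v n x * g x) atTop (𝓝 (∫ x in Ω, w x * g x)) := by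
    intro g hg hgc
    have hg2 : MemLp g 2 (volume.restrict Ω) := (hg.memLp_of_hasCompactSupport hgc).restrict _
    rw [tendsto_iff_norm_sub_tendsto_zero]
    have h0 := (hL.sqrt).mul_const (√(∫ x in Ω, g x * g x))
    rw [Real.sqrt_zero, zero_mul] at h0
    refine squeeze_zero (fun n => norm_nonneg _) (fun n => ?_) h0
    rw [← integral_sub (memLp_integrable_mul (hv n).memLp hg2) (memLp_integrable_mul H.mem hg2)]
    simp_rw [← sub_mul]
    exact integral_mul_le_sqrt ((hv n).memLp.sub H.mem) hg2
  have h1 : Tendsto (fun n => form Ω μ (v n) φ) atTop (𝓝 (∫ x in Ω, h x * φ x)) := by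
    rw [tendsto_iff_norm_sub_tendsto_zero]
    have h0 := hε.mul_const (nrm Ω μ φ)
    rw [zero_mul] at h0
    exact squeeze_zero (fun n => norm_nonneg _) (fun n => hle n φ hT) h0
  have h2 : ∀ n, form Ω μ (v n) φ = (∫ x in Ω, v n x * -lap φ x) + μ * ∫ x in Ω, v n x * φ x := by
    intro n
    rw [form_comm, form_eq μ hT (hv n), integral_pd_mul_pd hΩ hφ.contDiffOn (hv n)]
    simp_rw [mul_comm]
  simp_rw [h2] at h1
  exact tendsto_nhds_unique ((hlim _ hlap.neg hlc.neg).add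
    ((hlim _ hφ.continuous hc).const_mul μ)) h1

theorem integral_mul_cv {W g F : Euc N → ℝ} (hW : AEStronglyMeasurable W) {S : ℝ}
    (hS : ∀ x, |W x| ≤ S) (hg : Integrable g) (hF : Integrable F) :
    ∫ x, W x * cv g F x = ∫ y, g y * cv W (fun z => F (-z)) y := by
  have h1 := hg.convolution_integrand (ContinuousLinearMap.mul ℝ ℝ) hF
  have h2 : Integrable (fun q : Euc N × Euc N => W q.1 * (g q.2 * F (q.1 - q.2)))
      (volume.prod volume) :=
    h1.bdd_mul (c := S) hW.comp_fst (ae_of_all _ fun q => hS q.1)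
  have h3 := integral_integral_swap (f := fun x y => W x * (g y * F (x - y))) h2
  simp only [cv]
  simp_rw [← integral_const_mul]
  rw [h3]
  refine integral_congr_ae (ae_of_all _ fun y => integral_congr_ae (ae_of_all _ fun x => ?_))
  simp only [neg_sub]
  ring

theorem tendsto_integral_mul_cv {W g : Euc N → ℝ} (hW : AEStronglyMeasurable W) {S : ℝ}
    (hS : ∀ x, |W x| ≤ S) (hg : Integrable g) {F : ℝ → Euc N → ℝ} (hF : ∀ t, Integrable (F t))
    (h : Tendsto (fun t => ∫ z, |F t z - F 0 z|) (𝓝[>] 0) (𝓝 0)) :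
    Tendsto (fun t => ∫ x, W x * cv g (F t) x) (𝓝[>] 0)
      (𝓝 (∫ y, g y * cv W (fun z => F 0 (-z)) y)) := by
  rw [← integral_mul_cv hW hS hg (hF 0), tendsto_iff_norm_sub_tendsto_zero]
  have h0 := (h.const_mul S).mul_const (∫ y, |g y|)
  rw [mul_zero, zero_mul] at h0
  refine squeeze_zero (fun _ => norm_nonneg _) (fun t => ?_) h0
  have hFn : ∀ t, Integrable fun z => F t (-z) := fun t => (hF t).comp_neg
  have hb : ∀ s, Integrable fun y => g y * cv W (fun z => F s (-z)) y := fun s => by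
    simp_rw [mul_comm (g _)]
    refine hg.bdd_mul (c := S * ∫ z, |F s (-z)|) ?_ (ae_of_all _ fun y => ?_)
    · rw [cv_comm, cv_eq]
      have h1 := ((hFn s).aestronglyMeasurable.convolution_integrand
        (ContinuousLinearMap.mul ℝ ℝ) hW (μ := volume)).integral_prod_right'
      exact h1
    · exact abs_cv_le hS (hFn s) y
  rw [integral_mul_cv hW hS hg (hF t), integral_mul_cv hW hS hg (hF 0),
    ← integral_sub (hb t) (hb 0), ← integral_const_mul]
  refine norm_integral_le_of_norm_le (hg.abs.const_mul _) (ae_of_all _ fun y => ?_)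
  rw [← mul_sub, norm_mul, mul_comm, Real.norm_eq_abs, Real.norm_eq_abs]
  refine mul_le_mul_of_nonneg_right ?_ (abs_nonneg _)
  have := abs_cv_sub_le hW hS (hFn t) (hFn 0) y
  rwa [integral_neg_eq_self (fun z => |F t z - F 0 z|) volume] at this

theorem ae_eq_cv (hN : 2 ≤ N) {W k : Euc N → ℝ} (hW : Measurable W) (hk : Measurable k) {S : ℝ}
    (hSW : ∀ x, |W x| ≤ S) (hSk : ∀ x, |k x| ≤ S) {U : Set (Euc N)}
    (H : ∀ φ : Euc N → ℝ, ContDiff ℝ (⊤ : ℕ∞) φ → HasCompactSupport φ → tsupport φ ⊆ U →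
      ∫ x, W x * -lap φ x = ∫ x, k x * φ x)
    (b : ContDiffBump (0 : Euc N)) {x₀ : Euc N} {r : ℝ}
    (hr : Metric.closedBall x₀ (r + b.rOut) ⊆ U) :
    ∀ᵐ y, y ∈ Metric.ball x₀ r →
      newtonConst N * W y = cv k (kerK b 0) y - cv W (fun z => kerOm b 0 (-z)) y := by
  have hKc : Continuous (cv k (kerK b 0)) := (contDiff_cv_kerK b hN hk hSk).continuous
  have hOc : Continuous (cv W (fun z => kerOm b 0 (-z))) :=
    (contDiff_cv (n := 0) (locallyIntegrable_of_bdd hW hSW) (hasCompactSupport_mul_cutoff b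
      fun z hz => kerOm_of_gt b 0 (by rwa [norm_neg])) (((contDiff_kerOm b 0).comp
      contDiff_neg).of_le (by simp))).continuous
  have hWl := locallyIntegrable_of_bdd hW hSW
  have main : ∀ᵐ y, y ∈ Metric.ball x₀ r →
      newtonConst N * W y + cv W (fun z => kerOm b 0 (-z)) y - cv k (kerK b 0) y = 0 := by
    refine Metric.isOpen_ball.ae_eq_zero_of_integral_contDiff_smul_eq_zero ?_ ?_
    · exact (((hWl.smul (newtonConst N)).add hOc.locallyIntegrable).sub
        hKc.locallyIntegrable).locallyIntegrableOn _
    intro g hg hgc hgs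
    obtain ⟨S', hS'0, hS', -⟩ := (⟨hg.of_le (by norm_cast), hgc, subset_univ _⟩ :
      IsTest univ g).exists_bound
    have hgi : Integrable g := hg.continuous.integrable_of_hasCompactSupport hgc
    have hgl := hgi.locallyIntegrable
    have hoff : ∀ (F : Euc N → ℝ), (∀ z, b.rOut < ‖z‖ → F z = 0) → ∀ x,
        x ∉ Metric.closedBall x₀ (r + b.rOut) → cv g F x = 0 := by
      intro F hF x hx
      refine integral_eq_zero_of_ae (ae_of_all _ fun y => ?_)
      by_cases hy : y ∈ tsupport g
      · have h1 := hgs hy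
        rw [Metric.mem_closedBall, not_le, dist_eq_norm] at hx
        rw [Metric.mem_ball, dist_eq_norm] at h1
        have h2 : b.rOut < ‖x - y‖ := by
          have := norm_sub_le_norm_sub_add_norm_sub x y x₀
          linarith
        simp [hF _ h2]
      · simp [image_eq_zero_of_notMem_tsupport hy]
    have heq : ∀ t : ℝ, 0 < t → (∫ x, W x * cv g (fun z => b z * kerRho t z) x) +
        ∫ x, W x * cv g (kerOm b t) x = ∫ x, k x * cv g (kerK b t) x := by
      intro t ht
      have hKs := contDiff_of_contDiffOn_kerDom ht.ne' (contDiffOn_kerK b t)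
      have hKcs := hasCompactSupport_mul_cutoff b fun _ hz => kerK_of_gt b t hz
      have hts : tsupport (cv g (kerK b t)) ⊆ Metric.closedBall x₀ (r + b.rOut) :=
        closure_minimal (fun x hx => by
          by_contra hx'
          exact hx (hoff _ (fun z hz => kerK_of_gt b t hz) x hx')) Metric.isClosed_closedBall
      have hcs : HasCompactSupport (cv g (kerK b t)) :=
        (isCompact_closedBall _ _).of_isClosed_subset (isClosed_tsupport _) hts
      rw [← H _ (contDiff_cv hgl hKcs hKs) hcs (hts.trans hr)]
      have hρc : Continuous fun z => b z * kerRho t z :=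
        b.continuous.mul (continuous_kerRho ht.ne')
      have hρs : HasCompactSupport fun z => b z * kerRho t z := b.hasCompactSupport.mul_right
      have hoc := (contDiff_kerOm b t).continuous
      have hos := hasCompactSupport_mul_cutoff b fun _ hz => kerOm_of_gt b t hz
      have hlap : ∀ x, -lap (cv g (kerK b t)) x =
          cv g (fun z => b z * kerRho t z) x + cv g (kerOm b t) x := by
        intro x
        rw [lap_cv hgl hKcs (hKs.of_le (by norm_cast)), cv, cv, cv,
          ← integral_add (integrable_cv hgl hρs hρc x) (integrable_cv hgl hos hoc x), ← integral_neg]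
        refine integral_congr_ae (ae_of_all _ fun y => ?_)
        change -(g y * lap (kerK b t) (x - y)) = _
        rw [← mul_neg, neg_lap_kerK b (mem_kerDom_of_ne ht.ne' _)]
        ring
      have hI : ∀ F : Euc N → ℝ, Continuous F → HasCompactSupport F →
          (∀ z, b.rOut < ‖z‖ → F z = 0) → Integrable fun x => W x * cv g F x := by
        intro F hF hFc hF0
        have h1 : Continuous (cv g F) := (contDiff_cv (n := 0) hgl hFc (contDiff_zero.2 hF)).continuous
        refine (h1.integrable_of_hasCompactSupport ?_).bdd_mul hW.aestronglyMeasurable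
          (ae_of_all _ hSW)
        exact (isCompact_closedBall x₀ (r + b.rOut)).of_isClosed_subset (isClosed_tsupport _)
          (closure_minimal (fun x hx => by
            by_contra hx'
            exact hx (hoff _ hF0 x hx')) Metric.isClosed_closedBall)
      rw [← integral_add (hI _ hρc hρs fun z hz => by
        rw [image_eq_zero_of_notMem_tsupport (cutoff_zero b hz), zero_mul])
        (hI _ hoc hos fun z hz => kerOm_of_gt b t hz)]
      simp_rw [hlap, mul_add]
    have hl1 : Tendsto (fun t => ∫ x, W x * cv g (fun z => b z * kerRho t z) x) (𝓝[>] 0)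
        (𝓝 (∫ x, W x * (g x * newtonConst N))) := by
      have hS0 : 0 ≤ S := (abs_nonneg _).trans (hSW 0)
      refine tendsto_integral_filter_of_dominated_convergence
        ((Metric.closedBall x₀ (r + b.rOut)).indicator fun _ => S * (S' * newtonConst N)) ?_ ?_ ?_ ?_
      · filter_upwards [self_mem_nhdsWithin] with t ht
        exact hW.aestronglyMeasurable.mul (contDiff_cv (n := 0) hgl b.hasCompactSupport.mul_right
          (contDiff_zero.2 (b.continuous.mul
            (continuous_kerRho (ne_of_gt ht))))).continuous.aestronglyMeasurable
      · filter_upwards [self_mem_nhdsWithin] with t ht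
        refine ae_of_all _ fun x => ?_
        by_cases hx : x ∈ Metric.closedBall x₀ (r + b.rOut)
        · rw [indicator_of_mem hx, norm_mul]
          exact mul_le_mul (hSW x) (abs_cv_cutoff_kerRho_le b hS' ht x) (norm_nonneg _) hS0
        · rw [indicator_of_notMem hx, hoff _ (fun z hz => by
            rw [image_eq_zero_of_notMem_tsupport (cutoff_zero b hz), zero_mul]) x hx]
          simp
      · exact (integrableOn_const (Metric.isBounded_closedBall.measure_lt_top.ne)).integrable_indicator
          measurableSet_closedBall
      · exact ae_of_all _ fun x => (tendsto_cv_cutoff_kerRho b hg.continuous.measurable hS'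
          hg.continuous.continuousAt).const_mul _
    have hl2 := tendsto_integral_mul_cv hW.aestronglyMeasurable hSW hgi (integrable_kerOm b)
      (tendsto_kerOm_L1 b hN)
    have hl3 := tendsto_integral_mul_cv hk.aestronglyMeasurable hSk hgi (integrable_kerK b hN)
      (tendsto_kerK_L1 b hN)
    simp_rw [kerK_even] at hl3
    have hlim := tendsto_nhds_unique_of_eventuallyEq (hl1.add hl2) hl3 (by
      filter_upwards [self_mem_nhdsWithin] with t ht using heq t ht)
    have hi : ∀ F : Euc N → ℝ, Continuous F → Integrable fun x => g x * F x := fun F hF =>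
      (hg.continuous.mul hF).integrable_of_hasCompactSupport hgc.mul_right
    have hiW : Integrable fun x => W x * (g x * newtonConst N) :=
      (hgi.mul_const _).bdd_mul hW.aestronglyMeasurable (ae_of_all _ hSW)
    rw [← integral_add hiW (hi _ hOc)] at hlim
    rw [← sub_eq_zero, ← integral_sub (hiW.fun_add (hi _ hOc)) (hi _ hKc)] at hlim
    refine (integral_congr_ae (ae_of_all _ fun x => ?_)).trans hlim
    simp only [smul_eq_mul]
    ring
  filter_upwards [main] with y hy hyb
  linarith [hy hyb]

end Representation

section InteriorRegularity

variable {N : ℕ} {Ω : Set (Euc N)}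

theorem exists_continuousOn_of_locally_ae_eq (hΩ : IsOpen Ω) {W : Euc N → ℝ}
    (h : ∀ x ∈ Ω, ∃ r > 0, ∃ v : Euc N → ℝ, Continuous v ∧
      ∀ᵐ y, y ∈ Metric.ball x r → W y = v y) :
    ∃ w, ContinuousOn w Ω ∧ ∀ᵐ x ∂volume.restrict Ω, w x = W x := by
  have h' : ∀ x : Ω, ∃ r > 0, ∃ v : Euc N → ℝ, Continuous v ∧
      ∀ᵐ y, y ∈ Metric.ball (x : Euc N) r → W y = v y := fun x => h x x.2
  choose r hr v hv hW using h'
  classical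
  set w : Euc N → ℝ := fun x => if hx : x ∈ Ω then v ⟨x, hx⟩ x else 0 with hw
  have key : ∀ (x : Ω) y, y ∈ Ω → y ∈ Metric.ball (x : Euc N) (r x) → w y = v x y := by
    intro x y hy hyx
    have h1 : w y = v ⟨y, hy⟩ y := by simp [hw, hy]
    rw [h1]
    set U := Metric.ball (x : Euc N) (r x) ∩ Metric.ball y (r ⟨y, hy⟩)
    have hU : IsOpen U := Metric.isOpen_ball.inter Metric.isOpen_ball
    have hae : v ⟨y, hy⟩ =ᵐ[volume.restrict U] v x := by
      rw [EventuallyEq, ae_restrict_iff' hU.measurableSet]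
      filter_upwards [hW x, hW ⟨y, hy⟩] with z h1 h2 hz
      rw [← h1 hz.1, h2 hz.2]
    exact Measure.eqOn_open_of_ae_eq hae hU (hv _).continuousOn (hv _).continuousOn
      ⟨hyx, Metric.mem_ball_self (hr _)⟩
  refine ⟨w, fun x hx => ?_, ?_⟩
  · refine ContinuousAt.continuousWithinAt ?_
    refine (hv ⟨x, hx⟩).continuousAt.congr ?_
    filter_upwards [hΩ.mem_nhds hx, Metric.ball_mem_nhds x (hr ⟨x, hx⟩)] with y hy hyx
    exact (key ⟨x, hx⟩ y hy hyx).symm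
  · rw [ae_restrict_iff' hΩ.measurableSet, ae_iff]
    refine measure_null_of_locally_null _ fun x hx => ?_
    have hxΩ : x ∈ Ω := by
      by_contra hx'
      exact hx fun h => absurd h hx'
    refine ⟨_, inter_mem self_mem_nhdsWithin
      (mem_nhdsWithin_of_mem_nhds (Metric.ball_mem_nhds x (hr ⟨x, hxΩ⟩))), ?_⟩
    refine measure_mono_null ?_ (ae_iff.1 (hW ⟨x, hxΩ⟩))
    rintro y ⟨hy, hyx⟩ hc
    exact hy fun hyΩ => (key ⟨x, hxΩ⟩ y hyΩ hyx).trans (hc hyx).symm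

theorem exists_cutoff_closedBall_subset (hΩ : IsOpen Ω) {x : Euc N} (hx : x ∈ Ω) :
    ∃ b : ContDiffBump (0 : Euc N), Metric.closedBall x (3 * b.rOut) ⊆ Ω := by
  obtain ⟨ε, hε, h⟩ := Metric.nhds_basis_closedBall.mem_iff.1 (hΩ.mem_nhds hx)
  refine ⟨⟨ε / 6, ε / 3, by positivity, by linarith⟩, ?_⟩
  have : 3 * (ε / 3) = ε := by ring
  simpa only [this] using h

theorem WSol.congr {μ : ℝ} {h w w' : Euc N → ℝ} (H : WSol Ω μ h w)
    (hw : w' =ᵐ[volume.restrict Ω] w) : WSol Ω μ h w' := by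
  obtain ⟨φ, ε, h1, h2, h3, h4⟩ := H.approx
  refine ⟨H.rhs, (memLp_congr_ae hw).2 H.mem, φ, ε, h1, h2, h3, ?_⟩
  convert! h4 using 2 with n
  refine integral_congr_ae ?_
  filter_upwards [hw] with x hx
  rw [hx]

theorem measurable_indicator_sub (hΩ : IsOpen Ω) {μ : ℝ} {h W : Euc N → ℝ}
    (hh : ContinuousOn h Ω) (hW : Measurable W) :
    Measurable (Ω.indicator fun x => h x - μ * W x) := by
  have : (Ω.indicator fun x => h x - μ * W x) = fun x => Ω.indicator h x - Ω.indicator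
      (fun x => μ * W x) x := by
    rw [← indicator_sub]
  rw [this]
  exact (measurable_indicator_of_continuousOn hΩ hh).sub
    ((hW.const_mul μ).indicator hΩ.measurableSet)

/-- The local representation of a function `W` with `-ΔW = k` by potentials. -/
def newtonRep (b : ContDiffBump (0 : Euc N)) (W k : Euc N → ℝ) (y : Euc N) : ℝ :=
  (cv k (kerK b 0) y - cv W (fun z => kerOm b 0 (-z)) y) / newtonConst N

theorem hasCompactSupport_kerOm_neg (b : ContDiffBump (0 : Euc N)) :
    HasCompactSupport fun z => kerOm b 0 (-z) :=
  hasCompactSupport_mul_cutoff b fun z hz => kerOm_of_gt b 0 (by rwa [norm_neg])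

theorem contDiff_cv_kerOm (b : ContDiffBump (0 : Euc N)) {n : ℕ∞} {W : Euc N → ℝ}
    (hW : Measurable W) {S : ℝ} (hSW : ∀ x, |W x| ≤ S) :
    ContDiff ℝ n (cv W fun z => kerOm b 0 (-z)) :=
  contDiff_cv (locallyIntegrable_of_bdd hW hSW) (hasCompactSupport_kerOm_neg b)
    (((contDiff_kerOm b 0).comp contDiff_neg).of_le (by simp))

theorem contDiff_newtonRep (b : ContDiffBump (0 : Euc N)) (hN : 2 ≤ N) {W k : Euc N → ℝ}
    (hW : Measurable W) (hk : Measurable k) {S : ℝ} (hSW : ∀ x, |W x| ≤ S)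
    (hSk : ∀ x, |k x| ≤ S) : ContDiff ℝ 1 (newtonRep b W k) :=
  ((contDiff_cv_kerK b hN hk hSk).sub (contDiff_cv_kerOm b (n := 1) hW hSW)).div_const _

theorem exists_lipschitz_newtonRep (b : ContDiffBump (0 : Euc N)) (hN : 2 ≤ N) :
    ∃ Λ, 0 ≤ Λ ∧ ∀ (W k : Euc N → ℝ) (S : ℝ), Measurable W → Measurable k → (∀ x, |W x| ≤ S) →
      (∀ x, |k x| ≤ S) → ∀ x y, |newtonRep b W k x - newtonRep b W k y| ≤ S * Λ * ‖x - y‖ := by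
  obtain ⟨Λ₁, h1, H1⟩ := exists_lipschitz_cv_kerK b hN
  obtain ⟨Λ₂, h2, H2⟩ := exists_lipschitz_cv (K := fun z => kerOm b 0 (-z))
    (((contDiff_kerOm b 0).comp contDiff_neg).of_le (by norm_cast))
    (hasCompactSupport_kerOm_neg b)
  have hc := newtonConst_pos hN
  refine ⟨(Λ₁ + Λ₂) / newtonConst N, by positivity, fun W k S hW hk hSW hSk x y => ?_⟩
  have e1 := H1 k S hk hSk x y
  have e2 := H2 W S hW hSW x y
  rw [newtonRep, newtonRep, ← sub_div, abs_div, abs_of_pos hc, div_le_iff₀ hc]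
  have e3 : S * ((Λ₁ + Λ₂) / newtonConst N) * ‖x - y‖ * newtonConst N =
      S * Λ₁ * ‖x - y‖ + S * Λ₂ * ‖x - y‖ := by
    field_simp
  rw [e3]
  rw [abs_le] at e1 e2 ⊢
  constructor <;> linarith

theorem WSol.ae_eq_cv (hN : 2 ≤ N) (hΩ : IsOpen Ω) {μ : ℝ} {h w W : Euc N → ℝ}
    (H : WSol Ω μ h w) (hh : ContinuousOn h Ω) (hW : Measurable W)
    (hwW : ∀ᵐ x ∂volume.restrict Ω, W x = w x) {S : ℝ} (hSW : ∀ x, |W x| ≤ S)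
    (hSk : ∀ x ∈ Ω, |h x - μ * W x| ≤ S) (b : ContDiffBump (0 : Euc N)) {x₀ : Euc N}
    (hb : Metric.closedBall x₀ (3 * b.rOut) ⊆ Ω) :
    ∀ᵐ y, y ∈ Metric.ball x₀ (2 * b.rOut) →
      newtonConst N * W y = cv (Ω.indicator fun x => h x - μ * W x) (kerK b 0) y -
        cv W (fun z => kerOm b 0 (-z)) y := by
  have hk := measurable_indicator_sub hΩ hh hW (μ := μ)
  refine _root_.ae_eq_cv hN hW hk hSW (abs_indicator_le ((abs_nonneg _).trans (hSW 0)) hSk)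
    (U := Ω) ?_ b ?_
  · intro φ hφ hc hs
    have h1 := (H.congr hwW).very_weak hΩ (hφ.of_le (by norm_cast)) hc hs
    have hT : IsTest Ω φ := ⟨hφ.of_le (by norm_cast), hc, hs⟩
    have hWm := (H.congr hwW).mem
    have h2 : ∫ x in Ω, W x * -lap φ x = ∫ x, W x * -lap φ x :=
      hT.setIntegral_eq fun x hx => by
        have : lap φ x = 0 := by
          refine Finset.sum_eq_zero fun i _ => ?_
          change pd i (pd i φ) x = 0
          exact image_eq_zero_of_notMem_tsupport fun h' =>
            hx (tsupport_pd_subset i φ (tsupport_pd_subset i _ h'))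
        rw [this, neg_zero, mul_zero]
    have h3 : ∫ x in Ω, (h x - μ * W x) * φ x = ∫ x, Ω.indicator (fun x => h x - μ * W x) x * φ x := by
      rw [← integral_indicator hΩ.measurableSet]
      refine integral_congr_ae (ae_of_all _ fun x => ?_)
      by_cases hx : x ∈ Ω <;> simp [hx]
    rw [← h2, ← h3]
    simp_rw [sub_mul, mul_assoc]
    rw [integral_sub (memLp_integrable_mul H.rhs hT.memLp)
      ((memLp_integrable_mul hWm hT.memLp).const_mul μ), integral_const_mul]
    linarith
  · rwa [show 2 * b.rOut + b.rOut = 3 * b.rOut by ring]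

/-- Weak solutions with bounded continuous right-hand side are continuous in the interior. -/
theorem WSol.exists_continuousOn (hN : 2 ≤ N) (hΩ : IsOpen Ω) {μ : ℝ} {h w : Euc N → ℝ}
    (H : WSol Ω μ h w) (hh : ContinuousOn h Ω) {S B : ℝ} (hS : ∀ x ∈ Ω, |h x| ≤ S)
    (hB : 0 ≤ B) (hw : ∀ᵐ x ∂volume.restrict Ω, |w x| ≤ B) :
    ∃ v, ContinuousOn v Ω ∧ (∀ x ∈ Ω, |v x| ≤ B) ∧ v =ᵐ[volume.restrict Ω] w := by
  set W : Euc N → ℝ := Ω.indicator fun x => max (-B) (min B (H.mem.1.mk w x)) with hWdef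
  have hWm : Measurable W := Measurable.indicator (measurable_const.max (measurable_const.min
    H.mem.1.stronglyMeasurable_mk.measurable)) hΩ.measurableSet
  have hWB : ∀ x, |W x| ≤ B := by
    intro x
    by_cases hx : x ∈ Ω
    · simp only [hWdef, indicator_of_mem hx]
      exact abs_le.2 ⟨le_max_left _ _, max_le (by linarith) (min_le_left _ _)⟩
    · simpa [hWdef, hx] using hB
  have hWw : ∀ᵐ x ∂volume.restrict Ω, W x = w x := by
    filter_upwards [hw, H.mem.1.ae_eq_mk, ae_restrict_mem hΩ.measurableSet] with x h1 h2 h3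
    rw [hWdef, indicator_of_mem h3, ← h2, min_eq_right (abs_le.1 h1).2, max_eq_right (abs_le.1 h1).1]
  have hc0 := (newtonConst_pos hN).ne'
  obtain ⟨v, hvc, hv⟩ := exists_continuousOn_of_locally_ae_eq hΩ (W := W) fun x hx => by
    obtain ⟨b, hb⟩ := exists_cutoff_closedBall_subset hΩ hx
    have hbp := b.rOut_pos
    have hSk : ∀ x ∈ Ω, |h x - μ * W x| ≤ B + (S + |μ| * B) := fun x hx => by
      refine (abs_sub _ _).trans ?_
      rw [abs_mul]
      have := mul_le_mul_of_nonneg_left (hWB x) (abs_nonneg μ)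
      linarith [hS x hx]
    have hS0 : 0 ≤ S := (abs_nonneg _).trans (hS x hx)
    have hSW : ∀ y, |W y| ≤ B + (S + |μ| * B) := fun y =>
      (hWB y).trans (le_add_of_nonneg_right (by positivity))
    refine ⟨2 * b.rOut, by positivity, newtonRep b W (Ω.indicator fun x => h x - μ * W x),
      (contDiff_newtonRep b hN hWm (measurable_indicator_sub hΩ hh hWm) hSW
        (abs_indicator_le (by positivity) hSk)).continuous, ?_⟩
    filter_upwards [H.ae_eq_cv hN hΩ hh hWm hWw hSW hSk b hb] with y hy hyb
    rw [newtonRep, ← hy hyb, mul_div_cancel_left₀ _ hc0]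
  set v' : Euc N → ℝ := fun x => max (-B) (min B (v x)) with hv'
  refine ⟨v', continuousOn_const.sup (continuousOn_const.inf hvc), fun x _ =>
    abs_le.2 ⟨le_max_left _ _, max_le (by linarith) (min_le_left _ _)⟩, ?_⟩
  filter_upwards [hv, hWw, hw] with x h1 h2 h3
  simp only [hv']
  rw [h1, h2, min_eq_right (abs_le.1 h3).2, max_eq_right (abs_le.1 h3).1]

theorem WSol.eq_newtonRep (hN : 2 ≤ N) (hΩ : IsOpen Ω) {μ : ℝ} {h w : Euc N → ℝ}
    (H : WSol Ω μ h w) (hh : ContinuousOn h Ω) (hw : ContinuousOn w Ω) {S : ℝ}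
    (hSw : ∀ x ∈ Ω, |w x| ≤ S) (hSk : ∀ x ∈ Ω, |h x - μ * w x| ≤ S)
    (b : ContDiffBump (0 : Euc N)) {x₀ : Euc N}
    (hb : Metric.closedBall x₀ (3 * b.rOut) ⊆ Ω) :
    EqOn w (newtonRep b (Ω.indicator w) (Ω.indicator fun x => h x - μ * w x))
      (Metric.ball x₀ (2 * b.rOut)) := by
  have hbp := b.rOut_pos
  have hsub : Metric.ball x₀ (2 * b.rOut) ⊆ Ω :=
    (Metric.ball_subset_closedBall.trans (Metric.closedBall_subset_closedBall (by linarith))).trans hb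
  have hx₀ : x₀ ∈ Ω := hsub (Metric.mem_ball_self (by positivity))
  have hS0 : 0 ≤ S := (abs_nonneg _).trans (hSw x₀ hx₀)
  have hWm := measurable_indicator_of_continuousOn hΩ hw
  have hSW := abs_indicator_le hS0 hSw
  have hk0 : (Ω.indicator fun x => h x - μ * Ω.indicator w x) =
      Ω.indicator fun x => h x - μ * w x := by
    ext x
    by_cases hx : x ∈ Ω <;> simp [hx]
  have hkm := measurable_indicator_sub hΩ hh hWm (μ := μ)
  have h1 := H.ae_eq_cv hN hΩ hh hWm ((ae_restrict_mem hΩ.measurableSet).mono fun x hx =>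
    indicator_of_mem hx w) hSW (fun x hx => by rw [indicator_of_mem hx]; exact hSk x hx) b hb
  rw [hk0] at h1 hkm
  refine Measure.eqOn_open_of_ae_eq (μ := volume) ?_ Metric.isOpen_ball (hw.mono hsub)
    (contDiff_newtonRep b hN hWm hkm hSW (abs_indicator_le hS0 hSk)).continuous.continuousOn
  rw [EventuallyEq, ae_restrict_iff' Metric.isOpen_ball.measurableSet]
  filter_upwards [h1] with y hy hyb
  rw [newtonRep, ← hy hyb, mul_div_cancel_left₀ _ (newtonConst_pos hN).ne',
    indicator_of_mem (hsub hyb)]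

/-- Interior Lipschitz estimate. -/
theorem exists_lipschitz_bound (hN : 2 ≤ N) (hΩ : IsOpen Ω) {x₀ : Euc N} (hx₀ : x₀ ∈ Ω) :
    ∃ r > 0, ∃ Λ, 0 ≤ Λ ∧ Metric.ball x₀ r ⊆ Ω ∧ ∀ (μ S : ℝ) (h w : Euc N → ℝ), WSol Ω μ h w →
      ContinuousOn h Ω → ContinuousOn w Ω → (∀ x ∈ Ω, |w x| ≤ S) →
      (∀ x ∈ Ω, |h x - μ * w x| ≤ S) →
      ∀ x ∈ Metric.ball x₀ r, ∀ y ∈ Metric.ball x₀ r, |w x - w y| ≤ S * Λ * ‖x - y‖ := by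
  obtain ⟨b, hb⟩ := exists_cutoff_closedBall_subset hΩ hx₀
  have hbp := b.rOut_pos
  have hsub : Metric.ball x₀ (2 * b.rOut) ⊆ Ω :=
    (Metric.ball_subset_closedBall.trans (Metric.closedBall_subset_closedBall (by linarith))).trans hb
  obtain ⟨Λ, hΛ, H⟩ := exists_lipschitz_newtonRep b hN
  refine ⟨2 * b.rOut, by positivity, Λ, hΛ, hsub, fun μ S h w hw hh hwc hSw hSk x hx y hy => ?_⟩
  have hS0 : 0 ≤ S := (abs_nonneg _).trans (hSw x₀ hx₀)
  have hE := hw.eq_newtonRep hN hΩ hh hwc hSw hSk b hb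
  rw [hE hx, hE hy]
  exact H _ _ S (measurable_indicator_of_continuousOn hΩ hwc)
    (measurable_indicator_of_continuousOn hΩ (hh.sub (continuousOn_const.mul hwc)))
    (abs_indicator_le hS0 hSw) (abs_indicator_le hS0 hSk) x y

theorem WSol.contDiffOn_one (hN : 2 ≤ N) (hΩ : IsOpen Ω) {μ : ℝ} {h w : Euc N → ℝ}
    (H : WSol Ω μ h w) (hh : ContinuousOn h Ω) (hw : ContinuousOn w Ω) {S : ℝ}
    (hSw : ∀ x ∈ Ω, |w x| ≤ S) (hSk : ∀ x ∈ Ω, |h x - μ * w x| ≤ S) : ContDiffOn ℝ 1 w Ω := by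
  intro x hx
  obtain ⟨b, hb⟩ := exists_cutoff_closedBall_subset hΩ hx
  have hS0 : 0 ≤ S := (abs_nonneg _).trans (hSw x hx)
  refine ContDiffAt.contDiffWithinAt ?_
  refine ((contDiff_newtonRep b hN (measurable_indicator_of_continuousOn hΩ hw)
    (measurable_indicator_of_continuousOn hΩ (hh.sub (continuousOn_const.mul hw)))
    (abs_indicator_le hS0 hSw) (abs_indicator_le hS0 hSk)).contDiffAt).congr_of_eventuallyEq ?_
  filter_upwards [Metric.ball_mem_nhds x (by have := b.rOut_pos; positivity : 0 < 2 * b.rOut)] with y hy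
  exact H.eq_newtonRep hN hΩ hh hw hSw hSk b hb hy

theorem WSol.contDiffOn_two (hN : 2 ≤ N) (hΩ : IsOpen Ω) {μ : ℝ} {h w : Euc N → ℝ}
    (H : WSol Ω μ h w) (hh : ContDiffOn ℝ 1 h Ω) (hw : ContinuousOn w Ω) {S : ℝ}
    (hSw : ∀ x ∈ Ω, |w x| ≤ S) (hSk : ∀ x ∈ Ω, |h x - μ * w x| ≤ S) : ContDiffOn ℝ 2 w Ω := by
  have hw1 := H.contDiffOn_one hN hΩ hh.continuousOn hw hSw hSk
  have hk1 : ContDiffOn ℝ 1 (fun x => h x - μ * w x) Ω := hh.sub (contDiffOn_const.mul hw1)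
  intro x hx
  obtain ⟨b, hb⟩ := exists_cutoff_closedBall_subset hΩ hx
  have hbp := b.rOut_pos
  have hS0 : 0 ≤ S := (abs_nonneg _).trans (hSw x hx)
  set k := Ω.indicator fun x => h x - μ * w x with hk
  let η : ContDiffBump x := ⟨2 * b.rOut, 5 / 2 * b.rOut, by positivity, by linarith⟩
  have hηs : tsupport η ⊆ Ω := by
    rw [η.tsupport_eq]
    exact (Metric.closedBall_subset_closedBall (by change 5 / 2 * b.rOut ≤ _; linarith)).trans hb
  have hηk : ContDiff ℝ 1 (fun y => k y * η y) := by
    rw [contDiff_iff_contDiffAt]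
    intro y
    by_cases hy : y ∈ tsupport η
    · refine ContDiffAt.mul ?_ η.contDiff.contDiffAt
      refine (hk1.contDiffAt (hΩ.mem_nhds (hηs hy))).congr_of_eventuallyEq ?_
      filter_upwards [hΩ.mem_nhds (hηs hy)] with z hz
      rw [hk, indicator_of_mem hz]
    · refine (contDiffAt_const (c := (0 : ℝ))).congr_of_eventuallyEq ?_
      filter_upwards [(isClosed_tsupport η).isOpen_compl.mem_nhds hy] with z hz
      rw [image_eq_zero_of_notMem_tsupport hz, mul_zero]
  have hηc : HasCompactSupport fun y => k y * η y := η.hasCompactSupport.mul_left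
  have hrep : ∀ y ∈ Metric.ball x b.rOut, w y =
      (cv (fun y => k y * η y) (kerK b 0) y - cv (Ω.indicator w) (fun z => kerOm b 0 (-z)) y) /
        newtonConst N := by
    intro y hy
    rw [H.eq_newtonRep hN hΩ hh.continuousOn hw hSw hSk b hb
      (Metric.ball_subset_ball (by linarith) hy), newtonRep]
    congr 2
    refine integral_congr_ae (ae_of_all _ fun z => ?_)
    change k z * kerK b 0 (y - z) = k z * η z * kerK b 0 (y - z)
    by_cases hz : b.rOut < ‖y - z‖
    · rw [kerK_of_gt b 0 hz, mul_zero, mul_zero]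
    · have : z ∈ Metric.closedBall x (2 * b.rOut) := by
        rw [Metric.mem_ball] at hy
        rw [Metric.mem_closedBall]
        have h1 : dist z y ≤ b.rOut := by rw [dist_comm, dist_eq_norm]; exact not_lt.1 hz
        linarith [dist_triangle z y x]
      rw [η.one_of_mem_closedBall this, mul_one]
  refine ContDiffAt.contDiffWithinAt ?_
  refine ContDiffAt.congr_of_eventuallyEq ?_ (Filter.mem_of_superset (Metric.ball_mem_nhds x hbp) hrep)
  refine ContDiffAt.div_const (ContDiffAt.sub (contDiff_two_cv_kerK b hN hηk hηc).contDiffAt ?_) _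
  exact (contDiff_cv_kerOm b (n := 2) (measurable_indicator_of_continuousOn hΩ hw)
    (abs_indicator_le hS0 hSw)).contDiffAt

theorem integral_mul_pd (hΩ : IsOpen Ω) {v ψ : Euc N → ℝ} (hv : ContDiffOn ℝ 1 v Ω)
    (hψ : IsTest Ω ψ) (i : Fin N) : ∫ x, v x * pd i ψ x = - ∫ x, pd i v x * ψ x :=
  integral_mul_fderiv_eq_neg_fderiv_mul_of_integrable
    (integrable_mul_of_tsupport hΩ ((hv.continuousOn_fderiv_of_isOpen hΩ (by norm_num)).clm_apply
      continuousOn_const) hψ.cd.continuous hψ.cs hψ.sub)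
    (integrable_mul_of_tsupport hΩ hv.continuousOn (continuous_pd hψ.cd i)
      (hasCompactSupport_pd hψ.cs i) ((tsupport_pd_subset i ψ).trans hψ.sub))
    (integrable_mul_of_tsupport hΩ hv.continuousOn hψ.cd.continuous hψ.cs hψ.sub)
    (fun _ hx => (hv.contDiffAt (hΩ.mem_nhds (hψ.sub hx))).differentiableAt (by norm_num))
    (fun x _ => hψ.cd.differentiable (by norm_num) x)

theorem WSol.neg_lap_add (hΩ : IsOpen Ω) {μ : ℝ} {h w : Euc N → ℝ}
    (H : WSol Ω μ h w) (hh : ContinuousOn h Ω) (hw : ContDiffOn ℝ 2 w Ω) :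
    ∀ x ∈ Ω, -lap w x + μ * w x = h x := by
  have hc : ContinuousOn (fun x => -lap w x + μ * w x - h x) Ω :=
    ((continuousOn_lap hΩ hw).neg.add (continuousOn_const.mul hw.continuousOn)).sub hh
  have hae : ∀ᵐ x, x ∈ Ω → -lap w x + μ * w x - h x = 0 := by
    refine hΩ.ae_eq_zero_of_integral_contDiff_smul_eq_zero
      (hc.locallyIntegrableOn hΩ.measurableSet) fun φ hφ hφc hφs => ?_
    have hT : IsTest Ω φ := ⟨hφ.of_le (by norm_cast), hφc, hφs⟩
    have hTi : ∀ i, IsTest Ω (pd i φ) := fun i =>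
      ⟨(contDiff_pd_top hφ i).of_le (by norm_cast), hasCompactSupport_pd hφc i,
        (tsupport_pd_subset i φ).trans hφs⟩
    have h1 := H.very_weak hΩ (hφ.of_le (by norm_cast)) hφc hφs
    have h2 : ∫ x in Ω, w x * -lap φ x = ∫ x in Ω, -lap w x * φ x := by
      rw [← integral_pd_mul_pd hΩ hw hT, hT.setIntegral_eq, hT.setIntegral_eq]
      · simp_rw [lap_eq_sum_pd, ← Finset.sum_neg_distrib, Finset.mul_sum, mul_neg]
        rw [integral_finsetSum, integral_finsetSum]
        · refine Finset.sum_congr rfl fun i _ => ?_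
          rw [integral_neg, integral_mul_pd hΩ (hw.of_le (by norm_num)) (hTi i), neg_neg]
        · exact fun i _ => integrable_mul_of_tsupport hΩ (contDiffOn_pd hΩ hw i).continuousOn
            (hTi i).cd.continuous (hTi i).cs (hTi i).sub
        · exact fun i _ => (integrable_mul_of_tsupport hΩ hw.continuousOn
            (continuous_pd (hTi i).cd i) (hasCompactSupport_pd (hTi i).cs i)
            ((tsupport_pd_subset i _).trans (hTi i).sub)).neg
      · intro x hx
        refine Finset.sum_eq_zero fun i _ => ?_
        rw [image_eq_zero_of_notMem_tsupport fun h' => hx (tsupport_pd_subset i φ h'), mul_zero]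
      · intro x hx
        have : lap φ x = 0 := by
          refine Finset.sum_eq_zero fun i _ => ?_
          change pd i (pd i φ) x = 0
          exact image_eq_zero_of_notMem_tsupport fun h' =>
            hx (tsupport_pd_subset i φ (tsupport_pd_subset i _ h'))
        rw [this, neg_zero, mul_zero]
    have hI : ∀ F : Euc N → ℝ, ContinuousOn F Ω →
        Integrable (fun x => F x * φ x) (volume.restrict Ω) := fun F hF =>
      (integrable_mul_of_tsupport hΩ hF hφ.continuous hφc hφs).integrableOn
    have h3 : ∫ x, φ x • (-lap w x + μ * w x - h x) =
        ∫ x in Ω, (-lap w x * φ x + μ * (w x * φ x) - h x * φ x) := by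
      rw [hT.setIntegral_eq fun x hx => by
        rw [image_eq_zero_of_notMem_tsupport hx]; simp]
      refine integral_congr_ae (ae_of_all _ fun x => ?_)
      simp only [smul_eq_mul]
      ring
    rw [h3, integral_sub ((hI (fun x => -lap w x) (continuousOn_lap hΩ hw).neg).fun_add
      ((hI _ hw.continuousOn).const_mul μ)) (hI _ hh),
      integral_add (hI (fun x => -lap w x) (continuousOn_lap hΩ hw).neg) ((hI _ hw.continuousOn).const_mul μ),
      integral_const_mul, ← h1, h2, sub_self]
  have hE := Measure.eqOn_open_of_ae_eq (μ := volume) (g := fun _ => (0 : ℝ))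
    ((ae_restrict_iff' hΩ.measurableSet).2 hae) hΩ hc continuousOn_const
  intro x hx
  have := hE hx
  simp only at this
  linarith

end InteriorRegularity

section Domain

variable {N : ℕ} {Ω : Set (Euc N)}

/-- A bounded open set with positive first eigenvalue carrying a positive strictly superharmonic
function vanishing continuously on the boundary. -/
structure Dom (Ω : Set (Euc N)) : Prop where
  dim : 2 ≤ N
  isOpen : IsOpen Ω
  bdd : Bornology.IsBounded Ω
  eig : 0 < firstEig Ω
  barrier : ∃ (v : Euc N → ℝ) (c : ℝ), 0 < c ∧ ContDiffOn ℝ 2 v Ω ∧ Continuous v ∧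
    (∀ x ∈ Ω, 0 < v x) ∧ (∀ x, x ∉ Ω → v x = 0) ∧ ∀ x ∈ Ω, c * v x ≤ -lap v x

theorem le_on_of_ae_le (hΩ : IsOpen Ω) {v g : Euc N → ℝ} (hv : ContinuousOn v Ω)
    (hg : ContinuousOn g Ω) (h : ∀ᵐ x ∂volume.restrict Ω, v x ≤ g x) : ∀ x ∈ Ω, v x ≤ g x := by
  have ho : IsOpen (Ω ∩ (fun x => g x - v x) ⁻¹' Iio 0) :=
    (hg.sub hv).isOpen_inter_preimage hΩ isOpen_Iio
  have h0 : volume (Ω ∩ (fun x => g x - v x) ⁻¹' Iio 0) = 0 := by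
    rw [ae_restrict_iff' hΩ.measurableSet] at h
    refine measure_mono_null ?_ h
    rintro x ⟨hx, hx'⟩
    simp only [mem_preimage, mem_Iio] at hx'
    simp only [mem_compl_iff, mem_ofPred_eq, not_forall, not_le]
    exact ⟨hx, by linarith⟩
  intro x hx
  by_contra hlt
  have : x ∈ Ω ∩ (fun x => g x - v x) ⁻¹' Iio 0 := ⟨hx, by simp only [mem_preimage, mem_Iio]; linarith⟩
  rw [(ho.measure_eq_zero_iff volume).1 h0] at this
  exact this

/-- The boundary cut-off attached to a function `v`: it is `1` where `v ≤ δ` and `0` where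
`v ≥ 2δ`. -/
def collar (v : Euc N → ℝ) (δ : ℝ) (x : Euc N) : ℝ := min 1 (max 0 (2 - v x / δ))

theorem collar_nonneg (v : Euc N → ℝ) (δ : ℝ) (x : Euc N) : 0 ≤ collar v δ x :=
  le_min zero_le_one (le_max_left _ _)

theorem collar_le_one (v : Euc N → ℝ) (δ : ℝ) (x : Euc N) : collar v δ x ≤ 1 := min_le_left _ _

theorem continuous_collar {v : Euc N → ℝ} (hv : Continuous v) (δ : ℝ) :
    Continuous (collar v δ) := by
  unfold collar
  fun_prop

theorem one_sub_collar_le {v : Euc N → ℝ} {δ : ℝ} (hδ : 0 < δ) {x : Euc N} (hv : 0 ≤ v x) :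
    1 - collar v δ x ≤ v x / δ := by
  have : 0 ≤ v x / δ := by positivity
  unfold collar
  rcases le_total 1 (max 0 (2 - v x / δ)) with h | h
  · rw [min_eq_left h]; linarith
  · rw [min_eq_right h]
    have h1 := le_max_right 0 (2 - v x / δ)
    linarith

theorem tendsto_integral_collar (D : Dom Ω) {v : Euc N → ℝ} (hv : Continuous v)
    (hpos : ∀ x ∈ Ω, 0 < v x) {q : ℝ} (hq : 0 < q) :
    Tendsto (fun n : ℕ => ∫ x in Ω, collar v (1 / ((n : ℝ) + 1)) x ^ q) atTop (𝓝 0) := by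
  have h0 : (0 : ℝ) = ∫ x in Ω, (0 : ℝ) := by simp
  rw [h0]
  refine tendsto_integral_filter_of_dominated_convergence (fun _ => 1) ?_ ?_ ?_ ?_
  · exact Eventually.of_forall fun n => ((continuous_collar hv _).rpow_const
      (fun _ => Or.inr hq.le)).aestronglyMeasurable
  · refine Eventually.of_forall fun n => ae_of_all _ fun x => ?_
    rw [Real.norm_of_nonneg (Real.rpow_nonneg (collar_nonneg _ _ _) _)]
    exact Real.rpow_le_one (collar_nonneg _ _ _) (collar_le_one _ _ _) hq.le
  · exact integrableOn_const (D.bdd.measure_lt_top).ne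
  · refine (ae_restrict_iff' D.isOpen.measurableSet).2 (ae_of_all _ fun x hx => ?_)
    have hvx := hpos x hx
    obtain ⟨n0, hn0⟩ := exists_nat_gt (2 / v x)
    refine tendsto_const_nhds.congr' ?_
    filter_upwards [eventually_ge_atTop n0] with n hn
    have : (2 : ℝ) ≤ v x / (1 / ((n : ℝ) + 1)) := by
      rw [div_div_eq_mul_div, div_one]
      have hn' : (n0 : ℝ) ≤ n := by exact_mod_cast hn
      rw [div_lt_iff₀ hvx] at hn0
      nlinarith
    have hz : collar v (1 / ((n : ℝ) + 1)) x = 0 := by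
      unfold collar
      rw [max_eq_left (by linarith), min_eq_right zero_le_one]
    rw [hz, Real.zero_rpow hq.ne']

theorem Dom.exists_barrier_bound (D : Dom Ω) : ∃ v : Euc N → ℝ, Continuous v ∧
    (∀ x, x ∉ Ω → v x = 0) ∧ (∀ x ∈ Ω, 0 < v x) ∧ ∀ η > 0, ∃ C, 0 ≤ C ∧ ∀ (μ S : ℝ) (h w : Euc N → ℝ), 0 ≤ μ → 0 ≤ S →
      ContinuousOn h Ω → (∀ x ∈ Ω, |h x| ≤ S) → WSol Ω μ h w →
      ∀ᵐ x ∂volume.restrict Ω, |w x| ≤ S * (C * v x + η) := by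
  obtain ⟨v, c, hc, hv2, hvc, hvp, hv0, hvl⟩ := D.barrier
  refine ⟨v, hvc, hv0, hvp, fun η hη => ?_⟩
  have hNpos : (0 : ℝ) < N := by have := D.dim; positivity
  obtain ⟨C, hC, hCb⟩ := exists_sup_bound D.dim D.isOpen D.bdd D.eig (q := N) (by linarith)
  obtain ⟨δ, hδ, hδη⟩ : ∃ δ > 0, C * (∫ x in Ω, collar v δ x ^ (N : ℝ)) ^ (1 / (N : ℝ)) ≤ η := by
    have h1 := tendsto_integral_collar D hvc hvp hNpos
    have h2 := (h1.rpow_const (p := 1 / (N : ℝ)) (Or.inr (by positivity))).const_mul C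
    rw [Real.zero_rpow (by positivity), mul_zero] at h2
    obtain ⟨n, hn⟩ := (h2.eventually (eventually_le_nhds hη)).exists
    exact ⟨1 / ((n : ℝ) + 1), by positivity, hn⟩
  have key : ∀ (μ S : ℝ) (h w : Euc N → ℝ), 0 ≤ μ → 0 ≤ S →
      ContinuousOn h Ω → (∀ x ∈ Ω, |h x| ≤ S) → WSol Ω μ h w →
      ∀ᵐ x ∂volume.restrict Ω, w x ≤ S * (1 / (δ * c) * v x + η) := by
    intro μ S h w hμ hS hh hhS H
    rcases hS.eq_or_lt with rfl | hS
    · have hz : ∀ x ∈ Ω, h x ≤ 0 := fun x hx => (le_abs_self _).trans (hhS x hx)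
      filter_upwards [H.ae_nonpos D.isOpen D.bdd D.eig hμ hz] with x hx
      simpa using hx
    have hθ := continuous_collar hvc δ
    have hh2 : ContinuousOn (fun x => h x * collar v δ x) Ω := hh.mul hθ.continuousOn
    have hb2 : ∀ x ∈ Ω, |h x * collar v δ x| ≤ S := fun x hx => by
      rw [abs_mul, abs_of_nonneg (collar_nonneg v δ x)]
      exact (mul_le_mul (hhS x hx) (collar_le_one v δ x) (collar_nonneg _ _ _) hS.le).trans
        (by simp)
    obtain ⟨w2, H2⟩ := exists_wsol D.isOpen D.bdd D.eig hμ
      (memLp_of_continuousOn_bdd D.isOpen D.bdd hh2 hb2 2)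
    have e2 := hCb μ hμ _ _ H2 hh2 ⟨S, hb2⟩
    have H1 := H.add H2 (c := -1)
    have e1 := H1.ae_le_of_supersolutions D.isOpen D.bdd D.eig hμ
      (V := fun x => S / (δ * c) * v x) (fun η' hη' => ⟨fun x => S / (δ * c) * v x, fun _ => 0,
        contDiffOn_const.mul hv2, fun x hx => by have := hvp x hx; positivity, fun x _ => le_rfl,
        MemLp.zero', fun x hx => ?_, by simpa using hη'.le⟩)
      (continuous_const.mul hvc).aestronglyMeasurable
    · have hI : ∫ x in Ω, |h x * collar v δ x| ^ (N : ℝ) ≤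
          S ^ (N : ℝ) * ∫ x in Ω, collar v δ x ^ (N : ℝ) := by
        rw [← integral_const_mul]
        have hint : Integrable (fun x => S ^ (N : ℝ) * collar v δ x ^ (N : ℝ))
            (volume.restrict Ω) := by
          refine Integrable.const_mul ?_ _
          refine Measure.integrableOn_of_bounded (M := 1) (D.bdd.measure_lt_top).ne
            (hθ.rpow_const fun _ => Or.inr hNpos.le).aestronglyMeasurable
            (ae_of_all _ fun x => ?_)
          rw [Real.norm_of_nonneg (Real.rpow_nonneg (collar_nonneg _ _ _) _)]
          exact Real.rpow_le_one (collar_nonneg _ _ _) (collar_le_one _ _ _) hNpos.le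
        refine integral_mono_of_nonneg (ae_of_all _ fun x => by positivity) hint
          ((ae_restrict_iff' D.isOpen.measurableSet).2 (ae_of_all _ fun x hx => ?_))
        simp only
        rw [← Real.mul_rpow hS.le (collar_nonneg _ _ _)]
        refine Real.rpow_le_rpow (abs_nonneg _) ?_ hNpos.le
        rw [abs_mul, abs_of_nonneg (collar_nonneg v δ x)]
        exact mul_le_mul_of_nonneg_right (hhS x hx) (collar_nonneg _ _ _)
      have hI0 : 0 ≤ ∫ x in Ω, collar v δ x ^ (N : ℝ) :=
        integral_nonneg fun x => Real.rpow_nonneg (collar_nonneg _ _ _) _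
      have hI2 : C * (∫ x in Ω, |h x * collar v δ x| ^ (N : ℝ)) ^ (1 / (N : ℝ)) ≤ S * η := by
        calc _ ≤ C * (S ^ (N : ℝ) * ∫ x in Ω, collar v δ x ^ (N : ℝ)) ^ (1 / (N : ℝ)) := by
              gcongr
          _ = S * (C * (∫ x in Ω, collar v δ x ^ (N : ℝ)) ^ (1 / (N : ℝ))) := by
              rw [Real.mul_rpow (by positivity) hI0, ← Real.rpow_mul hS.le,
                mul_one_div_cancel hNpos.ne', Real.rpow_one]
              ring
          _ ≤ S * η := by gcongr
      filter_upwards [e1, e2] with x h1 h2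
      have h3 := (le_abs_self (w2 x)).trans (h2.trans hI2)
      have : S / (δ * c) * v x + S * η = S * (1 / (δ * c) * v x + η) := by ring
      linarith
    · have hcv : ContDiffAt ℝ 2 v x := hv2.contDiffAt (D.isOpen.mem_nhds hx)
      have hl : lap (fun y => S / (δ * c) * v y) x = S / (δ * c) * lap v x := by
        rw [lap_eq_sum_pd, lap_eq_sum_pd, Finset.mul_sum]
        refine Finset.sum_congr rfl fun i _ => ?_
        have h1 : pd i (fun y => S / (δ * c) * v y) =ᶠ[𝓝 x] fun y => S / (δ * c) * pd i v y := by
          filter_upwards [D.isOpen.mem_nhds hx] with y hy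
          unfold pd
          rw [fderiv_const_mul ((hv2.contDiffAt (D.isOpen.mem_nhds hy)).differentiableAt
            (by norm_num))]
          rfl
        have h2 := h1.fderiv_eq (𝕜 := ℝ)
        have h3 : DifferentiableAt ℝ (pd i v) x :=
          ((contDiffOn_pd D.isOpen hv2 i).contDiffAt (D.isOpen.mem_nhds hx)).differentiableAt
            (by norm_num)
        change fderiv ℝ (pd i _) x _ = _ * fderiv ℝ (pd i v) x _
        rw [h2, fderiv_const_mul h3]
        rfl
      have h1 := one_sub_collar_le hδ (hvp x hx).le
      have h2 : h x - h x * collar v δ x ≤ S * (v x / δ) := by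
        have := collar_le_one v δ x
        have h3 := (le_abs_self _).trans (hhS x hx)
        nlinarith
      have h4 : S * (v x / δ) ≤ S / (δ * c) * -lap v x := by
        calc S * (v x / δ) = S / (δ * c) * (c * v x) := by field_simp
          _ ≤ _ := by
            have := hvl x hx
            gcongr
      have h5 : 0 ≤ μ * (S / (δ * c) * v x) := by
        have := hvp x hx
        positivity
      rw [hl]
      linarith
  refine ⟨1 / (δ * c), by positivity, fun μ S h w hμ hS hh hhS H => ?_⟩
  filter_upwards [key μ S h w hμ hS hh hhS H, key μ S _ _ hμ hS hh.neg
    (fun x hx => by simpa using hhS x hx) H.neg] with x h1 h2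
  exact abs_le.2 ⟨by linarith, h1⟩

end Domain

section ContinuousSolutions

variable {N : ℕ} {Ω : Set (Euc N)}

/-- `w` is the continuous representative, extended by zero, of the weak solution of
`-Δ w + μ w = h` with bounded continuous right-hand side. -/
structure Sol (Ω : Set (Euc N)) (μ : ℝ) (h w : Euc N → ℝ) : Prop where
  weak : WSol Ω μ h w
  cont : Continuous w
  off : ∀ x, x ∉ Ω → w x = 0
  rhs : ContinuousOn h Ω
  bdd : ∃ S, ∀ x ∈ Ω, |h x| ≤ S

theorem Dom.exists_barrier (D : Dom Ω) : ∃ v : Euc N → ℝ, Continuous v ∧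
    (∀ x, x ∉ Ω → v x = 0) ∧ (∀ x ∈ Ω, 0 < v x) ∧ ∀ η > 0, ∃ C, 0 ≤ C ∧
      ∀ (μ S : ℝ) (h w : Euc N → ℝ), 0 ≤ μ → 0 ≤ S → (∀ x ∈ Ω, |h x| ≤ S) → Sol Ω μ h w →
      ∀ x, |w x| ≤ S * (C * v x + η) := by
  obtain ⟨v, hvc, hv0, hvp, hv⟩ := D.exists_barrier_bound
  refine ⟨v, hvc, hv0, hvp, fun η hη => ?_⟩
  obtain ⟨C, hC, hCb⟩ := hv η hη
  refine ⟨C, hC, fun μ S h w hμ hS hhS H x => ?_⟩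
  by_cases hx : x ∈ Ω
  · exact le_on_of_ae_le D.isOpen H.cont.abs.continuousOn
      (continuous_const.mul ((continuous_const.mul hvc).add continuous_const)).continuousOn
      (hCb μ S h w hμ hS H.rhs hhS H.weak) x hx
  · rw [H.off x hx, hv0 x hx]
    simp only [abs_zero, mul_zero, zero_add]
    positivity

theorem Dom.exists_bound_of_continuous (D : Dom Ω) {v : Euc N → ℝ} (hv : Continuous v)
    (h0 : ∀ x, x ∉ Ω → v x = 0) : ∃ B, 0 < B ∧ ∀ x, |v x| ≤ B := by
  obtain ⟨B, hB⟩ := D.bdd.isCompact_closure.exists_bound_of_continuousOn hv.continuousOn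
  refine ⟨max B 1, by positivity, fun x => ?_⟩
  by_cases hx : x ∈ Ω
  · exact (hB x (subset_closure hx)).trans (le_max_left _ _)
  · rw [h0 x hx, abs_zero]; positivity

theorem Sol.exists_bound (D : Dom Ω) {μ : ℝ} {h w : Euc N → ℝ} (H : Sol Ω μ h w) :
    ∃ B, 0 < B ∧ ∀ x, |w x| ≤ B := D.exists_bound_of_continuous H.cont H.off

theorem Dom.exists_linear_bound (D : Dom Ω) : ∃ C, 0 < C ∧
      ∀ (μ S : ℝ) (h w : Euc N → ℝ), 0 ≤ μ → 0 ≤ S → (∀ x ∈ Ω, |h x| ≤ S) → Sol Ω μ h w →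
      ∀ x, |w x| ≤ C * S := by
  obtain ⟨v, hvc, hv0, -, hv⟩ := D.exists_barrier
  obtain ⟨C, hC, hCb⟩ := hv 1 one_pos
  obtain ⟨B, hB, hvB⟩ := D.exists_bound_of_continuous hvc hv0
  refine ⟨C * B + 1, by positivity, fun μ S h w hμ hS hhS H x =>
    (hCb μ S h w hμ hS hhS H x).trans ?_⟩
  rw [mul_comm]
  have := (le_abs_self _).trans (hvB x)
  gcongr

theorem Dom.exists_lq_bound (D : Dom Ω) {q : ℝ} (hq : (N : ℝ) / 2 < q) : ∃ C, 0 < C ∧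
      ∀ (μ : ℝ) (h w : Euc N → ℝ), 0 ≤ μ → Sol Ω μ h w →
      ∀ x, |w x| ≤ C * (∫ x in Ω, |h x| ^ q) ^ (1 / q) := by
  obtain ⟨C, hC, hCb⟩ := exists_sup_bound D.dim D.isOpen D.bdd D.eig hq
  refine ⟨C, hC, fun μ h w hμ H x => ?_⟩
  by_cases hx : x ∈ Ω
  · exact le_on_of_ae_le D.isOpen H.cont.abs.continuousOn continuousOn_const
      (hCb μ hμ h w H.weak H.rhs H.bdd) x hx
  · rw [H.off x hx, abs_zero]
    have : 0 ≤ ∫ x in Ω, |h x| ^ q := integral_nonneg fun x => by positivity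
    positivity

theorem Dom.exists_sol (D : Dom Ω) {μ : ℝ} (hμ : 0 ≤ μ) {h : Euc N → ℝ} (hh : ContinuousOn h Ω)
    {S : ℝ} (hS : ∀ x ∈ Ω, |h x| ≤ S) : ∃ w, Sol Ω μ h w := by
  have hS' : ∀ x ∈ Ω, |h x| ≤ max S 0 := fun x hx => (hS x hx).trans (le_max_left _ _)
  have hS0 : 0 ≤ max S 0 := le_max_right _ _
  generalize max S 0 = S' at hS' hS0
  obtain ⟨w, H⟩ := exists_wsol D.isOpen D.bdd D.eig hμ
    (memLp_of_continuousOn_bdd D.isOpen D.bdd hh hS 2)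
  obtain ⟨v, hvc, hv0, -, hv⟩ := D.exists_barrier_bound
  obtain ⟨B, hB, hvB⟩ := D.exists_bound_of_continuous hvc hv0
  obtain ⟨C, hC, hCb⟩ := hv 1 one_pos
  have hwB : ∀ᵐ x ∂volume.restrict Ω, |w x| ≤ S' * (C * B + 1) := by
    filter_upwards [hCb μ S' h w hμ hS0 hh hS' H] with x hx
    refine hx.trans ?_
    have := (le_abs_self _).trans (hvB x)
    gcongr
  obtain ⟨z, hzc, -, hzw⟩ := H.exists_continuousOn D.dim D.isOpen hh hS (by positivity) hwB
  have Hz := H.congr hzw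
  have hae : Ω.indicator z =ᵐ[volume.restrict Ω] w :=
    (indicator_ae_eq_restrict D.isOpen.measurableSet).trans hzw
  refine ⟨Ω.indicator z, H.congr hae, ?_, fun x hx => indicator_of_notMem hx _, hh, S, hS⟩
  rw [continuous_iff_continuousAt]
  intro x
  by_cases hx : x ∈ Ω
  · refine (hzc.continuousAt (D.isOpen.mem_nhds hx)).congr ?_
    filter_upwards [D.isOpen.mem_nhds hx] with y hy
    rw [indicator_of_mem hy]
  · rw [Metric.continuousAt_iff']
    intro ε hε
    obtain ⟨C, hC, hCb⟩ := hv (ε / (2 * (S' + 1))) (by positivity)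
    have hle : ∀ y ∈ Ω, |z y| ≤ S' * (C * v y + ε / (2 * (S' + 1))) :=
      le_on_of_ae_le D.isOpen hzc.abs
        (continuous_const.mul ((continuous_const.mul hvc).add continuous_const)).continuousOn
        (hCb μ S' h z hμ hS0 hh hS' Hz)
    have hlim : Tendsto (fun y => S' * (C * v y + ε / (2 * (S' + 1)))) (𝓝 x)
        (𝓝 (S' * (C * 0 + ε / (2 * (S' + 1))))) := by
      rw [← hv0 x hx]
      exact (continuous_const.mul ((continuous_const.mul hvc).add continuous_const)).tendsto x
    have hlt : S' * (C * 0 + ε / (2 * (S' + 1))) < ε := by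
      rw [mul_zero, zero_add, ← mul_div_assoc, div_lt_iff₀ (by positivity)]
      nlinarith
    filter_upwards [hlim.eventually (eventually_lt_nhds hlt)] with y hy
    rw [indicator_of_notMem hx, dist_zero_right, Real.norm_eq_abs]
    by_cases hyΩ : y ∈ Ω
    · rw [indicator_of_mem hyΩ]
      exact (hle y hyΩ).trans_lt hy
    · rw [indicator_of_notMem hyΩ, abs_zero]
      exact hε

theorem Dom.eventually_abs_sub_le (D : Dom Ω) {μ S : ℝ} (hμ : 0 ≤ μ) (hS : 0 ≤ S) (x : Euc N)
    {ε : ℝ} (hε : 0 < ε) : ∀ᶠ y in 𝓝 x, ∀ h w, (∀ x ∈ Ω, |h x| ≤ S) → Sol Ω μ h w →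
      |w y - w x| < ε := by
  by_cases hx : x ∈ Ω
  · obtain ⟨r, hr, Λ, hΛ, hrΩ, hL⟩ := exists_lipschitz_bound D.dim D.isOpen hx
    obtain ⟨C, hC, hCb⟩ := D.exists_linear_bound
    set S' := S + (1 + μ) * (C * S) with hS'
    have hS'0 : 0 ≤ S' := by positivity
    have hlim : Tendsto (fun y => S' * Λ * ‖y - x‖) (𝓝 x) (𝓝 (S' * Λ * ‖x - x‖)) :=
      (continuous_const.mul (continuous_id.sub continuous_const).norm).tendsto x
    rw [sub_self, norm_zero, mul_zero] at hlim
    filter_upwards [hlim.eventually (eventually_lt_nhds hε), Metric.ball_mem_nhds x hr]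
      with y hy hyr h w hh H
    refine (hL μ S' h w H.weak H.rhs H.cont.continuousOn (fun z hz => ?_) (fun z hz => ?_) y hyr x
      (Metric.mem_ball_self hr)).trans_lt hy
    · have := hCb μ S h w hμ hS hh H z
      have h2 : 0 ≤ μ * (C * S) := by positivity
      rw [hS']
      linarith
    · have h1 := hCb μ S h w hμ hS hh H z
      have h2 := abs_sub (h z) (μ * w z)
      rw [abs_mul, abs_of_nonneg hμ] at h2
      have h3 := mul_le_mul_of_nonneg_left h1 hμ
      have h4 := hh z hz
      have h5 : 0 ≤ C * S := by positivity
      rw [hS']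
      linarith
  · obtain ⟨v, hvc, hv0, -, hv⟩ := D.exists_barrier
    obtain ⟨C, hC, hCb⟩ := hv (ε / (2 * (S + 1))) (by positivity)
    have hlim : Tendsto (fun y => S * (C * v y + ε / (2 * (S + 1)))) (𝓝 x)
        (𝓝 (S * (C * 0 + ε / (2 * (S + 1))))) := by
      rw [← hv0 x hx]
      exact (continuous_const.mul ((continuous_const.mul hvc).add continuous_const)).tendsto x
    have hlt : S * (C * 0 + ε / (2 * (S + 1))) < ε := by
      rw [mul_zero, zero_add, ← mul_div_assoc, div_lt_iff₀ (by positivity)]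
      nlinarith
    filter_upwards [hlim.eventually (eventually_lt_nhds hlt)] with y hy h w hh H
    rw [H.off x hx, sub_zero]
    exact (hCb μ S h w hμ hS hh H y).trans_lt hy

theorem Dom.exists_subseq (D : Dom Ω) {μ S : ℝ} (hμ : 0 ≤ μ) (h w : ℕ → Euc N → ℝ)
    (hS : ∀ n, ∀ x ∈ Ω, |h n x| ≤ S) (H : ∀ n, Sol Ω μ (h n) (w n)) :
    ∃ (W : Euc N → ℝ) (φ : ℕ → ℕ), StrictMono φ ∧ Continuous W ∧ (∀ x, x ∉ Ω → W x = 0) ∧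
      TendstoUniformly (fun n => w (φ n)) W atTop := by
  have hS' : ∀ n, ∀ x ∈ Ω, |h n x| ≤ max S 0 := fun n x hx => (hS n x hx).trans (le_max_left _ _)
  have hS0 : 0 ≤ max S 0 := le_max_right _ _
  generalize max S 0 = S' at hS' hS0
  have hK : IsCompact (closure Ω) := D.bdd.isCompact_closure
  have : CompactSpace (closure Ω) := isCompact_iff_compactSpace.1 hK
  obtain ⟨C, hC, hCb⟩ := D.exists_linear_bound
  let F : ℕ → BoundedContinuousFunction (closure Ω) ℝ := fun n =>
    BoundedContinuousFunction.mkOfCompact ⟨fun x => w n x, (H n).cont.comp continuous_subtype_val⟩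
  have hcomp := BoundedContinuousFunction.arzela_ascoli (Metric.closedBall (0 : ℝ) (C * S'))
    (isCompact_closedBall _ _) (range F)
    (by
      rintro _ x ⟨n, rfl⟩
      rw [mem_closedBall_zero_iff]
      exact hCb μ S' _ _ hμ hS0 (hS' n) (H n) x)
    (by
      intro x
      rw [Metric.equicontinuousAt_iff_right]
      intro ε hε
      have := D.eventually_abs_sub_le hμ hS0 (x : Euc N) hε
      filter_upwards [continuous_subtype_val.continuousAt.eventually this] with y hy
      rintro ⟨_, n, rfl⟩
      rw [dist_comm]
      exact hy _ _ (hS' n) (H n))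
  obtain ⟨G, -, φ, hφ, hlim⟩ := hcomp.tendsto_subseq
    (fun n => subset_closure (mem_range_self n) : ∀ n, F n ∈ closure (range F))
  rw [BoundedContinuousFunction.tendsto_iff_tendstoUniformly] at hlim
  classical
  let W : Euc N → ℝ := fun x => if hx : x ∈ closure Ω then G ⟨x, hx⟩ else 0
  have hU : TendstoUniformly (fun n => w (φ n)) W atTop := by
    rw [Metric.tendstoUniformly_iff] at hlim ⊢
    intro ε hε
    filter_upwards [hlim ε hε] with n hn x
    by_cases hx : x ∈ closure Ω
    · rw [show W x = G ⟨x, hx⟩ from dif_pos hx]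
      exact hn ⟨x, hx⟩
    · simp only [W, dif_neg hx, (H (φ n)).off x fun h => hx (subset_closure h), dist_self, hε]
  refine ⟨W, φ, hφ, hU.continuous (Frequently.of_forall fun n => (H (φ n)).cont), fun x hx => ?_, hU⟩
  have h1 := hU.tendsto_at x
  have h2 : (fun n => w (φ n) x) = fun _ => 0 := funext fun n => (H (φ n)).off x hx
  rw [h2] at h1
  exact tendsto_nhds_unique h1 tendsto_const_nhds

end ContinuousSolutions

section EnergyIdentities

variable {N : ℕ} {Ω : Set (Euc N)}

theorem Sol.add {μ : ℝ} {h₁ h₂ w₁ w₂ : Euc N → ℝ} (H₁ : Sol Ω μ h₁ w₁) (H₂ : Sol Ω μ h₂ w₂)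
    (c : ℝ) : Sol Ω μ (fun x => h₁ x + c * h₂ x) (fun x => w₁ x + c * w₂ x) where
  weak := H₁.weak.add H₂.weak
  cont := H₁.cont.add (continuous_const.mul H₂.cont)
  off x hx := by rw [H₁.off x hx, H₂.off x hx]; simp
  rhs := H₁.rhs.add (continuousOn_const.mul H₂.rhs)
  bdd := by
    obtain ⟨S₁, h1⟩ := H₁.bdd
    obtain ⟨S₂, h2⟩ := H₂.bdd
    refine ⟨S₁ + |c| * S₂, fun x hx => (abs_add_le _ _).trans (add_le_add (h1 x hx) ?_)⟩
    rw [abs_mul]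
    exact mul_le_mul_of_nonneg_left (h2 x hx) (abs_nonneg c)

theorem Sol.congr_rhs {μ : ℝ} {h h' w : Euc N → ℝ} (H : Sol Ω μ h w) (hΩ : IsOpen Ω)
    (hh : EqOn h' h Ω) : Sol Ω μ h' w where
  weak := by
    have hae : h' =ᵐ[volume.restrict Ω] h :=
      (ae_restrict_iff' hΩ.measurableSet).2 (ae_of_all _ hh)
    obtain ⟨φ, ε, h1, h2, h3, h4⟩ := H.weak.approx
    refine ⟨H.weak.rhs.ae_eq hae.symm, H.weak.mem, φ, ε, h1, h2, fun n ψ hψ => ?_, h4⟩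
    rw [setIntegral_congr_fun hΩ.measurableSet (g := fun x => h x * ψ x)
      (fun x hx => by simp only [hh hx])]
    exact h3 n ψ hψ
  cont := H.cont
  off := H.off
  rhs := H.rhs.congr hh
  bdd := by
    obtain ⟨S, hS⟩ := H.bdd
    exact ⟨S, fun x hx => by rw [hh hx]; exact hS x hx⟩

theorem Sol.const_mul {μ : ℝ} {h w : Euc N → ℝ} (H : Sol Ω μ h w) (hΩ : IsOpen Ω) (c : ℝ) :
    Sol Ω μ (fun x => c * h x) (fun x => c * w x) := by
  have := H.add H (c - 1)
  convert! this.congr_rhs hΩ (h' := fun x => c * h x) (fun x _ => by simp only; ring) using 1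
  funext x
  ring

theorem Dom.sol_of_tendsto (D : Dom Ω) {μ : ℝ} (hμ : 0 ≤ μ) {h W : Euc N → ℝ}
    {hn wn : ℕ → Euc N → ℝ} (H : ∀ n, Sol Ω μ (hn n) (wn n))
    (hh : TendstoUniformlyOn hn h atTop Ω) (hW : ∀ x, Tendsto (fun n => wn n x) atTop (𝓝 (W x))) :
    Sol Ω μ h W := by
  have hc : ContinuousOn h Ω := hh.continuousOn (Frequently.of_forall fun n => (H n).rhs)
  rw [Metric.tendstoUniformlyOn_iff] at hh
  obtain ⟨S, hS⟩ : ∃ S, ∀ x ∈ Ω, |h x| ≤ S := by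
    obtain ⟨n, hn⟩ := (hh 1 one_pos).exists
    obtain ⟨S, hS⟩ := (H n).bdd
    refine ⟨1 + S, fun x hx => ?_⟩
    have h1 := (hn x hx).le
    rw [Real.dist_eq] at h1
    have h2 := hS x hx
    rw [abs_le] at *
    constructor <;> linarith
  obtain ⟨w, Hw⟩ := D.exists_sol hμ hc hS
  obtain ⟨C, hC, hCb⟩ := D.exists_linear_bound
  have heq : W = w := by
    funext x
    refine tendsto_nhds_unique (hW x) ?_
    rw [Metric.tendsto_atTop']
    intro ε hε
    obtain ⟨n0, hn0⟩ := eventually_atTop.1 (hh (ε / (2 * C)) (by positivity))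
    refine ⟨n0, fun n hn => ?_⟩
    have := hCb μ (ε / (2 * C)) _ _ hμ (by positivity) (fun x hx => ?_) ((H n).add Hw (-1)) x
    · rw [Real.dist_eq, show wn n x - w x = wn n x + -1 * w x by ring]
      refine this.trans_lt ?_
      field_simp
      linarith
    · have h1 := (hn0 n hn.le x hx).le
      rw [dist_comm, Real.dist_eq] at h1
      simpa only [neg_one_mul, ← sub_eq_add_neg] using h1
  rwa [heq]

theorem tendsto_integral_mul_of_l2 {α : Type*} [MeasurableSpace α] {ν : Measure α} {g w : α → ℝ}
    {φ : ℕ → α → ℝ} (hg : MemLp g 2 ν) (hw : MemLp w 2 ν) (hφ : ∀ n, MemLp (φ n) 2 ν)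
    (h : Tendsto (fun n => ∫ x, (φ n x - w x) * (φ n x - w x) ∂ν) atTop (𝓝 0)) :
    Tendsto (fun n => ∫ x, g x * φ n x ∂ν) atTop (𝓝 (∫ x, g x * w x ∂ν)) := by
  rw [tendsto_iff_norm_sub_tendsto_zero]
  have h1 : Tendsto (fun n => √(∫ x, g x * g x ∂ν) * √(∫ x, (φ n x - w x) * (φ n x - w x) ∂ν))
      atTop (𝓝 0) := by
    simpa using (h.sqrt.const_mul (√(∫ x, g x * g x ∂ν)))
  refine squeeze_zero (fun _ => norm_nonneg _) (fun n => ?_) h1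
  rw [← integral_sub (memLp_integrable_mul hg (hφ n)) (memLp_integrable_mul hg hw),
    Real.norm_eq_abs]
  simp_rw [← mul_sub]
  exact integral_mul_le_sqrt hg ((hφ n).sub hw)

theorem tendsto_integral_sq_of_l2 {α : Type*} [MeasurableSpace α] {ν : Measure α} {w : α → ℝ}
    {φ : ℕ → α → ℝ} (hw : MemLp w 2 ν) (hφ : ∀ n, MemLp (φ n) 2 ν)
    (h : Tendsto (fun n => ∫ x, (φ n x - w x) * (φ n x - w x) ∂ν) atTop (𝓝 0)) :
    Tendsto (fun n => ∫ x, φ n x * φ n x ∂ν) atTop (𝓝 (∫ x, w x * w x ∂ν)) := by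
  have h1 := (h.add ((tendsto_integral_mul_of_l2 hw hw hφ h).const_mul 2)).sub_const
    (∫ x, w x * w x ∂ν)
  have e : 0 + 2 * ∫ x, w x * w x ∂ν = (∫ x, w x * w x ∂ν) + ∫ x, w x * w x ∂ν := by ring
  rw [e, add_sub_cancel_right] at h1
  refine h1.congr fun n => ?_
  have i1 : Integrable (fun x => (φ n x - w x) * (φ n x - w x)) ν :=
    memLp_integrable_mul ((hφ n).sub hw) ((hφ n).sub hw)
  rw [← integral_const_mul, ← integral_add i1
    ((memLp_integrable_mul hw (hφ n)).const_mul 2), ← integral_sub _ (memLp_integrable_mul hw hw)]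
  · refine integral_congr_ae (ae_of_all _ fun x => ?_)
    simp only
    ring
  · exact i1.fun_add ((memLp_integrable_mul hw (hφ n)).const_mul 2)

theorem Dom.exists_nrm_bound (D : Dom Ω) {μ : ℝ} (hμ : 0 ≤ μ) {h : Euc N → ℝ}
    (hh : MemLp h 2 (volume.restrict Ω)) {φ : ℕ → Euc N → ℝ} {ε : ℕ → ℝ}
    (hφ : ∀ n, IsTest Ω (φ n)) (hε : Tendsto ε atTop (𝓝 0))
    (H : ∀ n ψ, IsTest Ω ψ → |form Ω μ (φ n) ψ - ∫ x in Ω, h x * ψ x| ≤ ε n * nrm Ω μ ψ) :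
    ∃ R, ∀ n, nrm Ω μ (φ n) ≤ R := by
  obtain ⟨E, hE⟩ := hε.bddAbove_range
  refine ⟨√(∫ x in Ω, h x * h x) * √(firstEig Ω)⁻¹ + E, fun n => ?_⟩
  rcases (nrm_nonneg (Ω := Ω) μ (φ n)).eq_or_lt with h0 | h0
  · rw [← h0]
    have := (abs_nonneg _).trans (H n (φ n) (hφ n))
    by_contra hlt
    have h1 : E < 0 := by
      have : 0 ≤ √(∫ x in Ω, h x * h x) * √(firstEig Ω)⁻¹ := by positivity
      linarith
    have h2 : (0 : ℝ) ≤ E := le_of_tendsto' hε fun n => hE (mem_range_self n)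
    linarith
  · have h1 := H n (φ n) (hφ n)
    rw [← nrm_sq hμ] at h1
    have h2 := integral_mul_le_sqrt hh (hφ n).memLp
    have h3 := sqrt_integral_le_nrm D.isOpen D.bdd D.eig hμ (hφ n)
    have h4 : ε n ≤ E := hE (mem_range_self n)
    have h5 := mul_le_mul_of_nonneg_left h3 (Real.sqrt_nonneg (∫ x in Ω, h x * h x))
    have h6 : nrm Ω μ (φ n) * nrm Ω μ (φ n) ≤
        (√(∫ x in Ω, h x * h x) * √(firstEig Ω)⁻¹ + E) * nrm Ω μ (φ n) := by
      have := le_abs_self (nrm Ω μ (φ n) ^ 2 - ∫ x in Ω, h x * φ n x)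
      have := le_abs_self (∫ x in Ω, h x * φ n x)
      have := mul_le_mul_of_nonneg_right h4 h0.le
      nlinarith
    exact le_of_mul_le_mul_right h6 h0

theorem Dom.tendsto_form (D : Dom Ω) {μ : ℝ} (hμ : 0 ≤ μ) {h₁ h₂ w₂ : Euc N → ℝ}
    {φ₁ φ₂ : ℕ → Euc N → ℝ} {ε₁ ε₂ : ℕ → ℝ}
    (hh₁ : MemLp h₁ 2 (volume.restrict Ω)) (hh₂ : MemLp h₂ 2 (volume.restrict Ω))
    (hw₂ : MemLp w₂ 2 (volume.restrict Ω))
    (hε₁ : Tendsto ε₁ atTop (𝓝 0))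
    (H₁ : ∀ n ψ, IsTest Ω ψ → |form Ω μ (φ₁ n) ψ - ∫ x in Ω, h₁ x * ψ x| ≤ ε₁ n * nrm Ω μ ψ)
    (hφ₂ : ∀ n, IsTest Ω (φ₂ n)) (hε₂ : Tendsto ε₂ atTop (𝓝 0))
    (H₂ : ∀ n ψ, IsTest Ω ψ → |form Ω μ (φ₂ n) ψ - ∫ x in Ω, h₂ x * ψ x| ≤ ε₂ n * nrm Ω μ ψ)
    (L₂ : Tendsto (fun n => ∫ x in Ω, (φ₂ n x - w₂ x) * (φ₂ n x - w₂ x)) atTop (𝓝 0)) :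
    Tendsto (fun n => form Ω μ (φ₁ n) (φ₂ n)) atTop (𝓝 (∫ x in Ω, h₁ x * w₂ x)) := by
  obtain ⟨R, hR⟩ := D.exists_nrm_bound hμ hh₂ hφ₂ hε₂ H₂
  have h1 : Tendsto (fun n => form Ω μ (φ₁ n) (φ₂ n) - ∫ x in Ω, h₁ x * φ₂ n x) atTop (𝓝 0) := by
    have : Tendsto (fun n => |ε₁ n| * R) atTop (𝓝 0) := by
      simpa using hε₁.abs.mul_const R
    refine squeeze_zero_norm (fun n => (H₁ n _ (hφ₂ n)).trans ?_) this
    exact (mul_le_mul_of_nonneg_right (le_abs_self _) (nrm_nonneg _ _)).trans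
      (mul_le_mul_of_nonneg_left (hR n) (abs_nonneg _))
  have h2 := h1.add (tendsto_integral_mul_of_l2 hh₁ hw₂ (fun n => (hφ₂ n).memLp) L₂)
  rw [zero_add] at h2
  exact h2.congr fun n => by ring

theorem Sol.symm (D : Dom Ω) {μ : ℝ} (hμ : 0 ≤ μ) {h₁ h₂ w₁ w₂ : Euc N → ℝ}
    (H₁ : Sol Ω μ h₁ w₁) (H₂ : Sol Ω μ h₂ w₂) :
    ∫ x in Ω, h₁ x * w₂ x = ∫ x in Ω, h₂ x * w₁ x := by
  obtain ⟨φ₁, ε₁, a1, a2, a3, a4⟩ := H₁.weak.approx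
  obtain ⟨φ₂, ε₂, b1, b2, b3, b4⟩ := H₂.weak.approx
  refine tendsto_nhds_unique
    (D.tendsto_form hμ H₁.weak.rhs H₂.weak.rhs H₂.weak.mem a2 a3 b1 b2 b3 b4) ?_
  refine (D.tendsto_form hμ H₂.weak.rhs H₁.weak.rhs H₁.weak.mem b2 b3 a1 a2 a3 a4).congr fun n => ?_
  exact form_comm _ _ _

theorem Sol.exists_energy_approx (D : Dom Ω) {μ : ℝ} (hμ : 0 ≤ μ) {h w : Euc N → ℝ}
    (H : Sol Ω μ h w) : ∃ φ : ℕ → Euc N → ℝ, (∀ n, IsTest Ω (φ n)) ∧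
      Tendsto (fun n => ∫ x in Ω, (φ n x - w x) * (φ n x - w x)) atTop (𝓝 0) ∧
      Tendsto (fun n => ∫ x in Ω, ∑ i, pd i (φ n) x * pd i (φ n) x) atTop
        (𝓝 ((∫ x in Ω, h x * w x) - μ * ∫ x in Ω, w x * w x)) := by
  obtain ⟨φ, ε, a1, a2, a3, a4⟩ := H.weak.approx
  refine ⟨φ, a1, a4, ?_⟩
  have h1 := D.tendsto_form hμ H.weak.rhs H.weak.rhs H.weak.mem a2 a3 a1 a2 a3 a4
  have h2 := (tendsto_integral_sq_of_l2 H.weak.mem (fun n => (a1 n).memLp) a4).const_mul μ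
  refine (h1.sub h2).congr fun n => ?_
  rw [form_eq μ (a1 n) (a1 n), add_sub_cancel_right]

theorem Sol.poincare (D : Dom Ω) {μ : ℝ} (hμ : 0 ≤ μ) {h w : Euc N → ℝ} (H : Sol Ω μ h w) :
    (firstEig Ω + μ) * ∫ x in Ω, w x * w x ≤ ∫ x in Ω, h x * w x := by
  obtain ⟨φ, a1, a2, a3⟩ := H.exists_energy_approx D hμ
  have h1 := (tendsto_integral_sq_of_l2 H.weak.mem (fun n => (a1 n).memLp) a2).const_mul
    (firstEig Ω)
  have := le_of_tendsto_of_tendsto' h1 a3 fun n => firstEig_mul_le D.isOpen D.bdd (a1 n)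
  linarith

theorem Sol.energy_nonneg (D : Dom Ω) {μ : ℝ} (hμ : 0 ≤ μ) {h w : Euc N → ℝ}
    (H : Sol Ω μ h w) : 0 ≤ ∫ x in Ω, h x * w x := by
  refine le_trans ?_ (H.poincare D hμ)
  have h1 := D.eig
  have h2 : 0 ≤ ∫ x in Ω, w x * w x := integral_nonneg fun x => mul_self_nonneg _
  positivity

theorem rpow_tangent_le {m : ℝ} (hm : 2 ≤ m) (a b : ℝ) :
    m * (|a| ^ (m - 2) * a * b) - (m - 1) * |a| ^ m ≤ |b| ^ m := by
  have hm1 : 1 < m := by linarith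
  have hconj : (m / (m - 1)).HolderConjugate m := by
    rw [Real.holderConjugate_iff]
    refine ⟨by rw [lt_div_iff₀ (by linarith)]; linarith, ?_⟩
    field_simp
    ring
  have h1 := Real.young_inequality_of_nonneg (a := |a| ^ (m - 1)) (b := |b|) (by positivity)
    (abs_nonneg b) hconj
  rw [← Real.rpow_mul (abs_nonneg a), mul_div_cancel₀ _ (by linarith : m - 1 ≠ 0)] at h1
  have h2 : |a| ^ (m - 2) * a * b ≤ |a| ^ (m - 1) * |b| := by
    rcases eq_or_ne a 0 with rfl | ha
    · simp only [abs_zero, mul_zero, zero_mul]; positivity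
    · have e : |a| ^ (m - 1) = |a| ^ (m - 2) * |a| := by
        rw [← Real.rpow_add_one (abs_pos.2 ha).ne']
        ring_nf
      rw [e, mul_assoc, mul_assoc, ← abs_mul]
      exact mul_le_mul_of_nonneg_left (le_abs_self _) (by positivity)
  have h3 : |a| ^ m / (m / (m - 1)) = (m - 1) * |a| ^ m / m := by field_simp
  rw [h3, ← add_div, le_div_iff₀ (by linarith)] at h1
  nlinarith

theorem Dom.sobolev (D : Dom Ω) {m : ℝ} (hm : 2 ≤ m) (hm' : 3 ≤ N → m < 2 * N / ((N : ℝ) - 2)) :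
    ∃ C, 0 < C ∧ ∀ (μ : ℝ) (h w : Euc N → ℝ), 0 ≤ μ → Sol Ω μ h w →
      ∫ x in Ω, |w x| ^ m ≤ C * (∫ x in Ω, h x * w x) ^ (m / 2) := by
  obtain ⟨C, hC, hCb⟩ := _root_.sobolev D.dim D.isOpen D.bdd hm hm'
  refine ⟨C, hC, fun μ h w hμ H => ?_⟩
  obtain ⟨φ, a1, a2, a3⟩ := H.exists_energy_approx D hμ
  obtain ⟨B, hB, hwB⟩ := H.exists_bound D
  have hm0 : 0 < m := by linarith
  have hcont : Continuous fun x => |w x| ^ (m - 2) * w x :=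
    (H.cont.abs.rpow_const fun _ => Or.inr (by linarith)).mul H.cont
  have hg : MemLp (fun x => |w x| ^ (m - 2) * w x) 2 (volume.restrict Ω) := by
    refine memLp_of_continuousOn_bdd D.isOpen D.bdd hcont.continuousOn (S := B ^ (m - 2) * B)
      (fun x _ => ?_) 2
    rw [abs_mul, abs_of_nonneg (by positivity : 0 ≤ |w x| ^ (m - 2))]
    exact mul_le_mul (Real.rpow_le_rpow (abs_nonneg _) (hwB x) (by linarith)) (hwB x)
      (abs_nonneg _) (by positivity)
  have hIw : Integrable (fun x => |w x| ^ m) (volume.restrict Ω) := by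
    refine Measure.integrableOn_of_bounded (M := B ^ m) (D.bdd.measure_lt_top).ne
      (H.cont.abs.rpow_const fun _ => Or.inr hm0.le).aestronglyMeasurable
      (ae_of_all _ fun x => ?_)
    rw [Real.norm_of_nonneg (by positivity)]
    exact Real.rpow_le_rpow (abs_nonneg _) (hwB x) hm0.le
  have hIφ : ∀ n, Integrable (fun x => |φ n x| ^ m) (volume.restrict Ω) := fun n => by
    refine ((((a1 n).cd.continuous.abs.rpow_const fun _ => Or.inr hm0.le)
      ).integrable_of_hasCompactSupport ?_).integrableOn
    exact (a1 n).cs.comp_left (g := fun t => |t| ^ m) (by simp [Real.zero_rpow hm0.ne'])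
  have h1 : ∀ n, m * (∫ x in Ω, |w x| ^ (m - 2) * w x * φ n x) - (m - 1) * ∫ x in Ω, |w x| ^ m ≤
      C * (∫ x in Ω, ∑ i, pd i (φ n) x * pd i (φ n) x) ^ (m / 2) := fun n => by
    refine le_trans ?_ (hCb (φ n) (a1 n))
    have i1 := memLp_integrable_mul hg (a1 n).memLp
    rw [← integral_const_mul, ← integral_const_mul,
      ← integral_sub (i1.const_mul m) (hIw.const_mul (m - 1))]
    exact integral_mono ((i1.const_mul m).sub (hIw.const_mul (m - 1))) (hIφ n)
      fun x => rpow_tangent_le hm _ _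
  have l1 := ((tendsto_integral_mul_of_l2 hg H.weak.mem (fun n => (a1 n).memLp) a2).const_mul
    m).sub_const ((m - 1) * ∫ x in Ω, |w x| ^ m)
  have l2 := (a3.rpow_const (p := m / 2) (Or.inr (by positivity))).const_mul C
  have l3 := le_of_tendsto_of_tendsto' l1 l2 h1
  have e : ∀ x, |w x| ^ (m - 2) * w x * w x = |w x| ^ m := fun x => by
    rw [mul_assoc, ← abs_mul_abs_self (w x), ← sq, ← Real.rpow_natCast,
      ← Real.rpow_add_of_nonneg (abs_nonneg _) (by linarith) (by norm_num)]
    norm_num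
  simp_rw [e] at l3
  have l4 : 0 ≤ (∫ x in Ω, h x * w x) - μ * ∫ x in Ω, w x * w x := by
    have := H.poincare D hμ
    have h2 : 0 ≤ ∫ x in Ω, w x * w x := integral_nonneg fun x => mul_self_nonneg _
    nlinarith [D.eig]
  have l5 : ((∫ x in Ω, h x * w x) - μ * ∫ x in Ω, w x * w x) ^ (m / 2) ≤
      (∫ x in Ω, h x * w x) ^ (m / 2) := by
    refine Real.rpow_le_rpow l4 ?_ (by positivity)
    have h2 : 0 ≤ ∫ x in Ω, w x * w x := integral_nonneg fun x => mul_self_nonneg _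
    nlinarith
  nlinarith

theorem Sol.cauchy_schwarz (D : Dom Ω) {μ : ℝ} (hμ : 0 ≤ μ) {h₁ h₂ w₁ w₂ : Euc N → ℝ}
    (H₁ : Sol Ω μ h₁ w₁) (H₂ : Sol Ω μ h₂ w₂) :
    (∫ x in Ω, h₁ x * w₂ x) ^ 2 ≤ (∫ x in Ω, h₁ x * w₁ x) * ∫ x in Ω, h₂ x * w₂ x := by
  have key : ∀ t : ℝ, 0 ≤ (∫ x in Ω, h₂ x * w₂ x) * (t * t) + (2 * ∫ x in Ω, h₁ x * w₂ x) * t +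
      ∫ x in Ω, h₁ x * w₁ x := fun t => by
    have h0 := (H₁.add H₂ t).energy_nonneg D hμ
    have hs := H₁.symm D hμ H₂
    have i11 := memLp_integrable_mul H₁.weak.rhs H₁.weak.mem
    have i12 := (memLp_integrable_mul H₁.weak.rhs H₂.weak.mem).const_mul t
    have i21 := (memLp_integrable_mul H₂.weak.rhs H₁.weak.mem).const_mul t
    have i22 := (memLp_integrable_mul H₂.weak.rhs H₂.weak.mem).const_mul (t * t)
    have e : ∀ x, (h₁ x + t * h₂ x) * (w₁ x + t * w₂ x) = h₁ x * w₁ x + t * (h₁ x * w₂ x) +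
        t * (h₂ x * w₁ x) + t * t * (h₂ x * w₂ x) := fun x => by ring
    simp_rw [e] at h0
    rw [integral_add ((i11.fun_add i12).fun_add i21) i22, integral_add (i11.fun_add i12) i21,
      integral_add i11 i12, integral_const_mul, integral_const_mul, integral_const_mul, ← hs] at h0
    linarith
  have := discrim_le_zero key
  unfold discrim at this
  nlinarith

theorem Sol.nonneg (D : Dom Ω) {μ : ℝ} (hμ : 0 ≤ μ) {h w : Euc N → ℝ} (H : Sol Ω μ h w)
    (hh : ∀ x ∈ Ω, 0 ≤ h x) (x : Euc N) : 0 ≤ w x := by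
  by_cases hx : x ∈ Ω
  · have h1 := H.weak.neg.ae_nonpos D.isOpen D.bdd D.eig hμ (fun x hx => by
      have := hh x hx
      linarith)
    have := le_on_of_ae_le D.isOpen H.cont.neg.continuousOn continuousOn_const h1 x hx
    change -w x ≤ 0 at this
    linarith
  · rw [H.off x hx]

theorem sol_of_contDiff {μ : ℝ} (hΩ : IsOpen Ω) (hb : Bornology.IsBounded Ω)
    {ψ : Euc N → ℝ} (hψ : ContDiff ℝ 2 ψ) (hs : tsupport ψ ⊆ Ω) :
    Sol Ω μ (fun x => -lap ψ x + μ * ψ x) ψ := by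
  have hc : HasCompactSupport ψ :=
    hb.isCompact_closure.of_isClosed_subset (isClosed_tsupport ψ) (hs.trans subset_closure)
  have hT : IsTest Ω ψ := ⟨hψ.of_le (by norm_num), hc, hs⟩
  have hrc : Continuous (fun x => -lap ψ x + μ * ψ x) := by
    have := continuousOn_lap isOpen_univ hψ.contDiffOn
    rw [continuousOn_univ] at this
    exact this.neg.add (continuous_const.mul hψ.continuous)
  obtain ⟨S, hS⟩ := hb.isCompact_closure.exists_bound_of_continuousOn hrc.continuousOn
  have hS' : ∀ x ∈ Ω, |-lap ψ x + μ * ψ x| ≤ S := fun x hx => hS x (subset_closure hx)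
  refine ⟨⟨memLp_of_continuousOn_bdd hΩ hb hrc.continuousOn hS' 2, hT.memLp, fun _ => ψ,
    fun _ => 0, fun _ => hT, tendsto_const_nhds, fun n χ hχ => ?_, by simp⟩, hψ.continuous,
    fun x hx => hT.zero_off hx, hrc.continuousOn, S, hS'⟩
  rw [form_eq μ hT hχ, integral_pd_mul_pd hΩ hψ.contDiffOn hχ, zero_mul, ← integral_const_mul,
    ← integral_add]
  · refine (abs_nonpos_iff.2 (sub_eq_zero.2 ?_))
    refine integral_congr_ae (ae_of_all _ fun x => ?_)
    simp only
    ring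
  · exact (integrable_mul_of_tsupport hΩ (f := fun x => -lap ψ x)
      (continuousOn_lap hΩ hψ.contDiffOn).neg hχ.cd.continuous hχ.cs hχ.sub).integrableOn
  · exact (hT.integrable_mul hχ).const_mul μ

end EnergyIdentities

section Nonlinearity

variable {N : ℕ} {Ω : Set (Euc N)}

/-- Nonnegative superlinear, subcritical nonlinearities satisfying the Ambrosetti-Rabinowitz
type monotonicity conditions with exponents `a ≤ b`. -/
structure Nonlin (Ω : Set (Euc N)) (f : Euc N → ℝ → ℝ) (a b M : ℝ) : Prop where
  c1 : ContDiffOn ℝ 1 (Function.uncurry f) (Ω ×ˢ (univ : Set ℝ))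
  two_lt : 2 < a
  le : a ≤ b
  sub : 3 ≤ N → b < 2 * N / ((N : ℝ) - 2)
  zero : ∀ x ∈ Ω, f x 0 = 0
  nonneg : ∀ x ∈ Ω, ∀ t, 0 ≤ t → 0 ≤ f x t
  pos : ∀ᵐ x ∂volume.restrict Ω, ∀ t, 0 < t → 0 < f x t
  lower : ∀ x ∈ Ω, ∀ s t, 0 < s → s ≤ t → f x s * t ^ (a - 1) ≤ f x t * s ^ (a - 1)
  upper : ∀ x ∈ Ω, ∀ s t, 0 < s → s ≤ t → f x t * s ^ (b - 1) ≤ f x s * t ^ (b - 1)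
  M_pos : 0 < M
  le_M : ∀ x ∈ Ω, f x 1 ≤ M
  lip : ∀ R, ∃ L, 0 ≤ L ∧ ∀ x ∈ Ω, ∀ s t, 0 ≤ s → s ≤ R → 0 ≤ t → t ≤ R →
    |f x s - f x t| ≤ L * |s - t|

theorem monotoneOn_div_rpow {F F' : ℝ → ℝ} {e : ℝ} (hF : ∀ t, 0 < t → HasDerivAt F (F' t) t)
    (h : ∀ t, 0 < t → e * F t * t ≤ F' t * t ^ 2) {s t : ℝ} (hs : 0 < s) (hst : s ≤ t) :
    F s * t ^ e ≤ F t * s ^ e := by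
  have hd : ∀ r, 0 < r → HasDerivAt (fun r => F r * r ^ (-e))
      (F' r * r ^ (-e) + F r * (-e * r ^ (-e - 1))) r := fun r hr =>
    (hF r hr).mul (Real.hasDerivAt_rpow_const (Or.inl hr.ne'))
  have hm : MonotoneOn (fun r => F r * r ^ (-e)) (Ioi 0) := by
    refine monotoneOn_of_deriv_nonneg (convex_Ioi 0)
      (fun r hr => (hd r hr).continuousAt.continuousWithinAt)
      (fun r hr => (hd r (interior_subset hr)).differentiableAt.differentiableWithinAt)
      fun r hr => ?_
    have hr' : (0 : ℝ) < r := interior_subset hr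
    rw [(hd r hr').deriv]
    have e1 : r ^ (-e) = r ^ (-e - 1) * r := by
      rw [← Real.rpow_add_one hr'.ne']; ring_nf
    have h1 : F' r * r ^ (-e) + F r * (-e * r ^ (-e - 1)) =
        r ^ (-e - 1) * (F' r * r ^ 2 - e * F r * r) / r := by
      rw [e1]; field_simp; ring
    rw [h1]
    have := h r hr'
    have : 0 ≤ F' r * r ^ 2 - e * F r * r := by linarith
    positivity
  have := hm hs (hs.trans_le hst : (0 : ℝ) < t) hst
  have ht := hs.trans_le hst
  simp only at this
  rw [Real.rpow_neg hs.le, Real.rpow_neg ht.le, ← div_eq_mul_inv, ← div_eq_mul_inv,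
    div_le_div_iff₀ (by positivity) (by positivity)] at this
  exact this

variable {f : Euc N → ℝ → ℝ} {a b M : ℝ}

theorem Nonlin.continuousOn_comp (A : Nonlin Ω f a b M) {u : Euc N → ℝ} {K : Set (Euc N)}
    (hK : K ⊆ Ω) (hu : ContinuousOn u K) : ContinuousOn (fun x => f x (u x)) K :=
  A.c1.continuousOn.comp (f := fun x => (x, u x)) (continuousOn_id.prodMk hu)
    fun x hx => ⟨hK hx, mem_univ (u x)⟩

theorem Nonlin.continuous_right (A : Nonlin Ω f a b M) {x : Euc N} (hx : x ∈ Ω) :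
    Continuous (f x) := by
  rw [← continuousOn_univ]
  exact A.c1.continuousOn.comp (f := fun t : ℝ => (x, t)) (by fun_prop)
    fun t _ => ⟨hx, mem_univ _⟩

theorem Nonlin.mul_le (A : Nonlin Ω f a b M) {x : Euc N} (hx : x ∈ Ω) {s t : ℝ} (hs : 0 ≤ s)
    (hs1 : s ≤ 1) (ht : 0 ≤ t) : f x (s * t) ≤ s ^ (a - 1) * f x t := by
  have h2 := A.two_lt
  rcases hs.eq_or_lt with rfl | hs
  · rw [zero_mul, A.zero x hx, Real.zero_rpow (by linarith), zero_mul]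
  rcases ht.eq_or_lt with rfl | ht
  · rw [mul_zero, A.zero x hx, mul_zero]
  have := A.lower x hx (s * t) t (by positivity) (by nlinarith)
  rw [Real.mul_rpow hs.le ht.le] at this
  have h3 : 0 < t ^ (a - 1) := by positivity
  refine le_of_mul_le_mul_right ?_ h3
  linarith

theorem Nonlin.le_mul (A : Nonlin Ω f a b M) {x : Euc N} (hx : x ∈ Ω) {s t : ℝ} (hs : 1 ≤ s)
    (ht : 0 ≤ t) : s ^ (a - 1) * f x t ≤ f x (s * t) := by
  have hs0 : 0 < s := by linarith
  have := A.mul_le hx (s := s⁻¹) (t := s * t) (by positivity) (inv_le_one_of_one_le₀ hs)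
    (by positivity)
  rw [inv_mul_cancel_left₀ hs0.ne', Real.inv_rpow hs0.le, inv_mul_eq_div,
    le_div_iff₀ (by positivity)] at this
  linarith

theorem Nonlin.mono (A : Nonlin Ω f a b M) {x : Euc N} (hx : x ∈ Ω) {s t : ℝ} (hs : 0 ≤ s)
    (hst : s ≤ t) : f x s ≤ f x t := by
  rcases hs.eq_or_lt with rfl | hs
  · rw [A.zero x hx]; exact A.nonneg x hx t hst
  have ht := hs.trans_le hst
  have := A.mul_le hx (s := s / t) (t := t) (by positivity) ((div_le_one ht).2 hst) ht.le
  rw [div_mul_cancel₀ _ ht.ne'] at this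
  refine this.trans ?_
  have h1 : (s / t) ^ (a - 1) ≤ 1 := Real.rpow_le_one (by positivity) ((div_le_one ht).2 hst)
    (by have := A.two_lt; linarith)
  have := A.nonneg x hx t ht.le
  nlinarith

theorem Nonlin.div_mono (A : Nonlin Ω f a b M) {x : Euc N} (hx : x ∈ Ω) {s t : ℝ} (hs : 0 ≤ s)
    (hst : s ≤ t) : f x s * t ≤ f x t * s := by
  rcases hs.eq_or_lt with rfl | hs
  · rw [A.zero x hx]; simp
  have ht := hs.trans_le hst
  have := A.mul_le hx (s := s / t) (t := t) (by positivity) ((div_le_one ht).2 hst) ht.le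
  rw [div_mul_cancel₀ _ ht.ne'] at this
  have h1 : (s / t) ^ (a - 1) ≤ (s / t) ^ (1 : ℝ) :=
    Real.rpow_le_rpow_of_exponent_ge (by positivity) ((div_le_one ht).2 hst)
      (by have := A.two_lt; linarith)
  rw [Real.rpow_one] at h1
  have h2 := this.trans (mul_le_mul_of_nonneg_right h1 (A.nonneg x hx t ht.le))
  rw [div_mul_eq_mul_div, le_div_iff₀ ht] at h2
  linarith

theorem Nonlin.le_add (A : Nonlin Ω f a b M) {x : Euc N} (hx : x ∈ Ω) {t : ℝ} (ht : 0 ≤ t) :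
    f x t ≤ M * (t ^ (a - 1) + t ^ (b - 1)) := by
  have h2 := A.two_lt
  have h3 := A.M_pos
  have hM := A.le_M x hx
  have p1 : 0 ≤ t ^ (a - 1) := by positivity
  have p2 : 0 ≤ t ^ (b - 1) := by positivity
  rcases le_total t 1 with h | h
  · have := A.mul_le hx ht h zero_le_one
    rw [mul_one] at this
    nlinarith
  · have := A.upper x hx 1 t one_pos h
    rw [Real.one_rpow, mul_one] at this
    nlinarith

/-- The primitive `∫₀ᵗ f(x, s) ds` of a nonlinearity, written over the unit interval. -/
def prim (f : Euc N → ℝ → ℝ) (x : Euc N) (t : ℝ) : ℝ := t * ∫ s in (0 : ℝ)..1, f x (s * t)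

theorem prim_eq (f : Euc N → ℝ → ℝ) (x : Euc N) (t : ℝ) :
    prim f x t = ∫ s in (0 : ℝ)..t, f x s := by
  unfold prim
  rw [intervalIntegral.mul_integral_comp_mul_right]
  simp

theorem Nonlin.intervalIntegrable (A : Nonlin Ω f a b M) {x : Euc N} (hx : x ∈ Ω) (t c d : ℝ) :
    IntervalIntegrable (fun s => f x (s * t)) volume c d :=
  ((A.continuous_right hx).comp (continuous_id.mul continuous_const)).intervalIntegrable _ _

theorem Nonlin.prim_nonneg (A : Nonlin Ω f a b M) {x : Euc N} (hx : x ∈ Ω) {t : ℝ} (ht : 0 ≤ t) :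
    0 ≤ prim f x t :=
  mul_nonneg ht (intervalIntegral.integral_nonneg zero_le_one fun _ hs =>
    A.nonneg x hx _ (mul_nonneg hs.1 ht))

theorem Nonlin.mul_prim_le (A : Nonlin Ω f a b M) {x : Euc N} (hx : x ∈ Ω) {t : ℝ}
    (ht : 0 ≤ t) : a * prim f x t ≤ f x t * t := by
  have h2 := A.two_lt
  have h1 : ∫ s in (0 : ℝ)..1, f x (s * t) ≤ ∫ s in (0 : ℝ)..1, s ^ (a - 1) * f x t := by
    refine intervalIntegral.integral_mono_on zero_le_one (A.intervalIntegrable hx _ _ _)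
      ((intervalIntegral.intervalIntegrable_rpow' (by linarith)).mul_const _) fun s hs =>
        A.mul_le hx hs.1 hs.2 ht
  rw [intervalIntegral.integral_mul_const, integral_rpow (Or.inl (by linarith)), sub_add_cancel,
    Real.one_rpow, Real.zero_rpow (by linarith), sub_zero, one_div_mul_eq_div,
    le_div_iff₀ (by linarith)] at h1
  unfold prim
  nlinarith

theorem Nonlin.le_prim_mul (A : Nonlin Ω f a b M) {x : Euc N} (hx : x ∈ Ω) {s t : ℝ}
    (hs : 1 ≤ s) (ht : 0 ≤ t) : s ^ a * prim f x t ≤ prim f x (s * t) := by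
  have hs0 : 0 < s := by linarith
  have h1 : ∫ r in (0 : ℝ)..1, s ^ (a - 1) * f x (r * t) ≤ ∫ r in (0 : ℝ)..1, f x (r * (s * t)) := by
    refine intervalIntegral.integral_mono_on zero_le_one
      ((A.intervalIntegrable hx _ _ _).const_mul _) (A.intervalIntegrable hx _ _ _) fun r hr => ?_
    rw [mul_left_comm]
    exact A.le_mul hx hs (mul_nonneg hr.1 ht)
  rw [intervalIntegral.integral_const_mul] at h1
  have e : s ^ a = s ^ (a - 1) * s := by rw [← Real.rpow_add_one hs0.ne']; ring_nf
  unfold prim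
  rw [e]
  calc _ = s * t * (s ^ (a - 1) * ∫ r in (0 : ℝ)..1, f x (r * t)) := by ring
    _ ≤ _ := by gcongr

theorem Nonlin.prim_sub_le (A : Nonlin Ω f a b M) {x : Euc N} (hx : x ∈ Ω) {s t : ℝ}
    (hs : 0 ≤ s) (ht : 0 ≤ t) :
    f x s / s * (t ^ 2 - s ^ 2) / 2 ≤ prim f x t - prim f x s := by
  rcases hs.eq_or_lt with rfl | hs
  · have := A.prim_nonneg hx ht
    simpa [prim] using this
  have hi : ∀ c d, IntervalIntegrable (f x) volume c d := fun c d =>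
    (A.continuous_right hx).intervalIntegrable _ _
  have hj : ∀ c d, IntervalIntegrable (fun r => f x s / s * r) volume c d := fun c d =>
    (continuous_const.mul continuous_id).intervalIntegrable _ _
  have e1 : prim f x t - prim f x s = ∫ r in s..t, f x r := by
    rw [prim_eq, prim_eq, intervalIntegral.integral_interval_sub_left (hi _ _) (hi _ _)]
  have e2 : f x s / s * (t ^ 2 - s ^ 2) / 2 = ∫ r in s..t, f x s / s * r := by
    rw [intervalIntegral.integral_const_mul, integral_id]; ring
  rw [e1, e2]
  rcases le_total s t with h | h
  · refine intervalIntegral.integral_mono_on h (hj _ _) (hi _ _) fun r hr => ?_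
    have := A.div_mono hx hs.le hr.1
    rw [div_mul_eq_mul_div, div_le_iff₀ hs]
    exact this
  · rw [intervalIntegral.integral_symm, intervalIntegral.integral_symm t s, neg_le_neg_iff]
    refine intervalIntegral.integral_mono_on h (hi _ _) (hj _ _) fun r hr => ?_
    have := A.div_mono hx (ht.trans hr.1) hr.2
    rw [div_mul_eq_mul_div, le_div_iff₀ hs]
    exact this

theorem Nonlin.continuousOn_prim (A : Nonlin Ω f a b M) (hΩ : IsOpen Ω) {u : Euc N → ℝ}
    (hu : Continuous u) (hu0 : ∀ x, 0 ≤ u x) : ContinuousOn (fun x => prim f x (u x)) Ω := by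
  intro x hx
  refine (ContinuousAt.mul hu.continuousAt ?_).continuousWithinAt
  have h2 := A.two_lt
  have h3 := A.le
  have h4 := A.M_pos
  have hnear : ∀ᶠ y in 𝓝 x, y ∈ Ω ∧ u y ≤ u x + 1 := (hΩ.eventually_mem hx).and
    ((hu.tendsto x).eventually (eventually_le_nhds (by linarith)))
  refine intervalIntegral.continuousAt_of_dominated_interval
    (bound := fun _ => M * ((u x + 1) ^ (a - 1) + (u x + 1) ^ (b - 1))) ?_ ?_ ?_ ?_
  · filter_upwards [hnear] with y hy
    exact ((A.continuous_right hy.1).comp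
      (continuous_id.mul continuous_const)).aestronglyMeasurable
  · filter_upwards [hnear] with y hy
    refine ae_of_all _ fun s hs => ?_
    rw [uIoc_of_le zero_le_one] at hs
    have h0 : 0 ≤ s * u y := mul_nonneg hs.1.le (hu0 y)
    have h1 : s * u y ≤ u x + 1 := by nlinarith [hs.1, hs.2, hy.2, hu0 y]
    rw [Real.norm_of_nonneg (A.nonneg y hy.1 _ h0)]
    refine (A.le_add hy.1 h0).trans ?_
    have p1 := Real.rpow_le_rpow h0 h1 (by linarith : 0 ≤ a - 1)
    have p2 := Real.rpow_le_rpow h0 h1 (by linarith : 0 ≤ b - 1)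
    gcongr
  · exact intervalIntegrable_const
  · refine ae_of_all _ fun s _ => ?_
    exact (A.continuousOn_comp subset_rfl (u := fun y => s * u y)
      (continuous_const.mul hu).continuousOn).continuousAt (hΩ.mem_nhds hx)

end Nonlinearity

section FromStanding

variable {N : ℕ} {Ω : Set (Euc N)} {f : Euc N → ℝ → ℝ} {d : Euc N → ℝ}
  {g : Euc N → ℝ → ℝ} {p : ℝ} {u : ℝ → Euc N → ℝ}

theorem Standing.hasDerivAt (H : Standing N Ω f d g p u) {x : Euc N} (hx : x ∈ Ω) (t : ℝ) :
    HasDerivAt (f x) (fderiv ℝ (Function.uncurry f) (x, t) (0, 1)) t := by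
  have h1 : ContDiffAt ℝ 1 (Function.uncurry f) (x, t) :=
    H.f_c1.contDiffAt ((H.isOpen.prod isOpen_univ).mem_nhds ⟨hx, mem_univ t⟩)
  have h2 : HasDerivAt (fun s : ℝ => (x, s)) ((0 : Euc N), (1 : ℝ)) t :=
    (hasDerivAt_const t x).prodMk (hasDerivAt_id t)
  exact (h1.differentiableAt (by norm_num)).hasFDerivAt.comp_hasDerivAt t h2

theorem Standing.continuousOn_deriv (H : Standing N Ω f d g p u) (t : ℝ) :
    ContinuousOn (fun x => deriv (f x) t) Ω := by
  have h1 : ContinuousOn (fderiv ℝ (Function.uncurry f)) (Ω ×ˢ (univ : Set ℝ)) :=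
    H.f_c1.continuousOn_fderiv_of_isOpen (H.isOpen.prod isOpen_univ) le_rfl
  have h2 : ContinuousOn (fun x => fderiv ℝ (Function.uncurry f) (x, t) (0, 1)) Ω :=
    (h1.comp (f := fun x => (x, t)) (by fun_prop) fun x hx => ⟨hx, mem_univ t⟩).clm_apply
      continuousOn_const
  exact h2.congr fun x hx => (H.hasDerivAt hx t).deriv

theorem Standing.continuousOn_left (H : Standing N Ω f d g p u) (t : ℝ) :
    ContinuousOn (fun x => f x t) Ω :=
  H.f_c1.continuousOn.comp (f := fun x => (x, t)) (by fun_prop) fun x hx => ⟨hx, mem_univ t⟩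

theorem Standing.exists_nonlin (H : Standing N Ω f d g p u) : ∃ a b M, Nonlin Ω f a b M := by
  obtain ⟨a, b, h2a, hab, hb, har⟩ := H.f_ar
  obtain ⟨M, hM, hfM⟩ := H.f_bdd
  have hc1 := H.continuousOn_left
  have hc2 := H.continuousOn_deriv
  have hl : ∀ x ∈ Ω, ∀ t, 0 < t → (a - 1) * f x t * t ≤ deriv (f x) t * t ^ 2 :=
    fun x hx t ht => le_on_of_ae_le (v := fun x => (a - 1) * f x t * t) H.isOpen
      ((continuousOn_const.mul (hc1 t)).mul continuousOn_const)
      ((hc2 t).mul continuousOn_const) (har.mono fun x h => (h t ht.ne').2.1) x hx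
  have hu : ∀ x ∈ Ω, ∀ t, 0 < t → deriv (f x) t * t ^ 2 ≤ (b - 1) * f x t * t :=
    fun x hx t ht => le_on_of_ae_le (v := fun x => deriv (f x) t * t ^ 2) H.isOpen
      ((hc2 t).mul continuousOn_const)
      ((continuousOn_const.mul (hc1 t)).mul continuousOn_const)
      (har.mono fun x h => (h t ht.ne').2.2) x hx
  have hpos : ∀ᵐ x ∂volume.restrict Ω, ∀ t, 0 < t → 0 < f x t := har.mono fun x h t ht => by
    have := (h t ht.ne').1
    have h1 : 0 < a - 1 := by linarith
    rw [mul_assoc] at this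
    exact pos_of_mul_pos_left (pos_of_mul_pos_right this h1.le) ht.le
  have hn : ∀ x ∈ Ω, ∀ t, 0 ≤ t → 0 ≤ f x t := fun x hx t ht => by
    rcases ht.eq_or_lt with rfl | ht
    · exact (H.f_zero x hx).1.ge
    · exact le_on_of_ae_le (v := fun _ => 0) H.isOpen continuousOn_const (hc1 t)
        (hpos.mono fun x h => (h t ht).le) x hx
  have hd : ∀ x ∈ Ω, ∀ t, HasDerivAt (f x) (deriv (f x) t) t := fun x hx t =>
    (H.hasDerivAt hx t).differentiableAt.hasDerivAt
  have hlow : ∀ x ∈ Ω, ∀ s t, 0 < s → s ≤ t → f x s * t ^ (a - 1) ≤ f x t * s ^ (a - 1) :=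
    fun x hx s t hs hst => monotoneOn_div_rpow (fun t _ => hd x hx t) (hl x hx) hs hst
  have hup : ∀ x ∈ Ω, ∀ s t, 0 < s → s ≤ t → f x t * s ^ (b - 1) ≤ f x s * t ^ (b - 1) :=
    fun x hx s t hs hst => by
      have := monotoneOn_div_rpow (F := fun t => -f x t) (e := b - 1)
        (fun t _ => (hd x hx t).neg)
        (fun t ht => by have := hu x hx t ht; linarith) hs hst
      linarith
  have hM1 : ∀ x ∈ Ω, f x 1 ≤ M := fun x hx => (le_abs_self _).trans (hfM x hx).1.le
  have hbound : ∀ x ∈ Ω, ∀ t, 0 < t → f x t ≤ M * (t * (t ^ (a - 2) + t ^ (b - 2))) := by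
    intro x hx t ht
    have e1 : t * t ^ (a - 2) = t ^ (a - 1) := by
      rw [mul_comm, ← Real.rpow_add_one ht.ne']; ring_nf
    have e2 : t * t ^ (b - 2) = t ^ (b - 1) := by
      rw [mul_comm, ← Real.rpow_add_one ht.ne']; ring_nf
    rw [mul_add, e1, e2]
    have p1 : 0 < t ^ (a - 1) := by positivity
    have p2 : 0 < t ^ (b - 1) := by positivity
    have := hM1 x hx
    rcases le_total t 1 with h | h
    · have := hlow x hx t 1 ht h
      rw [Real.one_rpow, mul_one] at this
      nlinarith
    · have := hup x hx 1 t one_pos h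
      rw [Real.one_rpow, mul_one] at this
      nlinarith
  refine ⟨a, b, M, H.f_c1, h2a, hab, hb, fun x hx => (H.f_zero x hx).1, hn, hpos, hlow, hup, hM,
    hM1, fun R => ?_⟩
  refine ⟨(b - 1) * (M * (|R| ^ (a - 2) + |R| ^ (b - 2))), ?_, fun x hx s t hs hsR ht htR => ?_⟩
  · have : 0 ≤ b - 1 := by linarith
    positivity
  have hdb : ∀ r ∈ Icc 0 R, ‖deriv (f x) r‖ ≤ (b - 1) * (M * (|R| ^ (a - 2) + |R| ^ (b - 2))) := by
    rintro r ⟨hr0, hrR⟩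
    have hb1 : 0 ≤ b - 1 := by linarith
    rcases hr0.eq_or_lt with rfl | hr0
    · rw [(H.f_zero x hx).2, norm_zero]
      positivity
    · have h1 := hl x hx r hr0
      have h2 := hu x hx r hr0
      have h3 := hbound x hx r hr0
      have h4 := hn x hx r hr0.le
      have h5 : 0 ≤ deriv (f x) r := by
        have : 0 ≤ deriv (f x) r * r ^ 2 := le_trans (by
          have : 0 ≤ a - 1 := by linarith
          positivity) h1
        exact nonneg_of_mul_nonneg_left this (by positivity)
      rw [Real.norm_of_nonneg h5]
      have hR : |R| = R := abs_of_nonneg (hr0.le.trans hrR)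
      have q1 := Real.rpow_le_rpow hr0.le hrR (by linarith : 0 ≤ a - 2)
      have q2 := Real.rpow_le_rpow hr0.le hrR (by linarith : 0 ≤ b - 2)
      rw [hR]
      refine le_trans ?_ (by gcongr : (b - 1) * (M * (r ^ (a - 2) + r ^ (b - 2))) ≤ _)
      refine le_of_mul_le_mul_right (h2.trans ?_) (by positivity : 0 < r ^ 2)
      calc (b - 1) * f x r * r ≤ (b - 1) * (M * (r * (r ^ (a - 2) + r ^ (b - 2)))) * r := by gcongr
        _ = _ := by ring
  exact (convex_Icc 0 R).norm_image_sub_le_of_norm_deriv_le (𝕜 := ℝ)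
    (fun r _ => (hd x hx r).differentiableAt) hdb ⟨ht, htR⟩ ⟨hs, hsR⟩

theorem continuous_indicator_of_frontier {v : Euc N → ℝ}
    (hv : ContinuousOn v (closure Ω)) (h0 : ∀ x ∈ frontier Ω, v x = 0) :
    Continuous (Ω.indicator v) := by
  classical
  have := continuous_piecewise (s := Ω) (f := v) (g := (0 : Euc N → ℝ)) h0 hv
    (continuousOn_const (c := (0 : ℝ)))
  rwa [piecewise_eq_indicator] at this

theorem lap_congr_on (hΩ : IsOpen Ω) {v w : Euc N → ℝ} (h : EqOn v w Ω) {x : Euc N}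
    (hx : x ∈ Ω) : lap v x = lap w x := by
  have h1 : v =ᶠ[𝓝 x] w := h.eventuallyEq_of_mem (hΩ.mem_nhds hx)
  unfold lap
  refine Finset.sum_congr rfl fun i _ => ?_
  have h2 : (fun y => fderiv ℝ v y (EuclideanSpace.single i 1)) =ᶠ[𝓝 x]
      fun y => fderiv ℝ w y (EuclideanSpace.single i 1) :=
    (h1.fderiv (𝕜 := ℝ)).mono fun y hy => congrArg (· (EuclideanSpace.single i 1)) hy
  rw [h2.fderiv_eq]

theorem Standing.dom (H : Standing N Ω f d g p u) : Dom Ω := by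
  have hl := firstEig_pos H.dim H.isOpen H.conn.nonempty H.bdd
  obtain ⟨a, b, M, A⟩ := H.exists_nonlin
  refine ⟨H.dim, H.isOpen, H.bdd, hl, ?_⟩
  obtain ⟨⟨h1, h2, h3, h4, h5⟩, -⟩ := H.sol (-(firstEig Ω / 2)) (by linarith)
  generalize u (-(firstEig Ω / 2)) = v at *
  have he : EqOn (Ω.indicator v) v Ω := fun x hx => indicator_of_mem hx _
  refine ⟨Ω.indicator v, firstEig Ω / 2, by linarith, h1.congr he,
    continuous_indicator_of_frontier h2 h4, fun x hx => by rw [he hx]; exact h3 x hx,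
    fun x hx => indicator_of_notMem hx _, fun x hx => ?_⟩
  rw [lap_congr_on H.isOpen he hx, he hx]
  have := h5 x hx
  have := A.nonneg x hx _ (h3 x hx).le
  linarith

end FromStanding

section StrongMaximum

variable {N : ℕ} {Ω : Set (Euc N)}

theorem lap_nonneg_of_isLocalMin {w : Euc N → ℝ} {y : Euc N} (hw : ContDiffAt ℝ 2 w y)
    (h : IsLocalMin w y) : 0 ≤ lap w y := by
  refine Finset.sum_nonneg fun i _ => ?_
  set e : Euc N := EuclideanSpace.single i 1
  set g : ℝ → ℝ := fun t => w (y + t • e) with hg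
  have hl : ∀ t : ℝ, HasDerivAt (fun t : ℝ => y + t • e) e t := fun t => by
    simpa using ((hasDerivAt_id t).smul_const e).const_add y
  have hc : Tendsto (fun t : ℝ => y + t • e) (𝓝 0) (𝓝 y) := by
    have := (hl 0).continuousAt.tendsto
    rwa [zero_smul, add_zero] at this
  have h0 : y + (0 : ℝ) • e = y := by simp
  have hev : ∀ᶠ z in 𝓝 y, DifferentiableAt ℝ w z :=
    (hw.eventually (by norm_num)).mono fun z hz => hz.differentiableAt (by norm_num)
  have hd : deriv g =ᶠ[𝓝 0] fun t => fderiv ℝ w (y + t • e) e :=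
    (hc.eventually hev).mono fun t ht => (ht.hasFDerivAt.comp_hasDerivAt t (hl t)).deriv
  have hfd : DifferentiableAt ℝ (fun z => fderiv ℝ w z e) y :=
    ((hw.fderiv_right (m := 1) (by norm_num)).differentiableAt (by norm_num)).clm_apply
      (differentiableAt_const e)
  have hdd : deriv (deriv g) 0 = fderiv ℝ (fun z => fderiv ℝ w z e) y e := by
    rw [hd.deriv_eq]
    have h1 : HasFDerivAt (fun z => fderiv ℝ w z e) (fderiv ℝ (fun z => fderiv ℝ w z e) y)
        (y + (0 : ℝ) • e) := by rw [h0]; exact hfd.hasFDerivAt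
    exact (h1.comp_hasDerivAt 0 (hl 0)).deriv
  rw [← hdd]
  by_contra! hneg
  have hmin : IsLocalMin g 0 := by
    have := hc.eventually h
    refine this.mono fun t ht => ?_
    change g 0 ≤ g t
    simpa [hg] using ht
  have hcont : ContinuousAt g 0 := by
    have h1 : ContinuousAt w (y + (0 : ℝ) • e) := by rw [h0]; exact hw.continuousAt
    exact ContinuousAt.comp (f := fun t : ℝ => y + t • e) h1 (hl 0).continuousAt
  have hmax : IsLocalMax g 0 := isLocalMax_of_deriv_deriv_neg hneg hmin.deriv_eq_zero hcont
  have hconst : g =ᶠ[𝓝 0] fun _ => g 0 := by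
    filter_upwards [hmin, hmax] with t h1 h2 using le_antisymm h2 h1
  have : deriv (deriv g) 0 = 0 := by
    rw [hconst.deriv.deriv_eq]; simp
  linarith

theorem pd_pd_gauss (x y : Euc N) (α : ℝ) (i : Fin N) :
    pd i (pd i fun y => Real.exp (-α * ‖y - x‖ ^ 2)) y =
      (4 * α ^ 2 * (y i - x i) ^ 2 - 2 * α) * Real.exp (-α * ‖y - x‖ ^ 2) := by
  have h1 : ∀ y : Euc N, HasFDerivAt (fun y : Euc N => Real.exp (-α * ‖y - x‖ ^ 2))
      (Real.exp (-α * ‖y - x‖ ^ 2) • (-α • (2 • innerSL ℝ (y - x)))) y := fun y => by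
    have h2 : HasFDerivAt (fun y : Euc N => ‖y - x‖ ^ 2) (2 • innerSL ℝ (y - x)) y := by
      simpa using ((hasFDerivAt_id y).sub_const x).norm_sq
    exact (h2.const_mul (-α)).exp
  have h2 : pd i (fun y => Real.exp (-α * ‖y - x‖ ^ 2)) =
      fun y : Euc N => Real.exp (-α * ‖y - x‖ ^ 2) * (-α * (2 * (y i - x i))) := by
    funext y
    unfold pd
    rw [(h1 y).fderiv]
    simp [EuclideanSpace.inner_single_right]
  rw [h2]
  unfold pd
  have h3 : HasFDerivAt (fun y : Euc N => -α * (2 * (y i - x i)))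
      (-α • ((2 : ℝ) • (EuclideanSpace.proj i : Euc N →L[ℝ] ℝ))) y :=
    ((((EuclideanSpace.proj i : Euc N →L[ℝ] ℝ).hasFDerivAt).sub_const (x i)).const_mul
      (2 : ℝ)).const_mul (-α)
  rw [show fderiv ℝ (fun y : Euc N => Real.exp (-α * ‖y - x‖ ^ 2) * (-α * (2 * (y i - x i)))) y = _
    from ((h1 y).mul h3).fderiv]
  simp [EuclideanSpace.inner_single_right]
  ring

theorem lap_gauss (x y : Euc N) (α : ℝ) :
    lap (fun y => Real.exp (-α * ‖y - x‖ ^ 2)) y =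
      (4 * α ^ 2 * ‖y - x‖ ^ 2 - 2 * α * N) * Real.exp (-α * ‖y - x‖ ^ 2) := by
  rw [lap_eq_sum_pd]
  simp_rw [pd_pd_gauss]
  rw [← Finset.sum_mul, Finset.sum_sub_distrib, ← Finset.mul_sum, EuclideanSpace.norm_sq_eq]
  simp [mul_comm]

theorem lap_sub_const_mul (hΩ : IsOpen Ω) {w v : Euc N → ℝ} (hw : ContDiffOn ℝ 2 w Ω)
    (hv : ContDiff ℝ 2 v) (c : ℝ) {x : Euc N} (hx : x ∈ Ω) :
    lap (fun y => w y - c * v y) x = lap w x - c * lap v x := by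
  have hdw : ∀ y ∈ Ω, DifferentiableAt ℝ w y := fun y hy =>
    (hw.contDiffAt (hΩ.mem_nhds hy)).differentiableAt (by norm_num)
  have hdv : ∀ y, DifferentiableAt ℝ v y := fun y => hv.contDiffAt.differentiableAt (by norm_num)
  have h1 : ∀ i, ∀ y ∈ Ω, pd i (fun y => w y - c * v y) y = pd i w y - c * pd i v y := by
    intro i y hy
    unfold pd
    rw [fderiv_fun_sub (hdw y hy) ((hdv y).const_mul c), fderiv_const_mul (hdv y)]
    rfl
  simp_rw [lap_eq_sum_pd, Finset.mul_sum, ← Finset.sum_sub_distrib]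
  refine Finset.sum_congr rfl fun i _ => ?_
  have h2 : pd i (fun y => w y - c * v y) =ᶠ[𝓝 x] fun y => pd i w y - c * pd i v y :=
    eventuallyEq_of_mem (hΩ.mem_nhds hx) (h1 i)
  have h3 : DifferentiableAt ℝ (pd i w) x :=
    ((contDiffOn_pd hΩ hw i).contDiffAt (hΩ.mem_nhds hx)).differentiableAt (by norm_num)
  have h4 : DifferentiableAt ℝ (pd i v) x :=
    ((contDiffOn_pd isOpen_univ hv.contDiffOn i).contDiffAt univ_mem).differentiableAt
      (by norm_num)
  change fderiv ℝ (pd i fun y => w y - c * v y) x _ = _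
  rw [h2.fderiv_eq, fderiv_fun_sub h3 (h4.const_mul c), fderiv_const_mul h4]
  rfl

theorem pos_of_pos_center (hΩ : IsOpen Ω) {w : Euc N → ℝ} (hw : ContDiffOn ℝ 2 w Ω)
    {Λ : ℝ} (hΛ : 0 ≤ Λ) (h0 : ∀ x ∈ Ω, 0 ≤ w x) (hl : ∀ x ∈ Ω, 0 ≤ -lap w x + Λ * w x)
    {x : Euc N} {R : ℝ} (hR : 0 < R) (hb : Metric.closedBall x R ⊆ Ω) (hx : 0 < w x)
    {z : Euc N} (hz : ‖z - x‖ < R) : 0 < w z := by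
  have hcx : ContinuousAt w x :=
    hw.continuousOn.continuousAt (hΩ.mem_nhds (hb (Metric.mem_closedBall_self hR.le)))
  obtain ⟨ε₀, hε₀, hε⟩ := Metric.eventually_nhds_iff_ball.1
    (hcx.eventually (lt_mem_nhds (half_lt_self hx)))
  set ε := min (min 1 (ε₀ / 2)) (R / 2)
  have hε1 : ε ≤ 1 := (min_le_left _ _).trans (min_le_left _ _)
  have hε2 : ε ≤ ε₀ / 2 := (min_le_left _ _).trans (min_le_right _ _)
  have hεpos : 0 < ε := by positivity
  have hsmall : ∀ y : Euc N, ‖y - x‖ ≤ ε → w x / 2 < w y := fun y hy =>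
    hε y (by rw [Metric.mem_ball, dist_eq_norm]; linarith)
  rcases le_or_gt ‖z - x‖ ε with hzε | hzε
  · linarith [hsmall z hzε]
  set δ := w x / 2 with hδ
  have hδ0 : 0 < δ := by positivity
  set α := (N + Λ + 1) / ε ^ 2 with hα
  have hε21 : ε ^ 2 ≤ 1 := pow_le_one₀ hεpos.le hε1
  have hα1 : 1 ≤ α := by
    rw [hα, le_div_iff₀ (by positivity)]
    have : (0 : ℝ) ≤ N := by positivity
    linarith
  have hαε : α * ε ^ 2 = N + Λ + 1 := div_mul_cancel₀ _ (by positivity)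
  set E : Euc N → ℝ := fun y => Real.exp (-α * ‖y - x‖ ^ 2) with hE
  set ER := Real.exp (-α * R ^ 2)
  have hEc : ContDiff ℝ 2 E := by
    have h1 : ContDiff ℝ 2 fun y : Euc N => ‖y - x‖ ^ 2 := (contDiff_id.sub contDiff_const).norm_sq ℝ
    exact (contDiff_const.mul h1).exp
  have hEz : ER < E z := Real.exp_lt_exp.2 (by
    have : ‖z - x‖ ^ 2 < R ^ 2 := by gcongr
    nlinarith)
  by_contra! hneg
  set K : Set (Euc N) := Metric.closedBall x R ∩ {y | ε ≤ ‖y - x‖} with hK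
  have hKc : IsCompact K := (isCompact_closedBall x R).inter_right
    (isClosed_le continuous_const (by fun_prop))
  have hzK : z ∈ K := ⟨by rw [Metric.mem_closedBall, dist_eq_norm]; exact hz.le, hzε.le⟩
  obtain ⟨y, hyK, hmin⟩ := hKc.exists_isMinOn (f := fun y => w y - δ * E y) ⟨z, hzK⟩
    ((hw.continuousOn.mono (inter_subset_left.trans hb)).sub
      (continuous_const.mul hEc.continuous).continuousOn)
  have hyz : w y - δ * E y ≤ w z - δ * E z := hmin hzK
  have hyΩ : y ∈ Ω := hb hyK.1
  have hyR : ‖y - x‖ ≤ R := by simpa [dist_eq_norm] using hyK.1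
  have hEy1 : E y ≤ 1 := Real.exp_le_one_iff.2 (by
    have : 0 ≤ ‖y - x‖ ^ 2 := by positivity
    nlinarith)
  have hEy0 : 0 < E y := Real.exp_pos _
  have hER0 : 0 < ER := Real.exp_pos _
  have hlt : w y - δ * E y < -(δ * ER) := by nlinarith
  have hyε' : ε < ‖y - x‖ := by
    rcases (show ε ≤ ‖y - x‖ from hyK.2).eq_or_lt with h | h
    · have := hsmall y h.ge
      nlinarith
    · exact h
  have hyR' : ‖y - x‖ < R := by
    rcases hyR.eq_or_lt with h | h
    · have h1 : E y = ER := by simp only [hE, ER, h]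
      rw [h1] at hlt
      linarith [h0 y hyΩ]
    · exact h
  have hloc : IsLocalMin (fun y => w y - δ * E y) y := by
    refine hmin.isLocalMin ?_
    have o1 : IsOpen {y : Euc N | ‖y - x‖ < R} := isOpen_lt (by fun_prop) continuous_const
    have o2 : IsOpen {y : Euc N | ε < ‖y - x‖} := isOpen_lt continuous_const (by fun_prop)
    filter_upwards [o1.mem_nhds hyR', o2.mem_nhds hyε'] with v h1 h2
    refine ⟨?_, le_of_lt h2⟩
    rw [Metric.mem_closedBall, dist_eq_norm]
    exact le_of_lt h1
  have hlap := lap_nonneg_of_isLocalMin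
    (((hw.contDiffAt (hΩ.mem_nhds hyΩ))).sub (contDiffAt_const.mul hEc.contDiffAt)) hloc
  rw [lap_sub_const_mul hΩ hw hEc δ hyΩ, lap_gauss] at hlap
  change 0 ≤ lap w y - δ * ((4 * α ^ 2 * ‖y - x‖ ^ 2 - 2 * α * N) * E y) at hlap
  have h1 := hl y hyΩ
  have h2 : w y < δ * E y := by nlinarith
  have h3 : Λ + 1 ≤ 4 * α ^ 2 * ‖y - x‖ ^ 2 - 2 * α * N := by
    have e1 : ε ^ 2 ≤ ‖y - x‖ ^ 2 := by gcongr
    have e2 : α * ε ^ 2 ≤ α * ‖y - x‖ ^ 2 := by gcongr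
    have hN : (0 : ℝ) ≤ N := by positivity
    have e3 : 2 * Λ + 1 ≤ 4 * (α * ‖y - x‖ ^ 2) - 2 * N := by linarith
    nlinarith
  have h4 : (Λ + 1) * (δ * E y) ≤
      (4 * α ^ 2 * ‖y - x‖ ^ 2 - 2 * α * N) * (δ * E y) := by gcongr
  have h5 : 0 < δ * E y := by positivity
  have h6 : Λ * w y ≤ Λ * (δ * E y) := by gcongr
  nlinarith

theorem strong_maximum (hΩ : IsOpen Ω) (hc : IsPreconnected Ω) {w : Euc N → ℝ}
    (hw : ContDiffOn ℝ 2 w Ω) {Λ : ℝ} (hΛ : 0 ≤ Λ) (h0 : ∀ x ∈ Ω, 0 ≤ w x)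
    (hl : ∀ x ∈ Ω, 0 ≤ -lap w x + Λ * w x) (hne : ∃ x ∈ Ω, w x ≠ 0) : ∀ x ∈ Ω, 0 < w x := by
  set P : Set (Euc N) := {x ∈ Ω | 0 < w x} with hP
  have hPo : IsOpen P := hw.continuousOn.isOpen_inter_preimage hΩ isOpen_Ioi
  have hsub : Ω ⊆ P := by
    refine hc.subset_of_closure_inter_subset hPo ?_ ?_
    · obtain ⟨x, hx, hx0⟩ := hne
      exact ⟨x, hx, hx, (h0 x hx).lt_of_ne' hx0⟩
    · rintro z ⟨hzc, hz⟩
      obtain ⟨r, hr, hrb⟩ := Metric.isOpen_iff.1 hΩ z hz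
      obtain ⟨x, hxP, hxz⟩ := Metric.mem_closure_iff.1 hzc (r / 3) (by positivity)
      refine ⟨hz, pos_of_pos_center hΩ hw hΛ h0 hl (by positivity : 0 < r / 3) ?_ hxP.2
        (by rwa [← dist_eq_norm])⟩
      intro y hy
      refine hrb ?_
      rw [Metric.mem_closedBall] at hy
      rw [Metric.mem_ball]
      linarith [dist_triangle y x z, dist_comm x z]
  exact fun x hx => (hsub hx).2

end StrongMaximum

section Positive

variable {N : ℕ} {Ω : Set (Euc N)} {f : Euc N → ℝ → ℝ} {a b M : ℝ}

theorem Sol.contDiffOn_two (D : Dom Ω) (A : Nonlin Ω f a b M) {μ κ : ℝ} {w : Euc N → ℝ}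
    (H : Sol Ω μ (fun x => f x (w x) + κ * w x) w) : ContDiffOn ℝ 2 w Ω := by
  obtain ⟨B, hB, hwB⟩ := H.exists_bound D
  obtain ⟨S, hS⟩ := H.bdd
  have hSk : ∀ x ∈ Ω, |f x (w x) + κ * w x - μ * w x| ≤ max B (S + |μ| * B) := fun x hx => by
    refine le_trans ?_ (le_max_right _ _)
    refine (abs_sub _ _).trans ?_
    rw [abs_mul μ]
    gcongr
    exacts [hS x hx, hwB x]
  have hSw : ∀ x ∈ Ω, |w x| ≤ max B (S + |μ| * B) := fun x _ => (hwB x).trans (le_max_left _ _)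
  have h1 := H.weak.contDiffOn_one D.dim D.isOpen H.rhs H.cont.continuousOn hSw hSk
  refine H.weak.contDiffOn_two D.dim D.isOpen ?_ H.cont.continuousOn hSw hSk
  have h2 : ContDiffOn ℝ 1 (fun x => f x (w x)) Ω :=
    A.c1.comp (g := Function.uncurry f) (f := fun x => (x, w x)) (contDiffOn_id.prodMk h1)
      fun x hx => ⟨hx, mem_univ _⟩
  exact h2.add (contDiffOn_const.mul h1)

theorem Sol.isPosSolution (D : Dom Ω) (hc : IsPreconnected Ω) (A : Nonlin Ω f a b M) {lam μ : ℝ}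
    {w : Euc N → ℝ} (H : Sol Ω μ (fun x => f x (w x) + (μ - lam) * w x) w) (h0 : ∀ x, 0 ≤ w x)
    (hne : ∃ x ∈ Ω, w x ≠ 0) : IsPosSolution Ω f lam w := by
  have h2 := H.contDiffOn_two D A
  have heq : ∀ x ∈ Ω, -lap w x + lam * w x = f x (w x) := fun x hx => by
    have := H.weak.neg_lap_add D.isOpen H.rhs h2 x hx
    linarith
  refine ⟨h2, H.cont.continuousOn, ?_, fun x hx => ?_, heq⟩
  · refine strong_maximum D.isOpen hc h2 (abs_nonneg lam) (fun x _ => h0 x) (fun x hx => ?_) hne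
    have h3 := heq x hx
    have h4 := A.nonneg x hx _ (h0 x)
    have h5 : lam * w x ≤ |lam| * w x := mul_le_mul_of_nonneg_right (le_abs_self _) (h0 x)
    linarith
  · rw [D.isOpen.frontier_eq] at hx
    exact H.off x hx.2

theorem IsPosSolution.indicator {lam : ℝ} {u : Euc N → ℝ}
    (H : IsPosSolution Ω f lam u) :
    Continuous (Ω.indicator u) ∧ (∀ x ∈ Ω, 0 < Ω.indicator u x) ∧ ∀ x, 0 ≤ Ω.indicator u x := by
  obtain ⟨-, h2, h3, h4, -⟩ := H
  exact ⟨continuous_indicator_of_frontier h2 h4, fun x hx => by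
    rw [indicator_of_mem hx]; exact h3 x hx, fun x => indicator_nonneg (fun x hx => (h3 x hx).le) x⟩

end Positive

section Bounded

variable {N : ℕ} {Ω : Set (Euc N)}

/-- Measurable and bounded on `Ω`. -/
structure BddOn (Ω : Set (Euc N)) (g : Euc N → ℝ) : Prop where
  aesm : AEStronglyMeasurable g (volume.restrict Ω)
  bdd : ∃ C, ∀ x ∈ Ω, |g x| ≤ C

theorem BddOn.integrable (D : Dom Ω) {g : Euc N → ℝ} (hg : BddOn Ω g) :
    Integrable g (volume.restrict Ω) := by
  obtain ⟨C, hC⟩ := hg.bdd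
  have : IsFiniteMeasure (volume.restrict Ω) := ⟨by
    rw [Measure.restrict_apply_univ]; exact D.bdd.measure_lt_top⟩
  exact Integrable.of_bound hg.aesm C ((ae_restrict_mem D.isOpen.measurableSet).mono hC)

theorem BddOn.add {g k : Euc N → ℝ} (hg : BddOn Ω g) (hk : BddOn Ω k) :
    BddOn Ω (fun x => g x + k x) := by
  obtain ⟨C, hC⟩ := hg.bdd
  obtain ⟨C', hC'⟩ := hk.bdd
  exact ⟨hg.aesm.add hk.aesm, C + C', fun x hx =>
    (abs_add_le _ _).trans (add_le_add (hC x hx) (hC' x hx))⟩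

theorem BddOn.sub {g k : Euc N → ℝ} (hg : BddOn Ω g) (hk : BddOn Ω k) :
    BddOn Ω (fun x => g x - k x) := by
  obtain ⟨C, hC⟩ := hg.bdd
  obtain ⟨C', hC'⟩ := hk.bdd
  exact ⟨hg.aesm.sub hk.aesm, C + C', fun x hx =>
    (abs_sub _ _).trans (add_le_add (hC x hx) (hC' x hx))⟩

theorem BddOn.mul {g k : Euc N → ℝ} (hg : BddOn Ω g) (hk : BddOn Ω k) :
    BddOn Ω (fun x => g x * k x) := by
  obtain ⟨C, hC⟩ := hg.bdd
  obtain ⟨C', hC'⟩ := hk.bdd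
  refine ⟨hg.aesm.mul hk.aesm, C * C', fun x hx => ?_⟩
  rw [abs_mul]
  exact mul_le_mul (hC x hx) (hC' x hx) (abs_nonneg _) ((abs_nonneg _).trans (hC x hx))

theorem bddOn_const (c : ℝ) : BddOn Ω (fun _ => c) :=
  ⟨aestronglyMeasurable_const, |c|, fun _ _ => le_rfl⟩

theorem Sol.bddOn (D : Dom Ω) {μ : ℝ} {h w : Euc N → ℝ} (H : Sol Ω μ h w) :
    BddOn Ω h :=
  ⟨H.rhs.aestronglyMeasurable D.isOpen.measurableSet, H.bdd⟩

/-- Nonnegative continuous functions vanishing outside `Ω`. -/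
structure Adm (Ω : Set (Euc N)) (u : Euc N → ℝ) : Prop where
  cont : Continuous u
  off : ∀ x, x ∉ Ω → u x = 0
  nonneg : ∀ x, 0 ≤ u x

theorem Adm.exists_bound (D : Dom Ω) {u : Euc N → ℝ} (hu : Adm Ω u) :
    ∃ B, 0 < B ∧ ∀ x, u x ≤ B := by
  obtain ⟨B, hB, h⟩ := D.exists_bound_of_continuous hu.cont hu.off
  exact ⟨B, hB, fun x => (le_abs_self _).trans (h x)⟩

theorem Adm.bddOn (D : Dom Ω) {u : Euc N → ℝ} (hu : Adm Ω u) : BddOn Ω u := by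
  obtain ⟨B, hB, h⟩ := D.exists_bound_of_continuous hu.cont hu.off
  exact ⟨hu.cont.aestronglyMeasurable, B, fun x _ => h x⟩

theorem Adm.const_mul {u : Euc N → ℝ} (hu : Adm Ω u) {t : ℝ} (ht : 0 ≤ t) :
    Adm Ω (fun x => t * u x) :=
  ⟨continuous_const.mul hu.cont, fun x hx => by rw [hu.off x hx, mul_zero],
    fun x => mul_nonneg ht (hu.nonneg x)⟩

theorem Sol.adm {μ : ℝ} {h w : Euc N → ℝ} (H : Sol Ω μ h w) (h0 : ∀ x, 0 ≤ w x) : Adm Ω w :=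
  ⟨H.cont, H.off, h0⟩

variable {f : Euc N → ℝ → ℝ} {a b M : ℝ}

theorem Nonlin.bddOn_comp (A : Nonlin Ω f a b M) (D : Dom Ω) {u : Euc N → ℝ} (hu : Adm Ω u) :
    BddOn Ω (fun x => f x (u x)) := by
  obtain ⟨B, hB, h⟩ := hu.exists_bound D
  obtain ⟨L, hL, hf⟩ := A.lip B
  refine ⟨(A.continuousOn_comp subset_rfl hu.cont.continuousOn).aestronglyMeasurable
    D.isOpen.measurableSet, L * B, fun x hx => ?_⟩
  have := hf x hx (u x) 0 (hu.nonneg x) (h x) le_rfl hB.le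
  rw [A.zero x hx, sub_zero, sub_zero, abs_of_nonneg (hu.nonneg x)] at this
  exact this.trans (by gcongr; exact h x)

theorem Nonlin.bddOn_div (A : Nonlin Ω f a b M) (D : Dom Ω) {u : Euc N → ℝ} (hu : Adm Ω u) :
    BddOn Ω (fun x => f x (u x) / u x) := by
  obtain ⟨B, hB, h⟩ := hu.exists_bound D
  obtain ⟨L, hL, hf⟩ := A.lip B
  refine ⟨((A.bddOn_comp D hu).aesm.aemeasurable.div
    hu.cont.measurable.aemeasurable).aestronglyMeasurable, L, fun x hx => ?_⟩
  have := hf x hx (u x) 0 (hu.nonneg x) (h x) le_rfl hB.le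
  rw [A.zero x hx, sub_zero, sub_zero, abs_of_nonneg (hu.nonneg x)] at this
  rw [abs_div, abs_of_nonneg (hu.nonneg x)]
  exact div_le_of_le_mul₀ (hu.nonneg x) hL this

theorem Nonlin.div_mul_eq (A : Nonlin Ω f a b M) {x : Euc N} (hx : x ∈ Ω) (t : ℝ) :
    f x t / t * t = f x t := by
  rcases eq_or_ne t 0 with rfl | ht
  · rw [mul_zero, A.zero x hx]
  · exact div_mul_cancel₀ _ ht

theorem Nonlin.bddOn_prim (A : Nonlin Ω f a b M) (D : Dom Ω) {u : Euc N → ℝ} (hu : Adm Ω u) :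
    BddOn Ω (fun x => prim f x (u x)) := by
  refine ⟨(A.continuousOn_prim D.isOpen hu.cont hu.nonneg).aestronglyMeasurable
    D.isOpen.measurableSet, ?_⟩
  obtain ⟨C, hC⟩ := ((A.bddOn_comp D hu).mul (hu.bddOn D)).bdd
  refine ⟨C, fun x hx => ?_⟩
  have h1 := A.mul_prim_le hx (hu.nonneg x)
  have h2 := A.prim_nonneg hx (hu.nonneg x)
  have h3 := A.two_lt
  rw [abs_of_nonneg h2]
  have h4 := (le_abs_self _).trans (hC x hx)
  nlinarith

theorem Adm.integral_mul_self_pos (D : Dom Ω) {u : Euc N → ℝ} (hu : Adm Ω u)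
    (hne : ∃ x ∈ Ω, u x ≠ 0) : 0 < ∫ x in Ω, u x * u x := by
  obtain ⟨x, hx, hx0⟩ := hne
  refine (setIntegral_pos_iff_support_of_nonneg_ae (ae_of_all _ fun x => mul_self_nonneg _)
    (((hu.bddOn D).mul (hu.bddOn D)).integrable D)).2 ?_
  exact ((hu.cont.mul hu.cont).isOpen_support.inter D.isOpen).measure_pos volume
    ⟨x, mul_ne_zero hx0 hx0, hx⟩

theorem Nonlin.integral_pos (A : Nonlin Ω f a b M) (D : Dom Ω) {u : Euc N → ℝ} (hu : Adm Ω u)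
    (hne : ∃ x ∈ Ω, u x ≠ 0) : 0 < ∫ x in Ω, f x (u x) * u x := by
  have hi := ((A.bddOn_comp D hu).mul (hu.bddOn D)).integrable D
  have h0 : ∀ᵐ x ∂volume.restrict Ω, 0 ≤ f x (u x) * u x :=
    (ae_restrict_mem D.isOpen.measurableSet).mono fun x hx =>
      mul_nonneg (A.nonneg x hx _ (hu.nonneg x)) (hu.nonneg x)
  refine (integral_nonneg_of_ae h0).lt_of_ne fun h => ?_
  have hz := (integral_eq_zero_iff_of_nonneg_ae h0 hi).1 h.symm
  have hz' : ∀ᵐ x ∂volume.restrict Ω, u x * u x = 0 := by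
    filter_upwards [hz, A.pos] with x h1 h2
    rcases (hu.nonneg x).eq_or_lt with h3 | h3
    · rw [← h3, mul_zero]
    · exact absurd h1 (mul_pos (h2 _ h3) h3).ne'
  have := hu.integral_mul_self_pos D hne
  rw [integral_congr_ae hz'] at this
  simp at this

end Bounded

section Iteration

variable {N : ℕ} {Ω : Set (Euc N)} {f : Euc N → ℝ → ℝ} {a b M : ℝ}

def nehariTerm (Ω : Set (Euc N)) (f : Euc N → ℝ → ℝ) (u : Euc N → ℝ) : ℝ :=
  ∫ x in Ω, f x (u x) * u x

def primTerm (Ω : Set (Euc N)) (f : Euc N → ℝ → ℝ) (u : Euc N → ℝ) : ℝ :=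
  ∫ x in Ω, prim f x (u x)

theorem setIntegral_mono_of_bdd (D : Dom Ω) {g k : Euc N → ℝ} (hg : BddOn Ω g) (hk : BddOn Ω k)
    (h : ∀ x ∈ Ω, g x ≤ k x) : ∫ x in Ω, g x ≤ ∫ x in Ω, k x :=
  setIntegral_mono_on (hg.integrable D) (hk.integrable D) D.isOpen.measurableSet h

theorem Nonlin.bddOn_nehari (A : Nonlin Ω f a b M) (D : Dom Ω) {u : Euc N → ℝ} (hu : Adm Ω u) :
    BddOn Ω fun x => f x (u x) * u x := (A.bddOn_comp D hu).mul (hu.bddOn D)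

theorem Nonlin.nehariTerm_smul_le (A : Nonlin Ω f a b M) (D : Dom Ω) {u : Euc N → ℝ}
    (hu : Adm Ω u) {s : ℝ} (hs : 0 < s) (hs1 : s ≤ 1) :
    nehariTerm Ω f (fun x => s * u x) ≤ s ^ a * nehariTerm Ω f u := by
  unfold nehariTerm
  rw [← integral_const_mul]
  refine setIntegral_mono_of_bdd D (A.bddOn_nehari D (hu.const_mul hs.le))
    ((bddOn_const _).mul (A.bddOn_nehari D hu)) fun x hx => ?_
  have e : s ^ a = s ^ (a - 1) * s := by rw [← Real.rpow_add_one hs.ne']; ring_nf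
  have h1 := A.mul_le hx hs.le hs1 (hu.nonneg x)
  calc f x (s * u x) * (s * u x) ≤ s ^ (a - 1) * f x (u x) * (s * u x) :=
        mul_le_mul_of_nonneg_right h1 (mul_nonneg hs.le (hu.nonneg x))
    _ = _ := by rw [e]; ring

theorem Nonlin.le_nehariTerm_smul (A : Nonlin Ω f a b M) (D : Dom Ω) {u : Euc N → ℝ}
    (hu : Adm Ω u) {s : ℝ} (hs1 : 1 ≤ s) :
    s ^ a * nehariTerm Ω f u ≤ nehariTerm Ω f (fun x => s * u x) := by
  have hs : 0 < s := by linarith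
  unfold nehariTerm
  rw [← integral_const_mul]
  refine setIntegral_mono_of_bdd D ((bddOn_const _).mul (A.bddOn_nehari D hu))
    (A.bddOn_nehari D (hu.const_mul hs.le)) fun x hx => ?_
  have e : s ^ a = s ^ (a - 1) * s := by rw [← Real.rpow_add_one hs.ne']; ring_nf
  have h1 := A.le_mul hx hs1 (hu.nonneg x)
  calc s ^ a * (f x (u x) * u x) = s ^ (a - 1) * f x (u x) * (s * u x) := by rw [e]; ring
    _ ≤ _ := mul_le_mul_of_nonneg_right h1 (mul_nonneg hs.le (hu.nonneg x))

theorem Nonlin.continuousOn_nehariTerm (A : Nonlin Ω f a b M) (D : Dom Ω) {u : Euc N → ℝ}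
    (hu : Adm Ω u) (T : ℝ) :
    ContinuousOn (fun t : ℝ => nehariTerm Ω f (fun x => t * u x)) (Icc 0 T) := by
  rcases lt_or_ge T 0 with hT | hT
  · rw [Icc_eq_empty (not_le.2 hT)]; exact continuousOn_empty _
  have hm := ae_restrict_mem (μ := (volume : Measure (Euc N))) D.isOpen.measurableSet
  refine continuousOn_of_dominated (bound := fun x => f x (T * u x) * (T * u x))
    (fun t ht => (A.bddOn_nehari D (hu.const_mul ht.1)).aesm) (fun t ht => hm.mono fun x hx => ?_)
    ((A.bddOn_nehari D (hu.const_mul hT)).integrable D) (hm.mono fun x hx => ?_)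
  · have h0 := hu.nonneg x
    have h1 : t * u x ≤ T * u x := mul_le_mul_of_nonneg_right ht.2 h0
    have h2 : 0 ≤ t * u x := mul_nonneg ht.1 h0
    have h3 := A.nonneg x hx _ h2
    rw [Real.norm_of_nonneg (mul_nonneg h3 h2)]
    exact mul_le_mul (A.mono hx h2 h1) h1 h2 (h3.trans (A.mono hx h2 h1))
  · have := (A.continuous_right hx).comp (continuous_id.mul (continuous_const (y := u x)))
    exact (this.mul (continuous_id.mul continuous_const)).continuousOn

theorem Nonlin.exists_scale (A : Nonlin Ω f a b M) (D : Dom Ω) {u : Euc N → ℝ} (hu : Adm Ω u)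
    (hne : ∃ x ∈ Ω, u x ≠ 0) {K : ℝ} (hK : 0 < K) :
    ∃ t, 0 < t ∧ nehariTerm Ω f (fun x => t * u x) = t ^ 2 * K := by
  have hg : 0 < nehariTerm Ω f u := A.integral_pos D hu hne
  have h2 := A.two_lt
  set r := (K / nehariTerm Ω f u) ^ (1 / (a - 2)) with hr
  have hr0 : 0 < r := by positivity
  have hra : r ^ a * nehariTerm Ω f u = r ^ 2 * K := by
    have e : r ^ a = r ^ 2 * r ^ (a - 2) := by
      rw [← Real.rpow_natCast r 2, ← Real.rpow_add hr0]; norm_num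
    rw [e, hr, ← Real.rpow_mul (by positivity) (1 / (a - 2)), one_div_mul_cancel (by linarith),
      Real.rpow_one]
    field_simp
  have hc : ContinuousOn (fun t : ℝ => nehariTerm Ω f (fun x => t * u x) - t ^ 2 * K)
      (Icc 0 (max 1 r)) :=
    (A.continuousOn_nehariTerm D hu _).sub (by fun_prop)
  have h1 : nehariTerm Ω f (fun x => 1 * u x) = nehariTerm Ω f u := by simp
  rcases le_total r 1 with hr1 | hr1
  · have hK1 : K ≤ nehariTerm Ω f u := by
      have : r ^ a ≤ r ^ 2 := by
        rw [← Real.rpow_natCast r 2]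
        exact Real.rpow_le_rpow_of_exponent_ge hr0 hr1 (by push_cast; linarith)
      have hr2 : 0 < r ^ 2 := by positivity
      nlinarith
    obtain ⟨t, ht, he⟩ := intermediate_value_Icc hr1
      (hc.mono (Icc_subset_Icc hr0.le (le_max_left _ _)))
      (show (0 : ℝ) ∈ Icc _ _ from ⟨by
        have := A.nehariTerm_smul_le D hu hr0 hr1
        linarith, by rw [h1]; linarith⟩)
    exact ⟨t, hr0.trans_le ht.1, sub_eq_zero.1 he⟩
  · have hK1 : nehariTerm Ω f u ≤ K := by
      have : r ^ 2 ≤ r ^ a := by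
        rw [← Real.rpow_natCast r 2]
        exact Real.rpow_le_rpow_of_exponent_le hr1 (by push_cast; linarith)
      have hr2 : 0 < r ^ 2 := by positivity
      nlinarith
    obtain ⟨t, ht, he⟩ := intermediate_value_Icc hr1
      (hc.mono (Icc_subset_Icc zero_le_one (le_max_right _ _)))
      (show (0 : ℝ) ∈ Icc _ _ from ⟨by rw [h1]; linarith, by
        have := A.le_nehariTerm_smul D hu hr1
        linarith⟩)
    exact ⟨t, one_pos.trans_le ht.1, sub_eq_zero.1 he⟩

/-- A nonnegative weak solution on the Nehari constraint. -/
structure Iter (Ω : Set (Euc N)) (f : Euc N → ℝ → ℝ) (μ κ : ℝ) (h u : Euc N → ℝ) : Prop where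
  sol : Sol Ω μ h u
  adm : Adm Ω u
  ne : ∃ x ∈ Ω, u x ≠ 0
  nehari : ∫ x in Ω, h x * u x = nehariTerm Ω f u + κ * ∫ x in Ω, u x * u x

def iterEnergy (Ω : Set (Euc N)) (f : Euc N → ℝ → ℝ) (u : Euc N → ℝ) : ℝ :=
  nehariTerm Ω f u / 2 - primTerm Ω f u

theorem Sol.coercive (D : Dom Ω) {μ κ : ℝ} (hμ : 0 ≤ μ) (hκ : 0 ≤ κ) {h w : Euc N → ℝ}
    (H : Sol Ω μ h w) : (firstEig Ω + μ - κ) / (firstEig Ω + μ) * ∫ x in Ω, h x * w x ≤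
      (∫ x in Ω, h x * w x) - κ * ∫ x in Ω, w x * w x := by
  have h1 := H.poincare D hμ
  have h2 := D.eig
  rw [sub_div, div_self (by positivity), sub_mul, one_mul, div_mul_eq_mul_div]
  have : κ * ∫ x in Ω, w x * w x ≤ κ * (∫ x in Ω, h x * w x) / (firstEig Ω + μ) := by
    rw [le_div_iff₀ (by positivity), mul_assoc]
    gcongr
    linarith
  linarith

theorem integral_smul_mul_smul (g k : Euc N → ℝ) (t : ℝ) :
    ∫ x in Ω, t * g x * (t * k x) = t ^ 2 * ∫ x in Ω, g x * k x := by
  rw [← integral_const_mul]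
  congr 1
  funext x
  ring

theorem Sol.exists_iter (D : Dom Ω) (A : Nonlin Ω f a b M) {μ κ : ℝ} (hμ : 0 ≤ μ)
    (hμκ : κ < firstEig Ω + μ) {h w : Euc N → ℝ} (H : Sol Ω μ h w) (h0 : ∀ x, 0 ≤ w x)
    (hne : ∃ x ∈ Ω, w x ≠ 0) :
    ∃ t, 0 < t ∧ Iter Ω f μ κ (fun x => t * h x) (fun x => t * w x) ∧
      nehariTerm Ω f (fun x => t * w x) =
        t ^ 2 * ((∫ x in Ω, h x * w x) - κ * ∫ x in Ω, w x * w x) := by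
  have hw := H.adm h0
  have hK : 0 < (∫ x in Ω, h x * w x) - κ * ∫ x in Ω, w x * w x := by
    have h1 := H.poincare D hμ
    have h2 := hw.integral_mul_self_pos D hne
    nlinarith
  obtain ⟨t, ht, he⟩ := A.exists_scale D hw hne hK
  refine ⟨t, ht, ⟨H.const_mul D.isOpen t, hw.const_mul ht.le, ?_, ?_⟩, he⟩
  · obtain ⟨x, hx, hx0⟩ := hne
    exact ⟨x, hx, mul_ne_zero ht.ne' hx0⟩
  · rw [he, integral_smul_mul_smul, integral_smul_mul_smul]
    ring

theorem Iter.step (D : Dom Ω) (A : Nonlin Ω f a b M) {μ κ : ℝ} (hμ : 0 ≤ μ) (hκ : 0 ≤ κ)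
    (hμκ : κ < firstEig Ω + μ) {h u : Euc N → ℝ} (H : Iter Ω f μ κ h u) :
    ∃ w t, 0 < t ∧ Sol Ω μ (fun x => f x (u x) + κ * u x) w ∧ (∀ x, 0 ≤ w x) ∧
      Iter Ω f μ κ (fun x => t * (f x (u x) + κ * u x)) (fun x => t * w x) ∧
      nehariTerm Ω f (fun x => t * w x) =
        t ^ 2 * ((∫ x in Ω, (f x (u x) + κ * u x) * w x) - κ * ∫ x in Ω, w x * w x) ∧
      (∫ x in Ω, h x * u x) ≤ ∫ x in Ω, (f x (u x) + κ * u x) * w x ∧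
      iterEnergy Ω f (fun x => t * w x) ≤ iterEnergy Ω f u -
        t ^ 2 / 2 * ((firstEig Ω + μ) * ∫ x in Ω, (w x - u x) * (w x - u x)) := by
  have hFb : BddOn Ω fun x => f x (u x) + κ * u x :=
    (A.bddOn_comp D H.adm).add ((bddOn_const κ).mul (H.adm.bddOn D))
  obtain ⟨S, hS⟩ := hFb.bdd
  have hFc : ContinuousOn (fun x => f x (u x) + κ * u x) Ω :=
    (A.continuousOn_comp subset_rfl H.adm.cont.continuousOn).add
      (continuousOn_const.mul H.adm.cont.continuousOn)
  have hF0 : ∀ x ∈ Ω, 0 ≤ f x (u x) + κ * u x := fun x hx =>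
    add_nonneg (A.nonneg x hx _ (H.adm.nonneg x)) (mul_nonneg hκ (H.adm.nonneg x))
  obtain ⟨w, hw⟩ := D.exists_sol hμ hFc hS
  have hw0 := hw.nonneg D hμ hF0
  have hwa := hw.adm hw0
  have bu := H.adm.bddOn D
  have bw := hwa.bddOn D
  set F : Euc N → ℝ := fun x => f x (u x) + κ * u x with hF
  set P := ∫ x in Ω, F x * w x with hP
  set U := ∫ x in Ω, h x * u x with hU
  have hFu : ∫ x in Ω, F x * u x = U := by
    rw [hU, H.nehari, nehariTerm, ← integral_const_mul, ← integral_add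
      ((A.bddOn_nehari D H.adm).integrable D) (((bddOn_const κ).mul (bu.mul bu)).integrable D)]
    congr 1
    funext x
    simp only [hF]
    ring
  have hsymm : ∫ x in Ω, h x * w x = U := by rw [← hFu]; exact H.sol.symm D hμ hw
  have hdiff : ∫ x in Ω, (F x + (-1) * h x) * (w x + (-1) * u x) = P - U := by
    have e : (fun x => (F x + (-1) * h x) * (w x + (-1) * u x)) =
        fun x => F x * w x - F x * u x - h x * w x + h x * u x := by funext x; ring
    have bh := H.sol.bddOn D
    have i1 := (hFb.mul bw).integrable D
    have i2 := (hFb.mul bu).integrable D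
    have i3 := (bh.mul bw).integrable D
    have i4 := (bh.mul bu).integrable D
    have i5 := ((hFb.mul bw).sub (hFb.mul bu)).integrable D
    have i6 := (((hFb.mul bw).sub (hFb.mul bu)).sub (bh.mul bw)).integrable D
    rw [e, integral_add i6 i4, integral_sub i5 i3, integral_sub i1 i2, hFu, hsymm]
    ring
  have hpoin := (hw.add H.sol (-1)).poincare D hμ
  rw [hdiff] at hpoin
  have hsq : ∫ x in Ω, (w x + -1 * u x) * (w x + -1 * u x) =
      ∫ x in Ω, (w x - u x) * (w x - u x) := by
    congr 1; funext x; ring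
  rw [hsq] at hpoin
  have hUpos : 0 < U := by
    have h1 := H.sol.poincare D hμ
    have h2 := H.adm.integral_mul_self_pos D H.ne
    have h3 := D.eig
    have : 0 < (firstEig Ω + μ) * ∫ x in Ω, u x * u x := by positivity
    exact this.trans_le h1
  have hUP : U ≤ P := by
    have h3 := D.eig
    have : 0 ≤ (firstEig Ω + μ) * ∫ x in Ω, (w x - u x) * (w x - u x) :=
      mul_nonneg (by positivity) (integral_nonneg fun x => mul_self_nonneg _)
    linarith
  have hwne : ∃ x ∈ Ω, w x ≠ 0 := by
    by_contra! hz
    have : P = 0 := by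
      rw [hP, setIntegral_congr_fun D.isOpen.measurableSet
        (g := fun _ => 0) fun x hx => by simp [hz x hx]]
      simp
    linarith
  obtain ⟨t, ht, hI, hn⟩ := hw.exists_iter D A hμ hμκ hw0 hwne
  refine ⟨w, t, ht, hw, hw0, hI, hn, hUP, ?_⟩
  set q : Euc N → ℝ := fun x => f x (u x) / u x with hq
  have bq : BddOn Ω q := A.bddOn_div D H.adm
  have hq0 : ∀ x ∈ Ω, 0 ≤ q x := fun x hx =>
    div_nonneg (A.nonneg x hx _ (H.adm.nonneg x)) (H.adm.nonneg x)
  have hqu : ∀ x ∈ Ω, q x * u x = f x (u x) := fun x hx => A.div_mul_eq hx _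
  have bqw := bq.mul (bw.mul bw)
  have bqu := bq.mul (bu.mul bu)
  set Qw := ∫ x in Ω, q x * (w x * w x) with hQw
  have hQu : ∫ x in Ω, q x * (u x * u x) = nehariTerm Ω f u :=
    setIntegral_congr_fun D.isOpen.measurableSet fun x hx => by
      rw [← mul_assoc, hqu x hx]
  have hquad : 2 * P - U ≤ Qw + κ * ∫ x in Ω, w x * w x := by
    have e : ∀ x ∈ Ω, 2 * (F x * w x) - F x * u x ≤ q x * (w x * w x) + κ * (w x * w x) := by
      intro x hx
      have h1 : 0 ≤ (q x + κ) * ((w x - u x) * (w x - u x)) :=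
        mul_nonneg (add_nonneg (hq0 x hx) hκ) (mul_self_nonneg _)
      have h2 : F x = (q x + κ) * u x := by simp only [hF]; rw [add_mul, hqu x hx]
      rw [h2]
      nlinarith
    have := setIntegral_mono_of_bdd D (((bddOn_const 2).mul (hFb.mul bw)).sub (hFb.mul bu))
      (bqw.add ((bddOn_const κ).mul (bw.mul bw))) e
    rw [integral_sub (((bddOn_const 2).mul (hFb.mul bw)).integrable D)
      ((hFb.mul bu).integrable D), integral_add (bqw.integrable D)
      (((bddOn_const κ).mul (bw.mul bw)).integrable D), integral_const_mul, integral_const_mul,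
      hFu] at this
    exact this
  have hprim : (t ^ 2 * Qw - nehariTerm Ω f u) / 2 ≤
      primTerm Ω f (fun x => t * w x) - primTerm Ω f u := by
    have b1 := A.bddOn_prim D (hwa.const_mul ht.le)
    have b2 := A.bddOn_prim D H.adm
    have e : ∀ x ∈ Ω, t ^ 2 / 2 * (q x * (w x * w x)) - 1 / 2 * (q x * (u x * u x)) ≤
        prim f x (t * w x) - prim f x (u x) := fun x hx => by
      have := A.prim_sub_le hx (H.adm.nonneg x) (mul_nonneg ht.le (hw0 x))
      change q x * ((t * w x) ^ 2 - u x ^ 2) / 2 ≤ _ at this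
      linarith
    have := setIntegral_mono_of_bdd D (((bddOn_const (t ^ 2 / 2)).mul bqw).sub
      ((bddOn_const (1 / 2)).mul bqu)) (b1.sub b2) e
    rw [integral_sub (((bddOn_const (t ^ 2 / 2)).mul bqw).integrable D)
      (((bddOn_const (1 / 2)).mul bqu).integrable D), integral_const_mul, integral_const_mul,
      hQu, integral_sub (b1.integrable D) (b2.integrable D)] at this
    unfold primTerm
    linarith
  unfold iterEnergy
  rw [hn]
  have ht2 : 0 ≤ t ^ 2 / 2 := by positivity
  have key : (firstEig Ω + μ) * ∫ x in Ω, (w x - u x) * (w x - u x) ≤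
    Qw + κ * (∫ x in Ω, w x * w x) - P := by linarith
  have := mul_le_mul_of_nonneg_left key ht2
  linarith

end Iteration

section Bounds

variable {N : ℕ} {Ω : Set (Euc N)} {f : Euc N → ℝ → ℝ} {a b M : ℝ}

theorem rpow_le_one_add_rpow {t p q : ℝ} (ht : 0 ≤ t) (hp : 0 ≤ p) (hpq : p ≤ q) :
    t ^ p ≤ 1 + t ^ q := by
  rcases le_total t 1 with h | h
  · linarith [Real.rpow_le_one ht h hp, Real.rpow_nonneg ht q]
  · linarith [Real.rpow_le_rpow_of_exponent_le h hpq]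

theorem Nonlin.add_le (A : Nonlin Ω f a b M) {x : Euc N} (hx : x ∈ Ω) {t κ κ₀ : ℝ} (ht : 0 ≤ t)
    (hκ : 0 ≤ κ) (hκ₀ : κ ≤ κ₀) : f x t + κ * t ≤ (2 * M + κ₀) * (1 + t ^ (b - 1)) := by
  have h1 := A.le_add hx ht
  have h2 := A.two_lt
  have h3 := A.le
  have h4 := A.M_pos
  have h5 := rpow_le_one_add_rpow ht (by linarith : 0 ≤ a - 1) (by linarith : a - 1 ≤ b - 1)
  have h6 := rpow_le_one_add_rpow ht zero_le_one (by linarith : 1 ≤ b - 1)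
  rw [Real.rpow_one] at h6
  have h7 : κ * t ≤ κ₀ * (1 + t ^ (b - 1)) := mul_le_mul hκ₀ h6 ht (hκ.trans hκ₀)
  nlinarith

theorem Nonlin.exists_exponents (A : Nonlin Ω f a b M) (hN : 2 ≤ N) :
    ∃ m s : ℝ, 2 ≤ m ∧ (3 ≤ N → m < 2 * N / ((N : ℝ) - 2)) ∧ (N : ℝ) / 2 < s ∧
      m / s < b - 1 ∧ b - 2 < m / s := by
  have h2 := A.two_lt
  have h3 := A.le
  have hN' : (2 : ℝ) ≤ N := by exact_mod_cast hN
  obtain ⟨m, hm2, hmb, hm⟩ : ∃ m : ℝ, 2 < m ∧ (N : ℝ) / 2 * (b - 2) < m ∧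
      (3 ≤ N → m < 2 * N / ((N : ℝ) - 2)) := by
    by_cases h : 3 ≤ N
    · have h' : (3 : ℝ) ≤ N := by exact_mod_cast h
      have hb := A.sub h
      have hN2 : 0 < (N : ℝ) - 2 := by linarith
      rw [lt_div_iff₀ hN2] at hb
      obtain ⟨m, h1, h2⟩ := exists_between (show max 2 ((N : ℝ) / 2 * (b - 2)) <
          2 * N / ((N : ℝ) - 2) from by
        rw [max_lt_iff, lt_div_iff₀ hN2, lt_div_iff₀ hN2]
        constructor <;> nlinarith)
      exact ⟨m, (le_max_left _ _).trans_lt h1, (le_max_right _ _).trans_lt h1, fun _ => h2⟩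
    · obtain ⟨m, h1⟩ := exists_gt (max 2 ((N : ℝ) / 2 * (b - 2)))
      exact ⟨m, (le_max_left _ _).trans_lt h1, (le_max_right _ _).trans_lt h1, fun h' => (h h').elim⟩
  have hb2 : 0 < b - 2 := by linarith
  have hb1 : 0 < b - 1 := by linarith
  obtain ⟨s, h1, h2⟩ := exists_between (show max ((N : ℝ) / 2) (m / (b - 1)) < m / (b - 2) from by
    rw [max_lt_iff, lt_div_iff₀ hb2]
    exact ⟨hmb, div_lt_div_of_pos_left (by linarith) hb2 (by linarith)⟩)
  have hs1 := (le_max_left _ _).trans_lt h1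
  have hs2 := (le_max_right _ _).trans_lt h1
  have hs : 0 < s := by linarith
  refine ⟨m, s, hm2.le, hm, hs1, ?_, ?_⟩
  · rw [div_lt_iff₀ hb1] at hs2
    rw [div_lt_iff₀ hs]
    linarith
  · rw [lt_div_iff₀ hb2] at h2
    rw [lt_div_iff₀ hs]
    linarith

theorem Nonlin.exists_sup_gain (A : Nonlin Ω f a b M) (D : Dom Ω) :
    ∃ θ : ℝ, 0 ≤ θ ∧ θ < 1 ∧ ∀ e κ₀ : ℝ, ∃ C, 0 < C ∧ ∀ (μ κ R : ℝ) (h u w : Euc N → ℝ),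
      0 ≤ μ → 0 ≤ κ → κ ≤ κ₀ → Sol Ω μ h u → Adm Ω u → ∫ x in Ω, h x * u x ≤ e →
      (∀ x, u x ≤ R) → Sol Ω μ (fun x => f x (u x) + κ * u x) w → ∀ x, |w x| ≤ C * (1 + R ^ θ) := by
  obtain ⟨m, s, hm2, hm, hs, hms1, hms2⟩ := A.exists_exponents D.dim
  have hN' : (2 : ℝ) ≤ N := by exact_mod_cast D.dim
  have hs1 : 1 < s := by linarith
  have hs0 : 0 < s := by linarith
  have h2 := A.two_lt
  have h3 := A.le
  have hM := A.M_pos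
  set θ := b - 1 - m / s with hθ
  have hθ0 : 0 ≤ θ := by linarith
  have hθs : θ * s = (b - 1) * s - m := by
    rw [hθ, sub_mul, div_mul_cancel₀ _ hs0.ne']
  refine ⟨θ, hθ0, by linarith, fun e κ₀ => ?_⟩
  obtain ⟨Cq, hCq, hq⟩ := D.exists_lq_bound hs
  obtain ⟨Cs, hCs, hsob⟩ := D.sobolev hm2 hm
  obtain ⟨c, hc⟩ : ∃ c, c = 2 * (2 * M + |κ₀|) := ⟨_, rfl⟩
  have hc0 : 0 < c := by rw [hc]; positivity
  obtain ⟨V, hV1, hV2⟩ : ∃ V, volume.real Ω ≤ V ∧ Cs * |e| ^ (m / 2) ≤ V :=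
    ⟨max (volume.real Ω) (Cs * |e| ^ (m / 2)), le_max_left _ _, le_max_right _ _⟩
  have hV0 : 0 ≤ V := measureReal_nonneg.trans hV1
  refine ⟨Cq * (c * V ^ (1 / s)) + 1, by positivity, ?_⟩
  intro μ κ R h u w hμ hκ hκ₀ hu hua he hR hw x
  have hR0 : 0 ≤ R := (hua.nonneg x).trans (hR x)
  have hum : ∫ y in Ω, |u y| ^ m ≤ V := by
    refine (hsob μ h u hμ hu).trans (le_trans ?_ hV2)
    have h0 := hu.energy_nonneg D hμ
    gcongr
    exact he.trans (le_abs_self e)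
  have bF : BddOn Ω fun y => f y (u y) + κ * u y :=
    (A.bddOn_comp D hua).add ((bddOn_const κ).mul (hua.bddOn D))
  have brpow : ∀ {g : Euc N → ℝ} {r : ℝ}, 0 ≤ r → BddOn Ω g → BddOn Ω fun y => |g y| ^ r := by
    intro g r hr hg
    obtain ⟨K, hK⟩ := hg.bdd
    refine ⟨(hg.aesm.norm.aemeasurable.pow_const r).aestronglyMeasurable, K ^ r, fun y hy => ?_⟩
    rw [abs_of_nonneg (by positivity)]
    exact Real.rpow_le_rpow (abs_nonneg _) (hK y hy) hr
  have bum := brpow (by linarith : 0 ≤ m) (hua.bddOn D)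
  have hpt : ∀ y ∈ Ω, |f y (u y) + κ * u y| ^ s ≤ c ^ s * 1 + c ^ s * (R ^ θ) ^ s * |u y| ^ m := by
    intro y hy
    have u0 := hua.nonneg y
    have k1 := A.add_le hy u0 hκ (hκ₀.trans (le_abs_self _))
    have k0 : 0 ≤ f y (u y) + κ * u y := add_nonneg (A.nonneg y hy _ u0) (mul_nonneg hκ u0)
    rw [abs_of_nonneg k0, abs_of_nonneg u0]
    have k2 : f y (u y) + κ * u y ≤ c * max 1 (u y ^ (b - 1)) := by
      refine k1.trans ?_
      have e1 := le_max_left 1 (u y ^ (b - 1))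
      have e2 := le_max_right 1 (u y ^ (b - 1))
      have : 0 < 2 * M + |κ₀| := by positivity
      rw [hc]
      nlinarith
    have k3 : (u y ^ (b - 1)) ^ s ≤ (R ^ θ) ^ s * u y ^ m := by
      rw [← Real.rpow_mul hR0, ← Real.rpow_mul u0, hθs,
        show (b - 1) * s = ((b - 1) * s - m) + m by ring]
      have hnn : 0 ≤ (b - 1) * s - m := by rw [← hθs]; positivity
      rw [Real.rpow_add_of_nonneg u0 hnn (by linarith), add_sub_cancel_right]
      gcongr
      exact hR y
    calc (f y (u y) + κ * u y) ^ s ≤ (c * max 1 (u y ^ (b - 1))) ^ s :=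
          Real.rpow_le_rpow k0 k2 hs0.le
      _ = c ^ s * (max 1 (u y ^ (b - 1))) ^ s := Real.mul_rpow hc0.le (by positivity)
      _ ≤ c ^ s * (1 + (R ^ θ) ^ s * u y ^ m) := by
        gcongr
        rcases le_total 1 (u y ^ (b - 1)) with h | h
        · rw [max_eq_right h]; linarith
        · rw [max_eq_left h, Real.one_rpow]
          have : 0 ≤ (R ^ θ) ^ s * u y ^ m := by positivity
          linarith
      _ = _ := by ring
  have hint : ∫ y in Ω, |f y (u y) + κ * u y| ^ s ≤ (c * (V ^ (1 / s) * (1 + R ^ θ))) ^ s := by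
    have := setIntegral_mono_of_bdd D (brpow hs0.le bF)
      ((bddOn_const (c ^ s * 1)).add ((bddOn_const (c ^ s * (R ^ θ) ^ s)).mul bum)) hpt
    rw [integral_add ((bddOn_const (c ^ s * 1)).integrable D)
      (((bddOn_const (c ^ s * (R ^ θ) ^ s)).mul bum).integrable D),
      integral_const_mul (c ^ s * (R ^ θ) ^ s), setIntegral_const] at this
    refine this.trans ?_
    have hRθ : 0 ≤ R ^ θ := by positivity
    rw [Real.mul_rpow (x := c) (y := V ^ (1 / s) * (1 + R ^ θ)) hc0.le (by positivity),
      Real.mul_rpow (x := V ^ (1 / s)) (y := 1 + R ^ θ) (by positivity) (by positivity),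
      ← Real.rpow_mul hV0, one_div_mul_cancel hs0.ne', Real.rpow_one]
    have k4 := Real.add_rpow_le_rpow_add zero_le_one hRθ hs1.le
    rw [Real.one_rpow] at k4
    have hcs : 0 < c ^ s := by positivity
    have hRs : 0 ≤ (R ^ θ) ^ s := by positivity
    calc volume.real Ω • (c ^ s * 1) + c ^ s * (R ^ θ) ^ s * ∫ y in Ω, |u y| ^ m
        ≤ V * c ^ s + c ^ s * (R ^ θ) ^ s * V := by
          rw [smul_eq_mul, mul_one]
          gcongr
      _ = c ^ s * (V * (1 + (R ^ θ) ^ s)) := by ring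
      _ ≤ _ := by gcongr
  refine (hq μ _ w hμ hw x).trans ?_
  have hRθ : 0 ≤ R ^ θ := by positivity
  have hk : (∫ y in Ω, |f y (u y) + κ * u y| ^ s) ^ (1 / s) ≤ c * (V ^ (1 / s) * (1 + R ^ θ)) := by
    refine (Real.rpow_le_rpow (integral_nonneg fun y => by positivity) hint
      (by positivity)).trans_eq ?_
    rw [← Real.rpow_mul (by positivity), mul_one_div_cancel hs0.ne', Real.rpow_one]
  calc Cq * (∫ y in Ω, |f y (u y) + κ * u y| ^ s) ^ (1 / s)
      ≤ Cq * (c * (V ^ (1 / s) * (1 + R ^ θ))) := by gcongr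
    _ ≤ (Cq * (c * V ^ (1 / s)) + 1) * (1 + R ^ θ) := by nlinarith

theorem exists_rpow_threshold {θ : ℝ} (hθ : θ < 1) (C : ℝ) :
    ∃ R₀ : ℝ, 0 < R₀ ∧ ∀ R, R₀ ≤ R → C * (1 + R ^ θ) < R := by
  have h1 : Tendsto (fun R : ℝ => R ^ (θ - 1)) atTop (𝓝 0) := by
    have := tendsto_rpow_neg_atTop (by linarith : 0 < 1 - θ)
    rwa [neg_sub] at this
  have h2 : Tendsto (fun R : ℝ => C * (R⁻¹ + R ^ (θ - 1))) atTop (𝓝 0) := by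
    simpa using (tendsto_inv_atTop_zero.add h1).const_mul C
  obtain ⟨R₀, h⟩ := ((h2.eventually (gt_mem_nhds one_pos)).and (eventually_gt_atTop 0)).exists_forall_of_atTop
  refine ⟨max R₀ 1, by positivity, fun R hR => ?_⟩
  obtain ⟨k1, k2⟩ := h R ((le_max_left _ _).trans hR)
  have k3 : R ^ θ = R ^ (θ - 1) * R := by
    rw [← Real.rpow_add_one k2.ne']; ring_nf
  have k4 : C * (1 + R ^ θ) = C * (R⁻¹ + R ^ (θ - 1)) * R := by
    rw [k3]; field_simp
  rw [k4]
  nlinarith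

/-- A priori lower bound on the Nehari constraint. -/
theorem Nonlin.exists_nehari_lower (A : Nonlin Ω f a b M) (D : Dom Ω) {μ κ : ℝ} (hμ : 0 ≤ μ)
    (hκ : 0 ≤ κ) (hμκ : κ < firstEig Ω + μ) :
    ∃ γ, 0 < γ ∧ ∀ h u, Iter Ω f μ κ h u → γ ≤ nehariTerm Ω f u := by
  have h2 := A.two_lt
  have h3 := A.le
  have hM := A.M_pos
  have hl := D.eig
  have ha : 3 ≤ N → a < 2 * N / ((N : ℝ) - 2) := fun h => h3.trans_lt (A.sub h)
  obtain ⟨C₁, hC₁, hs₁⟩ := D.sobolev h2.le ha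
  obtain ⟨C₂, hC₂, hs₂⟩ := D.sobolev (h2.le.trans h3) A.sub
  set c := (firstEig Ω + μ - κ) / (firstEig Ω + μ) with hc
  have hc0 : 0 < c := div_pos (by linarith) (by linarith)
  set K := M * (C₁ * (1 / c) ^ (a / 2) + C₂ * (1 / c) ^ (b / 2)) with hK
  have hK0 : 0 < K := by positivity
  refine ⟨min 1 ((1 / K) ^ (1 / (a / 2 - 1))), by positivity, fun h u H => ?_⟩
  set G := nehariTerm Ω f u with hG
  have hG0 : 0 < G := A.integral_pos D H.adm H.ne
  by_contra! hlt
  have hG1 : G ≤ 1 := (hlt.trans_le (min_le_left _ _)).le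
  have hu := H.sol.coercive D hμ hκ
  rw [H.nehari, add_sub_cancel_right, ← H.nehari, ← hc] at hu
  have hE : ∫ x in Ω, h x * u x ≤ 1 / c * G := by
    rw [one_div, inv_mul_eq_div, le_div_iff₀ hc0]; linarith
  have hE0 := H.sol.energy_nonneg D hμ
  have hbig : G ≤ K * G ^ (a / 2) := by
    have brpow : ∀ {r : ℝ}, 0 ≤ r → BddOn Ω fun y => |u y| ^ r := by
      intro r hr
      obtain ⟨B, hB⟩ := (H.adm.bddOn D).bdd
      refine ⟨((H.adm.bddOn D).aesm.norm.aemeasurable.pow_const r).aestronglyMeasurable, B ^ r,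
        fun y hy => ?_⟩
      rw [abs_of_nonneg (by positivity)]
      exact Real.rpow_le_rpow (abs_nonneg _) (hB y hy) hr
    have b1 := brpow (by linarith : 0 ≤ a)
    have b2 := brpow (by linarith : 0 ≤ b)
    have hpt : ∀ x ∈ Ω, f x (u x) * u x ≤ M * |u x| ^ a + M * |u x| ^ b := fun x hx => by
      have u0 := H.adm.nonneg x
      rw [abs_of_nonneg u0]
      refine (mul_le_mul_of_nonneg_right (A.le_add hx u0) u0).trans_eq ?_
      rw [mul_assoc, add_mul, ← Real.rpow_add_one' u0 (by linarith),
        ← Real.rpow_add_one' u0 (by linarith)]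
      ring_nf
    have := setIntegral_mono_of_bdd D (A.bddOn_nehari D H.adm)
      (((bddOn_const M).mul b1).add ((bddOn_const M).mul b2)) hpt
    rw [integral_add (((bddOn_const M).mul b1).integrable D)
      (((bddOn_const M).mul b2).integrable D), integral_const_mul, integral_const_mul] at this
    have k1 : (∫ x in Ω, h x * u x) ^ (a / 2) ≤ (1 / c) ^ (a / 2) * G ^ (a / 2) := by
      rw [← Real.mul_rpow (by positivity) hG0.le]
      gcongr
    have k2 : (∫ x in Ω, h x * u x) ^ (b / 2) ≤ (1 / c) ^ (b / 2) * G ^ (a / 2) := by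
      refine (Real.rpow_le_rpow hE0 hE (by linarith)).trans ?_
      rw [Real.mul_rpow (by positivity) hG0.le]
      gcongr ?_ * ?_
      exact Real.rpow_le_rpow_of_exponent_ge hG0 hG1 (by linarith)
    calc G ≤ _ := this
      _ ≤ M * (C₁ * ((1 / c) ^ (a / 2) * G ^ (a / 2))) +
          M * (C₂ * ((1 / c) ^ (b / 2) * G ^ (a / 2))) := by
        gcongr
        · exact (hs₁ μ h u hμ H.sol).trans (by gcongr)
        · exact (hs₂ μ h u hμ H.sol).trans (by gcongr)
      _ = _ := by rw [hK]; ring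
  have hp : 0 < a / 2 - 1 := by linarith
  have k1 : G ^ (a / 2) = G * G ^ (a / 2 - 1) := by
    rw [mul_comm, ← Real.rpow_add_one hG0.ne']; ring_nf
  have k2 : G ^ (a / 2 - 1) < 1 / K := by
    have := Real.rpow_lt_rpow hG0.le (hlt.trans_le (min_le_right _ _)) hp
    rwa [← Real.rpow_mul (by positivity), one_div_mul_cancel hp.ne', Real.rpow_one] at this
  rw [k1] at hbig
  rw [lt_div_iff₀ hK0] at k2
  nlinarith

end Bounds

section

variable {N : ℕ} {Ω : Set (Euc N)} {f : Euc N → ℝ → ℝ} {a b M : ℝ}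

theorem tendsto_setIntegral_of_bdd (D : Dom Ω) {g : ℕ → Euc N → ℝ} {G : Euc N → ℝ} {B : ℝ}
    (hg : ∀ n, BddOn Ω (g n)) (hB : ∀ n, ∀ x ∈ Ω, |g n x| ≤ B)
    (h : ∀ x ∈ Ω, Tendsto (fun n => g n x) atTop (𝓝 (G x))) :
    Tendsto (fun n => ∫ x in Ω, g n x) atTop (𝓝 (∫ x in Ω, G x)) :=
  tendsto_integral_of_dominated_convergence (fun _ => B) (fun n => (hg n).aesm)
    ((bddOn_const B).integrable D)
    (fun n => (ae_restrict_iff' D.isOpen.measurableSet).2 (Eventually.of_forall (hB n)))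
    ((ae_restrict_iff' D.isOpen.measurableSet).2 (Eventually.of_forall h))

theorem Nonlin.exists_le (A : Nonlin Ω f a b M) (R : ℝ) :
    ∃ S, 0 < S ∧ ∀ x ∈ Ω, ∀ t, 0 ≤ t → t ≤ R → f x t ≤ S := by
  have h2 := A.two_lt
  have h3 := A.le
  have hM := A.M_pos
  refine ⟨2 * M * (1 + |R| ^ (b - 1)), by positivity, fun x hx t ht hR => ?_⟩
  have := A.add_le hx ht le_rfl le_rfl
  simp only [zero_mul, add_zero] at this
  refine this.trans ?_
  gcongr
  · linarith
  · exact hR.trans (le_abs_self R)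

theorem Adm.of_tendsto {u : ℕ → Euc N → ℝ} {U : Euc N → ℝ} (hu : ∀ n, Adm Ω (u n))
    (h : TendstoUniformly u U atTop) : Adm Ω U where
  cont := h.continuous (Frequently.of_forall fun n => (hu n).cont)
  off x hx := tendsto_nhds_unique (h.tendsto_at x)
    (by simp only [(hu _).off x hx]; exact tendsto_const_nhds)
  nonneg x := ge_of_tendsto' (h.tendsto_at x) fun n => (hu n).nonneg x

theorem Adm.tendsto_mass (D : Dom Ω) {u : ℕ → Euc N → ℝ} {U : Euc N → ℝ} {R : ℝ}
    (hu : ∀ n, Adm Ω (u n)) (hR : ∀ n x, u n x ≤ R)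
    (h : ∀ x, Tendsto (fun n => u n x) atTop (𝓝 (U x))) :
    Tendsto (fun n => ∫ x in Ω, u n x * u n x) atTop (𝓝 (∫ x in Ω, U x * U x)) := by
  refine tendsto_setIntegral_of_bdd D (B := R * R) (fun n => ((hu n).bddOn D).mul ((hu n).bddOn D))
    (fun n x _ => ?_) fun x _ => (h x).mul (h x)
  have h0 := (hu n).nonneg x
  rw [abs_of_nonneg (mul_nonneg h0 h0)]
  exact mul_self_le_mul_self h0 (hR n x)

theorem Nonlin.tendsto_nehariTerm (A : Nonlin Ω f a b M) (D : Dom Ω) {u : ℕ → Euc N → ℝ}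
    {U : Euc N → ℝ} {R : ℝ} (hu : ∀ n, Adm Ω (u n)) (hR : ∀ n x, u n x ≤ R)
    (h : ∀ x, Tendsto (fun n => u n x) atTop (𝓝 (U x))) :
    Tendsto (fun n => nehariTerm Ω f (u n)) atTop (𝓝 (nehariTerm Ω f U)) := by
  obtain ⟨S, hS, hSb⟩ := A.exists_le R
  refine tendsto_setIntegral_of_bdd D (B := S * R) (fun n => A.bddOn_nehari D (hu n))
    (fun n x hx => ?_) fun x hx => ?_
  · have h0 := (hu n).nonneg x
    rw [abs_of_nonneg (mul_nonneg (A.nonneg x hx _ h0) h0)]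
    exact mul_le_mul (hSb x hx _ h0 (hR n x)) (hR n x) h0 hS.le
  · exact (((A.continuous_right hx).tendsto _).comp (h x)).mul (h x)

theorem Nonlin.tendstoUniformlyOn_rhs (A : Nonlin Ω f a b M) {u : ℕ → Euc N → ℝ}
    {U : Euc N → ℝ} {R : ℝ} {κ : ℕ → ℝ} {κ₀ : ℝ} (hu : ∀ n, Adm Ω (u n)) (hR : ∀ n x, u n x ≤ R)
    (hκ : Tendsto κ atTop (𝓝 κ₀)) (h : TendstoUniformly u U atTop) :
    TendstoUniformlyOn (fun n x => f x (u n x) + κ n * u n x)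
      (fun x => f x (U x) + κ₀ * U x) atTop Ω := by
  have hU := Adm.of_tendsto hu h
  have hUR : ∀ x, U x ≤ R := fun x => le_of_tendsto' (h.tendsto_at x) fun n => hR n x
  obtain ⟨L, hL, hlip⟩ := A.lip R
  rw [Metric.tendstoUniformlyOn_iff]
  intro ε hε
  rw [Metric.tendstoUniformly_iff] at h
  have h1 := h (ε / 2 / (L + |κ₀| + 1)) (by positivity)
  have h2 := Metric.tendsto_nhds.1 hκ (ε / 2 / (|R| + 1)) (by positivity)
  filter_upwards [h1, h2] with n k1 k2 x hx
  have k1 := k1 x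
  rw [Real.dist_eq] at k1 k2 ⊢
  have k3 := hlip x hx (U x) (u n x) (hU.nonneg x) (hUR x) ((hu n).nonneg x) (hR n x)
  have k4 : |u n x| ≤ |R| := by
    rw [abs_of_nonneg ((hu n).nonneg x)]
    exact (hR n x).trans (le_abs_self R)
  rw [lt_div_iff₀ (by positivity)] at k1 k2
  calc |f x (U x) + κ₀ * U x - (f x (u n x) + κ n * u n x)|
      = |(f x (U x) - f x (u n x)) + κ₀ * (U x - u n x) - (κ n - κ₀) * u n x| := by ring_nf
    _ ≤ |f x (U x) - f x (u n x)| + |κ₀| * |U x - u n x| + |κ n - κ₀| * |u n x| := by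
      rw [← abs_mul, ← abs_mul]
      exact (abs_sub _ _).trans (add_le_add_left (abs_add_le _ _) _)
    _ < ε := by
      have := abs_nonneg (U x - u n x)
      have := abs_nonneg (κ n - κ₀)
      nlinarith [mul_le_mul_of_nonneg_left k4 (abs_nonneg (κ n - κ₀))]

theorem Nonlin.nehariTerm_le (A : Nonlin Ω f a b M) (D : Dom Ω) {u : Euc N → ℝ} (hu : Adm Ω u) :
    nehariTerm Ω f u ≤ 2 * a / (a - 2) * iterEnergy Ω f u := by
  have h2 := A.two_lt
  have h : a * primTerm Ω f u ≤ nehariTerm Ω f u := by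
    rw [primTerm, nehariTerm, ← integral_const_mul]
    exact setIntegral_mono_of_bdd D ((bddOn_const a).mul (A.bddOn_prim D hu)) (A.bddOn_nehari D hu)
      fun x hx => A.mul_prim_le hx (hu.nonneg x)
  rw [iterEnergy, div_mul_eq_mul_div, le_div_iff₀ (by linarith)]
  nlinarith

theorem Iter.energy_le (D : Dom Ω) {μ κ : ℝ} (hμ : 0 ≤ μ) (hκ : 0 ≤ κ)
    (hμκ : κ < firstEig Ω + μ) {h u : Euc N → ℝ} (H : Iter Ω f μ κ h u) :
    ∫ x in Ω, h x * u x ≤ (firstEig Ω + μ) / (firstEig Ω + μ - κ) * nehariTerm Ω f u := by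
  have h1 := H.sol.coercive D hμ hκ
  have := H.nehari
  have h2 : 0 < firstEig Ω + μ := by linarith [D.eig]
  rw [div_mul_eq_mul_div, div_le_iff₀ h2] at h1
  rw [div_mul_eq_mul_div, le_div_iff₀ (by linarith)]
  nlinarith

theorem eq_of_integral_sq_eq_zero (D : Dom Ω) {u v : Euc N → ℝ} (hu : Adm Ω u) (hv : Adm Ω v)
    (h : ∫ x in Ω, (u x - v x) * (u x - v x) = 0) : u = v := by
  have hA : Adm Ω fun x => |u x - v x| := ⟨(hu.cont.sub hv.cont).abs,
    fun x hx => by simp [hu.off x hx, hv.off x hx], fun x => abs_nonneg _⟩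
  by_contra hne
  obtain ⟨x, hx⟩ := Function.ne_iff.1 hne
  have hxΩ : x ∈ Ω := by
    by_contra hc
    exact hx (by rw [hu.off x hc, hv.off x hc])
  have := hA.integral_mul_self_pos D ⟨x, hxΩ, abs_ne_zero.2 (sub_ne_zero.2 hx)⟩
  simp only [abs_mul_abs_self] at this
  linarith

end

section

variable {N : ℕ} {Ω : Set (Euc N)} {f : Euc N → ℝ → ℝ} {a b M : ℝ}

/-- Existence of a fixed point of the solution operator with a Nehari bound, as the limit of the
rescaled fixed-point iteration. -/
theorem Sol.exists_fixed (D : Dom Ω) (A : Nonlin Ω f a b M) {μ κ : ℝ} (hμ : 0 ≤ μ) (hκ : 0 ≤ κ)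
    (hμκ : κ < firstEig Ω + μ) {h₀ ψ : Euc N → ℝ} (H₀ : Sol Ω μ h₀ ψ) (hψ : ∀ x, 0 ≤ ψ x)
    (hne : ∃ x ∈ Ω, ψ x ≠ 0) :
    ∃ U t, 0 < t ∧ Sol Ω μ (fun x => f x (U x) + κ * U x) U ∧ Adm Ω U ∧ (∃ x ∈ Ω, U x ≠ 0) ∧
      nehariTerm Ω f U ≤ 2 * a / (a - 2) *
        (t ^ 2 / 2 * ((∫ x in Ω, h₀ x * ψ x) - κ * ∫ x in Ω, ψ x * ψ x) -
          primTerm Ω f (fun x => t * ψ x)) := by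
  have h2 := A.two_lt
  have hl := D.eig
  obtain ⟨t₀, ht₀, I₀, hn₀⟩ := H₀.exists_iter D A hμ hμκ hψ hne
  set E₀ := iterEnergy Ω f (fun x => t₀ * ψ x) with hE₀
  have hstep := fun q : {q : (Euc N → ℝ) × (Euc N → ℝ) // Iter Ω f μ κ q.1 q.2} =>
    q.2.step D A hμ hκ hμκ
  choose W T hT hWs hW0 hI hneh hinc hen using hstep
  let st : ℕ → {q : (Euc N → ℝ) × (Euc N → ℝ) // Iter Ω f μ κ q.1 q.2} := fun n =>
    Nat.rec ⟨(_, _), I₀⟩ (fun _ q => ⟨(_, _), hI q⟩) n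
  obtain ⟨h, u, w, t, hu0, hu1, hh1, hIt, ht, hws, hw0, hneh, hinc, hen⟩ :
      ∃ (h u w : ℕ → Euc N → ℝ) (t : ℕ → ℝ), u 0 = (fun x => t₀ * ψ x) ∧
        (∀ n, u (n + 1) = fun x => t n * w n x) ∧
        (∀ n, h (n + 1) = fun x => t n * (f x (u n x) + κ * u n x)) ∧
        (∀ n, Iter Ω f μ κ (h n) (u n)) ∧ (∀ n, 0 < t n) ∧
        (∀ n, Sol Ω μ (fun x => f x (u n x) + κ * u n x) (w n)) ∧ (∀ n x, 0 ≤ w n x) ∧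
        (∀ n, nehariTerm Ω f (u (n + 1)) = t n ^ 2 *
          ((∫ x in Ω, (f x (u n x) + κ * u n x) * w n x) - κ * ∫ x in Ω, w n x * w n x)) ∧
        (∀ n, ∫ x in Ω, h n x * u n x ≤ ∫ x in Ω, (f x (u n x) + κ * u n x) * w n x) ∧
        (∀ n, iterEnergy Ω f (u (n + 1)) ≤ iterEnergy Ω f (u n) -
          t n ^ 2 / 2 * ((firstEig Ω + μ) *
            ∫ x in Ω, (w n x - u n x) * (w n x - u n x))) :=
    ⟨fun n => (st n).1.1, fun n => (st n).1.2, fun n => W (st n), fun n => T (st n), rfl,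
      fun _ => rfl, fun _ => rfl, fun n => (st n).2, fun n => hT _, fun n => hWs _,
      fun n => hW0 _, fun n => hneh _, fun n => hinc _, fun n => hen _⟩
  clear_value st
  clear st hI
  -- bounds on the energy
  have hint0 : ∀ n, 0 ≤ ∫ x in Ω, (w n x - u n x) * (w n x - u n x) := fun n =>
    integral_nonneg fun x => mul_self_nonneg _
  have hanti : Antitone fun n => iterEnergy Ω f (u n) := antitone_nat_of_succ_le fun n => by
    refine (hen n).trans (sub_le_self _ ?_)
    have := hint0 n
    positivity
  have hE : ∀ n, iterEnergy Ω f (u n) ≤ E₀ := fun n => by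
    have := hanti (Nat.zero_le n)
    simpa only [hu0] using this
  obtain ⟨γ, hγ, hγl⟩ := A.exists_nehari_lower D hμ hκ hμκ
  have hγl : ∀ n, γ ≤ nehariTerm Ω f (u n) := fun n => hγl _ _ (hIt n)
  have ha2 : 0 < 2 * a / (a - 2) := div_pos (by linarith) (by linarith)
  set G := 2 * a / (a - 2) * E₀ with hG
  have hGu : ∀ n, nehariTerm Ω f (u n) ≤ G := fun n =>
    (A.nehariTerm_le D (hIt n).adm).trans (mul_le_mul_of_nonneg_left (hE n) ha2.le)
  have hG0 : 0 < G := hγ.trans_le ((hγl 0).trans (hGu 0))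
  have hEpos : ∀ n, 0 ≤ iterEnergy Ω f (u n) := fun n => by
    by_contra hc
    have := A.nehariTerm_le D (hIt n).adm
    have := hγl n
    nlinarith [mul_neg_of_pos_of_neg ha2 (not_le.1 hc)]
  have hr0 : 0 < (firstEig Ω + μ) / (firstEig Ω + μ - κ) := div_pos (by linarith) (by linarith)
  set r := (firstEig Ω + μ) / (firstEig Ω + μ - κ) with hr
  have hen' : ∀ n, ∫ x in Ω, h n x * u n x ≤ r * G := fun n =>
    ((hIt n).energy_le D hμ hκ hμκ).trans (mul_le_mul_of_nonneg_left (hGu n) hr0.le)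
  -- bounds on the scaling factors
  set c := (firstEig Ω + μ - κ) / (firstEig Ω + μ) with hc
  have hc0 : 0 < c := div_pos (by linarith) (by linarith)
  have hK : ∀ n, c * γ ≤ (∫ x in Ω, (f x (u n x) + κ * u n x) * w n x) -
      κ * ∫ x in Ω, w n x * w n x := fun n => by
    refine le_trans ?_ ((hws n).coercive D hμ hκ)
    refine mul_le_mul_of_nonneg_left (le_trans ?_ (hinc n)) hc0.le
    rw [(hIt n).nehari]
    have : 0 ≤ ∫ x in Ω, u n x * u n x := integral_nonneg fun x => mul_self_nonneg _
    have := hγl n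
    nlinarith [mul_nonneg hκ ‹0 ≤ ∫ x in Ω, u n x * u n x›]
  have ht2 : ∀ n, t n ^ 2 * (c * γ) ≤ G := fun n => by
    refine le_trans ?_ (hGu (n + 1))
    rw [hneh n]
    exact mul_le_mul_of_nonneg_left (hK n) (sq_nonneg _)
  obtain ⟨τ, hτ, htτ⟩ : ∃ τ, 0 < τ ∧ ∀ n, t n ≤ τ := by
    refine ⟨G / (c * γ) + 1, by positivity, fun n => ?_⟩
    have h1 := ht2 n
    rw [← le_div_iff₀ (by positivity)] at h1
    have : 0 < G / (c * γ) := by positivity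
    nlinarith [ht n]
  -- sup bounds
  obtain ⟨θ, hθ0, hθ1, hsup⟩ := A.exists_sup_gain D
  obtain ⟨C, hC, hsup⟩ := hsup (r * G) κ
  obtain ⟨R₀, hR₀, hthr⟩ := exists_rpow_threshold hθ1 (τ * C)
  obtain ⟨B, hB, hBu⟩ := (hIt 0).adm.exists_bound D
  obtain ⟨R, hR1, hR2⟩ : ∃ R, R₀ ≤ R ∧ B ≤ R := ⟨max R₀ B, le_max_left _ _, le_max_right _ _⟩
  have hR0 : 0 ≤ R := hB.le.trans hR2
  have hwb' : ∀ n, (∀ x, u n x ≤ R) → ∀ x, |w n x| ≤ C * (1 + R ^ θ) := fun n hn =>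
    hsup μ κ R (h n) (u n) (w n) hμ hκ le_rfl (hIt n).sol (hIt n).adm (hen' n) hn (hws n)
  have huR : ∀ n x, u n x ≤ R := by
    intro n
    induction n with
    | zero => exact fun x => (hBu x).trans hR2
    | succ n ih =>
      intro x
      have h1 := hwb' n ih x
      rw [abs_of_nonneg (hw0 n x)] at h1
      rw [hu1]
      calc t n * w n x ≤ τ * (C * (1 + R ^ θ)) := mul_le_mul (htτ n) h1 (hw0 n x) hτ.le
        _ = τ * C * (1 + R ^ θ) := by ring
        _ ≤ R := (hthr R hR1).le
  have hwb : ∀ n x, |w n x| ≤ C * (1 + R ^ θ) := fun n => hwb' n (huR n)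
  obtain ⟨S₁, hS₁, hS₁b⟩ := A.exists_le R
  obtain ⟨S, hS, hSb⟩ : ∃ S, 0 < S ∧ ∀ n, ∀ x ∈ Ω, |f x (u n x) + κ * u n x| ≤ S := by
    refine ⟨S₁ + κ * R, by positivity, fun n x hx => ?_⟩
    have hux := (hIt n).adm.nonneg x
    rw [abs_of_nonneg (add_nonneg (A.nonneg x hx _ hux) (mul_nonneg hκ hux))]
    exact add_le_add (hS₁b x hx _ hux (huR n x)) (mul_le_mul_of_nonneg_left (huR n x) hκ)
  -- lower bound on the scaling factors
  obtain ⟨P, hP, hPb⟩ : ∃ P, 0 < P ∧ ∀ n, γ ≤ t n ^ 2 * P := by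
    refine ⟨volume.real Ω * (S * (C * (1 + R ^ θ))) + 1, by positivity, fun n => ?_⟩
    have h1 := hγl (n + 1)
    rw [hneh n] at h1
    refine h1.trans (mul_le_mul_of_nonneg_left ?_ (sq_nonneg _))
    have h3 : 0 ≤ ∫ x in Ω, w n x * w n x := integral_nonneg fun x => mul_self_nonneg _
    have h4 := setIntegral_mono_of_bdd D
      (((hws n).bddOn D).mul (((hws n).adm (hw0 n)).bddOn D))
      (bddOn_const (S * (C * (1 + R ^ θ)))) fun x hx => by
        refine (le_abs_self _).trans ?_
        rw [abs_mul]
        exact mul_le_mul (hSb n x hx) (hwb n x) (abs_nonneg _) hS.le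
    rw [setIntegral_const, smul_eq_mul] at h4
    nlinarith [mul_nonneg hκ h3]
  -- the increments tend to zero
  have hdiff : Tendsto (fun n => ∫ x in Ω, (w n x - u n x) * (w n x - u n x)) atTop (𝓝 0) := by
    have h1 := tendsto_atTop_ciInf hanti ⟨0, by rintro _ ⟨n, rfl⟩; exact hEpos n⟩
    have h3 := (h1.sub (h1.comp (tendsto_add_atTop_nat 1))).mul_const
      (2 * P / (γ * (firstEig Ω + μ)))
    simp only [sub_self, zero_mul] at h3
    refine squeeze_zero hint0 (fun n => ?_) h3
    have h4 := hen n
    have h5 := hPb n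
    have h6 := hint0 n
    have h7 : 0 < firstEig Ω + μ := by linarith
    rw [Function.comp_apply, ← mul_div_assoc, le_div_iff₀ (by positivity)]
    nlinarith [mul_le_mul_of_nonneg_right h5 (mul_nonneg h7.le h6)]
  -- passage to the limit
  obtain ⟨V, φ, hφ, hVc, hV0, hV⟩ := D.exists_subseq (S := τ * S) hμ (fun n => h (n + 1))
    (fun n => u (n + 1)) (fun n x hx => by
      rw [hh1, abs_mul, abs_of_pos (ht n)]
      exact mul_le_mul (htτ n) (hSb n x hx) (abs_nonneg _) hτ.le) fun n => (hIt (n + 1)).sol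
  obtain ⟨W', φ', hφ', hWc', hW0', hW'⟩ := D.exists_subseq (S := S) hμ
    (fun n x => f x (u (φ n + 1) x) + κ * u (φ n + 1) x)
    (fun n => w (φ n + 1)) (fun n => hSb _) fun n => hws _
  obtain ⟨k, hk, hkV, hkW⟩ : ∃ k : ℕ → ℕ, Tendsto k atTop atTop ∧
      TendstoUniformly (fun n => u (k n)) V atTop ∧
      TendstoUniformly (fun n => w (k n)) W' atTop := by
    refine ⟨fun n => φ (φ' n) + 1, ?_, ?_, hW'⟩
    · exact (tendsto_add_atTop_nat 1).comp (hφ.tendsto_atTop.comp hφ'.tendsto_atTop)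
    · exact fun s hs => hφ'.tendsto_atTop.eventually (hV s hs)
  have hVA : Adm Ω V := Adm.of_tendsto (fun n => (hIt (k n)).adm) hkV
  have hWA : Adm Ω W' := Adm.of_tendsto (fun n => (hws (k n)).adm (hw0 _)) hkW
  have hWV : W' = V := by
    refine eq_of_integral_sq_eq_zero D hWA hVA (tendsto_nhds_unique ?_ (hdiff.comp hk))
    have bw := fun n => (((hws (k n)).adm (hw0 _)).bddOn D).sub ((hIt (k n)).adm.bddOn D)
    refine tendsto_setIntegral_of_bdd D (B := (C * (1 + R ^ θ) + R) * (C * (1 + R ^ θ) + R))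
      (fun n => (bw n).mul (bw n)) (fun n x _ => ?_) fun x _ =>
        ((hkW.tendsto_at x).sub (hkV.tendsto_at x)).mul ((hkW.tendsto_at x).sub (hkV.tendsto_at x))
    rw [abs_mul]
    have h1 : |w (k n) x - u (k n) x| ≤ C * (1 + R ^ θ) + R := by
      refine (abs_sub _ _).trans (add_le_add (hwb _ x) ?_)
      rw [abs_of_nonneg ((hIt _).adm.nonneg x)]
      exact huR _ x
    exact mul_self_le_mul_self (abs_nonneg _) h1
  have hrhs := A.tendstoUniformlyOn_rhs (κ := fun _ => κ) (fun n => (hIt (k n)).adm)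
    (fun n => huR (k n)) tendsto_const_nhds hkV
  have hSol := D.sol_of_tendsto hμ (fun n => hws (k n)) hrhs fun x => hkW.tendsto_at x
  rw [hWV] at hSol
  have hlim := A.tendsto_nehariTerm D (fun n => (hIt (k n)).adm) (fun n => huR (k n))
    fun x => hkV.tendsto_at x
  refine ⟨V, t₀, ht₀, hSol, hVA, ?_, ?_⟩
  · by_contra! hz
    have h1 : nehariTerm Ω f V = 0 :=
      setIntegral_eq_zero_of_forall_eq_zero fun x hx => by rw [hz x hx, mul_zero]
    have := ge_of_tendsto' hlim fun n => hγl (k n)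
    linarith
  · refine (le_of_tendsto' hlim fun n => hGu (k n)).trans_eq ?_
    rw [hG, hE₀, iterEnergy, hn₀]
    ring

end

section

variable {N : ℕ} {Ω : Set (Euc N)} {f : Euc N → ℝ → ℝ} {d : Euc N → ℝ} {g : Euc N → ℝ → ℝ}
  {p : ℝ} {u : ℝ → Euc N → ℝ} {a b M : ℝ}

theorem Standing.eq_indicator (H : Standing N Ω f d g p u) (A : Nonlin Ω f a b M) {lam μ : ℝ}
    (hlam : -firstEig Ω < lam) {U : Euc N → ℝ}
    (hU : Sol Ω μ (fun x => f x (U x) + (μ - lam) * U x) U) (h0 : ∀ x, 0 ≤ U x)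
    (hne : ∃ x ∈ Ω, U x ≠ 0) : U = Ω.indicator (u lam) := by
  have h := (H.sol lam hlam).2 U (hU.isPosSolution H.dom H.conn.isPreconnected A h0 hne)
  ext x
  by_cases hx : x ∈ Ω
  · rw [indicator_of_mem hx, h (subset_closure hx)]
  · rw [indicator_of_notMem hx, hU.off x hx]

/-- The positive solution is a weak solution and satisfies the minimax bound. -/
theorem Standing.nehariTerm_le (H : Standing N Ω f d g p u) (A : Nonlin Ω f a b M) {lam μ : ℝ}
    (hlam : -firstEig Ω < lam) (hμ : 0 ≤ μ) (hle : lam ≤ μ) {h₀ ψ : Euc N → ℝ}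
    (H₀ : Sol Ω μ h₀ ψ) (hψ : ∀ x, 0 ≤ ψ x) (hne : ∃ x ∈ Ω, ψ x ≠ 0) :
    Sol Ω μ (fun x => f x (Ω.indicator (u lam) x) + (μ - lam) * Ω.indicator (u lam) x)
      (Ω.indicator (u lam)) ∧
    ∃ t, 0 < t ∧ nehariTerm Ω f (Ω.indicator (u lam)) ≤ 2 * a / (a - 2) *
        (t ^ 2 / 2 * ((∫ x in Ω, h₀ x * ψ x) - (μ - lam) * ∫ x in Ω, ψ x * ψ x) -
          primTerm Ω f (fun x => t * ψ x)) := by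
  obtain ⟨U, t, ht, hS, hA, hne', hn⟩ :=
    H₀.exists_fixed H.dom A hμ (sub_nonneg.2 hle) (by linarith : μ - lam < firstEig Ω + μ) hψ hne
  rw [← H.eq_indicator A hlam hS hA.nonneg hne']
  exact ⟨hS, t, ht, hn⟩

theorem exists_bump {Ω : Set (Euc N)} (hΩ : IsOpen Ω) {x : Euc N} (hx : x ∈ Ω) :
    ∃ ψ : Euc N → ℝ, ContDiff ℝ 2 ψ ∧ tsupport ψ ⊆ Ω ∧ (∀ y, 0 ≤ ψ y) ∧ ψ x = 1 := by
  obtain ⟨ψ, h1, _, h3, h4, h5⟩ := exists_contDiff_tsupport_subset (n := 2) (hΩ.mem_nhds hx)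
  exact ⟨ψ, h3, h1, fun y => (h4 ⟨y, rfl⟩).1, h5⟩

theorem Standing.sol_indicator (H : Standing N Ω f d g p u) (A : Nonlin Ω f a b M) {lam μ : ℝ}
    (hlam : -firstEig Ω < lam) (hμ : 0 ≤ μ) (hle : lam ≤ μ) :
    Sol Ω μ (fun x => f x (Ω.indicator (u lam) x) + (μ - lam) * Ω.indicator (u lam) x)
      (Ω.indicator (u lam)) := by
  obtain ⟨x, hx⟩ := H.conn.nonempty
  obtain ⟨ψ, h1, h2, h3, h4⟩ := exists_bump H.isOpen hx
  exact (H.nehariTerm_le A hlam hμ hle (sol_of_contDiff H.isOpen H.bdd h1 h2) h3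
    ⟨x, hx, by rw [h4]; exact one_ne_zero⟩).1

theorem Standing.adm (H : Standing N Ω f d g p u) {lam : ℝ} (hlam : -firstEig Ω < lam) :
    Adm Ω (Ω.indicator (u lam)) :=
  have h := (H.sol lam hlam).1.indicator
  ⟨h.1, fun _ hx => indicator_of_notMem hx _, h.2.2⟩

/-- The mass of the positive solution. -/
def mass (Ω : Set (Euc N)) (u : ℝ → Euc N → ℝ) (lam : ℝ) : ℝ :=
  ∫ x in Ω, Ω.indicator (u lam) x * Ω.indicator (u lam) x

theorem Standing.mass_eq (H : Standing N Ω f d g p u) (lam : ℝ) :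
    ∫ x in Ω, u lam x ^ 2 = mass Ω u lam :=
  setIntegral_congr_fun H.isOpen.measurableSet fun x hx => by
    simp only [indicator_of_mem hx, sq]

theorem Standing.mass_pos (H : Standing N Ω f d g p u) {lam : ℝ} (hlam : -firstEig Ω < lam) :
    0 < mass Ω u lam := by
  obtain ⟨x, hx⟩ := H.conn.nonempty
  exact (H.adm hlam).integral_mul_self_pos H.dom
    ⟨x, hx, ((H.sol lam hlam).1.indicator.2.1 x hx).ne'⟩

theorem Standing.iter (H : Standing N Ω f d g p u) (A : Nonlin Ω f a b M) {lam μ : ℝ}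
    (hlam : -firstEig Ω < lam) (hμ : 0 ≤ μ) (hle : lam ≤ μ) :
    Iter Ω f μ (μ - lam)
      (fun x => f x (Ω.indicator (u lam) x) + (μ - lam) * Ω.indicator (u lam) x)
      (Ω.indicator (u lam)) where
  sol := H.sol_indicator A hlam hμ hle
  adm := H.adm hlam
  ne := by
    obtain ⟨x, hx⟩ := H.conn.nonempty
    exact ⟨x, hx, ((H.sol lam hlam).1.indicator.2.1 x hx).ne'⟩
  nehari := by
    have h1 := (A.bddOn_nehari H.dom (H.adm hlam)).integrable H.dom
    have h2 := (((H.adm hlam).bddOn H.dom).mul ((H.adm hlam).bddOn H.dom)).integrable H.dom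
    rw [nehariTerm, ← integral_const_mul, ← integral_add h1 (h2.const_mul _)]
    exact integral_congr_ae (Eventually.of_forall fun x => by ring)

end

section

variable {N : ℕ} {Ω : Set (Euc N)} {f : Euc N → ℝ → ℝ} {a b M : ℝ}

theorem Nonlin.le_prim (A : Nonlin Ω f a b M) {x : Euc N} (hx : x ∈ Ω) {s t : ℝ} (hs : 0 ≤ s)
    (ht : 0 ≤ t) : f x s / s * (t ^ 2 - s ^ 2) / 2 ≤ prim f x t :=
  (A.prim_sub_le hx hs ht).trans (sub_le_self _ (A.prim_nonneg hx hs))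

theorem Nonlin.exists_minimax_bound (A : Nonlin Ω f a b M) (D : Dom Ω) {ψ : Euc N → ℝ}
    (hψ : Adm Ω ψ) (hne : ∃ x ∈ Ω, ψ x ≠ 0) (K : ℝ) :
    ∃ E, ∀ t, 0 < t → t ^ 2 / 2 * K - primTerm Ω f (fun x => t * ψ x) ≤ E := by
  have h2 := A.two_lt
  set c := primTerm Ω f (fun x => 2 * ψ x) with hc
  have hc0 : 0 < c := by
    have h1 : 3 / 2 * nehariTerm Ω f ψ ≤ c := by
      rw [hc, nehariTerm, primTerm, ← integral_const_mul]
      refine setIntegral_mono_of_bdd D ((bddOn_const _).mul (A.bddOn_nehari D hψ))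
        (A.bddOn_prim D (hψ.const_mul zero_le_two)) fun x hx => ?_
      refine le_trans (le_of_eq ?_) (A.le_prim hx (hψ.nonneg x) (t := 2 * ψ x) (by
        have := hψ.nonneg x; positivity))
      linear_combination -(3 / 2 * ψ x) * A.div_mul_eq hx (ψ x)
    have := A.integral_pos D hψ hne
    rw [← nehariTerm] at this
    linarith
  obtain ⟨Λ, hΛ1, hΛ⟩ := ((eventually_ge_atTop (1 : ℝ)).and
    ((tendsto_rpow_atTop (by linarith : 0 < a - 2)).eventually_ge_atTop (2 * K / c))).exists
  rw [div_le_iff₀ hc0] at hΛ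
  refine ⟨2 * Λ ^ 2 * |K|, fun t ht => ?_⟩
  have hK := le_abs_self K
  rcases le_total t (2 * Λ) with h | h
  · have hp : 0 ≤ primTerm Ω f (fun x => t * ψ x) :=
      setIntegral_nonneg D.isOpen.measurableSet fun x hx =>
        A.prim_nonneg hx (mul_nonneg ht.le (hψ.nonneg x))
    have : t ^ 2 / 2 * K ≤ t ^ 2 / 2 * |K| := by gcongr
    have : t ^ 2 / 2 * |K| ≤ (2 * Λ) ^ 2 / 2 * |K| := by gcongr
    nlinarith
  · have ht2 : Λ ≤ t / 2 := by linarith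
    have h1 : (t / 2) ^ a * c ≤ primTerm Ω f (fun x => t * ψ x) := by
      rw [hc, primTerm, primTerm, ← integral_const_mul]
      refine setIntegral_mono_of_bdd D ((bddOn_const _).mul
        (A.bddOn_prim D (hψ.const_mul zero_le_two)))
        (A.bddOn_prim D (hψ.const_mul ht.le)) fun x hx => ?_
      have := A.le_prim_mul hx (hΛ1.trans ht2) (t := 2 * ψ x) (by
        have := hψ.nonneg x; positivity)
      rwa [show t / 2 * (2 * ψ x) = t * ψ x by ring] at this
    have h3 : Λ ^ (a - 2) * (t / 2) ^ 2 ≤ (t / 2) ^ a := by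
      rw [show a = (a - 2) + 2 by ring, Real.rpow_add (by linarith), add_sub_cancel_right,
        Real.rpow_two]
      gcongr
    have h4 : 0 ≤ 2 * Λ ^ 2 * |K| := by positivity
    have h5 : 2 * K * (t / 2) ^ 2 ≤ (t / 2) ^ a * c := by
      calc 2 * K * (t / 2) ^ 2 ≤ Λ ^ (a - 2) * c * (t / 2) ^ 2 := by gcongr
        _ = Λ ^ (a - 2) * (t / 2) ^ 2 * c := by ring
        _ ≤ _ := by gcongr
    nlinarith

theorem Nonlin.exists_sup_bound (A : Nonlin Ω f a b M) (D : Dom Ω) (e κ₀ : ℝ) :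
    ∃ R, 0 < R ∧ ∀ (μ κ : ℝ) (u : Euc N → ℝ), 0 ≤ μ → 0 ≤ κ → κ ≤ κ₀ →
      Sol Ω μ (fun x => f x (u x) + κ * u x) u → Adm Ω u →
      ∫ x in Ω, (f x (u x) + κ * u x) * u x ≤ e → ∀ x, u x ≤ R := by
  obtain ⟨θ, hθ0, hθ1, hsup⟩ := A.exists_sup_gain D
  obtain ⟨C, hC, hsup⟩ := hsup e κ₀
  obtain ⟨R, hR, hthr⟩ := exists_rpow_threshold hθ1 C
  refine ⟨R, hR, fun μ κ u hμ hκ hκ₀ hS hA he x => ?_⟩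
  obtain ⟨B, hB, hBu⟩ := hA.exists_bound D
  have hle : ∀ x, u x ≤ ⨆ y, u y := le_ciSup ⟨B, by rintro _ ⟨y, rfl⟩; exact hBu y⟩
  have hsup' : ⨆ y, u y ≤ C * (1 + (⨆ y, u y) ^ θ) := ciSup_le fun y =>
    (le_abs_self _).trans (hsup μ κ _ _ u u hμ hκ hκ₀ hS hA he hle hS y)
  by_contra! hc
  exact absurd hsup' (not_le.2 (hthr _ (hc.le.trans (hle x))))

theorem Nonlin.nehariTerm_le_of_le (A : Nonlin Ω f a b M) (D : Dom Ω) {u : Euc N → ℝ}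
    (hu : Adm Ω u) {ε : ℝ} (hε : ε ≤ 1) (h : ∀ x ∈ Ω, u x ≤ ε) :
    nehariTerm Ω f u ≤ M * ε ^ (a - 2) * ∫ x in Ω, u x * u x := by
  have h2 := A.two_lt
  rw [nehariTerm, ← integral_const_mul]
  refine setIntegral_mono_of_bdd D (A.bddOn_nehari D hu)
    ((bddOn_const _).mul ((hu.bddOn D).mul (hu.bddOn D))) fun x hx => ?_
  have h0 := hu.nonneg x
  have h1 := A.mul_le hx h0 ((h x hx).trans hε) zero_le_one
  rw [mul_one] at h1
  have h3 : u x ^ (a - 1) = u x ^ (a - 2) * u x := by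
    rw [show a - 1 = (a - 2) + 1 by ring, Real.rpow_add_one' h0 (by linarith)]
  have h4 : u x ^ (a - 2) ≤ ε ^ (a - 2) := Real.rpow_le_rpow h0 (h x hx) (by linarith)
  have hf := A.le_M x hx
  have hM := A.M_pos
  have h5 : f x (u x) ≤ M * ε ^ (a - 2) * u x := by
    refine h1.trans ?_
    rw [h3]
    have : 0 ≤ u x ^ (a - 2) * u x := by positivity
    calc u x ^ (a - 2) * u x * f x 1 ≤ u x ^ (a - 2) * u x * M := by gcongr
      _ ≤ ε ^ (a - 2) * u x * M := by gcongr
      _ = _ := by ring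
  calc f x (u x) * u x ≤ M * ε ^ (a - 2) * u x * u x := by gcongr
    _ = _ := by ring

end

section

variable {N : ℕ} {Ω : Set (Euc N)} {f : Euc N → ℝ → ℝ} {d : Euc N → ℝ} {g : Euc N → ℝ → ℝ}
  {p : ℝ} {u : ℝ → Euc N → ℝ} {a b M : ℝ}

theorem Standing.exists_nehari_bound (H : Standing N Ω f d g p u) (A : Nonlin Ω f a b M) {μ : ℝ}
    (hμ : 0 ≤ μ) : ∃ e, ∀ lam, -firstEig Ω < lam → lam ≤ μ →
      nehariTerm Ω f (Ω.indicator (u lam)) ≤ e := by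
  obtain ⟨x, hx⟩ := H.conn.nonempty
  obtain ⟨ψ, h1, h2, h3, h4⟩ := exists_bump H.isOpen hx
  have hψ := sol_of_contDiff (μ := μ) H.isOpen H.bdd h1 h2
  have hne : ∃ x ∈ Ω, ψ x ≠ 0 := ⟨x, hx, by rw [h4]; exact one_ne_zero⟩
  obtain ⟨E, hE⟩ := A.exists_minimax_bound H.dom (hψ.adm h3) hne
    (∫ x in Ω, (-lap ψ x + μ * ψ x) * ψ x)
  have a2 := A.two_lt
  refine ⟨2 * a / (a - 2) * E, fun lam hlam hle => ?_⟩
  obtain ⟨-, t, ht, hn⟩ := H.nehariTerm_le A hlam hμ hle hψ h3 hne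
  refine hn.trans (mul_le_mul_of_nonneg_left (le_trans ?_ (hE t ht))
    (div_nonneg (by linarith) (by linarith)))
  have : 0 ≤ ∫ x in Ω, ψ x * ψ x := integral_nonneg fun x => mul_self_nonneg _
  gcongr
  nlinarith [mul_nonneg (sub_nonneg.2 hle) this]

theorem Standing.mul_mass_le (H : Standing N Ω f d g p u) (A : Nonlin Ω f a b M) {lam : ℝ}
    (hlam : -firstEig Ω < lam) :
    (firstEig Ω + lam) * mass Ω u lam ≤ nehariTerm Ω f (Ω.indicator (u lam)) := by
  have hI := H.iter A hlam (le_max_right lam 0) (le_max_left lam 0)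
  have h1 := hI.sol.poincare H.dom (le_max_right lam 0)
  have h2 := hI.nehari
  rw [← mass] at h1 h2
  linarith

theorem Standing.tendsto_mass_of_seq (H : Standing N Ω f d g p u) (A : Nonlin Ω f a b M)
    {s : ℕ → ℝ} {l lo μ : ℝ} (hlo : -firstEig Ω < lo) (hs : ∀ n, lo ≤ s n) (hμ : 0 ≤ μ)
    (hsμ : ∀ n, s n ≤ μ) (hl : Tendsto s atTop (𝓝 l)) :
    ∃ φ : ℕ → ℕ, Tendsto (fun n => mass Ω u (s (φ n))) atTop (𝓝 (mass Ω u l)) := by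
  have D := H.dom
  have hs' : ∀ n, -firstEig Ω < s n := fun n => hlo.trans_le (hs n)
  have hl1 : lo ≤ l := ge_of_tendsto' hl hs
  have hlμ : l ≤ μ := le_of_tendsto' hl hsμ
  obtain ⟨e, he⟩ := H.exists_nehari_bound A hμ
  have hL : 0 < firstEig Ω + lo := by linarith
  have hmass : ∀ n, mass Ω u (s n) ≤ e / (firstEig Ω + lo) := fun n => by
    rw [le_div_iff₀ hL]
    have h1 := (H.mul_mass_le A (hs' n)).trans (he _ (hs' n) (hsμ n))
    nlinarith [hs n, H.mass_pos (hs' n)]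
  have hm0 : 0 ≤ e / (firstEig Ω + lo) := (H.mass_pos (hs' 0)).le.trans (hmass 0)
  obtain ⟨R, hR, hsup⟩ := A.exists_sup_bound D (e + (μ - lo) * (e / (firstEig Ω + lo))) (μ - lo)
  set v : ℕ → Euc N → ℝ := fun n => Ω.indicator (u (s n)) with hv
  have hIt := fun n => H.iter A (hs' n) hμ (hsμ n)
  have hvR : ∀ n x, v n x ≤ R := fun n => hsup μ (μ - s n) (v n) hμ (sub_nonneg.2 (hsμ n))
    (sub_le_sub_left (hs n) _) (hIt n).sol (hIt n).adm (by
      rw [(hIt n).nehari, ← mass]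
      have := hmass n
      refine add_le_add (he _ (hs' n) (hsμ n)) (mul_le_mul (sub_le_sub_left (hs n) _) this
        (H.mass_pos (hs' n)).le (by linarith [hs 0, hsμ 0])))
  obtain ⟨S, hS, hSb⟩ := A.exists_le R
  obtain ⟨U, φ, hφ, hUc, hU0, hU⟩ := D.exists_subseq (S := S + (μ - lo) * R) hμ
    (fun n x => f x (v n x) + (μ - s n) * v n x) v (fun n x hx => by
      have h0 := (hIt n).adm.nonneg x
      have hk := sub_nonneg.2 (hsμ n)
      rw [abs_of_nonneg (add_nonneg (A.nonneg x hx _ h0) (mul_nonneg hk h0))]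
      exact add_le_add (hSb x hx _ h0 (hvR n x)) (mul_le_mul (sub_le_sub_left (hs n) _) (hvR n x)
        h0 (by linarith))) fun n => (hIt n).sol
  have hadm := fun n => (hIt (φ n)).adm
  have hUA : Adm Ω U := Adm.of_tendsto hadm hU
  have hlφ : Tendsto (fun n => μ - s (φ n)) atTop (𝓝 (μ - l)) :=
    (hl.comp hφ.tendsto_atTop).const_sub μ
  have hrhs := A.tendstoUniformlyOn_rhs hadm (fun n => hvR (φ n)) hlφ hU
  have hSol := D.sol_of_tendsto hμ (fun n => (hIt (φ n)).sol) hrhs fun x => hU.tendsto_at x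
  have hne : ∃ x ∈ Ω, U x ≠ 0 := by
    by_contra! hz
    have hz' : ∀ x, U x = 0 := fun x => by
      by_cases hx : x ∈ Ω
      · exact hz x hx
      · exact hU0 x hx
    have a2 := A.two_lt
    have hM := A.M_pos
    have hε : ∀ᶠ ε : ℝ in 𝓝[>] 0, ε < 1 ∧ M * ε ^ (a - 2) < firstEig Ω + lo := by
      have h1 : Tendsto (fun ε : ℝ => M * ε ^ (a - 2)) (𝓝[>] 0) (𝓝 (M * 0 ^ (a - 2))) :=
        ((Real.continuousAt_rpow_const 0 (a - 2) (Or.inr (by linarith))).tendsto.mono_left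
          nhdsWithin_le_nhds).const_mul M
      rw [Real.zero_rpow (by linarith), mul_zero] at h1
      have h0 : ∀ᶠ ε : ℝ in 𝓝[>] 0, ε < 1 := nhdsWithin_le_nhds (eventually_lt_nhds one_pos)
      exact h0.and (h1.eventually_lt_const hL)
    obtain ⟨ε, ⟨hε1, hε2⟩, hε0⟩ := (hε.and self_mem_nhdsWithin).exists
    obtain ⟨n, hn⟩ := (Metric.tendstoUniformly_iff.1 hU ε hε0).exists
    have h1 := A.nehariTerm_le_of_le D (hadm n) hε1.le fun x _ => by
      have := hn x
      rw [hz' x, dist_comm, Real.dist_eq, sub_zero] at this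
      exact (le_abs_self _).trans this.le
    have h3 := H.mul_mass_le A (hs' (φ n))
    have h4 := H.mass_pos (hs' (φ n))
    have h5 := hs (φ n)
    rw [← mass] at h1
    nlinarith
  have hUeq := H.eq_indicator A (hlo.trans_le hl1) hSol hUA.nonneg hne
  refine ⟨φ, ?_⟩
  have := Adm.tendsto_mass D hadm (fun n => hvR (φ n)) fun x => hU.tendsto_at x
  rw [hUeq] at this
  exact this

theorem Standing.continuousOn_mass (H : Standing N Ω f d g p u) :
    ContinuousOn (mass Ω u) (Ioi (-firstEig Ω)) := by
  obtain ⟨a, b, M, A⟩ := H.exists_nonlin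
  refine fun l hl => ContinuousAt.continuousWithinAt ?_
  obtain ⟨lo, hlo, hlo'⟩ := exists_between (show -firstEig Ω < l from hl)
  refine tendsto_of_seq_tendsto fun s hs => tendsto_of_subseq_tendsto fun ns hns => ?_
  have h1 := hs.comp hns
  obtain ⟨n₀, hn₀⟩ := ((h1.eventually_const_lt hlo').and
    (h1.eventually_lt_const (show l < |l| + 1 by linarith [le_abs_self l]))).exists_forall_of_atTop
  obtain ⟨φ, hφ⟩ := H.tendsto_mass_of_seq A (s := fun n => s (ns (n + n₀))) (μ := |l| + 1) hlo
    (fun n => (hn₀ _ (Nat.le_add_left _ _)).1.le) (by positivity)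
    (fun n => (hn₀ _ (Nat.le_add_left _ _)).2.le) (h1.comp (tendsto_add_atTop_nat n₀))
  exact ⟨fun n => φ n + n₀, hφ⟩

end

section

variable {N : ℕ} {Ω : Set (Euc N)} {f : Euc N → ℝ → ℝ} {d : Euc N → ℝ}
  {g : Euc N → ℝ → ℝ} {p : ℝ} {u : ℝ → Euc N → ℝ} {a b M : ℝ}

theorem Adm.bddOn_comp (D : Dom Ω) {w : Euc N → ℝ} (hw : Adm Ω w) {F : ℝ → ℝ}
    (hF : Continuous F) : BddOn Ω (fun x => F (w x)) := by
  obtain ⟨B, hB, hwB⟩ := hw.exists_bound D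
  obtain ⟨C, hC⟩ := (isCompact_Icc (a := (0 : ℝ)) (b := B)).exists_bound_of_continuousOn
    hF.continuousOn
  exact ⟨(hF.comp hw.cont).aestronglyMeasurable, C, fun x _ => hC _ ⟨hw.nonneg x, hwB x⟩⟩

theorem Nonlin.bddOn_one (A : Nonlin Ω f a b M) (D : Dom Ω) : BddOn Ω (fun x => f x 1) :=
  ⟨(A.continuousOn_comp subset_rfl continuousOn_const).aestronglyMeasurable
    D.isOpen.measurableSet, M, fun x hx => by
      rw [abs_of_nonneg (A.nonneg x hx 1 zero_le_one)]; exact A.le_M x hx⟩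

theorem Nonlin.bddOn_weight (A : Nonlin Ω f a b M) (D : Dom Ω) {n : ℝ} (hn : 0 ≤ n) :
    BddOn Ω (fun x => 1 / (1 + n * f x 1)) := by
  have h0 : ∀ x ∈ Ω, 0 ≤ n * f x 1 := fun x hx => mul_nonneg hn (A.nonneg x hx 1 zero_le_one)
  refine ⟨ContinuousOn.aestronglyMeasurable ?_ D.isOpen.measurableSet, 1, fun x hx => ?_⟩
  · refine continuousOn_const.div (continuousOn_const.add (continuousOn_const.mul
      (A.continuousOn_comp subset_rfl continuousOn_const))) fun x hx => ?_
    have := h0 x hx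
    positivity
  · have := h0 x hx
    rw [abs_of_nonneg (by positivity), div_le_one (by positivity)]
    linarith

theorem Nonlin.exists_weight (A : Nonlin Ω f a b M) (D : Dom Ω) {ε : ℝ} (hε : 0 < ε) :
    ∃ n : ℝ, 0 < n ∧ ∫ x in Ω, 1 / (1 + n * f x 1) < ε := by
  have h : Tendsto (fun n : ℕ => ∫ x in Ω, 1 / (1 + (n : ℝ) * f x 1)) atTop
      (𝓝 (∫ x in Ω, (0 : ℝ))) := by
    refine tendsto_integral_of_dominated_convergence (fun _ => (1 : ℝ))
      (fun n => (A.bddOn_weight D (Nat.cast_nonneg n)).aesm) ((bddOn_const 1).integrable D)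
      (fun n => ?_) ?_
    · filter_upwards [ae_restrict_mem D.isOpen.measurableSet] with x hx
      have := mul_nonneg (Nat.cast_nonneg (α := ℝ) n) (A.nonneg x hx 1 zero_le_one)
      rw [Real.norm_eq_abs, abs_of_nonneg (by positivity), div_le_one (by positivity)]
      linarith
    · filter_upwards [A.pos] with x hx
      refine Tendsto.div_atTop tendsto_const_nhds (tendsto_atTop_add_const_left _ _ ?_)
      exact tendsto_natCast_atTop_atTop.atTop_mul_const (hx 1 one_pos)
  rw [integral_zero] at h
  obtain ⟨n, hn, hn0⟩ := ((h.eventually_lt_const hε).and (eventually_gt_atTop 0)).exists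
  exact ⟨n, Nat.cast_pos.2 hn0, hn⟩

theorem Nonlin.exists_half_mass (A : Nonlin Ω f a b M) (D : Dom Ω) {B : ℝ} (hB : 0 ≤ B) :
    ∃ n : ℝ, 0 < n ∧ ∀ h w, Sol Ω 0 h w → Adm Ω w →
      ∫ x in Ω, h x * w x ≤ B * ∫ x in Ω, w x * w x →
      ∫ x in Ω, w x * w x ≤ 2 * n * ∫ x in Ω, f x 1 * (w x * w x) := by
  have h2 := A.two_lt
  obtain ⟨C, hC, hsob⟩ := D.sobolev h2.le fun h3 => A.le.trans_lt (A.sub h3)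
  have hlim : Tendsto (fun K : ℝ => K ^ (1 - a / 2) * (C * B ^ (a / 2))) atTop (𝓝 0) := by
    have := (tendsto_rpow_neg_atTop (show 0 < a / 2 - 1 by linarith)).mul_const (C * B ^ (a / 2))
    simpa only [neg_sub, zero_mul] using this
  obtain ⟨K, hK, hK0⟩ := ((hlim.eventually_lt_const (show (0 : ℝ) < 1 / 4 by norm_num)).and
    (eventually_gt_atTop 0)).exists
  obtain ⟨n, hn, hχ⟩ := A.exists_weight D (show 0 < 1 / (4 * K) by positivity)
  refine ⟨n, hn, fun h w H hw hE => ?_⟩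
  have hρ0 : 0 ≤ ∫ x in Ω, w x * w x := integral_nonneg fun x => mul_self_nonneg _
  obtain ⟨ρ, hρ⟩ : ∃ ρ, ρ = ∫ x in Ω, w x * w x := ⟨_, rfl⟩
  rw [← hρ] at hρ0 hE ⊢
  have hg0 : 0 ≤ ∫ x in Ω, f x 1 * (w x * w x) :=
    setIntegral_nonneg D.isOpen.measurableSet fun x hx =>
      mul_nonneg (A.nonneg x hx 1 zero_le_one) (mul_self_nonneg _)
  rcases hρ0.eq_or_lt with h0 | hρ0
  · rw [← h0]; positivity
  have hsq : (0 : ℝ) < √(K * ρ) := Real.sqrt_pos.2 (by positivity)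
  have hsqsq : √(K * ρ) * √(K * ρ) = K * ρ := Real.mul_self_sqrt (by positivity)
  have hpw : √(K * ρ) ^ (2 - a) = (K * ρ) ^ (1 - a / 2) := by
    rw [Real.sqrt_eq_rpow, ← Real.rpow_mul (by positivity)]
    congr 1
    ring
  have bw := hw.bddOn D
  have b1 := (A.bddOn_weight D hn.le).mul (bddOn_const (Ω := Ω) (K * ρ))
  have b2 := (bddOn_const (Ω := Ω) ((K * ρ) ^ (1 - a / 2))).mul
    (hw.bddOn_comp D (F := fun t => |t| ^ a)
      (continuous_abs.rpow_const fun _ => Or.inr (by linarith)))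
  have b3 := (bddOn_const (Ω := Ω) n).mul ((A.bddOn_one D).mul (bw.mul bw))
  have key : ρ ≤ (∫ x in Ω, 1 / (1 + n * f x 1)) * (K * ρ) +
      (K * ρ) ^ (1 - a / 2) * (∫ x in Ω, |w x| ^ a) +
      n * ∫ x in Ω, f x 1 * (w x * w x) := by
    rw [← integral_mul_const, ← integral_const_mul, ← integral_const_mul,
      ← integral_add (b1.integrable D) (b2.integrable D),
      ← integral_add ((b1.add b2).integrable D) (b3.integrable D)]
    refine hρ.le.trans (setIntegral_mono_of_bdd D (bw.mul bw) ((b1.add b2).add b3) fun x hx => ?_)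
    have hf := A.nonneg x hx 1 zero_le_one
    have hnf : 0 ≤ n * f x 1 := by positivity
    have hw0 := hw.nonneg x
    have hc0 : 0 ≤ 1 / (1 + n * f x 1) := by positivity
    have hc1 : 1 / (1 + n * f x 1) ≤ 1 := by
      rw [div_le_one (by positivity)]; linarith
    have hc2 : 1 ≤ 1 / (1 + n * f x 1) + n * f x 1 := by
      have : 1 / (1 + n * f x 1) * (1 + n * f x 1) = 1 := one_div_mul_cancel (by positivity)
      nlinarith
    have hs : 1 / (1 + n * f x 1) * (w x * w x) ≤
        1 / (1 + n * f x 1) * (K * ρ) + (K * ρ) ^ (1 - a / 2) * |w x| ^ a := by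
      have h5 : 0 ≤ (K * ρ) ^ (1 - a / 2) * |w x| ^ a := by positivity
      rcases le_total (w x) (√(K * ρ)) with h | h
      · have : w x * w x ≤ K * ρ := by rw [← hsqsq]; gcongr
        have := mul_le_mul_of_nonneg_left this hc0
        linarith
      · have hwp : 0 < w x := hsq.trans_le h
        have e : w x * w x = w x ^ (2 - a) * w x ^ a := by
          rw [← Real.rpow_add hwp, sub_add_cancel, Real.rpow_two, sq]
        have h6 : w x ^ (2 - a) ≤ √(K * ρ) ^ (2 - a) :=
          Real.rpow_le_rpow_of_nonpos hsq h (by linarith)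
        have h7 : w x * w x ≤ (K * ρ) ^ (1 - a / 2) * |w x| ^ a := by
          rw [abs_of_nonneg hw0, e, ← hpw]
          gcongr
        have h8 : 1 / (1 + n * f x 1) * (w x * w x) ≤ w x * w x :=
          mul_le_of_le_one_left (mul_self_nonneg _) hc1
        have : 0 ≤ 1 / (1 + n * f x 1) * (K * ρ) := by positivity
        linarith
    have := mul_le_mul_of_nonneg_right hc2 (mul_self_nonneg (w x))
    linarith
  have h1 : (K * ρ) ^ (1 - a / 2) * (∫ x in Ω, |w x| ^ a) ≤ ρ / 4 := by
    have h3 : (∫ x in Ω, h x * w x) ^ (a / 2) ≤ (B * ρ) ^ (a / 2) :=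
      Real.rpow_le_rpow (H.energy_nonneg D le_rfl) hE (by linarith)
    calc (K * ρ) ^ (1 - a / 2) * (∫ x in Ω, |w x| ^ a)
        ≤ (K * ρ) ^ (1 - a / 2) * (C * (B * ρ) ^ (a / 2)) := by
          gcongr
          exact (hsob 0 h w le_rfl H).trans (by gcongr)
      _ = K ^ (1 - a / 2) * (C * B ^ (a / 2)) * (ρ ^ (1 - a / 2) * ρ ^ (a / 2)) := by
          rw [Real.mul_rpow hK0.le hρ0.le, Real.mul_rpow hB hρ0.le]; ring
      _ ≤ 1 / 4 * ρ := by
          rw [← Real.rpow_add hρ0, sub_add_cancel, Real.rpow_one]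
          gcongr
      _ = ρ / 4 := by ring
  have h4 : (∫ x in Ω, 1 / (1 + n * f x 1)) * (K * ρ) ≤ ρ / 4 := by
    calc _ ≤ 1 / (4 * K) * (K * ρ) := by gcongr
      _ = ρ / 4 := by field_simp
  linarith

theorem Nonlin.exists_prim_lower (A : Nonlin Ω f a b M) (D : Dom Ω) {B : ℝ} (hB : 0 ≤ B) :
    ∃ δ V : ℝ, 0 < δ ∧ 0 < V ∧ ∀ h w, Sol Ω 0 h w → Adm Ω w →
      ∫ x in Ω, h x * w x ≤ B * ∫ x in Ω, w x * w x → ∀ L, 0 < L → L ≤ 1 →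
      δ * L ^ (b - 2) * ((∫ x in Ω, w x * w x) - V * L ^ 2) ≤ primTerm Ω f w := by
  obtain ⟨n, hn, H⟩ := A.exists_half_mass D hB
  have hG : 0 ≤ ∫ x in Ω, f x 1 :=
    setIntegral_nonneg D.isOpen.measurableSet fun x hx => A.nonneg x hx 1 zero_le_one
  refine ⟨1 / (4 * n), 2 * n * (∫ x in Ω, f x 1) + 1, by positivity, by positivity,
    fun h w Hs hw hE L hL hL1 => ?_⟩
  have h1 := H h w Hs hw hE
  have bw := hw.bddOn D
  have b1 := (A.bddOn_one D).mul (bw.mul bw)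
  have b2 := (A.bddOn_one D).mul (bddOn_const (Ω := Ω) (L ^ 2))
  have key : L ^ (b - 2) / 2 * ((∫ x in Ω, f x 1 * (w x * w x)) - (∫ x in Ω, f x 1) * L ^ 2) ≤
      primTerm Ω f w := by
    rw [← integral_mul_const, ← integral_sub (b1.integrable D) (b2.integrable D),
      ← integral_const_mul, primTerm]
    refine setIntegral_mono_of_bdd D ((bddOn_const _).mul (b1.sub b2)) (A.bddOn_prim D hw)
      fun x hx => ?_
    have hw0 := hw.nonneg x
    have hf := A.nonneg x hx 1 zero_le_one
    rcases le_total (w x) L with hle | hle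
    · refine le_trans ?_ (A.prim_nonneg hx hw0)
      have : w x * w x ≤ L ^ 2 := by rw [sq]; gcongr
      have h3 : f x 1 * (w x * w x) - f x 1 * L ^ 2 ≤ 0 := by
        have := mul_le_mul_of_nonneg_left this hf
        linarith
      exact mul_nonpos_of_nonneg_of_nonpos (by positivity) h3
    · refine le_trans ?_ (A.le_prim hx hL.le hw0)
      have hu := A.upper x hx L 1 hL hL1
      rw [Real.one_rpow, mul_one] at hu
      have h3 : f x 1 * L ^ (b - 2) ≤ f x L / L := by
        rw [le_div_iff₀ hL, mul_assoc, ← Real.rpow_add_one hL.ne',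
          show b - 2 + 1 = b - 1 by ring]
        exact hu
      have h4 : 0 ≤ w x ^ 2 - L ^ 2 := by
        have : L ^ 2 ≤ w x ^ 2 := by gcongr
        linarith
      calc _ = f x 1 * L ^ (b - 2) * (w x ^ 2 - L ^ 2) / 2 := by ring
        _ ≤ _ := by gcongr
  refine le_trans ?_ key
  have h5 : 1 / (4 * n) * (∫ x in Ω, w x * w x) ≤ 1 / 2 * ∫ x in Ω, f x 1 * (w x * w x) := by
    calc _ ≤ 1 / (4 * n) * (2 * n * ∫ x in Ω, f x 1 * (w x * w x)) := by gcongr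
      _ = _ := by field_simp; norm_num
  have h6 : 1 / (4 * n) * ((2 * n * (∫ x in Ω, f x 1) + 1) * L ^ 2) =
      1 / 2 * ((∫ x in Ω, f x 1) * L ^ 2) + 1 / (4 * n) * L ^ 2 := by field_simp; ring
  have h7 : 0 ≤ 1 / (4 * n) * L ^ 2 := by positivity
  calc _ = L ^ (b - 2) * (1 / (4 * n) * (∫ x in Ω, w x * w x) -
        1 / (4 * n) * ((2 * n * (∫ x in Ω, f x 1) + 1) * L ^ 2)) := by ring
    _ ≤ L ^ (b - 2) * (1 / 2 * ((∫ x in Ω, f x 1 * (w x * w x)) -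
        (∫ x in Ω, f x 1) * L ^ 2)) := by
      gcongr ?_ * ?_
      linarith
    _ = _ := by ring

theorem Dom.exists_near_minimizer (D : Dom Ω) {ε : ℝ} (hε : 0 < ε) :
    ∃ h ψ, Sol Ω 0 h ψ ∧ (∀ x, 0 ≤ ψ x) ∧ (∃ x ∈ Ω, ψ x ≠ 0) ∧
      ∫ x in Ω, h x * ψ x ≤ (firstEig Ω + ε) * ∫ x in Ω, ψ x * ψ x := by
  have heig := D.eig
  have hlt : firstEig Ω < firstEig Ω + ε := by linarith
  obtain ⟨q, hq⟩ : ∃ q, q = firstEig Ω + ε := ⟨_, rfl⟩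
  rw [← hq]
  have hq0 : 0 < q := by linarith
  rw [← hq] at hlt
  obtain ⟨_, ⟨φ, c1, c2, c3, c4, rfl⟩, hφ⟩ := exists_lt_of_csInf_lt (by
    by_contra hne
    rw [not_nonempty_iff_eq_empty] at hne
    rw [firstEig, hne, Real.sInf_empty] at heig
    exact lt_irrefl _ heig) hlt
  have hT : IsTest Ω φ := ⟨c1.of_le (by norm_cast), c2, c3⟩
  have hφ2 : ContDiff ℝ 2 φ := c1.of_le (by norm_cast)
  have hpos : 0 < ∫ x in Ω, φ x * φ x := by
    have hA : Adm Ω (fun x => |φ x|) :=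
      ⟨hT.cd.continuous.abs, fun x hx => by simp [hT.zero_off hx], fun x => abs_nonneg _⟩
    obtain ⟨x, hx⟩ := Function.ne_iff.1 c4
    have := hA.integral_mul_self_pos D ⟨x, by
      by_contra h
      exact hx (hT.zero_off h), abs_ne_zero.2 hx⟩
    simpa only [abs_mul_abs_self] using this
  have e1 : ∫ x in Ω, φ x * φ x = ∫ x, (φ x) ^ 2 := by
    rw [hT.setIntegral_eq fun x hx => by simp [image_eq_zero_of_notMem_tsupport hx]]
    simp [sq]
  have e2 : ∫ x in Ω, ∑ i, pd i φ x * pd i φ x = ∫ x, ‖fderiv ℝ φ x‖ ^ 2 := by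
    rw [hT.setIntegral_eq fun x hx => Finset.sum_eq_zero fun i _ => by
      rw [image_eq_zero_of_notMem_tsupport fun h => hx (tsupport_pd_subset i φ h), mul_zero]]
    simp [norm_fderiv_sq_eq]
  rw [← e1, ← e2, integral_pd_mul_pd D.isOpen hφ2.contDiffOn hT, div_lt_iff₀ hpos] at hφ
  have S1 := sol_of_contDiff (μ := 0) D.isOpen D.bdd hφ2 c3
  simp only [zero_mul, add_zero] at S1
  obtain ⟨C, -, hC, -⟩ := hT.exists_bound
  obtain ⟨z, Hz⟩ := D.exists_sol le_rfl hT.cd.continuous.continuousOn fun x _ => hC x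
  obtain ⟨w, Hw⟩ := D.exists_sol le_rfl (h := fun x => |φ x|)
    hT.cd.continuous.abs.continuousOn fun x _ => by rw [abs_abs]; exact hC x
  have w0 := Hw.nonneg D le_rfl fun x _ => abs_nonneg _
  have hA := Hw.adm w0
  have hm := (Hw.add Hz (-1)).nonneg D le_rfl fun x _ => by
    have := le_abs_self (φ x); linarith
  have hp := (Hw.add Hz 1).nonneg D le_rfl fun x _ => by
    have := neg_abs_le (φ x); linarith
  have bφ : BddOn Ω φ := Hz.bddOn D
  have baφ : BddOn Ω (fun x => |φ x|) := Hw.bddOn D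
  have bw := hA.bddOn D
  have bz : BddOn Ω z := by
    obtain ⟨B, hB, hwB⟩ := hA.exists_bound D
    refine ⟨Hz.cont.aestronglyMeasurable, B, fun x _ => abs_le.2 ⟨?_, ?_⟩⟩ <;>
      linarith [hm x, hp x, hwB x]
  have k1 : ∫ x in Ω, φ x * z x ≤ ∫ x in Ω, |φ x| * w x := by
    refine setIntegral_mono_of_bdd D (bφ.mul bz) (baφ.mul bw) fun x _ => ?_
    have : |z x| ≤ w x := abs_le.2 ⟨by linarith [hp x], by linarith [hm x]⟩
    calc φ x * z x ≤ |φ x| * |z x| := by rw [← abs_mul]; exact le_abs_self _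
      _ ≤ _ := by gcongr
  have k2 := Hz.cauchy_schwarz D le_rfl S1
  have k3 : ∫ x in Ω, |φ x| * w x ≤
      1 / (2 * q) * (∫ x in Ω, φ x * φ x) + q / 2 * ∫ x in Ω, w x * w x := by
    rw [← integral_const_mul, ← integral_const_mul,
      ← integral_add (((bddOn_const _).mul (bφ.mul bφ)).integrable D)
        (((bddOn_const _).mul (bw.mul bw)).integrable D)]
    refine setIntegral_mono_of_bdd D (baφ.mul bw) (((bddOn_const _).mul (bφ.mul bφ)).add
      ((bddOn_const _).mul (bw.mul bw))) fun x _ => ?_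
    have e : 1 / (2 * q) * (φ x * φ x) + q / 2 * (w x * w x) - |φ x| * w x =
        1 / (2 * q) * (|φ x| - q * w x) ^ 2 := by
      rw [sub_sq, sq_abs]
      field_simp
      ring
    have : 0 ≤ 1 / (2 * q) * (|φ x| - q * w x) ^ 2 := by positivity
    linarith
  have hE := Hz.energy_nonneg D le_rfl
  generalize (∫ x in Ω, φ x * φ x) = m at *
  generalize (∫ x in Ω, -lap φ x * φ x) = E at *
  generalize hF : (∫ x in Ω, |φ x| * w x) = F at *
  generalize (∫ x in Ω, φ x * z x) = F' at *
  have hmF : m ≤ q * F := by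
    have : m * m ≤ m * (q * F) := by
      calc m * m = m ^ 2 := (sq m).symm
        _ ≤ F' * E := k2
        _ ≤ F' * (q * m) := by gcongr
        _ ≤ F * (q * m) := by gcongr
        _ = _ := by ring
    exact le_of_mul_le_mul_left this hpos
  have k4 : 1 / (2 * q) * m ≤ F / 2 := by
    calc _ ≤ 1 / (2 * q) * (q * F) := by gcongr
      _ = F / 2 := by field_simp
  refine ⟨_, w, Hw, w0, ?_, by rw [hF]; linarith⟩
  by_contra! h
  have : F = 0 := by
    rw [← hF]
    exact setIntegral_eq_zero_of_forall_eq_zero fun x hx => by simp [h x hx]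
  rw [this] at hmF
  linarith

theorem Standing.exists_nehari_left (H : Standing N Ω f d g p u) (A : Nonlin Ω f a b M) :
    ∃ C ε₀ : ℝ, 0 < ε₀ ∧ ε₀ ≤ firstEig Ω ∧ ∀ ε, 0 < ε → ε ≤ ε₀ →
      nehariTerm Ω f (Ω.indicator (u (-firstEig Ω + ε))) ≤ C * ε := by
  have D := H.dom
  have heig := D.eig
  have h2 := A.two_lt
  have hb : 0 < b - 2 := by linarith [A.le]
  obtain ⟨δ, V, hδ, hV, hP⟩ := A.exists_prim_lower D (B := firstEig Ω + 1) (by linarith)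
  refine ⟨2 * a / (a - 2) * V, min (firstEig Ω) (min 1 δ),
    lt_min heig (lt_min one_pos hδ), min_le_left _ _, fun ε hε hle => ?_⟩
  obtain ⟨l1, l2, l3⟩ : ε ≤ firstEig Ω ∧ ε ≤ 1 ∧ ε ≤ δ := by simpa using hle
  obtain ⟨h, ψ, Hψ, hψ0, hne, hq⟩ := D.exists_near_minimizer hε
  obtain ⟨-, t, ht, hN⟩ := H.nehariTerm_le A (lam := -firstEig Ω + ε) (by linarith) le_rfl
    (by linarith) Hψ hψ0 hne
  have hρ : 0 ≤ ∫ x in Ω, ψ x * ψ x := integral_nonneg fun x => mul_self_nonneg _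
  have hL0 : 0 < (ε / δ) ^ (1 / (b - 2)) := by positivity
  have hL1 : (ε / δ) ^ (1 / (b - 2)) ≤ 1 :=
    Real.rpow_le_one (by positivity) ((div_le_one hδ).2 l3) (by positivity)
  have hL : ((ε / δ) ^ (1 / (b - 2))) ^ (b - 2) = ε / δ := by
    rw [← Real.rpow_mul (by positivity), one_div_mul_cancel hb.ne', Real.rpow_one]
  have hp := hP _ _ (Hψ.const_mul D.isOpen t) ((Hψ.adm hψ0).const_mul ht.le) (by
    rw [integral_smul_mul_smul, integral_smul_mul_smul]
    have : (firstEig Ω + ε) * ∫ x in Ω, ψ x * ψ x ≤ (firstEig Ω + 1) * ∫ x in Ω, ψ x * ψ x := by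
      gcongr
    have h3 := hq.trans this
    calc _ ≤ t ^ 2 * ((firstEig Ω + 1) * ∫ x in Ω, ψ x * ψ x) := by gcongr
      _ = _ := by ring) _ hL0 hL1
  rw [hL, mul_div_cancel₀ _ hδ.ne', integral_smul_mul_smul] at hp
  refine hN.trans ?_
  rw [mul_assoc]
  have : 0 ≤ 2 * a / (a - 2) := div_nonneg (by linarith) (by linarith)
  gcongr
  have h5 : V * ((ε / δ) ^ (1 / (b - 2))) ^ 2 ≤ V * 1 := by
    gcongr
    exact pow_le_one₀ hL0.le hL1
  have h6 : t ^ 2 / 2 * ((∫ x in Ω, h x * ψ x) -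
      (0 - (-firstEig Ω + ε)) * ∫ x in Ω, ψ x * ψ x) ≤
      ε * (t ^ 2 * ∫ x in Ω, ψ x * ψ x) := by
    calc _ ≤ t ^ 2 / 2 * ((firstEig Ω + ε) * (∫ x in Ω, ψ x * ψ x) -
        (0 - (-firstEig Ω + ε)) * ∫ x in Ω, ψ x * ψ x) := by gcongr
      _ = _ := by ring
  nlinarith

theorem Standing.tendsto_mass_left (H : Standing N Ω f d g p u) :
    Tendsto (fun ε => mass Ω u (-firstEig Ω + ε)) (𝓝[>] 0) (𝓝 0) := by
  obtain ⟨a, b, M, A⟩ := H.exists_nonlin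
  have D := H.dom
  have heig := D.eig
  have h2 := A.two_lt
  obtain ⟨C, ε₀, hε₀, hle, hN⟩ := H.exists_nehari_left A
  obtain ⟨δ, V, hδ, hV, hP⟩ := A.exists_prim_lower D (B := firstEig Ω + 1) (by linarith)
  refine (nhdsGT_basis (0 : ℝ)).tendsto_iff (nhds_basis_zero_abs_lt ℝ) |>.2 fun τ hτ => ?_
  obtain ⟨L, ⟨hLV, hL1⟩, hL0⟩ : ∃ L : ℝ, (V * L ^ 2 < τ / 2 ∧ L < 1) ∧ 0 < L := by
    have h1 : Tendsto (fun L : ℝ => V * L ^ 2) (𝓝[>] 0) (𝓝 0) := by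
      have : Tendsto (fun L : ℝ => V * L ^ 2) (𝓝 0) (𝓝 (V * 0 ^ 2)) :=
        (continuous_const.mul (continuous_pow 2)).tendsto 0
      rw [zero_pow two_ne_zero, mul_zero] at this
      exact this.mono_left nhdsWithin_le_nhds
    have h0 : ∀ᶠ L : ℝ in 𝓝[>] 0, L < 1 := nhdsWithin_le_nhds (eventually_lt_nhds one_pos)
    exact (((h1.eventually_lt_const (half_pos hτ)).and h0).and self_mem_nhdsWithin).exists
  have hQ : 0 < a * (δ * L ^ (b - 2)) := by positivity
  obtain ⟨r, ⟨hr1, hr2⟩, hr0⟩ : ∃ r : ℝ, (|C| * r < min (τ) (a * (δ * L ^ (b - 2)) * (τ / 2)) ∧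
      r < ε₀) ∧ 0 < r := by
    have h1 : Tendsto (fun r : ℝ => |C| * r) (𝓝[>] 0) (𝓝 0) := by
      have : Tendsto (fun L : ℝ => |C| * L) (𝓝 0) (𝓝 (|C| * 0)) :=
        (continuous_const.mul continuous_id).tendsto 0
      rw [mul_zero] at this
      exact this.mono_left nhdsWithin_le_nhds
    have h0 : ∀ᶠ L : ℝ in 𝓝[>] 0, L < ε₀ := nhdsWithin_le_nhds (eventually_lt_nhds hε₀)
    exact (((h1.eventually_lt_const (lt_min hτ (by positivity))).and h0).and
      self_mem_nhdsWithin).exists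
  obtain ⟨hr3, hr4⟩ := lt_min_iff.1 hr1
  refine ⟨r, hr0, fun ε hε => ?_⟩
  obtain ⟨hε0, hεr⟩ := hε
  have hlam : -firstEig Ω < -firstEig Ω + ε := by linarith
  have hn : nehariTerm Ω f (Ω.indicator (u (-firstEig Ω + ε))) ≤ |C| * r :=
    (hN ε hε0 (hεr.trans hr2).le).trans (by
      have := le_abs_self C
      gcongr)
  have hρ := H.mass_pos hlam
  rw [mem_ofPred_eq, abs_of_pos hρ]
  have hv := H.adm hlam
  have It := H.iter A hlam (μ := 0) le_rfl (by linarith)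
  have hm : mass Ω u (-firstEig Ω + ε) = ∫ x in Ω, Ω.indicator (u (-firstEig Ω + ε)) x *
    Ω.indicator (u (-firstEig Ω + ε)) x := rfl
  rcases lt_or_ge (nehariTerm Ω f (Ω.indicator (u (-firstEig Ω + ε))))
    (mass Ω u (-firstEig Ω + ε)) with h | h
  · have h3 := hP _ _ It.sol hv (by
      rw [It.nehari, ← hm]
      nlinarith) L hL0 hL1.le
    have h4 : a * primTerm Ω f (Ω.indicator (u (-firstEig Ω + ε))) ≤
        nehariTerm Ω f (Ω.indicator (u (-firstEig Ω + ε))) := by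
      rw [primTerm, nehariTerm, ← integral_const_mul]
      exact setIntegral_mono_of_bdd D ((bddOn_const _).mul (A.bddOn_prim D hv))
        (A.bddOn_nehari D hv) fun x hx => A.mul_prim_le hx (hv.nonneg x)
    rw [← hm] at h3
    have h5 : a * (δ * L ^ (b - 2)) * (mass Ω u (-firstEig Ω + ε) - V * L ^ 2) <
        a * (δ * L ^ (b - 2)) * (τ / 2) := by
      have := mul_le_mul_of_nonneg_left h3 (by linarith : 0 ≤ a)
      linarith
    have := lt_of_mul_lt_mul_left h5 hQ.le
    linarith
  · linarith

end

section

variable {N : ℕ} {Ω : Set (Euc N)} {f : Euc N → ℝ → ℝ} {d : Euc N → ℝ}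
  {g : Euc N → ℝ → ℝ} {p : ℝ} {u : ℝ → Euc N → ℝ} {a b M : ℝ}

/-- The reflection of `Euc N` flipping the sign of the `i`-th coordinate. -/
def coordReflection (i : Fin N) : Euc N ≃ₗᵢ[ℝ] Euc N :=
  LinearIsometryEquiv.piLpCongrRight 2 fun j =>
    if j = i then LinearIsometryEquiv.neg ℝ else LinearIsometryEquiv.refl ℝ ℝ

theorem coordReflection_apply (i : Fin N) (x : Euc N) (j : Fin N) :
    coordReflection i x j = if j = i then -x j else x j := by
  rw [coordReflection, LinearIsometryEquiv.piLpCongrRight_apply]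
  split_ifs with h <;> simp [h]

theorem Standing.mem_of_update (H : Standing N Ω f d g p u) {y z : Euc N} (hy : y ∈ Ω) (i : Fin N)
    (h : ∀ j, j ≠ i → y j = z j) (hi : |z i| ≤ |y i|) : z ∈ Ω := by
  obtain ⟨ℓ, -, β, -, -, -, hs⟩ := H.symm
  have he := (hs (coordReflection i) fun j x hx k hk => by
    rw [coordReflection_apply]
    split_ifs <;> simp [hx k hk]).1
  have hy' : coordReflection i y ∈ Ω := by
    rw [← he]; exact mem_image_of_mem _ hy
  refine H.conv i y hy _ hy' (fun j hj => by rw [coordReflection_apply, if_neg hj]) ?_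
  rw [segment_eq_image']
  have h1 : |z i / y i| ≤ 1 := by
    rw [abs_div]
    exact div_le_one_of_le₀ hi (abs_nonneg _)
  obtain ⟨h2, h3⟩ := abs_le.1 h1
  refine ⟨(1 - z i / y i) / 2, ⟨by linarith, by linarith⟩, ?_⟩
  ext j
  simp only [PiLp.add_apply, PiLp.smul_apply, PiLp.sub_apply, smul_eq_mul]
  rw [coordReflection_apply]
  split_ifs with hj
  · subst hj
    rcases eq_or_ne (y j) 0 with h0 | h0
    · rw [h0, abs_zero, abs_nonpos_iff] at hi
      simp [h0, hi]
    · field_simp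
      ring
  · simp [h j hj]

theorem Standing.mem_of_abs_le (H : Standing N Ω f d g p u) {x y : Euc N} (hy : y ∈ Ω)
    (h : ∀ i, |x i| ≤ |y i|) : x ∈ Ω ∧ ∀ t, f y t ≤ f x t := by
  classical
  have key : ∀ s : Finset (Fin N), ∀ z : Euc N, (∀ i ∈ s, z i = x i) → (∀ i ∉ s, z i = y i) →
      z ∈ Ω ∧ ∀ t, f y t ≤ f z t := by
    intro s
    induction s using Finset.induction_on with
    | empty =>
      intro z _ hz
      have : z = y := by ext i; exact hz i (Finset.notMem_empty i)
      rw [this]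
      exact ⟨hy, fun _ => le_rfl⟩
    | insert i s hi ih =>
      intro z hz hz'
      let z₀ : Euc N := WithLp.toLp 2 (Function.update z i (y i))
      have e0 : ∀ j, z₀ j = Function.update z i (y i) j := fun _ => rfl
      obtain ⟨h1, h2⟩ := ih z₀ (fun j hj => by
        rw [e0, Function.update_of_ne (by rintro rfl; exact hi hj)]
        exact hz j (Finset.mem_insert_of_mem hj)) fun j hj => by
          rw [e0]
          rcases eq_or_ne j i with rfl | hji
          · simp
          · rw [Function.update_of_ne hji]
            exact hz' j (by simp [hji, hj])
      have e1 : ∀ j, j ≠ i → z₀ j = z j := fun j hj => by rw [e0, Function.update_of_ne hj]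
      have e2 : |z i| ≤ |z₀ i| := by
        rw [e0, Function.update_self, hz i (Finset.mem_insert_self i s)]
        exact h i
      have hzΩ := H.mem_of_update h1 i e1 e2
      exact ⟨hzΩ, fun t => (h2 t).trans
        ((H.mono i z hzΩ z₀ h1 (fun j hj => (e1 j hj).symm) e2).1 t)⟩
  exact key Finset.univ x (fun _ _ => rfl) fun i hi => absurd (Finset.mem_univ i) hi

theorem Standing.zero_mem (H : Standing N Ω f d g p u) : (0 : Euc N) ∈ Ω := by
  obtain ⟨y, hy⟩ := H.conn.nonempty
  exact (H.mem_of_abs_le (x := 0) hy fun i => by simp).1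

theorem Standing.exists_lower_near_zero (H : Standing N Ω f d g p u) :
    ∃ r c T : ℝ, 0 < r ∧ 0 < c ∧ 0 < T ∧ Metric.ball 0 r ⊆ Ω ∧
      ∀ x ∈ Metric.ball (0 : Euc N) r, ∀ t, T ≤ t → c * t ^ (p - 1) ≤ f x t := by
  have h0 := H.zero_mem
  have hd : ContinuousAt d 0 :=
    (H.d_c1.continuousOn.mono subset_closure).continuousAt (H.isOpen.mem_nhds h0)
  have hd' : ∀ᶠ y in 𝓝 (0 : Euc N), 0 < d y ∧ y ∈ Ω :=
    (hd.eventually (lt_mem_nhds (by rw [H.d_zero]; exact one_pos))).and (H.isOpen.mem_nhds h0)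
  have hcurve : Tendsto (fun r : ℝ => (WithLp.toLp 2 fun _ => r : Euc N)) (𝓝[>] 0) (𝓝 0) := by
    have hc : Continuous (fun r : ℝ => (WithLp.toLp 2 fun _ => r : Euc N)) :=
      (PiLp.continuous_toLp 2 _).comp (continuous_pi fun _ => continuous_id)
    have := hc.tendsto 0
    rw [show (WithLp.toLp 2 fun _ => (0 : ℝ) : Euc N) = 0 from rfl] at this
    exact this.mono_left nhdsWithin_le_nhds
  obtain ⟨r, ⟨hdr, hrΩ⟩, hr⟩ := ((hcurve.eventually hd').and self_mem_nhdsWithin).exists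
  replace hr : 0 < r := hr
  obtain ⟨y, hy⟩ : ∃ y : Euc N, y = WithLp.toLp 2 fun _ => r := ⟨_, rfl⟩
  rw [← hy] at hdr hrΩ
  obtain ⟨T, hT⟩ := eventually_atTop.1 (((H.g_top y hrΩ).eventually_const_lt
    (show -(d y / 2) < 0 by linarith)).and (eventually_gt_atTop 0))
  have hxy : ∀ x ∈ Metric.ball (0 : Euc N) r, ∀ i, |x i| ≤ |y i| := fun x hx i => by
    rw [hy]
    rw [mem_ball_zero_iff] at hx
    exact ((PiLp.norm_apply_le x i).trans hx.le).trans (le_abs_self r)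
  refine ⟨r, d y / 2, T, hr, by linarith, (hT T le_rfl).2,
    fun x hx => (H.mem_of_abs_le hrΩ (hxy x hx)).1, fun x hx t ht => ?_⟩
  refine le_trans ?_ ((H.mem_of_abs_le hrΩ (hxy x hx)).2 t)
  obtain ⟨h1, h2⟩ := hT t ht
  have hp : 0 < t ^ (p - 1) := by positivity
  rw [lt_div_iff₀ hp] at h1
  rw [H.f_split, abs_of_pos h2, mul_assoc, ← Real.rpow_add_one h2.ne',
    show p - 2 + 1 = p - 1 by ring]
  linarith

theorem lap_comp_smul {φ : Euc N → ℝ} (hφ : ContDiff ℝ 2 φ) (s : ℝ) (x : Euc N) :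
    lap (fun y => φ (s • y)) x = s ^ 2 * lap φ (s • x) := by
  rw [lap, lap, Finset.mul_sum]
  refine Finset.sum_congr rfl fun i _ => ?_
  have e : (fun y => fderiv ℝ (fun y => φ (s • y)) y (EuclideanSpace.single i 1)) =
      fun y => s • (fun z => fderiv ℝ φ z (EuclideanSpace.single i 1)) (s • y) := by
    funext y
    rw [fderiv_comp_smul]
    rfl
  have hd : Differentiable ℝ (fun z => fderiv ℝ φ z (EuclideanSpace.single i 1)) :=
    ((hφ.fderiv_right (m := 1) (by norm_num)).clm_apply contDiff_const).differentiable one_ne_zero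
  have hd' : DifferentiableAt ℝ
      (fun y => (fun z => fderiv ℝ φ z (EuclideanSpace.single i 1)) (s • y)) x :=
    DifferentiableAt.comp x (hd (s • x)) (differentiableAt_id.const_smul s)
  rw [e, fderiv_fun_const_smul hd']
  rw [fderiv_comp_smul (f := fun z => fderiv ℝ φ z (EuclideanSpace.single i 1))]
  simp only [smul_apply, smul_eq_mul]
  ring

theorem setIntegral_comp_smul {F : Euc N → ℝ} (hF : ∀ x, x ∉ Metric.ball (0 : Euc N) 1 → F x = 0)
    {s : ℝ} (hs : 0 < s) (hΩ : Metric.ball 0 s⁻¹ ⊆ Ω) :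
    ∫ x in Ω, F (s • x) = (s ^ N)⁻¹ * ∫ x, F x := by
  rw [setIntegral_eq_integral_of_forall_compl_eq_zero fun x hx => hF _ fun h => hx (hΩ ?_),
    Measure.integral_comp_smul, finrank_euclideanSpace, Fintype.card_fin,
    abs_of_nonneg (by positivity), smul_eq_mul]
  rw [mem_ball_zero_iff, norm_smul, Real.norm_eq_abs, abs_of_pos hs] at h
  rwa [mem_ball_zero_iff, ← one_div, lt_div_iff₀ hs, mul_comm]

theorem Standing.exists_mass_le (H : Standing N Ω f d g p u) :
    ∃ C l₀ : ℝ, 0 < l₀ ∧ ∀ lam, l₀ ≤ lam →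
      mass Ω u lam ≤ C * lam ^ (2 / (p - 2) - N / 2) := by
  obtain ⟨a, b, M, A⟩ := H.exists_nonlin
  have D := H.dom
  have heig := D.eig
  have h2 := A.two_lt
  have hp2 : 0 < p - 2 := by linarith [H.hp.1]
  obtain ⟨r, c, T, hr, hc, hT, hrΩ, hlow⟩ := H.exists_lower_near_zero
  obtain ⟨φ, hφ, hφs, hφ0, hφ1⟩ := exists_bump (N := N) Metric.isOpen_ball
    (Metric.mem_ball_self (x := (0 : Euc N)) one_pos)
  have hoff : ∀ x, x ∉ Metric.ball (0 : Euc N) 1 → φ x = 0 := fun x hx =>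
    image_eq_zero_of_notMem_tsupport fun h => hx (hφs h)
  obtain ⟨m, hm⟩ : ∃ m, m = ∫ x, φ x * φ x := ⟨_, rfl⟩
  obtain ⟨E, hE⟩ : ∃ E, E = |∫ x, (-lap φ x + φ x) * φ x| + 1 := ⟨_, rfl⟩
  have hE0 : 0 < E := by rw [hE]; positivity
  have hmpos : 0 < m := by
    rw [hm]
    have hcs : HasCompactSupport φ := (isCompact_closedBall (0 : Euc N) 1).of_isClosed_subset
      (isClosed_tsupport φ) (hφs.trans Metric.ball_subset_closedBall)
    refine (hφ.continuous.mul hφ.continuous).integral_pos_of_hasCompactSupport_nonneg_nonzero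
      hcs.mul_right (fun x => mul_self_nonneg _) (x := 0) ?_
    simp [hφ1]
  obtain ⟨χ, hχ⟩ : ∃ χ : Euc N → ℝ, χ = (Metric.ball (0 : Euc N) 1).indicator fun _ => 1 :=
    ⟨_, rfl⟩
  have hχm : Measurable χ := by
    rw [hχ]; exact measurable_const.indicator Metric.isOpen_ball.measurableSet
  have hχ0 : ∀ x, 0 ≤ χ x := fun x => by
    rw [hχ]; exact indicator_nonneg (fun _ _ => zero_le_one) x
  have hχ1 : ∀ x, χ x ≤ 1 := fun x => by
    rw [hχ]; exact indicator_le_self' (fun _ _ => zero_le_one) x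
  obtain ⟨V, hV⟩ : ∃ V, V = ∫ x, χ x := ⟨_, rfl⟩
  have hV0 : 0 ≤ V := by rw [hV]; exact integral_nonneg hχ0
  obtain ⟨Q, hQ⟩ : ∃ Q, Q = E / (c * m) := ⟨_, rfl⟩
  have hQ0 : 0 < Q := by rw [hQ]; positivity
  have hca : 0 ≤ 2 * a / (a - 2) := div_nonneg (by linarith) (by linarith)
  have hev : ∀ᶠ lam : ℝ in atTop, (0 < lam ∧ (√lam)⁻¹ ≤ r) ∧ T ≤ (Q * lam) ^ (1 / (p - 2)) := by
    refine ((eventually_gt_atTop 0).and ?_).and ?_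
    · exact (tendsto_inv_atTop_zero.comp Real.tendsto_sqrt_atTop).eventually_le_const hr
    · exact ((tendsto_rpow_atTop (by positivity)).comp
        (tendsto_id.const_mul_atTop hQ0)).eventually_ge_atTop T
  obtain ⟨l₀, hl₀⟩ := eventually_atTop.1 hev
  refine ⟨2 * a / (a - 2) * (c * Q / 2 * V * Q ^ (2 / (p - 2))), l₀, (hl₀ l₀ le_rfl).1.1,
    fun lam hlam => ?_⟩
  obtain ⟨⟨hlam0, hs⟩, hΛT⟩ := hl₀ lam hlam
  obtain ⟨s, hs'⟩ : ∃ s, s = √lam := ⟨_, rfl⟩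
  rw [← hs'] at hs
  have hs0 : 0 < s := by rw [hs']; exact Real.sqrt_pos.2 hlam0
  have hs2 : s ^ 2 = lam := by rw [hs']; exact Real.sq_sqrt hlam0.le
  obtain ⟨Λ, hΛ⟩ : ∃ Λ, Λ = (Q * lam) ^ (1 / (p - 2)) := ⟨_, rfl⟩
  rw [← hΛ] at hΛT
  have hΛ0 : 0 < Λ := hT.trans_le hΛT
  have hΛp : Λ ^ (p - 2) = Q * lam := by
    rw [hΛ, ← Real.rpow_mul (by positivity), one_div_mul_cancel hp2.ne', Real.rpow_one]
  have hΛ2 : Λ ^ 2 = Q ^ (2 / (p - 2)) * lam ^ (2 / (p - 2)) := by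
    rw [hΛ, ← Real.rpow_natCast, ← Real.rpow_mul (by positivity), ← Real.mul_rpow hQ0.le hlam0.le]
    congr 1
    push_cast
    ring
  have hsN : (s ^ N)⁻¹ = lam ^ (-(N / 2) : ℝ) := by
    rw [hs', Real.sqrt_eq_rpow, ← Real.rpow_natCast, ← Real.rpow_mul hlam0.le,
      ← Real.rpow_neg hlam0.le]
    congr 1
    ring
  have hbs : Metric.ball (0 : Euc N) s⁻¹ ⊆ Metric.ball 0 r := Metric.ball_subset_ball hs
  have hbΩ := hbs.trans hrΩ
  have hball : ∀ x : Euc N, s • x ∈ Metric.ball (0 : Euc N) 1 → x ∈ Metric.ball (0 : Euc N) s⁻¹ :=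
    fun x h => by
      rw [mem_ball_zero_iff, norm_smul, Real.norm_eq_abs, abs_of_pos hs0] at h
      rwa [mem_ball_zero_iff, ← one_div, lt_div_iff₀ hs0, mul_comm]
  have hψ : ContDiff ℝ 2 (fun x => φ (s • x)) := hφ.comp (contDiff_id.const_smul s)
  have hψs : tsupport (fun x => φ (s • x)) ⊆ Ω := fun x hx =>
    hbΩ (hball x (hφs (tsupport_comp_subset_preimage φ (continuous_const_smul s) hx)))
  have S := sol_of_contDiff (μ := lam) D.isOpen D.bdd hψ hψs
  have hlam' : -firstEig Ω < lam := by linarith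
  have hψ0 : ∀ x, 0 ≤ φ (s • x) := fun x => hφ0 _
  obtain ⟨-, t, ht, hN⟩ := H.nehariTerm_le A hlam' hlam0.le le_rfl S hψ0
    ⟨0, H.zero_mem, by rw [smul_zero, hφ1]; exact one_ne_zero⟩
  have hψA := S.adm hψ0
  have e1 : ∫ x in Ω, (-lap (fun x => φ (s • x)) x + lam * φ (s • x)) * φ (s • x) =
      lam * ((s ^ N)⁻¹ * ∫ x, (-lap φ x + φ x) * φ x) := by
    rw [← setIntegral_comp_smul (F := fun x => (-lap φ x + φ x) * φ x)
      (fun x hx => by rw [hoff x hx, mul_zero]) hs0 hbΩ, ← integral_const_mul]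
    congr 1
    funext x
    rw [lap_comp_smul hφ, hs2]
    ring
  have e2 : ∫ x in Ω, φ (s • x) * φ (s • x) = (s ^ N)⁻¹ * m := by
    rw [hm, ← setIntegral_comp_smul (F := fun x => φ x * φ x)
      (fun x hx => by rw [hoff x hx, mul_zero]) hs0 hbΩ]
  have e3 : ∫ x in Ω, χ (s • x) = (s ^ N)⁻¹ * V := by
    rw [hV, ← setIntegral_comp_smul (fun x hx => by rw [hχ, indicator_of_notMem hx]) hs0 hbΩ]
  have bψ := hψA.bddOn D
  have bχ : BddOn Ω (fun x => χ (s • x)) :=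
    ⟨(hχm.comp (measurable_const_smul s)).aestronglyMeasurable, 1, fun x _ => by
      rw [abs_of_nonneg (hχ0 _)]; exact hχ1 _⟩
  have b1 := (bddOn_const (Ω := Ω) (t ^ 2)).mul (bψ.mul bψ)
  have b2 := (bddOn_const (Ω := Ω) (Λ ^ 2)).mul bχ
  have hprim : c * Λ ^ (p - 2) / 2 * (t ^ 2 * ((s ^ N)⁻¹ * m) - Λ ^ 2 * ((s ^ N)⁻¹ * V)) ≤
      primTerm Ω f (fun x => t * φ (s • x)) := by
    rw [← e2, ← e3, ← integral_const_mul, ← integral_const_mul,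
      ← integral_sub (b1.integrable D) (b2.integrable D), ← integral_const_mul, primTerm]
    refine setIntegral_mono_of_bdd D ((bddOn_const _).mul (b1.sub b2))
      (A.bddOn_prim D (hψA.const_mul ht.le)) fun x hx => ?_
    have hp0 := A.prim_nonneg hx (mul_nonneg ht.le (hψ0 x))
    have hcΛ : 0 ≤ c * Λ ^ (p - 2) / 2 := by positivity
    by_cases hxb : s • x ∈ Metric.ball (0 : Euc N) 1
    · have e : χ (s • x) = 1 := by rw [hχ, indicator_of_mem hxb]
      rw [e, mul_one]
      rcases le_total (t ^ 2 * (φ (s • x) * φ (s • x))) (Λ ^ 2) with h | h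
      · exact (mul_nonpos_of_nonneg_of_nonpos hcΛ (by linarith)).trans hp0
      · refine le_trans ?_ (A.le_prim hx hΛ0.le (mul_nonneg ht.le (hψ0 x)))
        have h3 : c * Λ ^ (p - 2) ≤ f x Λ / Λ := by
          rw [le_div_iff₀ hΛ0, mul_assoc, ← Real.rpow_add_one hΛ0.ne',
            show p - 2 + 1 = p - 1 by ring]
          exact hlow x (hbs (hball x hxb)) Λ hΛT
        have h4 : 0 ≤ (t * φ (s • x)) ^ 2 - Λ ^ 2 := by
          rw [mul_pow, sq (φ (s • x))]; linarith
        calc _ = c * Λ ^ (p - 2) * ((t * φ (s • x)) ^ 2 - Λ ^ 2) / 2 := by ring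
          _ ≤ _ := by gcongr
    · refine le_trans (le_of_eq ?_) hp0
      rw [hoff _ hxb, hχ, indicator_of_notMem hxb]
      ring
  have hmass := H.mul_mass_le A hlam'
  have hmp := H.mass_pos hlam'
  have h7 : lam * mass Ω u lam ≤ 2 * a / (a - 2) * (c * (Q * lam) / 2 * (Λ ^ 2 * ((s ^ N)⁻¹ * V))) := by
    have h8 : lam * mass Ω u lam ≤ (firstEig Ω + lam) * mass Ω u lam := by
      gcongr
      linarith
    refine (h8.trans hmass).trans (hN.trans ?_)
    gcongr
    rw [e1, sub_self, zero_mul, sub_zero]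
    rw [hΛp] at hprim
    have hEQ : E = c * Q * m := by rw [hQ]; field_simp
    have h9 : t ^ 2 / 2 * (lam * ((s ^ N)⁻¹ * ∫ x, (-lap φ x + φ x) * φ x)) ≤
        t ^ 2 / 2 * (lam * ((s ^ N)⁻¹ * (c * Q * m))) := by
      gcongr
      rw [← hEQ, hE]
      linarith [le_abs_self (∫ x, (-lap φ x + φ x) * φ x)]
    linarith
  refine le_of_mul_le_mul_left (h7.trans (le_of_eq ?_)) hlam0
  rw [hΛ2, hsN, show 2 / (p - 2) - (N : ℝ) / 2 = 2 / (p - 2) + -((N : ℝ) / 2) by ring,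
    Real.rpow_add hlam0]
  ring

theorem Standing.tendsto_mass_right (H : Standing N Ω f d g p u) (hp : 2 + 4 / (N : ℝ) < p) :
    Tendsto (mass Ω u) atTop (𝓝 0) := by
  obtain ⟨C, l₀, h0, hle⟩ := H.exists_mass_le
  have heig := H.dom.eig
  have hN : (0 : ℝ) < N := Nat.cast_pos.2 (by linarith [H.dim])
  have hp2 : 0 < p - 2 := by linarith [H.hp.1]
  have he : 0 < (N : ℝ) / 2 - 2 / (p - 2) := by
    have h1 : 4 / (N : ℝ) < p - 2 := by linarith
    rw [div_lt_iff₀ hN] at h1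
    rw [sub_pos, div_lt_div_iff₀ hp2 two_pos]
    linarith
  have hlim := (tendsto_rpow_neg_atTop he).const_mul C
  rw [mul_zero] at hlim
  refine tendsto_of_tendsto_of_tendsto_of_le_of_le' tendsto_const_nhds hlim ?_ ?_
  · filter_upwards [eventually_ge_atTop l₀] with l hl
    exact (H.mass_pos (by linarith)).le
  · filter_upwards [eventually_ge_atTop l₀] with l hl
    rw [neg_sub]
    exact hle l hl

end

/-- A positive continuous function on a half-line vanishing at both ends attains its maximum and
takes every smaller positive value at two different points. -/
theorem exists_threshold {m : ℝ → ℝ} {l₀ : ℝ} (hc : ContinuousOn m (Ioi l₀))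
    (hpos : ∀ l, l₀ < l → 0 < m l) (hleft : Tendsto (fun ε => m (l₀ + ε)) (𝓝[>] 0) (𝓝 0))
    (hright : Tendsto m atTop (𝓝 0)) :
    ∃ b : ℝ, 0 < b ∧ (∃ l, l₀ < l ∧ m l = b) ∧
      (∀ c, 0 < c → c < b → ∃ l l', l₀ < l ∧ l₀ < l' ∧ l ≠ l' ∧ m l = c ∧ m l' = c) ∧
      ∀ l, l₀ < l → m l ≤ b := by
  have hL : ∀ c, 0 < c → ∀ x, l₀ < x → ∃ y, l₀ < y ∧ y < x ∧ ∀ l, l₀ < l → l ≤ y → m l < c := by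
    intro c hc0 x hx
    obtain ⟨δ, hδ, h⟩ := Metric.mem_nhdsWithin_iff.1 (hleft.eventually_lt_const hc0)
    refine ⟨l₀ + min (δ / 2) ((x - l₀) / 2), ?_, ?_, fun l h1 h2 => ?_⟩
    · have : 0 < min (δ / 2) ((x - l₀) / 2) := lt_min (by linarith) (by linarith)
      linarith
    · have := min_le_right (δ / 2) ((x - l₀) / 2)
      linarith
    · have h3 := min_le_left (δ / 2) ((x - l₀) / 2)
      have h4 : m (l₀ + (l - l₀)) < c := h ⟨by
        rw [mem_ball_zero_iff, Real.norm_eq_abs, abs_of_pos (by linarith)]; linarith,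
        show 0 < l - l₀ by linarith⟩
      rwa [add_sub_cancel] at h4
  have hR : ∀ c, 0 < c → ∀ x, ∃ y, x < y ∧ ∀ l, y ≤ l → m l < c := by
    intro c hc0 x
    obtain ⟨y, hy⟩ := eventually_atTop.1 (hright.eventually_lt_const hc0)
    exact ⟨max y (x + 1), lt_max_of_lt_right (by linarith),
      fun l hl => hy l ((le_max_left _ _).trans hl)⟩
  have h1 : l₀ < l₀ + 1 := by linarith
  obtain ⟨y, hy, hy1, hyl⟩ := hL _ (hpos _ h1) _ h1
  obtain ⟨z, hz1, hzl⟩ := hR _ (hpos _ h1) (l₀ + 1)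
  obtain ⟨s, hs, hmax⟩ := isCompact_Icc.exists_isMaxOn (nonempty_Icc.2 (hy1.trans hz1).le)
    (hc.mono fun l (hl : l ∈ Icc y z) => hy.trans_le hl.1)
  have hs0 : l₀ < s := hy.trans_le hs.1
  have h1s : m (l₀ + 1) ≤ m s := hmax ⟨hy1.le, hz1.le⟩
  refine ⟨m s, hpos s hs0, ⟨s, hs0, rfl⟩, fun c hc0 hcb => ?_, fun l hl => ?_⟩
  · obtain ⟨v, hv, hvs, hvl⟩ := hL c hc0 s hs0
    obtain ⟨w, hw, hwl⟩ := hR c hc0 s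
    obtain ⟨l, hl, hlc⟩ := intermediate_value_Ioo hvs.le
      (hc.mono fun l (hl : l ∈ Icc v s) => hv.trans_le hl.1) ⟨hvl v hv le_rfl, hcb⟩
    obtain ⟨l', hl', hlc'⟩ := intermediate_value_Ioo' hw.le
      (hc.mono fun l (hl : l ∈ Icc s w) => hs0.trans_le hl.1) ⟨hwl w le_rfl, hcb⟩
    exact ⟨l, l', hv.trans hl.1, hs0.trans hl'.1, (hl.2.trans hl'.1).ne, hlc, hlc'⟩
  · rcases le_or_gt l y with h | h
    · exact (hyl l hl h).le.trans h1s
    rcases le_or_gt z l with hz | hz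
    · exact (hzl l hz).le.trans h1s
    · exact hmax ⟨h.le, hz.le⟩

/-- in the mass-supercritical case `2 + 4/N < p < 2*`, there is a
threshold mass `b > 0` which is attained, below which there are at least two positive
normalized solutions with distinct parameters, and above which there are none. -/
theorem statement0 {N : ℕ} {Ω : Set (Euc N)} {f : Euc N → ℝ → ℝ} {d : Euc N → ℝ}
    {g : Euc N → ℝ → ℝ} {p : ℝ} {u : ℝ → Euc N → ℝ}
    (H : Standing N Ω f d g p u) (hp : 2 + 4 / (N : ℝ) < p) :
    ∃ b : ℝ, 0 < b ∧
      (∃ lam : ℝ, - firstEig Ω < lam ∧ (∫ x in Ω, (u lam x) ^ 2) = b) ∧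
      (∀ c : ℝ, 0 < c → c < b →
        ∃ lam lam' : ℝ, - firstEig Ω < lam ∧ - firstEig Ω < lam' ∧ lam ≠ lam' ∧
          (∫ x in Ω, (u lam x) ^ 2) = c ∧ (∫ x in Ω, (u lam' x) ^ 2) = c) ∧
      (∀ c : ℝ, b < c →
        ¬ ∃ lam : ℝ, - firstEig Ω < lam ∧ (∫ x in Ω, (u lam x) ^ 2) = c) := by
  obtain ⟨b, hb, ⟨l, hl, hlb⟩, h2, h3⟩ := exists_threshold H.continuousOn_mass
    (fun lam hlam => H.mass_pos hlam) H.tendsto_mass_left (H.tendsto_mass_right hp)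
  simp only [H.mass_eq]
  refine ⟨b, hb, ⟨l, hl, hlb⟩, h2, ?_⟩
  rintro c hbc ⟨lam, hlam, rfl⟩
  exact absurd (h3 lam hlam) hbc.not_ge
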